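/- Assume r ≥ 1 and either N ≤ 3, or N = 4 and p = 2r+1 < 15/4. Let U = (u_1,…,u_m) be a nonnegative bounded classical solution of (S) on the half-space ℝ^N_+ × ℝ such that each u_i extends continuously to the closed half-space and u_i = 0 on {x ∈ ℝ^N : x_1 = 0} × ℝ. Then u_i ≡ 0 on ℝ^N_+ × ℝ for every i = 1,…,m. -/

import Mathlib

open Real Set Metric MeasureTheory

/-- The Laplacian in the space variable, as the sum of second derivatives in
the coordinate directions. -/
noncomputable def lap {N : ℕ} (f : EuclideanSpace ℝ (Fin N) → ℝ)
    (x : EuclideanSpace ℝ (Fin N)) : ℝ :=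
  ∑ i, iteratedFDeriv ℝ 2 f x ![EuclideanSpace.single i 1, EuclideanSpace.single i 1]

namespace Liouville
open Filter Topology
open scoped ContDiff

set_option linter.unusedSectionVars false

section

/-! ### Directional derivatives -/

section Directional

variable {V : Type*} [NormedAddCommGroup V] [NormedSpace ℝ V]

/-- The derivative of `f` in the direction `v`. -/
noncomputable def dd (v : V) (f : V → ℝ) : V → ℝ := fun z => fderiv ℝ f z v

lemma dd_contDiff {v : V} {f : V → ℝ} (hf : ContDiff ℝ ∞ f) : ContDiff ℝ ∞ (dd v f) :=
  (hf.fderiv_right (by simp)).clm_apply contDiff_const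

lemma dd_contDiffAt {v : V} {f : V → ℝ} {z : V} {k : ℕ} (hf : ContDiffAt ℝ (k + 1) f z) :
    ContDiffAt ℝ k (dd v f) z :=
  (hf.fderiv_right le_rfl).clm_apply contDiffAt_const

lemma dd_hasDerivAt {v : V} {f : V → ℝ} {z : V} (hf : DifferentiableAt ℝ f z) :
    HasDerivAt (fun s : ℝ => f (z + s • v)) (dd v f z) 0 := by
  have h1 : HasDerivAt (fun s : ℝ => z + s • v) v 0 := by
    simpa using ((hasDerivAt_id (0 : ℝ)).smul_const v).const_add z
  have h2 : HasFDerivAt f (fderiv ℝ f z) (z + (0 : ℝ) • v) := by simpa using hf.hasFDerivAt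
  exact h2.comp_hasDerivAt 0 h1

lemma dd_hasDerivAt' {v : V} {f : V → ℝ} {z : V} {s : ℝ}
    (hf : DifferentiableAt ℝ f (z + s • v)) :
    HasDerivAt (fun s : ℝ => f (z + s • v)) (dd v f (z + s • v)) s := by
  have h1 : HasDerivAt (fun s : ℝ => z + s • v) v s := by
    simpa using ((hasDerivAt_id s).smul_const v).const_add z
  exact hf.hasFDerivAt.comp_hasDerivAt s h1

lemma dd_congr {v : V} {f g : V → ℝ} {z : V} (h : f =ᶠ[𝓝 z] g) : dd v f =ᶠ[𝓝 z] dd v g := by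
  filter_upwards [h.eventually_nhds] with y hy
  simp only [dd, EventuallyEq.fderiv_eq hy]

lemma dd_add {v : V} {f g : V → ℝ} {z : V} (hf : DifferentiableAt ℝ f z)
    (hg : DifferentiableAt ℝ g z) : dd v (fun y => f y + g y) z = dd v f z + dd v g z := by
  simp only [dd]
  rw [fderiv_fun_add hf hg]; simp

lemma dd_sub {v : V} {f g : V → ℝ} {z : V} (hf : DifferentiableAt ℝ f z)
    (hg : DifferentiableAt ℝ g z) : dd v (fun y => f y - g y) z = dd v f z - dd v g z := by
  simp only [dd]
  rw [fderiv_fun_sub hf hg]; simp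

lemma dd_mul {v : V} {f g : V → ℝ} {z : V} (hf : DifferentiableAt ℝ f z)
    (hg : DifferentiableAt ℝ g z) :
    dd v (fun y => f y * g y) z = dd v f z * g z + f z * dd v g z := by
  simp only [dd]
  rw [fderiv_fun_mul hf hg]; simp; ring

lemma dd_const_mul {v : V} {f : V → ℝ} {z : V} (c : ℝ) :
    dd v (fun y => c * f y) z = c * dd v f z := by
  have h : (fun y => c * f y) = c • f := rfl
  simp only [dd]
  rw [h, fderiv_const_smul_field]; simp

lemma dd_neg {v : V} {f : V → ℝ} {z : V} : dd v (fun y => - f y) z = - dd v f z := by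
  simp only [dd]
  rw [fderiv_fun_neg]; simp

lemma dd_const {v : V} {z : V} (c : ℝ) : dd v (fun _ => c) z = 0 := by
  simp [dd]

lemma dd_sum {ι : Type*} {s : Finset ι} {v : V} {f : ι → V → ℝ} {z : V}
    (hf : ∀ i ∈ s, DifferentiableAt ℝ (f i) z) :
    dd v (fun y => ∑ i ∈ s, f i y) z = ∑ i ∈ s, dd v (f i) z := by
  simp only [dd]
  rw [fderiv_fun_sum hf]; simp

lemma dd_comp {v : V} {f : V → ℝ} {z : V} {g : ℝ → ℝ} (hg : DifferentiableAt ℝ g (f z))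
    (hf : DifferentiableAt ℝ f z) :
    dd v (fun y => g (f y)) z = deriv g (f z) * dd v f z := by
  have := (hg.hasDerivAt.comp_hasFDerivAt z hf.hasFDerivAt).fderiv
  simp only [dd]
  change fderiv ℝ (g ∘ f) z v = _
  rw [this]; simp

lemma dd_comm {v w : V} {f : V → ℝ} {z : V} (hf : ContDiffAt ℝ 2 f z) :
    dd v (dd w f) z = dd w (dd v f) z := by
  have h := hf.isSymmSndFDerivAt (by simp)
  have hd : DifferentiableAt ℝ (fderiv ℝ f) z :=
    (hf.fderiv_right (m := 1) (by norm_num)).differentiableAt (by norm_num)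
  have key : ∀ a b : V, dd a (dd b f) z = fderiv ℝ (fderiv ℝ f) z a b := by
    intro a b
    change fderiv ℝ (fun y => fderiv ℝ f y b) z a = _
    rw [fderiv_clm_apply hd (differentiableAt_const b)]
    simp
  rw [key, key]; exact h v w

/-- At a local maximum along a line the second directional derivative is nonpositive. -/
lemma dd_dd_nonpos {v : V} {f : V → ℝ} {z : V} (hf : ContDiffAt ℝ 2 f z)
    (hmax : IsLocalMax (fun s : ℝ => f (z + s • v)) 0) : dd v (dd v f) z ≤ 0 := by
  by_contra! hpos
  set g : ℝ → ℝ := fun s => f (z + s • v) with hg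
  have hcont : ContinuousAt (fun s : ℝ => z + s • v) 0 := by fun_prop
  have hd1 : ∀ᶠ y in 𝓝 z, DifferentiableAt ℝ f y :=
    (hf.eventually (by simp)).mono fun y hy => hy.differentiableAt (by norm_num)
  have hd2 : ∀ᶠ s in 𝓝 (0 : ℝ), DifferentiableAt ℝ f (z + s • v) := by
    apply hcont.eventually
    simpa using hd1
  have hderiv : deriv g =ᶠ[𝓝 0] fun s => dd v f (z + s • v) := by
    filter_upwards [hd2] with s hs
    exact (dd_hasDerivAt' hs).deriv
  have hdv : DifferentiableAt ℝ (dd v f) z :=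
    (dd_contDiffAt (k := 1) (by simpa [one_add_one_eq_two] using hf)).differentiableAt (by norm_num)
  have h2 : deriv (deriv g) 0 = dd v (dd v f) z := by
    rw [hderiv.deriv_eq, (dd_hasDerivAt hdv).deriv]
  have h1 : deriv g 0 = 0 := hmax.deriv_eq_zero
  have hc : ContinuousAt g 0 := by
    have := hd2.self_of_nhds
    exact (dd_hasDerivAt' this).continuousAt
  have hmin : IsLocalMin g 0 := isLocalMin_of_deriv_deriv_pos (by rw [h2]; exact hpos) h1 hc
  have hcst : g =ᶠ[𝓝 0] fun _ => g 0 := by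
    filter_upwards [hmax, hmin] with s h1 h2
    exact le_antisymm h1 h2
  have : deriv g =ᶠ[𝓝 0] fun _ => 0 := by
    filter_upwards [hcst.eventually_nhds] with s hs
    rw [EventuallyEq.deriv_eq hs]; simp
  rw [this.deriv_eq] at h2
  simp at h2
  linarith

lemma integral_dd_eq_zero [MeasurableSpace V] [BorelSpace V] [FiniteDimensional ℝ V]
    {μ : Measure V} [μ.IsAddHaarMeasure] {v : V} {f : V → ℝ} (hf : ContDiff ℝ 1 f)
    (hc : HasCompactSupport f) : ∫ z, dd v f z ∂μ = 0 := by
  have hi : Integrable (fun z => f z) μ := hf.continuous.integrable_of_hasCompactSupport hc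
  have hi2 : Integrable (fun z => fderiv ℝ f z v) μ := by
    apply Continuous.integrable_of_hasCompactSupport
    · exact (hf.continuous_fderiv (by norm_num)).clm_apply continuous_const
    · exact (hc.fderiv (𝕜 := ℝ)).mono (fun z hz h => hz (by simp [h]))
  have := integral_mul_fderiv_eq_neg_fderiv_mul_of_integrable (μ := μ) (f := fun _ : V => (1 : ℝ))
    (g := f) (v := v) (by simp) (by simpa using hi2) (by simpa using hi)
    (fun x _ => differentiableAt_const _) (fun x _ => hf.differentiable (by norm_num) x)
  simpa [dd] using this

lemma dd_hasCompactSupport {v : V} {f : V → ℝ} (hc : HasCompactSupport f) :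
    HasCompactSupport (dd v f) :=
  (hc.fderiv (𝕜 := ℝ)).mono (fun z hz h => hz (by simp [dd, h]))

lemma dd_tsupport {v : V} {f : V → ℝ} : tsupport (dd v f) ⊆ tsupport f := by
  refine (closure_mono ?_).trans (tsupport_fderiv_subset ℝ (f := f))
  intro z hz h
  exact hz (by simp [dd, h])

end Directional

end

section

/-! ### Second order calculus rules -/

section SecondOrder

lemma two_le_infty : (2 : WithTop ℕ∞) ≤ ∞ := WithTop.coe_le_coe.2 (le_top : (2 : ℕ∞) ≤ ⊤)

lemma one_le_infty : (1 : WithTop ℕ∞) ≤ ∞ := by simp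

variable {V : Type*} [NormedAddCommGroup V] [NormedSpace ℝ V]

lemma eventually_differentiableAt {f : V → ℝ} {z : V} (hf : ContDiffAt ℝ 2 f z) :
    ∀ᶠ y in 𝓝 z, DifferentiableAt ℝ f y :=
  (hf.eventually (by simp)).mono fun _ hy => hy.differentiableAt (by norm_num)

lemma dd_differentiableAt {f : V → ℝ} {z v : V} (hf : ContDiffAt ℝ 2 f z) :
    DifferentiableAt ℝ (dd v f) z :=
  (dd_contDiffAt (k := 1) (by simpa [one_add_one_eq_two] using hf)).differentiableAt (by norm_num)

lemma dd_dd_add {v w : V} {f g : V → ℝ} {z : V} (hf : ContDiffAt ℝ 2 f z)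
    (hg : ContDiffAt ℝ 2 g z) :
    dd w (dd v (fun y => f y + g y)) z = dd w (dd v f) z + dd w (dd v g) z := by
  have h : dd v (fun y => f y + g y) =ᶠ[𝓝 z] fun y => dd v f y + dd v g y := by
    filter_upwards [eventually_differentiableAt hf, eventually_differentiableAt hg] with y h1 h2
    exact dd_add h1 h2
  rw [(dd_congr h).eq_of_nhds, dd_add (dd_differentiableAt hf) (dd_differentiableAt hg)]

lemma dd_dd_sub {v w : V} {f g : V → ℝ} {z : V} (hf : ContDiffAt ℝ 2 f z)
    (hg : ContDiffAt ℝ 2 g z) :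
    dd w (dd v (fun y => f y - g y)) z = dd w (dd v f) z - dd w (dd v g) z := by
  have h : dd v (fun y => f y - g y) =ᶠ[𝓝 z] fun y => dd v f y - dd v g y := by
    filter_upwards [eventually_differentiableAt hf, eventually_differentiableAt hg] with y h1 h2
    exact dd_sub h1 h2
  rw [(dd_congr h).eq_of_nhds, dd_sub (dd_differentiableAt hf) (dd_differentiableAt hg)]

lemma dd_dd_const_mul {v w : V} {f : V → ℝ} {z : V} (c : ℝ) :
    dd w (dd v (fun y => c * f y)) z = c * dd w (dd v f) z := by
  have h : dd v (fun y => c * f y) = fun y => c * dd v f y := funext fun y => dd_const_mul c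
  rw [h, dd_const_mul]

lemma dd_dd_mul {v : V} {f g : V → ℝ} {z : V} (hf : ContDiffAt ℝ 2 f z)
    (hg : ContDiffAt ℝ 2 g z) :
    dd v (dd v (fun y => f y * g y)) z
      = dd v (dd v f) z * g z + 2 * (dd v f z * dd v g z) + f z * dd v (dd v g) z := by
  have h : dd v (fun y => f y * g y) =ᶠ[𝓝 z] fun y => dd v f y * g y + f y * dd v g y := by
    filter_upwards [eventually_differentiableAt hf, eventually_differentiableAt hg] with y h1 h2
    exact dd_mul h1 h2
  have h1 := dd_differentiableAt (v := v) hf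
  have h2 := dd_differentiableAt (v := v) hg
  have h3 := hf.differentiableAt (by norm_num)
  have h4 := hg.differentiableAt (by norm_num)
  rw [(dd_congr h).eq_of_nhds, dd_add (h1.fun_mul h4) (h3.fun_mul h2), dd_mul h1 h4, dd_mul h3 h2]
  ring

lemma dd_dd_comp {v : V} {f : V → ℝ} {z : V} {g : ℝ → ℝ} (hg : ContDiffAt ℝ 2 g (f z))
    (hf : ContDiffAt ℝ 2 f z) :
    dd v (dd v (fun y => g (f y))) z
      = deriv (deriv g) (f z) * (dd v f z) ^ 2 + deriv g (f z) * dd v (dd v f) z := by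
  have h : dd v (fun y => g (f y)) =ᶠ[𝓝 z] fun y => deriv g (f y) * dd v f y := by
    filter_upwards [eventually_differentiableAt hf,
      hf.continuousAt.eventually (eventually_differentiableAt hg)] with y h1 h2
    exact dd_comp h2 h1
  have h1 := dd_differentiableAt (v := v) hf
  have h3 := hf.differentiableAt (by norm_num)
  have hg' : DifferentiableAt ℝ (deriv g) (f z) := by
    have : deriv g = dd 1 g := by ext x; simp [dd]
    rw [this]; exact dd_differentiableAt hg
  have h5 : DifferentiableAt ℝ (fun y => deriv g (f y)) z :=
    DifferentiableAt.comp z hg' h3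
  rw [(dd_congr h).eq_of_nhds, dd_mul h5 h1, dd_comp hg' h3]
  ring

end SecondOrder

/-! ### Space-time and the heat operator -/

/-- Space-time, with `n + 1` space dimensions. -/
abbrev X (n : ℕ) := (Fin (n + 1) → ℝ) × ℝ

variable {n : ℕ}

/-- The unit vector in the `i`-th space direction. -/
def ex (i : Fin (n + 1)) : X n := (Pi.single i 1, 0)

/-- The unit vector in the time direction. -/
def et : X n := (0, 1)

/-- The heat operator. -/
noncomputable def heat (f : X n → ℝ) (z : X n) : ℝ :=
  dd et f z - ∑ i, dd (ex i) (dd (ex i) f) z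

/-- The backward heat operator, adjoint of `heat`. -/
noncomputable def heatS (f : X n → ℝ) (z : X n) : ℝ :=
  - dd et f z - ∑ i, dd (ex i) (dd (ex i) f) z

lemma heat_add {f g : X n → ℝ} {z : X n} (hf : ContDiffAt ℝ 2 f z) (hg : ContDiffAt ℝ 2 g z) :
    heat (fun y => f y + g y) z = heat f z + heat g z := by
  simp only [heat, dd_dd_add hf hg, Finset.sum_add_distrib,
    dd_add (hf.differentiableAt (by norm_num)) (hg.differentiableAt (by norm_num))]
  ring

lemma heat_sub {f g : X n → ℝ} {z : X n} (hf : ContDiffAt ℝ 2 f z) (hg : ContDiffAt ℝ 2 g z) :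
    heat (fun y => f y - g y) z = heat f z - heat g z := by
  simp only [heat, dd_dd_sub hf hg, Finset.sum_sub_distrib,
    dd_sub (hf.differentiableAt (by norm_num)) (hg.differentiableAt (by norm_num))]
  ring

lemma heat_const_mul {f : X n → ℝ} {z : X n} (c : ℝ) :
    heat (fun y => c * f y) z = c * heat f z := by
  simp only [heat, dd_dd_const_mul, dd_const_mul, ← Finset.mul_sum]
  ring

lemma heat_const {z : X n} (c : ℝ) : heat (fun _ => c) z = 0 := by
  have h : ∀ v : X n, dd v (fun _ => c) = fun _ => 0 := fun v => funext fun z => dd_const c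
  simp [heat, h, dd_const]

lemma heat_neg {f : X n → ℝ} {z : X n} : heat (fun y => - f y) z = - heat f z := by
  have := heat_const_mul (f := f) (z := z) (-1)
  simpa using this

lemma heat_mul {f g : X n → ℝ} {z : X n} (hf : ContDiffAt ℝ 2 f z) (hg : ContDiffAt ℝ 2 g z) :
    heat (fun y => f y * g y) z = heat f z * g z + f z * heat g z
      - 2 * ∑ i, dd (ex i) f z * dd (ex i) g z := by
  simp only [heat, dd_dd_mul hf hg, Finset.sum_add_distrib,
    dd_mul (hf.differentiableAt (by norm_num)) (hg.differentiableAt (by norm_num)),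
    ← Finset.mul_sum, ← Finset.sum_mul]
  ring

lemma heat_comp {f : X n → ℝ} {z : X n} {g : ℝ → ℝ} (hg : ContDiffAt ℝ 2 g (f z))
    (hf : ContDiffAt ℝ 2 f z) :
    heat (fun y => g (f y)) z = deriv g (f z) * heat f z
      - deriv (deriv g) (f z) * ∑ i, (dd (ex i) f z) ^ 2 := by
  simp only [heat, dd_dd_comp hg hf, Finset.sum_add_distrib, ← Finset.mul_sum,
    dd_comp (hg.differentiableAt (by norm_num)) (hf.differentiableAt (by norm_num))]
  ring

lemma dd_coord (v : X n) (i : Fin (n + 1)) : dd v (fun z : X n => z.1 i) = fun _ => v.1 i := by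
  ext z
  let L : X n →L[ℝ] ℝ := (ContinuousLinearMap.proj i).comp (ContinuousLinearMap.fst ℝ _ _)
  have : fderiv ℝ (fun z : X n => z.1 i) z = L := L.fderiv
  simp only [dd]; rw [this]; rfl

lemma dd_time (v : X n) : dd v (fun z : X n => z.2) = fun _ => v.2 := by
  ext z
  have : fderiv ℝ (fun z : X n => z.2) z = ContinuousLinearMap.snd ℝ _ _ :=
    (ContinuousLinearMap.snd ℝ (Fin (n + 1) → ℝ) ℝ).fderiv
  simp only [dd]; rw [this]; rfl

lemma heat_coord (i : Fin (n + 1)) (z : X n) : heat (fun z : X n => z.1 i) z = 0 := by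
  simp [heat, dd_coord, dd_const, et]

lemma heat_time (z : X n) : heat (fun z : X n => z.2) z = 1 := by
  simp [heat, dd_time, dd_const, et]

/-- `|x - c - t b|²`. -/
noncomputable def qs (c b : Fin (n + 1) → ℝ) (z : X n) : ℝ :=
  ∑ i, (z.1 i - c i - z.2 * b i) ^ 2

lemma qs_contDiff (c b : Fin (n + 1) → ℝ) : ContDiff ℝ ∞ (qs c b) := by
  unfold qs; fun_prop

lemma dd_qs (c b : Fin (n + 1) → ℝ) (v : X n) :
    dd v (qs c b) = fun z => ∑ i, 2 * (v.1 i - v.2 * b i) * (z.1 i - c i - z.2 * b i) := by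
  ext z
  have hs : ∀ i : Fin (n+1), dd v (fun y : X n => (y.1 i - c i - y.2 * b i) ^ 2) z
      = 2 * (v.1 i - v.2 * b i) * (z.1 i - c i - z.2 * b i) := by
    intro i
    have h0 : (fun y : X n => (y.1 i - c i - y.2 * b i) ^ 2)
      = fun y => (fun s : ℝ => s ^ 2) (y.1 i - c i - b i * y.2) := by ext y; ring
    rw [h0, dd_comp (g := fun s : ℝ => s ^ 2) (by fun_prop) (by fun_prop), dd_sub (by fun_prop) (by fun_prop),
      dd_sub (by fun_prop) (by fun_prop), dd_const, dd_const_mul, dd_coord, dd_time]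
    simp; ring
  change dd v (fun z => ∑ i, (z.1 i - c i - z.2 * b i) ^ 2) z = _
  rw [dd_sum (fun i _ => by fun_prop)]
  simp only [hs]

lemma dd_ex_qs (c b : Fin (n + 1) → ℝ) (k : Fin (n + 1)) :
    dd (ex k) (qs c b) = fun z => 2 * (z.1 k - c k - z.2 * b k) := by
  rw [dd_qs]; ext z
  rw [Finset.sum_eq_single k] <;> simp +contextual [ex]

lemma dd_et_qs (c b : Fin (n + 1) → ℝ) :
    dd et (qs c b) = fun z => - 2 * ∑ i, b i * (z.1 i - c i - z.2 * b i) := by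
  rw [dd_qs]; ext z
  simp [et, Finset.mul_sum]
  exact Finset.sum_congr rfl fun i _ => by ring

lemma heat_qs (c b : Fin (n + 1) → ℝ) (z : X n) :
    heat (qs c b) z = - 2 * (∑ i, b i * (z.1 i - c i - z.2 * b i)) - 2 * (n + 1) := by
  have h : ∀ k : Fin (n + 1), dd (ex k) (fun z : X n => 2 * (z.1 k - c k - z.2 * b k)) z = 2 := by
    intro k
    have h0 : (fun y : X n => 2 * (y.1 k - c k - y.2 * b k))
      = fun y => 2 * (y.1 k - c k - b k * y.2) := by ext y; ring
    rw [h0, dd_const_mul, dd_sub (by fun_prop) (by fun_prop),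
      dd_sub (by fun_prop) (by fun_prop), dd_const, dd_const_mul, dd_coord, dd_time]
    simp [ex]
  simp only [heat, dd_ex_qs, dd_et_qs, h]
  simp; ring

/-- The square of the Euclidean distance to `c` in space-time. -/
noncomputable def qq (c z : X n) : ℝ := qs c.1 0 z + (z.2 - c.2) ^ 2

lemma qq_contDiff (c : X n) : ContDiff ℝ ∞ (qq c) := by
  have := qs_contDiff c.1 0
  unfold qq; fun_prop

lemma heat_qq (c z : X n) : heat (qq c) z = 2 * (z.2 - c.2) - 2 * (n + 1) := by
  have h1 : heat (fun z : X n => (z.2 - c.2) ^ 2) z = 2 * (z.2 - c.2) := by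
    have := heat_comp (f := fun z : X n => z.2) (z := z) (g := fun s => (s - c.2) ^ 2)
      (by fun_prop) (by fun_prop)
    rw [this, heat_time]
    simp [dd_time, ex]
  change heat (fun z => qs c.1 0 z + (z.2 - c.2) ^ 2) z = _
  rw [heat_add ((qs_contDiff _ _).contDiffAt.of_le two_le_infty) (by fun_prop),
    heat_qs, h1]
  simp; ring

lemma qs_nonneg (c b : Fin (n + 1) → ℝ) (z : X n) : 0 ≤ qs c b z :=
  Finset.sum_nonneg fun _ _ => sq_nonneg _

lemma qq_nonneg (c z : X n) : 0 ≤ qq c z := by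
  have := qs_nonneg c.1 0 z
  unfold qq; positivity

@[simp] lemma qq_self (c : X n) : qq c c = 0 := by simp [qq, qs]

lemma dist_sq_le_qq (c z : X n) : dist z c ^ 2 ≤ qq c z := by
  have h1 : ∀ i, (z.1 i - c.1 i) ^ 2 ≤ qq c z := by
    intro i
    have := Finset.single_le_sum (f := fun i => (z.1 i - c.1 i - z.2 * (0 : Fin (n + 1) → ℝ) i) ^ 2)
      (fun i _ => sq_nonneg _) (Finset.mem_univ i)
    simp only [Pi.zero_apply, mul_zero, sub_zero] at this
    simp only [qq, qs, Pi.zero_apply, mul_zero, sub_zero]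
    nlinarith [sq_nonneg (z.2 - c.2)]
  have h2 : (z.2 - c.2) ^ 2 ≤ qq c z := by
    have := qs_nonneg c.1 0 z
    unfold qq; linarith
  have h3 : dist z c ≤ √(qq c z) := by
    rw [Prod.dist_eq, max_le_iff]
    refine ⟨(dist_pi_le_iff (Real.sqrt_nonneg _)).2 fun i => ?_, ?_⟩
    · exact Real.abs_le_sqrt (h1 i)
    · exact Real.abs_le_sqrt h2
  calc dist z c ^ 2 ≤ √(qq c z) ^ 2 := by gcongr
    _ = qq c z := Real.sq_sqrt (qq_nonneg c z)

/-! ### The maximum principle -/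

lemma heat_nonneg_of_max {f : X n → ℝ} {z : X n} (hf : ContDiffAt ℝ 2 f z)
    (h : ∀ᶠ w in 𝓝 z, w.2 ≤ z.2 → f w ≤ f z) : 0 ≤ heat f z := by
  have hline : ∀ v : X n, Tendsto (fun s : ℝ => z + s • v) (𝓝 0) (𝓝 z) := by
    intro v
    have : ContinuousAt (fun s : ℝ => z + s • v) 0 := by fun_prop
    simpa [ContinuousAt] using this
  have ht : 0 ≤ dd et f z := by
    have hd := dd_hasDerivAt (v := et) (hf.differentiableAt (by norm_num))
    have hs := (hasDerivAt_iff_tendsto_slope.1 hd).mono_left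
      (nhdsWithin_mono (0 : ℝ) (fun x (hx : x ∈ Iio (0 : ℝ)) => ne_of_lt hx))
    refine ge_of_tendsto hs ?_
    filter_upwards [self_mem_nhdsWithin, nhdsWithin_le_nhds ((hline et).eventually h)] with s hs1 hs2
    have hs1 : s < 0 := hs1
    have := hs2 (by simp [et]; linarith)
    simp only [slope_def_field, zero_smul, add_zero, sub_zero]
    exact div_nonneg_of_nonpos (by linarith) hs1.le
  have hx : ∀ i, dd (ex i) (dd (ex i) f) z ≤ 0 := by
    intro i
    refine dd_dd_nonpos hf ?_
    filter_upwards [(hline (ex i)).eventually h] with s hs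
    simpa using hs (by simp [ex])
  have := Finset.sum_nonpos fun i (_ : i ∈ Finset.univ) => hx i
  simp only [heat]; linarith

lemma max_principle {S : Set (X n)} (hS : IsClosed S) {D : X n → ℝ} (hD : ContinuousOn D S)
    {M : ℝ} (hM : ∀ z ∈ S, D z ≤ M) {η : ℝ} (hη : 0 < η)
    (hloc : ∀ z ∈ S, 0 < D z → (∀ᶠ w in 𝓝 z, w.2 ≤ z.2 → w ∈ S) ∧ ContDiffAt ℝ 2 D z ∧
      heat D z ≤ - η) :
    ∀ z ∈ S, D z ≤ 0 := by
  intro z₁ hz₁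
  by_contra! hpos
  have hM0 : 0 < M := hpos.trans_le (hM _ hz₁)
  set a := η / (4 * M) with ha
  have ha0 : 0 < a := by positivity
  set ε := η / (4 * (2 * (n + 1) + 1 / a)) with hε
  have hε0 : 0 < ε := by positivity
  set F : X n → ℝ := fun z => D z - ε * qq z₁ z with hF
  have hFc : ContinuousOn F S := hD.sub ((qq_contDiff z₁).continuous.continuousOn.const_smul ε)
  have hco : ∀ᶠ z in cocompact (X n) ⊓ 𝓟 S, F z ≤ F z₁ := by
    have h1 : ∀ᶠ z in cocompact (X n), √(M / ε) < dist z z₁ :=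
      (tendsto_dist_right_cocompact_atTop z₁).eventually_gt_atTop _
    filter_upwards [h1.filter_mono inf_le_left, (eventually_principal.2 fun z hz => hz :
      ∀ᶠ z in 𝓟 S, z ∈ S).filter_mono inf_le_right] with z hz hzS
    have h2 : M / ε ≤ qq z₁ z := by
      calc M / ε = √(M / ε) ^ 2 := (Real.sq_sqrt (by positivity)).symm
        _ ≤ dist z z₁ ^ 2 := by gcongr
        _ ≤ _ := dist_sq_le_qq _ _
    have h3 : M ≤ ε * qq z₁ z := by rw [div_le_iff₀ hε0] at h2; linarith
    simp only [hF, qq_self]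
    linarith [hM z hzS]
  obtain ⟨z, hzS, hz⟩ := hFc.exists_isMaxOn' hS hz₁ hco
  have hz1 : F z₁ ≤ F z := hz hz₁
  simp only [hF, qq_self, mul_zero, sub_zero] at hz1
  have hq := qq_nonneg z₁ z
  have hDz : 0 < D z := by nlinarith
  obtain ⟨hint, hsm, hheat⟩ := hloc z hzS hDz
  have hqs : ContDiffAt ℝ 2 (fun y => ε * qq z₁ y) z := by
    have := (qq_contDiff z₁).contDiffAt (x := z)
    exact (contDiffAt_const.mul this).of_le two_le_infty
  have h0 : 0 ≤ heat F z := by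
    refine heat_nonneg_of_max (hsm.sub hqs) ?_
    filter_upwards [hint] with w hw hwt
    exact hz (hw hwt)
  rw [hF, heat_sub hsm hqs, heat_const_mul, heat_qq] at h0
  have hs2 : ε * (z.2 - z₁.2) ^ 2 ≤ M := by
    have : (z.2 - z₁.2) ^ 2 ≤ qq z₁ z := by
      have := qs_nonneg z₁.1 0 z
      unfold qq; linarith
    have h5 := hM z hzS
    nlinarith
  have hy : - (a * (z.2 - z₁.2) ^ 2 + 1 / a) ≤ 2 * (z.2 - z₁.2) := by
    have : 0 ≤ (a * (z.2 - z₁.2) + 1) ^ 2 / a := by positivity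
    have h6 : (a * (z.2 - z₁.2) + 1) ^ 2 / a = a * (z.2 - z₁.2) ^ 2 + 2 * (z.2 - z₁.2) + 1 / a := by
      field_simp
      ring
    linarith
  have h7 : ε * (2 * (n + 1) + 1 / a) = η / 4 := by
    rw [hε]; field_simp
  have h8 : a * M = η / 4 := by rw [ha]; field_simp
  have h9 : a * (ε * (z.2 - z₁.2) ^ 2) ≤ η / 4 := by
    rw [← h8]; gcongr
  nlinarith

end

section

/-! ### Mollification -/

section Mollify

variable {V : Type*} [NormedAddCommGroup V] [NormedSpace ℝ V] [MeasureSpace V] [BorelSpace V]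
  [FiniteDimensional ℝ V] [(volume : Measure V).IsAddHaarMeasure]

/-- Convolution of `u` with the kernel `k`. -/
noncomputable def moll (u k : V → ℝ) (z : V) : ℝ := ∫ y, u y * k (z - y)

lemma moll_eq_convolution (u k : V → ℝ) :
    moll u k = convolution u k (ContinuousLinearMap.mul ℝ ℝ) volume := by
  ext z; rfl

lemma moll_contDiff {u k : V → ℝ} (hu : LocallyIntegrable u) (hk : ContDiff ℝ ∞ k)
    (hc : HasCompactSupport k) : ContDiff ℝ ∞ (moll u k) := by
  rw [moll_eq_convolution]
  exact hc.contDiff_convolution_right _ hu hk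

lemma dd_moll {u k : V → ℝ} (hu : LocallyIntegrable u) (hk : ContDiff ℝ ∞ k)
    (hc : HasCompactSupport k) (v : V) : dd v (moll u k) = moll u (dd v k) := by
  ext z
  have h1 := (hc.hasFDerivAt_convolution_right (μ := volume) (ContinuousLinearMap.mul ℝ ℝ) hu
    (hk.of_le one_le_infty) z).fderiv
  rw [← moll_eq_convolution] at h1
  simp only [dd]
  rw [h1, convolution_precompR_apply _ hu (hc.fderiv (𝕜 := ℝ))
    (hk.continuous_fderiv (by simp))]
  rfl

lemma moll_integrable {u k : V → ℝ} (hu : LocallyIntegrable u) (hk : Continuous k)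
    (hc : HasCompactSupport k) (z : V) : Integrable (fun y => u y * k (z - y)) := by
  have hk' : Continuous fun y => k (z - y) := by fun_prop
  have hc' : HasCompactSupport fun y => k (z - y) :=
    hc.comp_homeomorph (Homeomorph.subLeft z)
  simpa [smul_eq_mul, mul_comm] using hu.integrable_smul_left_of_hasCompactSupport hk' hc'

/-- A shrinking family of smooth bumps. -/
noncomputable def bump (V : Type*) [NormedAddCommGroup V] [NormedSpace ℝ V]
    [FiniteDimensional ℝ V] (j : ℕ) : ContDiffBump (0 : V) where
  rIn := 1 / (2 * (j + 1))
  rOut := 1 / (j + 1)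
  rIn_pos := by positivity
  rIn_lt_rOut := by
    have : (0 : ℝ) < (j : ℝ) + 1 := by positivity
    apply one_div_lt_one_div_of_lt this; linarith

/-- The standard smooth mollifiers. -/
noncomputable def ker (j : ℕ) : V → ℝ := (bump V j).normed volume

/-- The radius of the support of `ker j`. -/
noncomputable def rad (j : ℕ) : ℝ := 1 / (j + 1)

lemma rad_pos (j : ℕ) : 0 < rad j := by unfold rad; positivity

lemma rad_tendsto : Tendsto rad atTop (𝓝 0) := tendsto_one_div_add_atTop_nhds_zero_nat

lemma ker_contDiff (j : ℕ) : ContDiff ℝ ∞ (ker j : V → ℝ) := (bump V j).contDiff_normed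

lemma ker_hasCompactSupport (j : ℕ) : HasCompactSupport (ker j : V → ℝ) :=
  (bump V j).hasCompactSupport_normed

lemma ker_nonneg (j : ℕ) (z : V) : 0 ≤ ker j z := (bump V j).nonneg_normed z

lemma ker_integral (j : ℕ) : ∫ z, (ker j : V → ℝ) z = 1 := (bump V j).integral_normed

lemma ker_eq_zero {j : ℕ} {z : V} (h : rad j ≤ ‖z‖) : ker j z = 0 := by
  have : z ∉ Function.support (ker j : V → ℝ) := by
    unfold ker
    rw [(bump V j).support_normed_eq]
    simpa [bump, rad] using h
  simpa using this

lemma ker_integral_sub (j : ℕ) (z : V) : ∫ y, (ker j : V → ℝ) (z - y) = 1 := by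
  rw [integral_sub_left_eq_self (fun y => (ker j : V → ℝ) y), ker_integral]

lemma le_moll {u : V → ℝ} (hu : LocallyIntegrable u) {j : ℕ} {z : V} {a : ℝ}
    (h : ∀ y, dist y z < rad j → a ≤ u y) : a ≤ moll u (ker j) z := by
  have h1 : ∫ y, a * (ker j : V → ℝ) (z - y) = a := by
    rw [integral_const_mul, ker_integral_sub, mul_one]
  rw [← h1]
  refine integral_mono ?_ (moll_integrable hu (ker_contDiff j).continuous
    (ker_hasCompactSupport j) z) ?_
  · exact moll_integrable (u := fun _ => a) (locallyIntegrable_const a) (ker_contDiff j).continuous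
      (ker_hasCompactSupport j) z
  · intro y
    by_cases hy : dist y z < rad j
    · exact mul_le_mul_of_nonneg_right (h y hy) (ker_nonneg _ _)
    · have : (ker j : V → ℝ) (z - y) = 0 := by
        apply ker_eq_zero
        rw [← dist_eq_norm, dist_comm]; linarith
      simp [this]

lemma moll_neg (u k : V → ℝ) (z : V) : moll (fun y => - u y) k z = - moll u k z := by
  simp [moll, integral_neg]

lemma moll_le {u : V → ℝ} (hu : LocallyIntegrable u) {j : ℕ} {z : V} {a : ℝ}
    (h : ∀ y, dist y z < rad j → u y ≤ a) : moll u (ker j) z ≤ a := by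
  have := le_moll (u := fun y => - u y) hu.neg (j := j) (z := z) (a := - a)
    (fun y hy => neg_le_neg (h y hy))
  rw [moll_neg] at this; linarith

lemma moll_tendsto {u : V → ℝ} (hu : Continuous u) (z : V) :
    Tendsto (fun j => moll u (ker j) z) atTop (𝓝 (u z)) := by
  rw [Metric.tendsto_atTop]
  intro ε hε
  obtain ⟨δ, hδ, h⟩ := Metric.continuousAt_iff.1 (hu.continuousAt (x := z)) (ε / 2) (by positivity)
  obtain ⟨J, hJ⟩ := (rad_tendsto.eventually_lt_const hδ).exists_forall_of_atTop
  refine ⟨J, fun j hj => ?_⟩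
  have h1 : ∀ y, dist y z < rad j → |u y - u z| < ε / 2 := fun y hy => h (hy.trans (hJ j hj))
  have h2 := le_moll (V := V) (hu.locallyIntegrable) (j := j) (z := z) (a := u z - ε / 2)
    fun y hy => by linarith [(abs_lt.1 (h1 y hy)).1]
  have h3 := moll_le (V := V) (hu.locallyIntegrable) (j := j) (z := z) (a := u z + ε / 2)
    fun y hy => by linarith [(abs_lt.1 (h1 y hy)).2]
  rw [Real.dist_eq, abs_lt]
  constructor <;> linarith

lemma moll_ae_tendsto {u : V → ℝ} (hu : LocallyIntegrable u) :
    ∀ᵐ z, Tendsto (fun j => moll u (ker j) z) atTop (𝓝 (u z)) := by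
  have := ContDiffBump.ae_convolution_tendsto_right_of_locallyIntegrable (μ := (volume : Measure V))
    (φ := bump V) (l := atTop) (K := 2) (g := u)
    (by simpa [bump] using tendsto_one_div_add_atTop_nhds_zero_nat (𝕜 := ℝ))
    (Eventually.of_forall fun j => by
      simp only [bump]
      have : (0 : ℝ) < (j : ℝ) + 1 := by positivity
      apply le_of_eq; field_simp) hu
  filter_upwards [this] with z hz
  convert hz using 2 with j
  rw [convolution_lsmul_swap]
  simp only [moll, ker, smul_eq_mul]
  simp only [mul_comm]

end Mollify

/-! ### Weak solutions of the heat equation -/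

variable {n : ℕ}

instance : (volume : Measure (X n)).IsAddHaarMeasure :=
  Measure.prod.instIsAddHaarMeasure (volume : Measure (Fin (n + 1) → ℝ)) (volume : Measure ℝ)

/-- `u` is a distributional solution of `∂ₜu - Δu = f` in `Ω`. -/
def Weak (Ω : Set (X n)) (u f : X n → ℝ) : Prop :=
  ∀ φ : X n → ℝ, ContDiff ℝ ∞ φ → HasCompactSupport φ → tsupport φ ⊆ Ω →
    ∫ z, u z * heatS φ z = ∫ z, f z * φ z

lemma Weak.mono {Ω Ω' : Set (X n)} {u f : X n → ℝ} (h : Weak Ω u f) (hs : Ω' ⊆ Ω) :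
    Weak Ω' u f := fun φ h1 h2 h3 => h φ h1 h2 (h3.trans hs)

lemma heatS_contDiff {φ : X n → ℝ} (hφ : ContDiff ℝ ∞ φ) : ContDiff ℝ ∞ (heatS φ) := by
  have h1 := dd_contDiff (v := et) hφ
  have h2 : ∀ i, ContDiff ℝ ∞ (dd (ex i) (dd (ex i) φ)) := fun i => dd_contDiff (dd_contDiff hφ)
  exact (h1.neg).sub (ContDiff.sum fun i _ => h2 i)

lemma heatS_eq_zero_of_notMem {φ : X n → ℝ} {z : X n} (hz : z ∉ tsupport φ) : heatS φ z = 0 := by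
  have h0 : ∀ v, dd v φ z = 0 := fun v => by
    by_contra h
    exact hz (dd_tsupport (subset_tsupport _ h))
  have h1 : ∀ v, dd v (dd v φ) z = 0 := fun v => by
    by_contra h
    exact hz (dd_tsupport (dd_tsupport (subset_tsupport _ h)))
  simp [heatS, h0, h1]

lemma heatS_hasCompactSupport {φ : X n → ℝ} (hc : HasCompactSupport φ) :
    HasCompactSupport (heatS φ) := by
  refine hc.mono' ?_
  intro z hz
  by_contra h
  exact hz (heatS_eq_zero_of_notMem h)

lemma LI_mul_integrable {u φ : X n → ℝ} (hu : LocallyIntegrable u) (hφ : Continuous φ)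
    (hc : HasCompactSupport φ) : Integrable (fun z => u z * φ z) := by
  simpa [smul_eq_mul, mul_comm] using hu.integrable_smul_left_of_hasCompactSupport hφ hc

lemma Weak.sub {Ω : Set (X n)} {u f v g : X n → ℝ} (h : Weak Ω u f) (h' : Weak Ω v g)
    (hu : LocallyIntegrable u) (hv : LocallyIntegrable v) (hf : LocallyIntegrable f)
    (hg : LocallyIntegrable g) : Weak Ω (fun z => u z - v z) (fun z => f z - g z) := by
  intro φ h1 h2 h3
  have a1 := (heatS_contDiff h1).continuous
  have a2 := heatS_hasCompactSupport h2
  simp only [sub_mul]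
  rw [integral_sub (LI_mul_integrable hu a1 a2) (LI_mul_integrable hv a1 a2),
    integral_sub (LI_mul_integrable hf h1.continuous h2) (LI_mul_integrable hg h1.continuous h2),
    h φ h1 h2 h3, h' φ h1 h2 h3]

lemma heat_moll {u k : X n → ℝ} (hu : LocallyIntegrable u) (hk : ContDiff ℝ ∞ k)
    (hc : HasCompactSupport k) (z : X n) :
    heat (moll u k) z = ∫ y, u y * heat k (z - y) := by
  have h1 : ∀ i, dd (ex i) (dd (ex i) (moll u k)) = moll u (dd (ex i) (dd (ex i) k)) := by
    intro i
    rw [dd_moll hu hk hc, dd_moll hu (dd_contDiff hk) (dd_hasCompactSupport hc)]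
  have hi : ∀ i, Integrable fun y => u y * dd (ex i) (dd (ex i) k) (z - y) := fun i =>
    moll_integrable hu (dd_contDiff (dd_contDiff hk)).continuous
      (dd_hasCompactSupport (dd_hasCompactSupport hc)) z
  have ht : Integrable fun y => u y * dd et k (z - y) :=
    moll_integrable hu (dd_contDiff hk).continuous (dd_hasCompactSupport hc) z
  have h0 : heat (moll u k) z = moll u (dd et k) z - ∑ i, moll u (dd (ex i) (dd (ex i) k)) z := by
    simp only [heat, h1]
    rw [dd_moll hu hk hc]
  rw [h0]
  simp only [heat, moll, mul_sub, Finset.mul_sum]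
  rw [integral_sub ht (integrable_finsetSum _ fun i _ => hi i), integral_finsetSum _ fun i _ => hi i]

lemma dd_sub_left {k : X n → ℝ} (hk : Differentiable ℝ k) (v z : X n) :
    dd v (fun y => k (z - y)) = fun y => - dd v k (z - y) := by
  ext y
  have h := (hk (z - y)).hasFDerivAt.comp y ((hasFDerivAt_id y).const_sub z)
  have h2 : fderiv ℝ (fun y => k (z - y)) y = _ := h.fderiv
  simp only [dd]
  rw [h2]; simp

lemma heatS_sub_left {k : X n → ℝ} (hk : ContDiff ℝ ∞ k) (z y : X n) :
    heatS (fun y => k (z - y)) y = heat k (z - y) := by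
  have : ∀ v : X n, dd v (dd v (fun y => k (z - y))) y = dd v (dd v k) (z - y) := by
    intro v
    rw [dd_sub_left (hk.differentiable (by simp))]
    have h2 := congrFun (dd_sub_left ((dd_contDiff hk).differentiable (by simp)) v z (k := dd v k)) y
    rw [dd_neg, h2]; simp
  simp only [heatS, heat, this]
  rw [dd_sub_left (hk.differentiable (by simp))]; simp

lemma Weak.heat_moll {Ω : Set (X n)} {u f : X n → ℝ} (h : Weak Ω u f)
    (hu : LocallyIntegrable u) {j : ℕ} {z : X n} (hz : closedBall z (rad j) ⊆ Ω) :
    heat (moll u (ker j)) z = moll f (ker j) z := by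
  rw [Liouville.heat_moll hu (ker_contDiff j) (ker_hasCompactSupport j)]
  simp only [← heatS_sub_left (ker_contDiff j)]
  refine h _ ((ker_contDiff j).comp (contDiff_const.sub contDiff_id))
    ((ker_hasCompactSupport j).comp_homeomorph (Homeomorph.subLeft z)) ?_
  refine (closure_minimal ?_ isClosed_closedBall).trans hz
  intro y hy
  rw [mem_closedBall, dist_comm, dist_eq_norm]
  by_contra! hlt
  exact hy (ker_eq_zero hlt.le)

end

section

variable {n : ℕ}

/-- Locally uniform convergence along a filter. -/
def LU {ι : Type*} (l : Filter ι) (uk : ι → X n → ℝ) (u : X n → ℝ) : Prop :=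
  ∀ K : Set (X n), IsCompact K → ∀ ε : ℝ, 0 < ε → ∀ᶠ k in l, ∀ z ∈ K, |uk k z - u z| ≤ ε

lemma moll_LU {w : X n → ℝ} (hw : Continuous w) : LU atTop (fun j => moll w (ker j)) w := by
  intro K hK ε hε
  obtain ⟨R, hR⟩ := hK.isBounded.subset_closedBall (0 : X n)
  have hc : IsCompact (closedBall (0 : X n) (R + 1)) := isCompact_closedBall _ _
  have huc := hc.uniformContinuousOn_of_continuous hw.continuousOn
  obtain ⟨δ, hδ, h⟩ := Metric.uniformContinuousOn_iff.1 huc ε hε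
  filter_upwards [rad_tendsto.eventually_lt_const hδ,
    rad_tendsto.eventually_lt_const one_pos] with j hj hj1 z hz
  have hz' := hR hz
  have h1 : ∀ y, dist y z < rad j → |w y - w z| < ε := by
    intro y hy
    refine h y ?_ z ?_ (hy.trans hj)
    · rw [mem_closedBall] at hz' ⊢
      linarith [dist_triangle y z 0]
    · exact closedBall_subset_closedBall (by linarith) hz'
  have h2 := le_moll hw.locallyIntegrable (j := j) (z := z) (a := w z - ε)
    fun y hy => by linarith [(abs_lt.1 (h1 y hy)).1]
  have h3 := moll_le hw.locallyIntegrable (j := j) (z := z) (a := w z + ε)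
    fun y hy => by linarith [(abs_lt.1 (h1 y hy)).2]
  rw [abs_le]; constructor <;> linarith

lemma heat_continuousAt {ψ : X n → ℝ} {P : X n} (h : ContDiffAt ℝ 2 ψ P) :
    ContinuousAt (heat ψ) P := by
  have h1 : ∀ v : X n, ContDiffAt ℝ 1 (dd v ψ) P := fun v =>
    dd_contDiffAt (k := 1) (by simpa [one_add_one_eq_two] using h)
  have h2 : ∀ v : X n, ContinuousAt (dd v (dd v ψ)) P := fun v =>
    (dd_contDiffAt (k := 0) (by simpa using h1 v)).continuousAt
  have h3 := (h1 et).continuousAt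
  unfold heat
  exact h3.sub (tendsto_finsetSum _ fun i _ => h2 (ex i))

/-- A continuous distributional solution is a viscosity supersolution, with test functions touching
from below in the past only. -/
lemma Weak.visc {Ω : Set (X n)} (hΩ : IsOpen Ω) {w f : X n → ℝ} (hw : Continuous w)
    (hf : Continuous f) (h : Weak Ω w f) {P : X n} (hP : P ∈ Ω) {ψ : X n → ℝ}
    (hψ : ContDiffAt ℝ 2 ψ P)
    (hmin : ∀ᶠ z in 𝓝 P, z.2 ≤ P.2 → ψ z - ψ P ≤ w z - w P) : f P ≤ heat ψ P := by
  by_contra! hlt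
  set g := f P - heat ψ P with hg
  have hg0 : 0 < g := by linarith
  set δ := g / (8 * (2 * (n + 1) + 2)) with hδ
  have hδ0 : 0 < δ := by positivity
  have hev : ∀ᶠ z in 𝓝 P, ((z.2 ≤ P.2 → ψ z - ψ P ≤ w z - w P) ∧ ContDiffAt ℝ 2 ψ z ∧
      heat ψ z < heat ψ P + g / 4) ∧ z ∈ Ω ∧ f P - g / 4 < f z :=
    (hmin.and ((hψ.eventually (by simp)).and ((heat_continuousAt hψ).eventually_lt_const
      (by linarith)))).and ((hΩ.eventually_mem hP).and (hf.continuousAt.eventually_const_lt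
      (by linarith)))
  obtain ⟨ρ', hρ', hball⟩ := Metric.eventually_nhds_iff.1 hev
  set ρ := min (ρ' / 3) 1 with hρ
  have hρ0 : 0 < ρ := by positivity
  have hρ1 : ρ ≤ 1 := min_le_right _ _
  have hρ2 : 2 * ρ < ρ' := by have := min_le_left (ρ' / 3) 1; linarith
  set K := closedBall P ρ ∩ {z : X n | z.2 ≤ P.2} with hK
  have hKc : IsCompact K :=
    (isCompact_closedBall P ρ).inter_right (isClosed_le continuous_snd continuous_const)
  have hPK : P ∈ K := ⟨mem_closedBall_self hρ0.le, le_refl P.2⟩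
  obtain ⟨j, hj1, hj2⟩ := ((moll_LU hw K hKc (δ * ρ ^ 2 / 4) (by positivity)).and
    (rad_tendsto.eventually_lt_const hρ0)).exists
  have hin : ∀ z ∈ K, dist z P < ρ' := fun z hz => by
    have := mem_closedBall.1 hz.1; linarith
  have hwj : ContDiff ℝ ∞ (moll w (ker j)) :=
    moll_contDiff hw.locallyIntegrable (ker_contDiff j) (ker_hasCompactSupport j)
  set G : X n → ℝ := fun z => (ψ z - δ * qq P z) - moll w (ker j) z with hG
  have hGs : ∀ z ∈ K, ContDiffAt ℝ 2 (fun z => ψ z - δ * qq P z) z := fun z hz =>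
    (hball (hin z hz)).1.2.1.sub
      (contDiffAt_const.mul ((qq_contDiff P).contDiffAt.of_le two_le_infty))
  have hGs' : ∀ z ∈ K, ContDiffAt ℝ 2 G z := fun z hz =>
    (hGs z hz).sub (hwj.contDiffAt.of_le two_le_infty)
  have hGc : ContinuousOn G K := fun z hz => (hGs' z hz).continuousAt.continuousWithinAt
  obtain ⟨z, hzK, hz⟩ := hKc.exists_isMaxOn ⟨P, hPK⟩ hGc
  have hzP := hz hPK
  simp only [hG, qq_self, mem_ofPred_eq] at hzP
  have hd : dist z P < ρ := by
    refine lt_of_le_of_ne hzK.1 fun heq => ?_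
    have h1 := (hball (hin z hzK)).1.1 hzK.2
    have h2 := dist_sq_le_qq P z
    rw [heq] at h2
    have h3 := abs_le.1 (hj1 z hzK)
    have h4 := abs_le.1 (hj1 P hPK)
    have h5 : 0 < δ * ρ ^ 2 := by positivity
    have h6 : δ * ρ ^ 2 ≤ δ * qq P z := by gcongr
    linarith
  have hmax : 0 ≤ heat G z := by
    refine heat_nonneg_of_max (hGs' z hzK) ?_
    have : ∀ᶠ y in 𝓝 z, dist y P < ρ :=
      (continuous_id.dist continuous_const).continuousAt.eventually_lt_const hd
    filter_upwards [this] with y hy hyt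
    exact hz ⟨hy.le, hyt.trans hzK.2⟩
  have hψz := (hball (hin z hzK)).1.2.1
  rw [hG, heat_sub (hGs z hzK) (hwj.contDiffAt.of_le two_le_infty), heat_sub hψz
    (contDiffAt_const.mul ((qq_contDiff P).contDiffAt.of_le two_le_infty)), heat_const_mul,
    heat_qq, h.heat_moll hw.locallyIntegrable] at hmax
  · have h1 : f P - g / 4 ≤ moll f (ker j) z := by
      refine le_moll hf.locallyIntegrable fun y hy => ?_
      exact (hball (show dist y P < ρ' by linarith [dist_triangle y z P])).2.2.le
    have h2 := (hball (hin z hzK)).1.2.2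
    have h3 : -1 ≤ z.2 - P.2 := by
      have : |z.2 - P.2| ≤ dist z P := le_max_right (dist z.1 P.1) _
      linarith [(abs_le.1 this).1]
    have h4 : δ * (2 * (n + 1) + 2) = g / 8 := by rw [hδ]; field_simp
    nlinarith
  · intro y hy
    exact (hball (show dist y P < ρ' by linarith [dist_triangle y z P, mem_closedBall.1 hy])).2.1

/-! ### Coordinate reflections and translations -/

/-- The affine map `(x, t) ↦ (s x + a, t + b)` with `s` acting coordinatewise. -/
def aff (s : Fin (n + 1) → ℝ) (a : X n) (z : X n) : X n :=
  (fun k => s k * z.1 k + a.1 k, z.2 + a.2)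

/-- `aff` as a homeomorphism, when the coefficients are signs. -/
def affHomeo (s : Fin (n + 1) → ℝ) (hs : ∀ k, s k * s k = 1) (a : X n) : X n ≃ₜ X n where
  toFun := aff s a
  invFun := aff s (fun k => - (s k * a.1 k), - a.2)
  left_inv z := by
    ext k <;> simp only [aff]
    · linear_combination z.1 k * hs k
    · ring
  right_inv z := by
    ext k <;> simp only [aff]
    · linear_combination (z.1 k - a.1 k) * hs k
    · ring
  continuous_toFun := by unfold aff; fun_prop
  continuous_invFun := by unfold aff; fun_prop

lemma aff_contDiff (s : Fin (n + 1) → ℝ) (a : X n) : ContDiff ℝ ∞ (aff s a) := by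
  unfold aff
  refine ContDiff.prodMk (contDiff_pi.2 fun k => ?_) (by fun_prop)
  fun_prop

lemma aff_continuous (s : Fin (n + 1) → ℝ) (a : X n) : Continuous (aff s a) :=
  (aff_contDiff s a).continuous

lemma dd_aff (s : Fin (n + 1) → ℝ) (a v : X n) {φ : X n → ℝ} {z : X n}
    (hφ : DifferentiableAt ℝ φ (aff s a z)) :
    dd v (fun y => φ (aff s a y)) z = dd (fun k => s k * v.1 k, v.2) φ (aff s a z) := by
  have h0 : DifferentiableAt ℝ (aff s a) z := (aff_contDiff s a).differentiable (by simp) z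
  have hL : fderiv ℝ (aff s a) z v = (fun k => s k * v.1 k, v.2) := by
    have h1 : HasDerivAt (fun r : ℝ => aff s a (z + r • v)) (fderiv ℝ (aff s a) z v) 0 := by
      have h1 : HasDerivAt (fun r : ℝ => z + r • v) v 0 := by
        simpa using ((hasDerivAt_id (0 : ℝ)).smul_const v).const_add z
      have h2 : HasFDerivAt (aff s a) (fderiv ℝ (aff s a) z) (z + (0 : ℝ) • v) := by
        simpa using h0.hasFDerivAt
      exact h2.comp_hasDerivAt 0 h1
    have h2 : HasDerivAt (fun r : ℝ => aff s a (z + r • v))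
        ((fun k => s k * v.1 k, v.2) : X n) 0 := by
      have h3 : (fun r : ℝ => aff s a (z + r • v))
          = fun r : ℝ => aff s a z + r • ((fun k => s k * v.1 k, v.2) : X n) := by
        ext r k <;> simp [aff] <;> ring
      rw [h3]
      simpa using ((hasDerivAt_id (0 : ℝ)).smul_const
        ((fun k => s k * v.1 k, v.2) : X n)).const_add (aff s a z)
    exact h1.unique h2
  have := (hφ.hasFDerivAt.comp z h0.hasFDerivAt).fderiv
  change fderiv ℝ (φ ∘ aff s a) z v = _
  rw [this]
  simp [hL, dd]

lemma heatS_aff {s : Fin (n + 1) → ℝ} (hs : ∀ k, s k * s k = 1) (a : X n) {φ : X n → ℝ}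
    (hφ : ContDiff ℝ ∞ φ) (z : X n) :
    heatS (fun y => φ (aff s a y)) z = heatS φ (aff s a z) := by
  have hdir : ∀ i, ((fun k => s k * (ex i : X n).1 k, (ex i : X n).2) : X n) = s i • ex i := by
    intro i
    ext k
    · by_cases hk : k = i
      · subst hk; simp [ex]
      · simp [ex, hk]
    · simp [ex]
  have ht : ((fun k => s k * (et : X n).1 k, (et : X n).2) : X n) = et := by
    ext k <;> simp [et]
  have hsm : ∀ (c : ℝ) (v : X n) (f : X n → ℝ), dd (c • v) f = fun z => c * dd v f z := by
    intro c v f; ext z; simp [dd]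
  have h1 : ∀ i, dd (ex i) (fun y => φ (aff s a y)) = fun y => s i * dd (ex i) φ (aff s a y) := by
    intro i; ext y
    rw [dd_aff s a _ (hφ.differentiable (by simp) _), hdir, hsm]
  have h2 : ∀ i, dd (ex i) (dd (ex i) (fun y => φ (aff s a y))) z
      = dd (ex i) (dd (ex i) φ) (aff s a z) := by
    intro i
    rw [h1, dd_const_mul, dd_aff s a _ ((dd_contDiff hφ).differentiable (by simp) _), hdir, hsm]
    rw [← mul_assoc, hs, one_mul]
  simp only [heatS, h2]
  rw [dd_aff s a _ (hφ.differentiable (by simp) _), ht]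

lemma aff_measurePreserving {s : Fin (n + 1) → ℝ} (hs : ∀ k, s k * s k = 1) (a : X n) :
    MeasurePreserving (aff s a) := by
  have h1 : ∀ k, MeasurePreserving (fun x : ℝ => s k * x + a.1 k) := by
    intro k
    rcases mul_self_eq_one_iff.1 (hs k) with h | h
    · simpa [h] using measurePreserving_add_right (volume : Measure ℝ) (a.1 k)
    · have := Measure.measurePreserving_sub_left (volume : Measure ℝ) (a.1 k)
      rw [h, show (fun x : ℝ => -1 * x + a.1 k) = fun x => a.1 k - x by ext x; ring]; exact this
  have h2 := volume_preserving_pi h1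
  have h3 := measurePreserving_add_right (volume : Measure ℝ) a.2
  exact h2.prod h3

lemma integral_aff {s : Fin (n + 1) → ℝ} (hs : ∀ k, s k * s k = 1) (a : X n) (g : X n → ℝ) :
    ∫ z, g (aff s a z) = ∫ z, g z :=
  (show MeasurePreserving (affHomeo s hs a).toMeasurableEquiv volume volume from
    aff_measurePreserving hs a).integral_comp' g

lemma Weak.aff {Ω : Set (X n)} {u f : X n → ℝ} (h : Weak Ω u f) {s : Fin (n + 1) → ℝ}
    (hs : ∀ k, s k * s k = 1) (a : X n) :
    Weak (Liouville.aff s a ⁻¹' Ω) (fun z => u (Liouville.aff s a z))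
      (fun z => f (Liouville.aff s a z)) := by
  intro φ h1 h2 h3
  set b : X n := (fun k => - (s k * a.1 k), - a.2) with hb
  set φ' : X n → ℝ := fun y => φ (Liouville.aff s b y) with hφ'
  have hinv : ∀ z, Liouville.aff s b (Liouville.aff s a z) = z := (affHomeo s hs a).left_inv
  have hφφ : ∀ z, φ z = φ' (Liouville.aff s a z) := fun z => by simp only [hφ', hinv]
  have hφ's : ContDiff ℝ ∞ φ' := h1.comp (aff_contDiff s b)
  have hts : tsupport φ' = (affHomeo s hs a) '' tsupport φ := by
    have : φ' = φ ∘ (affHomeo s hs a).symm := rfl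
    rw [this, tsupport_comp_eq_preimage]
    exact ((affHomeo s hs a).image_eq_preimage_symm _).symm
  have h4 := h φ' hφ's (h2.comp_homeomorph (affHomeo s hs a).symm) (by
    rw [hts]; rintro _ ⟨y, hy, rfl⟩; exact h3 hy)
  have h5 : ∀ z, heatS φ z = heatS φ' (Liouville.aff s a z) := fun z => by
    rw [← heatS_aff hs a hφ's]
    congr 1; ext y; exact hφφ y
  simp only [h5, hφφ]
  rw [integral_aff hs a (fun z => u z * heatS φ' z), integral_aff hs a (fun z => f z * φ' z), h4]

/-! ### Stability under locally uniform limits -/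

lemma LU.integral_tendsto {ι : Type*} {l : Filter ι} {uk : ι → X n → ℝ} {u φ : X n → ℝ}
    (h : LU l uk u) (hk : ∀ k, LocallyIntegrable (uk k)) (hu : LocallyIntegrable u)
    (hφ : Continuous φ) (hc : HasCompactSupport φ) :
    Tendsto (fun k => ∫ z, uk k z * φ z) l (𝓝 (∫ z, u z * φ z)) := by
  rw [Metric.tendsto_nhds]
  intro ε hε
  set A := ∫ z, |φ z| with hA
  have hA0 : 0 ≤ A := integral_nonneg fun _ => abs_nonneg _
  filter_upwards [h _ hc (ε / (2 * (A + 1))) (by positivity)] with k hk'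
  rw [Real.dist_eq, ← integral_sub (LI_mul_integrable (hk k) hφ hc) (LI_mul_integrable hu hφ hc)]
  have h1 : ∀ z, |uk k z * φ z - u z * φ z| ≤ ε / (2 * (A + 1)) * |φ z| := by
    intro z
    rw [← sub_mul, abs_mul]
    by_cases hz : z ∈ tsupport φ
    · exact mul_le_mul_of_nonneg_right (hk' z hz) (abs_nonneg _)
    · simp [image_eq_zero_of_notMem_tsupport hz]
  have hi : Integrable φ := hφ.integrable_of_hasCompactSupport hc
  calc |∫ z, (uk k z * φ z - u z * φ z)| ≤ ∫ z, |uk k z * φ z - u z * φ z| :=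
        abs_integral_le_integral_abs
    _ ≤ ∫ z, ε / (2 * (A + 1)) * |φ z| := by
        refine integral_mono ?_ (hi.abs.const_mul _) h1
        exact ((LI_mul_integrable (hk k) hφ hc).sub (LI_mul_integrable hu hφ hc)).abs
    _ = ε / (2 * (A + 1)) * A := by rw [integral_const_mul]
    _ < ε := by
        rw [div_mul_eq_mul_div, div_lt_iff₀ (by positivity)]; nlinarith

lemma Weak.of_LU {ι : Type*} {l : Filter ι} [l.NeBot] {Ω : Set (X n)} {uk fk : ι → X n → ℝ}
    {u f : X n → ℝ} (h : ∀ k, Weak Ω (uk k) (fk k)) (h1 : LU l uk u) (h2 : LU l fk f)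
    (c1 : ∀ k, LocallyIntegrable (uk k)) (c2 : LocallyIntegrable u)
    (c3 : ∀ k, LocallyIntegrable (fk k)) (c4 : LocallyIntegrable f) : Weak Ω u f := by
  intro φ hφ hc hs
  have t1 := h1.integral_tendsto c1 c2 (heatS_contDiff hφ).continuous (heatS_hasCompactSupport hc)
  have t2 := h2.integral_tendsto c3 c4 hφ.continuous hc
  refine tendsto_nhds_unique t1 (t2.congr fun k => ?_)
  exact (h k φ hφ hc hs).symm

/-- `md` is a modulus of continuity for `u`. -/
def Mod (md : ℝ → ℝ) (u : X n → ℝ) : Prop :=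
  ∀ ε : ℝ, 0 < ε → ∀ z w, dist z w < md ε → |u z - u w| ≤ ε

lemma Mod.continuous {md : ℝ → ℝ} (hmd : ∀ ε, 0 < ε → 0 < md ε) {u : X n → ℝ} (h : Mod md u) :
    Continuous u := by
  rw [Metric.continuous_iff]
  intro b ε hε
  refine ⟨md (ε / 2), hmd _ (by positivity), fun a ha => ?_⟩
  have := h (ε / 2) (by positivity) a b ha
  rw [Real.dist_eq]; linarith

lemma Mod.of_tendsto {ι : Type*} {l : Filter ι} [l.NeBot] {md : ℝ → ℝ} {uk : ι → X n → ℝ}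
    {u : X n → ℝ} (h : ∀ k, Mod md (uk k)) (hl : ∀ z, Tendsto (fun k => uk k z) l (𝓝 (u z))) :
    Mod md u := by
  intro ε hε z w hzw
  exact le_of_tendsto (((hl z).sub (hl w)).abs) (Eventually.of_forall fun k => h k ε hε z w hzw)

lemma LU.of_tendsto {ι : Type*} {l : Filter ι} [l.NeBot] {md : ℝ → ℝ}
    (hmd : ∀ ε, 0 < ε → 0 < md ε) {uk : ι → X n → ℝ}
    {u : X n → ℝ} (h : ∀ k, Mod md (uk k)) (hl : ∀ z, Tendsto (fun k => uk k z) l (𝓝 (u z))) :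
    LU l uk u := by
  intro K hK ε hε
  have hu := Mod.of_tendsto h hl
  obtain ⟨t, -, htf, ht⟩ := hK.finite_cover_balls (hmd (ε / 3) (by positivity))
  have : ∀ᶠ k in l, ∀ x ∈ t, |uk k x - u x| < ε / 3 := by
    rw [eventually_all_finite htf]
    intro x _
    have := (Metric.tendsto_nhds.1 (hl x)) (ε / 3) (by positivity)
    simpa [Real.dist_eq] using this
  filter_upwards [this] with k hk z hz
  obtain ⟨x, hx, hzx⟩ := mem_iUnion₂.1 (ht hz)
  have a1 := abs_le.1 (h k (ε / 3) (by positivity) z x hzx)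
  have a2 := abs_le.1 (hu (ε / 3) (by positivity) z x hzx)
  have a3 := abs_lt.1 (hk x hx)
  rw [abs_le]; constructor <;> linarith

end

section

variable {n : ℕ}

/-! ### Interior regularity -/

/-- The reflection signs in the `i`-th coordinate. -/
noncomputable def sg (i : Fin (n + 1)) : Fin (n + 1) → ℝ := fun k => if k = i then -1 else 1

lemma sg_mul_self (i k : Fin (n + 1)) : sg i k * sg i k = 1 := by
  unfold sg; split_ifs <;> norm_num

/-- The reflection in the hyperplane `x i = c`. -/
noncomputable def rfl' (i : Fin (n + 1)) (c : ℝ) : X n → X n := aff (sg i) (Pi.single i (2 * c), 0)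

lemma rfl'_apply (i : Fin (n + 1)) (c : ℝ) (z : X n) :
    rfl' i c z = (Function.update z.1 i (2 * c - z.1 i), z.2) := by
  ext k
  · by_cases hk : k = i
    · subst hk; simp [rfl', aff, sg]; ring
    · simp [rfl', aff, sg, hk]
  · simp [rfl', aff]

lemma heat_aff {s : Fin (n + 1) → ℝ} (hs : ∀ k, s k * s k = 1) (a : X n) {φ : X n → ℝ}
    (hφ : ContDiff ℝ ∞ φ) (z : X n) :
    heat (fun y => φ (aff s a y)) z = heat φ (aff s a z) := by
  have h1 := heatS_aff hs a hφ z
  have ht : ((fun k => s k * (et : X n).1 k, (et : X n).2) : X n) = et := by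
    ext k <;> simp [et]
  have h2 : dd et (fun y => φ (aff s a y)) z = dd et φ (aff s a z) := by
    rw [dd_aff s a _ (hφ.differentiable (by simp) _), ht]
  simp only [heat, heatS] at *
  linarith

lemma lipschitz_space_aux {g : X n → ℝ} (hg : ContDiff ℝ ∞ g) {C A : ℝ}
    (hC : ∀ z, |g z| ≤ C) (hA : ∀ z, |heat g z| ≤ A) (i : Fin (n + 1)) (c : ℝ) (z : X n)
    (h0 : 0 ≤ z.1 i - c) (h1 : z.1 i - c ≤ 1) :
    g z - g (rfl' i c z) ≤ (A + 1 + 2 * C) * (2 * (z.1 i - c)) := by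
  set K := A + 1 + 2 * C with hK
  have hC0 : 0 ≤ C := (abs_nonneg _).trans (hC 0)
  have hA0 : 0 ≤ A := (abs_nonneg _).trans (hA 0)
  have hgr : ContDiff ℝ ∞ fun y => g (rfl' i c y) := hg.comp (aff_contDiff _ _)
  set b : X n → ℝ := fun y => (fun s : ℝ => K * (2 * (s - c) - (s - c) ^ 2)) (y.1 i) with hb
  have hbs : ContDiff ℝ ∞ b := by unfold b; fun_prop
  set D : X n → ℝ := fun y => g y - g (rfl' i c y) - b y with hD
  have hDs : ContDiff ℝ ∞ D := (hg.sub hgr).sub hbs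
  set S : Set (X n) := {y | c ≤ y.1 i ∧ y.1 i ≤ c + 1} with hS
  have hci : Continuous fun y : X n => y.1 i := by fun_prop
  have hSc : IsClosed S := (isClosed_le continuous_const hci).inter
    (isClosed_le hci continuous_const)
  have hbd : ∀ y, |g y - g (rfl' i c y)| ≤ 2 * C := fun y => by
    have := abs_sub (g y) (g (rfl' i c y))
    linarith [hC y, hC (rfl' i c y)]
  have hheatb : ∀ y, heat b y = 2 * K := by
    intro y
    have e1 : deriv (fun s : ℝ => K * (2 * (s - c) - (s - c) ^ 2))
        = fun s => K * (2 - 2 * (s - c)) := by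
      ext s
      have : HasDerivAt (fun s : ℝ => K * (2 * (s - c) - (s - c) ^ 2))
          (K * (2 * 1 - 2 * (s - c) ^ 1 * 1)) s :=
        ((((hasDerivAt_id s).sub_const c).const_mul 2).sub
          (((hasDerivAt_id s).sub_const c).pow 2)).const_mul K
      rw [this.deriv]; ring
    have e2 : deriv (fun s : ℝ => K * (2 - 2 * (s - c))) = fun _ => - (2 * K) := by
      ext s
      have : HasDerivAt (fun s : ℝ => K * (2 - 2 * (s - c))) (K * (- (2 * 1))) s :=
        ((((hasDerivAt_id s).sub_const c).const_mul 2).const_sub 2).const_mul K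
      rw [this.deriv]; ring
    rw [hb, heat_comp (g := fun s : ℝ => K * (2 * (s - c) - (s - c) ^ 2)) (f := fun y : X n => y.1 i)
      (by fun_prop) (by fun_prop), heat_coord, e1, e2]
    simp [dd_coord, ex, Pi.single_apply]
  have key := max_principle hSc (D := D) hDs.continuous.continuousOn (M := 2 * C) (η := 1)
    (fun y hy => by
      have := abs_le.1 (hbd y)
      have : 0 ≤ b y := by
        simp only [hb]
        have h1 := hy.1
        have h2 := hy.2
        have : 0 ≤ K := by positivity
        exact mul_nonneg this (by nlinarith)
      simp only [hD]; linarith) one_pos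
    (fun y hy hpos => by
      refine ⟨?_, hDs.contDiffAt.of_le two_le_infty, ?_⟩
      · have ha : c < y.1 i := by
          refine lt_of_le_of_ne hy.1 fun heq => ?_
          have : rfl' i c y = y := by
            rw [rfl'_apply]
            ext k
            · by_cases hk : k = i
              · subst hk; simp [← heq]; ring
              · simp [hk]
            · rfl
          simp only [hD, this, hb, ← heq] at hpos
          simp at hpos
        have hb' : y.1 i < c + 1 := by
          refine lt_of_le_of_ne hy.2 fun heq => ?_
          have h2 := abs_le.1 (hbd y)
          simp only [hD, hb, heq] at hpos
          have : K * (2 * (c + 1 - c) - (c + 1 - c) ^ 2) = K := by ring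
          rw [this] at hpos
          linarith
        filter_upwards [hci.continuousAt.eventually_const_lt ha,
          hci.continuousAt.eventually_lt_const hb'] with w h1 h2 _
        exact ⟨h1.le, h2.le⟩
      · have e : heat D y = heat g y - heat g (rfl' i c y) - heat b y := by
          rw [hD, heat_sub (f := fun y => g y - g (rfl' i c y)) ((hg.sub hgr).contDiffAt.of_le two_le_infty)
            (hbs.contDiffAt.of_le two_le_infty), heat_sub (hg.contDiffAt.of_le two_le_infty)
            (hgr.contDiffAt.of_le two_le_infty)]
          congr 2
          exact heat_aff (sg_mul_self i) _ hg y
        rw [e, hheatb]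
        have h1 := abs_le.1 (hA y)
        have h2 := abs_le.1 (hA (rfl' i c y))
        linarith)
    z ⟨by linarith, by linarith⟩
  have hK0 : 0 ≤ K := by positivity
  simp only [hD, hb] at key
  nlinarith [mul_nonneg hK0 (sq_nonneg (z.1 i - c))]

lemma lipschitz_coord {g : X n → ℝ} (hg : ContDiff ℝ ∞ g) {C A : ℝ}
    (hC : ∀ z, |g z| ≤ C) (hA : ∀ z, |heat g z| ≤ A) (i : Fin (n + 1)) (z : X n) :
    |dd (ex i) g z| ≤ A + 1 + 2 * C := by
  set K := A + 1 + 2 * C with hK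
  have hC0 : 0 ≤ C := (abs_nonneg _).trans (hC 0)
  have hA0 : 0 ≤ A := (abs_nonneg _).trans (hA 0)
  have one : ∀ (g : X n → ℝ), ContDiff ℝ ∞ g → (∀ z, |g z| ≤ C) → (∀ z, |heat g z| ≤ A) →
      ∀ (y : X n) (s : ℝ), 0 ≤ s → s ≤ 1 → g (y + s • ex i) - g y ≤ K * s := by
    intro g hg hC hA y s hs0 hs1
    have := lipschitz_space_aux hg hC hA i (y.1 i + s / 2) (y + s • ex i)
      (by simp [ex]; linarith) (by simp [ex]; linarith)
    have e : rfl' i (y.1 i + s / 2) (y + s • ex i) = y := by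
      rw [rfl'_apply]
      ext k
      · by_cases hk : k = i
        · subst hk; simp [ex]; ring
        · simp [ex, hk]
      · simp [ex]
    rw [e] at this
    simp [ex] at this
    calc _ ≤ K * (2 * (s - s / 2)) := by simpa [ex] using this
      _ = K * s := by ring
  have both : ∀ (y : X n) (s : ℝ), 0 ≤ s → s ≤ 1 → |g (y + s • ex i) - g y| ≤ K * s := by
    intro y s h0 h1
    have a := one g hg hC hA y s h0 h1
    have b := one (fun y => - g y) hg.neg (fun z => by rw [abs_neg]; exact hC z)
      (fun z => by rw [heat_neg, abs_neg]; exact hA z) y s h0 h1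
    rw [abs_le]; constructor <;> linarith
  have hd := dd_hasDerivAt (v := ex i) (hg.differentiable (by simp) z)
  have := hd.hasFDerivAt.le_of_lip' (C := K) (by positivity) (by
    have : ∀ᶠ s in 𝓝 (0 : ℝ), |s| < 1 := by
      simpa using (continuous_abs.tendsto (0 : ℝ)).eventually_lt_const (u := 1) (by simp)
    filter_upwards [this] with s hs
    rcases le_total 0 s with h | h
    · have := both z s h (by linarith [le_abs_self s])
      simpa [abs_of_nonneg h] using this
    · have := both (z + s • ex i) (-s) (by linarith) (by linarith [neg_le_abs s])
      rw [abs_sub_comm] at this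
      simpa [abs_of_nonpos h] using this)
  simpa using this

lemma lipschitz_space {g : X n → ℝ} (hg : ContDiff ℝ ∞ g) {K : ℝ}
    (hK : ∀ i z, |dd (ex i) g z| ≤ K) (x y : Fin (n + 1) → ℝ) (t : ℝ) :
    |g (x, t) - g (y, t)| ≤ K * (n + 1) * dist x y := by
  set v : X n := (x - y, 0) with hv
  have hv' : v = ∑ i, (x i - y i) • ex i := by
    ext k
    · simp [hv, ex, Prod.fst_sum, Finset.sum_apply, Pi.single_apply]
    · simp [hv, ex, Prod.snd_sum]
  have hder : ∀ s ∈ Set.Icc (0 : ℝ) 1,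
      HasDerivWithinAt (fun s : ℝ => g ((y, t) + s • v)) (dd v g ((y, t) + s • v)) (Icc 0 1) s :=
    fun s _ => (dd_hasDerivAt' (hg.differentiable (by simp) _)).hasDerivWithinAt
  have hb : ∀ s ∈ Set.Ico (0 : ℝ) 1, ‖dd v g ((y, t) + s • v)‖ ≤ K * (n + 1) * dist x y := by
    intro s _
    set p := (y, t) + s • v
    have : dd v g p = ∑ i, (x i - y i) * dd (ex i) g p := by
      simp only [dd]
      rw [hv', map_sum]; simp
    rw [this]
    calc ‖∑ i, (x i - y i) * dd (ex i) g p‖ ≤ ∑ i, ‖(x i - y i) * dd (ex i) g p‖ :=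
          norm_sum_le _ _
      _ ≤ ∑ _i : Fin (n + 1), dist x y * K := by
          refine Finset.sum_le_sum fun i _ => ?_
          rw [norm_mul]
          exact mul_le_mul (dist_le_pi_dist x y i) (hK i p) (norm_nonneg _) dist_nonneg
      _ = _ := by simp; ring
  have := norm_image_sub_le_of_norm_deriv_le_segment_01' hder hb
  simpa [hv] using this

lemma holder_time {g : X n → ℝ} (hg : ContDiff ℝ ∞ g) {C A K : ℝ} (hK0 : 0 ≤ K)
    (hC : ∀ z, |g z| ≤ C) (hA : ∀ z, |heat g z| ≤ A)
    (hK : ∀ (x y : Fin (n + 1) → ℝ) (t : ℝ), |g (x, t) - g (y, t)| ≤ K * dist x y)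
    (x : Fin (n + 1) → ℝ) (s h : ℝ) (hh : 0 < h) :
    g (x, s + h ^ 2) - g (x, s) ≤ K * (2 * n + 3) * h + (A + 1) * h ^ 2 := by
  have hC0 : 0 ≤ C := (abs_nonneg _).trans (hC 0)
  have hA0 : 0 ≤ A := (abs_nonneg _).trans (hA 0)
  set L := A + 1 + 2 * (n + 1) * K / h with hL
  have hL0 : 0 ≤ L := by positivity
  set b : X n → ℝ := fun z => K / h * qs x 0 z + (L * z.2 + (g (x, s) + K * h - L * s)) with hb
  have hq2 : ∀ z : X n, ContDiffAt ℝ 2 (fun z => K / h * qs x 0 z) z := fun z =>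
    contDiffAt_const.mul ((qs_contDiff x 0).contDiffAt.of_le two_le_infty)
  have hbs : ContDiff ℝ ∞ b := by
    have := qs_contDiff x 0
    unfold b; fun_prop
  have hheat : ∀ z, heat b z = A + 1 := by
    intro z
    rw [hb, heat_add (hq2 z) (by fun_prop), heat_const_mul, heat_qs,
      heat_add (by fun_prop) (by fun_prop), heat_const_mul, heat_time, heat_const]
    simp [hL]; field_simp; ring
  set S : Set (X n) := {z | s ≤ z.2} with hS
  have hSc : IsClosed S := isClosed_le continuous_const continuous_snd
  have key := max_principle hSc (D := fun z => g z - b z) (hg.continuous.sub hbs.continuous).continuousOn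
    (M := 2 * C) (η := 1)
    (fun z hz => by
      have h1 := abs_le.1 (hC z)
      have h2 := abs_le.1 (hC (x, s))
      have h3 : 0 ≤ K / h * qs x 0 z := mul_nonneg (by positivity) (qs_nonneg _ _ _)
      have h4 : 0 ≤ L * (z.2 - s) := mul_nonneg hL0 (sub_nonneg.2 hz)
      have h5 : 0 ≤ K * h := by positivity
      simp only [hb]; linarith) one_pos
    (fun z hz hpos => by
      refine ⟨?_, (hg.sub hbs).contDiffAt.of_le two_le_infty, ?_⟩
      · have : s < z.2 := by
          refine lt_of_le_of_ne hz fun heq => ?_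
          have h1 := hK z.1 x s
          rw [show (z.1, s) = z by rw [heq]] at h1
          have h2 : dist z (x, s) ^ 2 ≤ qq (x, s) z := dist_sq_le_qq _ _
          have h3 : dist z.1 x ^ 2 ≤ qs x 0 z := by
            have : qq (x, s) z = qs x 0 z := by simp [qq, ← heq]
            rw [← this]
            refine le_trans ?_ h2
            have : dist z.1 x ≤ dist z (x, s) := le_max_left _ _
            gcongr
          have h4 : dist z.1 x ≤ qs x 0 z / h + h := by
            have : dist z.1 x ≤ dist z.1 x ^ 2 / h + h := by
              rw [div_add' _ _ _ hh.ne', le_div_iff₀ hh]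
              nlinarith [sq_nonneg (dist z.1 x - h), dist_nonneg (x := z.1) (y := x), sq_nonneg (dist z.1 x + h)]
            have : dist z.1 x ^ 2 / h ≤ qs x 0 z / h := by gcongr
            linarith
          have h5 : K * dist z.1 x ≤ K * (qs x 0 z / h + h) := by gcongr
          have h6 := le_abs_self (g z - g (x, s))
          have h7 : K * (qs x 0 z / h + h) = K / h * qs x 0 z + K * h := by ring
          simp only [hb, ← heq] at hpos
          linarith
        filter_upwards [continuous_snd.continuousAt.eventually_const_lt this] with w hw _
        exact hw.le
      · rw [heat_sub (hg.contDiffAt.of_le two_le_infty) (hbs.contDiffAt.of_le two_le_infty), hheat]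
        have h1 := abs_le.1 (hA z)
        linarith)
    (x, s + h ^ 2) (by simp only [hS, mem_ofPred_eq]; nlinarith)
  have e0 : qs x 0 (x, s + h ^ 2) = 0 := by simp [qs]
  simp only [hb, e0] at key
  have e1 : L * (s + h ^ 2) - L * s = (A + 1) * h ^ 2 + 2 * (n + 1) * K * h := by
    rw [hL]; field_simp; ring
  nlinarith

/-- The modulus of continuity of bounded solutions with bounded right-hand side. -/
noncomputable def regMod (n : ℕ) (C A : ℝ) (ε : ℝ) : ℝ :=
  min 1 ((ε / ((A + 1 + 2 * C) * (n + 1) * (2 * n + 4) + A + 2)) ^ 2)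

lemma regMod_pos {C A : ℝ} (hC : 0 ≤ C) (hA : 0 ≤ A) (ε : ℝ) (hε : 0 < ε) :
    0 < regMod n C A ε := by
  unfold regMod; positivity

lemma smooth_mod {g : X n → ℝ} (hg : ContDiff ℝ ∞ g) {C A : ℝ}
    (hC : ∀ z, |g z| ≤ C) (hA : ∀ z, |heat g z| ≤ A) : Mod (regMod n C A) g := by
  have hC0 : 0 ≤ C := (abs_nonneg _).trans (hC 0)
  have hA0 : 0 ≤ A := (abs_nonneg _).trans (hA 0)
  intro ε hε z w hzw
  set K := (A + 1 + 2 * C) * (n + 1) with hK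
  have hK0 : 0 ≤ K := by positivity
  set d := dist z w with hd
  have hd1 : d < 1 := hzw.trans_le (min_le_left _ _)
  have hd2 : d < (ε / (K * (2 * n + 4) + A + 2)) ^ 2 := hzw.trans_le (min_le_right _ _)
  have hlip : ∀ (x y : Fin (n + 1) → ℝ) (t : ℝ), |g (x, t) - g (y, t)| ≤ K * dist x y :=
    lipschitz_space hg (lipschitz_coord hg hC hA)
  have hlip' : ∀ (x y : Fin (n + 1) → ℝ) (t : ℝ), |- g (x, t) - - g (y, t)| ≤ K * dist x y :=
    fun x y t => by
      rw [neg_sub_neg, abs_sub_comm]; exact hlip x y t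
  have htime : ∀ x s h, 0 < h →
      |g (x, s + h ^ 2) - g (x, s)| ≤ K * (2 * n + 3) * h + (A + 1) * h ^ 2 := by
    intro x s h hh
    have a := holder_time hg hK0 hC hA hlip x s h hh
    have b := holder_time (g := fun y => - g y) hg.neg hK0 (fun z => by rw [abs_neg]; exact hC z)
      (fun z => by rw [heat_neg, abs_neg]; exact hA z) hlip' x s h hh
    rw [abs_le]; constructor <;> linarith
  have hsq : √d ≤ ε / (K * (2 * n + 4) + A + 2) := by
    rw [← Real.sqrt_sq (show 0 ≤ ε / (K * (2 * n + 4) + A + 2) by positivity)]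
    exact Real.sqrt_le_sqrt hd2.le
  have hd0 : 0 ≤ d := dist_nonneg
  have hdsq : d ≤ √d := Real.le_sqrt_of_sq_le (by nlinarith)
  have ht : |g (w.1, z.2) - g w| ≤ K * (2 * n + 3) * √d + (A + 1) * d := by
    have gen : ∀ s t : ℝ, s < t → t - s ≤ d →
        |g (w.1, t) - g (w.1, s)| ≤ K * (2 * n + 3) * √d + (A + 1) * d := by
      intro s t hst hle
      have := htime w.1 s (√(t - s)) (Real.sqrt_pos.2 (by linarith))
      rw [Real.sq_sqrt (by linarith), add_sub_cancel] at this
      have h1 : √(t - s) ≤ √d := Real.sqrt_le_sqrt hle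
      calc _ ≤ _ := this
        _ ≤ _ := by gcongr
    have hzw2 : |z.2 - w.2| ≤ d := le_max_right (dist z.1 w.1) _
    rcases lt_trichotomy z.2 w.2 with h | h | h
    · rw [abs_sub_comm]
      exact gen z.2 w.2 h (by linarith [neg_le_abs (z.2 - w.2)])
    · rw [h]; simp; positivity
    · exact gen w.2 z.2 h (by linarith [le_abs_self (z.2 - w.2)])
  have hx : |g z - g (w.1, z.2)| ≤ K * d :=
    (hlip z.1 w.1 z.2).trans (by have : dist z.1 w.1 ≤ d := le_max_left _ _; gcongr)
  calc |g z - g w| ≤ |g z - g (w.1, z.2)| + |g (w.1, z.2) - g w| := abs_sub_le _ _ _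
    _ ≤ K * d + (K * (2 * n + 3) * √d + (A + 1) * d) := add_le_add hx ht
    _ ≤ K * √d + (K * (2 * n + 3) * √d + (A + 1) * √d) := by gcongr
    _ = (K * (2 * n + 4) + A + 1) * √d := by ring
    _ ≤ (K * (2 * n + 4) + A + 2) * (ε / (K * (2 * n + 4) + A + 2)) := by
        gcongr; linarith
    _ = ε := by field_simp

lemma exists_ulim {a : ℕ → ℝ} {C : ℝ} (h : ∀ k, |a k| ≤ C) :
    ∃ x, |x| ≤ C ∧ Tendsto a (hyperfilter ℕ) (𝓝 x) := by
  have hc : IsCompact (Icc (-C) C) := isCompact_Icc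
  obtain ⟨x, hx, hle⟩ := hc.ultrafilter_le_nhds ((hyperfilter ℕ).map a) (by
    rw [le_principal_iff]
    exact mem_map.2 (Filter.univ_mem' fun k => abs_le.1 (h k)))
  exact ⟨x, abs_le.2 hx, hle⟩

/-- Bounded separately continuous distributional solutions with bounded right-hand side have a
universal modulus of continuity. -/
lemma Weak.mod {u f : X n → ℝ} (h : Weak univ u f) {C A : ℝ} (hC : ∀ z, |u z| ≤ C)
    (hA : ∀ z, |f z| ≤ A) (hu : LocallyIntegrable u) (hf : LocallyIntegrable f)
    (hx : ∀ t, Continuous fun x => u (x, t)) (ht : ∀ x, Continuous fun t => u (x, t)) :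
    Mod (regMod n C A) u := by
  have hC0 : 0 ≤ C := (abs_nonneg _).trans (hC 0)
  have hA0 : 0 ≤ A := (abs_nonneg _).trans (hA 0)
  have hb : ∀ (u : X n → ℝ) (C : ℝ), LocallyIntegrable u → (∀ z, |u z| ≤ C) →
      ∀ j z, |moll u (ker j) z| ≤ C := fun u C hu hC j z =>
    abs_le.2 ⟨le_moll hu fun y _ => (abs_le.1 (hC y)).1, moll_le hu fun y _ => (abs_le.1 (hC y)).2⟩
  have hm : ∀ j, Mod (regMod n C A) (moll u (ker j)) := fun j =>
    smooth_mod (moll_contDiff hu (ker_contDiff j) (ker_hasCompactSupport j)) (hb u C hu hC j)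
      fun z => by
        rw [h.heat_moll hu (subset_univ _)]
        exact hb f A hf hA j z
  choose v hvC hv using fun z => exists_ulim fun j => hb u C hu hC j z
  have hvm : Mod (regMod n C A) v := Mod.of_tendsto hm hv
  have hvc : Continuous v := hvm.continuous (regMod_pos hC0 hA0)
  have hae : ∀ᵐ z, u z = v z := by
    filter_upwards [moll_ae_tendsto hu] with z hz
    exact tendsto_nhds_unique (hz.mono_left Nat.hyperfilter_le_atTop) (hv z)
  have hae2 : ∀ᵐ x : Fin (n + 1) → ℝ, ∀ᵐ t : ℝ, u (x, t) = v (x, t) :=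
    Measure.ae_ae_of_ae_prod hae
  have hae3 : ∀ᵐ x : Fin (n + 1) → ℝ, ∀ t : ℝ, u (x, t) = v (x, t) := by
    filter_upwards [hae2] with x hx'
    have := (ht x).ae_eq_iff_eq (μ := volume) (g := fun t => v (x, t)) (by fun_prop) |>.1 hx'
    exact congrFun this
  have : u = v := by
    ext ⟨x, t⟩
    have h2 : ∀ᵐ x : Fin (n + 1) → ℝ, u (x, t) = v (x, t) := hae3.mono fun x h => h t
    exact congrFun ((hx t).ae_eq_iff_eq (μ := volume) (g := fun x => v (x, t)) (by fun_prop)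
      |>.1 h2) x
  rw [this]; exact hvm

end

section

variable {n : ℕ}

lemma heat_time_comp {a : ℝ → ℝ} {z : X n} (ha : ContDiffAt ℝ 2 a z.2) :
    heat (fun y : X n => a y.2) z = deriv a z.2 := by
  rw [heat_comp (f := fun y : X n => y.2) (g := a) ha (by fun_prop), heat_time]
  simp [dd_time, ex]

lemma heat_coord_comp {a : ℝ → ℝ} {i : Fin (n + 1)} {z : X n} (ha : ContDiffAt ℝ 2 a (z.1 i)) :
    heat (fun y : X n => a (y.1 i)) z = - deriv (deriv a) (z.1 i) := by
  rw [heat_comp (f := fun y : X n => y.1 i) (g := a) ha (by fun_prop), heat_coord]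
  simp [dd_coord, ex, Pi.single_apply]

lemma heat_time_mul {a : ℝ → ℝ} {f : X n → ℝ} {z : X n} (ha : ContDiffAt ℝ 2 a z.2)
    (hf : ContDiffAt ℝ 2 f z) :
    heat (fun y : X n => a y.2 * f y) z = deriv a z.2 * f z + a z.2 * heat f z := by
  have h1 : ContDiffAt ℝ 2 (fun y : X n => a y.2) z :=
    ContDiffAt.comp z (g := a) (f := fun y : X n => y.2) ha (by fun_prop)
  rw [heat_mul h1 hf, heat_time_comp ha]
  have : ∀ i, dd (ex i) (fun y : X n => a y.2) z = 0 := by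
    intro i
    rw [dd_comp (g := a) (f := fun y : X n => y.2) (ha.differentiableAt (by norm_num))
      (by fun_prop)]
    simp [dd_time, ex]
  simp [this]

lemma ball_barrier (c b : Fin (n + 1) → ℝ) {R : ℝ} (hR : 0 < R) :
    ∃ α : ℝ, ∀ z, qs c b z < R ^ 2 →
      heat (fun z => Real.exp (-α * z.2) * (R ^ 2 - qs c b z) ^ 2) z < 0 := by
  set B := ∑ i, b i ^ 2 with hB
  have hB0 : 0 ≤ B := Finset.sum_nonneg fun _ _ => sq_nonneg _
  set M := 4 * (B + R ^ 2 + (n + 1)) + 8 with hM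
  have hM0 : 0 < M := by positivity
  refine ⟨M ^ 2 / (16 * R ^ 2), fun z hz => ?_⟩
  set α := M ^ 2 / (16 * R ^ 2) with hα
  have hq := qs_contDiff c b
  have hq2 : ContDiffAt ℝ 2 (qs c b) z := (hq.of_le two_le_infty).contDiffAt
  have hq3 : ContDiffAt ℝ 2 (fun z => (R ^ 2 - qs c b z) ^ 2) z := by fun_prop
  rw [heat_time_mul (a := fun s => Real.exp (-α * s)) (by fun_prop) hq3]
  have h1 : deriv (fun s => Real.exp (-α * s)) z.2 = -α * Real.exp (-α * z.2) := by
    have : HasDerivAt (fun s => Real.exp (-α * s)) (Real.exp (-α * z.2) * (-α * 1)) z.2 :=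
      ((hasDerivAt_id z.2).const_mul (-α)).exp
    rw [this.deriv]; ring
  have h2 : heat (fun z => (R ^ 2 - qs c b z) ^ 2) z
      = 4 * (R ^ 2 - qs c b z) * ((∑ i, b i * (z.1 i - c i - z.2 * b i)) + (n + 1))
        - 8 * qs c b z := by
    rw [heat_comp (f := qs c b) (g := fun s => (R ^ 2 - s) ^ 2) (by fun_prop) hq2, heat_qs]
    have d1 : deriv (fun s => (R ^ 2 - s) ^ 2) = fun s => -2 * (R ^ 2 - s) := by
      ext s
      have : HasDerivAt (fun s => (R ^ 2 - s) ^ 2) (2 * (R ^ 2 - s) ^ 1 * (-1)) s :=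
        ((hasDerivAt_id s).const_sub (R ^ 2)).pow 2
      rw [this.deriv]; ring
    have d2 : deriv (fun s => -2 * (R ^ 2 - s)) (qs c b z) = 2 := by
      have : HasDerivAt (fun s => -2 * (R ^ 2 - s)) (-2 * (-1)) (qs c b z) :=
        ((hasDerivAt_id _).const_sub (R ^ 2)).const_mul (-2)
      rw [this.deriv]; ring
    rw [d1, d2]
    simp only [dd_ex_qs]
    have : ∑ i, (2 * (z.1 i - c i - z.2 * b i)) ^ 2 = 4 * qs c b z := by
      simp only [qs, Finset.mul_sum]; exact Finset.sum_congr rfl fun i _ => by ring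
    rw [this]; ring
  rw [h1, h2]
  have h3 : ∑ i, b i * (z.1 i - c i - z.2 * b i) ≤ B + qs c b z := by
    simp only [hB, qs, ← Finset.sum_add_distrib]
    refine Finset.sum_le_sum fun i _ => ?_
    nlinarith [sq_nonneg (b i - (z.1 i - c i - z.2 * b i)), sq_nonneg (b i),
      sq_nonneg (z.1 i - c i - z.2 * b i)]
  set d := R ^ 2 - qs c b z with hd
  have hd0 : 0 < d := by linarith
  have hQ0 := qs_nonneg c b z
  set S := ∑ i, b i * (z.1 i - c i - z.2 * b i)
  have h4 : 4 * d * (S + (n + 1)) ≤ 4 * d * (B + R ^ 2 + (n + 1)) := by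
    gcongr; linarith
  have h5 : M * d ≤ α * d ^ 2 + 4 * R ^ 2 := by
    have : α * d ^ 2 + 4 * R ^ 2 - M * d = (M * d / (4 * R) - 2 * R) ^ 2 := by
      rw [hα]; field_simp; ring
    nlinarith [sq_nonneg (M * d / (4 * R) - 2 * R)]
  have hR2 : 0 < R ^ 2 := by positivity
  have h6 : -α * d ^ 2 + (4 * d * (S + (n + 1)) - 8 * qs c b z) < 0 := by
    have : qs c b z = R ^ 2 - d := by rw [hd]; ring
    rw [this]
    have : M * d = 4 * d * (B + R ^ 2 + (n + 1)) + 8 * d := by rw [hM]; ring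
    linarith
  have := mul_neg_of_pos_of_neg (Real.exp_pos (-α * z.2)) h6
  linarith

lemma continuous_qs (c b : Fin (n + 1) → ℝ) : Continuous (qs c b) := (qs_contDiff c b).continuous

lemma abs_le_of_qs_le {c b : Fin (n + 1) → ℝ} {z : X n} {R : ℝ} (hR : 0 ≤ R)
    (h : qs c b z ≤ R ^ 2) (i : Fin (n + 1)) : |z.1 i - c i - z.2 * b i| ≤ R := by
  have := Finset.single_le_sum (f := fun i => (z.1 i - c i - z.2 * b i) ^ 2)
    (fun i _ => sq_nonneg _) (Finset.mem_univ i)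
  exact abs_le_of_sq_le_sq (this.trans h) hR

/-- Strong maximum principle. -/
lemma strong_max {S : Set (Fin (n + 1) → ℝ)} (hS : IsOpen S) (hSc : Convex ℝ S)
    {w f : X n → ℝ} (hw : Continuous w) (hf : Continuous f)
    (h : Weak {z | z.1 ∈ S} w f) (hw0 : ∀ z : X n, z.1 ∈ S → 0 ≤ w z)
    (hf0 : ∀ z : X n, z.1 ∈ S → 0 ≤ f z) {y z : X n} (hy : y.1 ∈ S) (hz : z.1 ∈ S)
    (hyz : y.2 < z.2) (hpos : 0 < w y) : 0 < w z := by
  set T := z.2 - y.2 with hT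
  have hT0 : 0 < T := by linarith
  set b : Fin (n + 1) → ℝ := T⁻¹ • (z.1 - y.1) with hb
  set c : Fin (n + 1) → ℝ := y.1 - y.2 • b with hc
  have hseg : segment ℝ y.1 z.1 ⊆ S := hSc.segment_subset hy hz
  have hcpt : IsCompact (segment ℝ y.1 z.1) := by
    rw [segment_eq_image_lineMap]; exact isCompact_Icc.image (by fun_prop)
  obtain ⟨R₁, hR₁, hthick⟩ := hcpt.exists_cthickening_subset_open hS hseg
  obtain ⟨R₂, hR₂, hball⟩ := Metric.eventually_nhds_iff_ball.1
    ((hw.tendsto y).eventually_const_lt (u := w y / 2) (by linarith))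
  set R := min R₁ (R₂ / 2) with hR
  have hR0 : 0 < R := by positivity
  obtain ⟨α, hα⟩ := ball_barrier c b hR0
  set K : Set (X n) := {v | y.2 ≤ v.2 ∧ v.2 ≤ z.2 ∧ qs c b v ≤ R ^ 2} with hK
  have hcoord : ∀ v : X n, ∀ i, v.1 i - c i - v.2 * b i
      = v.1 i - (y.1 i + (v.2 - y.2) * b i) := by
    intro v i; simp only [hc, Pi.sub_apply, Pi.smul_apply, smul_eq_mul]; ring
  have hKS : ∀ v ∈ K, v.1 ∈ S := by
    intro v hv
    apply hthick
    refine mem_cthickening_of_dist_le _ (y.1 + (v.2 - y.2) • b) _ _ ?_ ?_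
    · rw [segment_eq_image']
      refine ⟨(v.2 - y.2) / T, ⟨by have := hv.1; apply div_nonneg <;> linarith, ?_⟩, ?_⟩
      · rw [div_le_one hT0]; have := hv.2.1; linarith
      · simp only [hb, smul_smul]; rfl
    · refine (dist_pi_le_iff hR₁.le).2 fun i => ?_
      have := abs_le_of_qs_le hR0.le hv.2.2 i
      rw [hcoord] at this
      exact this.trans (min_le_left _ _)
  have hKb : K ⊆ closedBall 0 (max (max |y.2| |z.2|) (R + ‖c‖ + max |y.2| |z.2| * ‖b‖)) := by
    intro v hv
    have ht : |v.2| ≤ max |y.2| |z.2| := abs_le_max_abs_abs hv.1 hv.2.1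
    rw [mem_closedBall_zero_iff, Prod.norm_def]
    refine max_le ?_ ?_
    · refine le_max_of_le_right ((pi_norm_le_iff_of_nonneg (by positivity)).2 fun i => ?_)
      have h1 := abs_le_of_qs_le hR0.le hv.2.2 i
      have h2 : |c i| ≤ ‖c‖ := norm_le_pi_norm c i
      have h3 : |b i| ≤ ‖b‖ := norm_le_pi_norm b i
      have h4 : |v.2 * b i| ≤ max |y.2| |z.2| * ‖b‖ := by
        rw [abs_mul]; gcongr
      calc ‖v.1 i‖ = |(v.1 i - c i - v.2 * b i) + c i + v.2 * b i| := by
            rw [Real.norm_eq_abs]; congr 1; ring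
        _ ≤ _ := (abs_add_three _ _ _).trans (by linarith)
    · exact le_max_of_le_left ht
  have hq := continuous_qs c b
  have hKc : IsCompact K := by
    refine (isCompact_closedBall _ _).of_isClosed_subset ?_ hKb
    have c1 : IsClosed {v : X n | y.2 ≤ v.2} := isClosed_le (by fun_prop) (by fun_prop)
    have c2 : IsClosed {v : X n | v.2 ≤ z.2} := isClosed_le (by fun_prop) (by fun_prop)
    have c3 : IsClosed {v : X n | qs c b v ≤ R ^ 2} := isClosed_le (by fun_prop) (by fun_prop)
    exact c1.inter (c2.inter c3)
  set E := Real.exp (-α * y.2) with hE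
  set δ := w y / 2 / (E * R ^ 4) with hδ
  have hE0 : 0 < E := Real.exp_pos _
  have hδ0 : 0 < δ := by positivity
  set ψ : X n → ℝ := fun v => δ * (Real.exp (-α * v.2) * (R ^ 2 - qs c b v) ^ 2) with hψ
  have hψs : ContDiff ℝ ∞ ψ := by
    have := qs_contDiff c b
    simp only [hψ]; fun_prop
  have hzK : z ∈ K := by
    refine ⟨hyz.le, le_rfl, ?_⟩
    have : qs c b z = 0 := by
      refine Finset.sum_eq_zero fun i _ => ?_
      rw [hcoord]; simp only [hb, Pi.smul_apply, Pi.sub_apply, smul_eq_mul]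
      field_simp; ring
    rw [this]; positivity
  have hqz : qs c b z = 0 := by
    refine Finset.sum_eq_zero fun i _ => ?_
    rw [hcoord]; simp only [hb, Pi.smul_apply, Pi.sub_apply, smul_eq_mul]
    field_simp; ring
  have hψz : 0 < ψ z := by
    simp only [hψ, hqz, sub_zero]; positivity
  have hcψ := hψs.continuous
  obtain ⟨P, hPK, hPmin⟩ := hKc.exists_isMinOn ⟨z, hzK⟩
    (f := fun v => w v - ψ v) (by fun_prop)
  have hP0 : 0 ≤ w P - ψ P := by
    by_contra! hneg
    have hPS := hKS P hPK
    have hQ : qs c b P < R ^ 2 := by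
      refine lt_of_le_of_ne hPK.2.2 fun he => ?_
      have : ψ P = 0 := by simp [hψ, he]
      linarith [hw0 P hPS]
    have ht : y.2 < P.2 := by
      refine lt_of_le_of_ne hPK.1 fun he => ?_
      have hPball : P ∈ ball y R₂ := by
        rw [mem_ball, Prod.dist_eq, max_lt_iff]
        refine ⟨?_, by rw [he, dist_self]; exact hR₂⟩
        refine lt_of_le_of_lt ((dist_pi_le_iff hR0.le).2 fun i => ?_)
          (show R < R₂ from (min_le_right _ _).trans_lt (by linarith))
        have := abs_le_of_qs_le hR0.le hPK.2.2 i
        rw [hcoord, ← he] at this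
        simpa [Real.dist_eq] using this
      have h1 := hball P hPball
      have h2 : ψ P ≤ w y / 2 := by
        have h3 : (R ^ 2 - qs c b P) ^ 2 ≤ R ^ 4 := by
          have h4 := qs_nonneg c b P
          calc (R ^ 2 - qs c b P) ^ 2 ≤ (R ^ 2) ^ 2 := by gcongr; linarith
            _ = R ^ 4 := by ring
        calc ψ P = δ * (E * (R ^ 2 - qs c b P) ^ 2) := by simp only [hψ, hE, he]
          _ ≤ δ * (E * R ^ 4) := by gcongr
          _ = w y / 2 := by rw [hδ]; field_simp
      linarith
    have hopen : IsOpen {z : X n | z.1 ∈ S} := hS.preimage continuous_fst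
    have hv := h.visc hopen hw hf hPS (ψ := ψ) (hψs.of_le two_le_infty).contDiffAt (by
      have e1 : ∀ᶠ v : X n in 𝓝 P, y.2 < v.2 :=
        continuousAt_const.eventually_lt continuous_snd.continuousAt ht
      have e2 : ∀ᶠ v : X n in 𝓝 P, qs c b v < R ^ 2 :=
        hq.continuousAt.eventually_lt continuousAt_const hQ
      filter_upwards [e1, e2] with v h1 h2 h3
      have : w P - ψ P ≤ w v - ψ v := hPmin ⟨h1.le, h3.trans hPK.2.1, h2.le⟩
      linarith)
    have hlt := hα P hQ
    have : heat ψ P < 0 := by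
      simp only [hψ]; rw [heat_const_mul]; exact mul_neg_of_pos_of_neg hδ0 hlt
    linarith [hf0 P hPS]
  have : w P - ψ P ≤ w z - ψ z := hPmin hzK
  linarith

/-- Forward uniqueness of the zero solution of a linearly bounded problem in the half-space. -/
lemma forward_zero {u f : X n → ℝ} (hu : Continuous u) (hf : Continuous f)
    (h : Weak {z | 0 < z.1 0} u f) {C L t₀ : ℝ} (hL : 0 ≤ L) (hC : ∀ z, u z ≤ C)
    (hb : ∀ z : X n, z.1 0 = 0 → u z ≤ 0) (hfL : ∀ z : X n, 0 < z.1 0 → f z ≤ L * u z)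
    (h0 : ∀ z : X n, 0 ≤ z.1 0 → z.2 ≤ t₀ → u z ≤ 0) (z : X n) (hz : 0 ≤ z.1 0) : u z ≤ 0 := by
  by_contra! hpos
  set K := L + 2 * (n + 1) + 1 with hK
  set Q : X n → ℝ := qs 0 0 with hQ
  have hQc : ContDiff ℝ ∞ Q := qs_contDiff 0 0
  have hQ0 : ∀ v, 0 ≤ Q v := qs_nonneg 0 0
  have hC0 : 0 < C := hpos.trans_le (hC z)
  have hzt : t₀ < z.2 := by
    by_contra! hle
    exact absurd (h0 z hz hle) (not_le.2 hpos)
  set ε := Real.exp (-K * (z.2 - t₀)) * u z / (2 * (1 + Q z)) with hε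
  have hε0 : 0 < ε := by have := hQ0 z; positivity
  set g : X n → ℝ := fun v => Real.exp (-K * (v.2 - t₀)) * u v - ε * (1 + Q v) with hg
  have hgc : Continuous g := by
    have := hQc.continuous
    simp only [hg]; fun_prop
  have hgz : 0 < g z := by
    have h1 : ε * (1 + Q z) = Real.exp (-K * (z.2 - t₀)) * u z / 2 := by
      have := hQ0 z
      rw [hε]; field_simp
    have : 0 < Real.exp (-K * (z.2 - t₀)) * u z := by positivity
    simp only [hg, h1]; linarith
  set S : Set (X n) := {v | 0 ≤ v.1 0 ∧ t₀ ≤ v.2 ∧ v.2 ≤ z.2 ∧ ε * Q v ≤ C} with hS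
  have hK0 : 0 < K := by positivity
  have hgS : ∀ v : X n, 0 ≤ v.1 0 → t₀ ≤ v.2 → v.2 ≤ z.2 → 0 < g v → v ∈ S := by
    intro v h1 h2 h3 h4
    refine ⟨h1, h2, h3, ?_⟩
    simp only [hg] at h4
    have h5 : Real.exp (-K * (v.2 - t₀)) ≤ 1 := by
      apply Real.exp_le_one_iff.2; nlinarith
    have h6 : Real.exp (-K * (v.2 - t₀)) * u v ≤ C := by
      have := hC v
      have h7 := Real.exp_pos (-K * (v.2 - t₀))
      rcases le_total 0 (u v) with h8 | h8
      · nlinarith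
      · nlinarith [mul_nonneg h7.le (neg_nonneg.2 h8)]
    nlinarith
  have hSc : IsCompact S := by
    set ρ := max (max |t₀| |z.2|) (√(C / ε)) with hρ
    refine (isCompact_closedBall (0 : X n) ρ).of_isClosed_subset ?_ ?_
    · have := hQc.continuous
      have c1 : IsClosed {v : X n | 0 ≤ v.1 0} := isClosed_le (by fun_prop) (by fun_prop)
      have c2 : IsClosed {v : X n | t₀ ≤ v.2} := isClosed_le (by fun_prop) (by fun_prop)
      have c3 : IsClosed {v : X n | v.2 ≤ z.2} := isClosed_le (by fun_prop) (by fun_prop)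
      have c4 : IsClosed {v : X n | ε * Q v ≤ C} := isClosed_le (by fun_prop) (by fun_prop)
      exact c1.inter (c2.inter (c3.inter c4))
    · intro v hv
      rw [mem_closedBall_zero_iff, Prod.norm_def]
      refine max_le ?_ ?_
      · refine le_max_of_le_right ((pi_norm_le_iff_of_nonneg (by positivity)).2 fun i => ?_)
        have h1 : Q v ≤ √(C / ε) ^ 2 := by
          rw [Real.sq_sqrt (by positivity), le_div_iff₀ hε0]; linarith [hv.2.2.2]
        simpa using abs_le_of_qs_le (Real.sqrt_nonneg _) h1 i
      · exact le_max_of_le_left (abs_le_max_abs_abs hv.2.1 hv.2.2.1)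
  obtain ⟨P, hPS, hPmax⟩ := hSc.exists_isMaxOn ⟨z, hgS z hz hzt.le le_rfl hgz⟩ hgc.continuousOn
  set m := g P with hm
  have hm0 : 0 < m := hgz.trans_le (hPmax (hgS z hz hzt.le le_rfl hgz))
  set e : ℝ → ℝ := fun s => Real.exp (K * (s - t₀)) with he
  have hee : ∀ s, e s * Real.exp (-K * (s - t₀)) = 1 := by
    intro s; simp only [he]; rw [← Real.exp_add, ← Real.exp_zero]; congr 1; ring
  have he0 : ∀ s, 0 < e s := fun s => Real.exp_pos _
  have huP : u P = e P.2 * (m + ε * (1 + Q P)) := by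
    rw [hm]; simp only [hg]; linear_combination (- u P) * hee P.2
  have hQP := hQ0 P
  have huP0 : 0 < u P := by rw [huP]; have := he0 P.2; positivity
  have hP0 : 0 < P.1 0 := by
    refine lt_of_le_of_ne hPS.1 fun h1 => ?_
    linarith [hb P h1.symm]
  have hPt : t₀ < P.2 := by
    by_contra! h1
    linarith [h0 P hPS.1 h1]
  have heat1 : ∀ v, ContDiffAt ℝ 2 (fun y => m + ε * (1 + Q y)) v := fun v => by
    have : ContDiff ℝ 2 Q := hQc.of_le two_le_infty
    fun_prop
  set ψ : X n → ℝ := fun v => -(e v.2 * (m + ε * (1 + Q v))) with hψ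
  have hec : ContDiff ℝ ∞ e := by simp only [he]; fun_prop
  have hψs : ContDiff ℝ ∞ ψ := by simp only [hψ]; fun_prop
  have hloc : ∀ w : X n, 0 ≤ w.1 0 → t₀ ≤ w.2 → w.2 ≤ z.2 → g w ≤ m := by
    intro w h1 h2 h3
    by_contra! h4
    exact absurd (hPmax (hgS w h1 h2 h3 (hm0.trans h4))) (not_le.2 h4)
  have hneg : Weak {z : X n | 0 < z.1 0} (fun z => - u z) (fun z => - f z) := by
    intro φ h1 h2 h3
    have := h φ h1 h2 h3
    simp only [neg_mul, integral_neg, this]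
  have hopen : IsOpen {z : X n | 0 < z.1 0} := isOpen_lt (by fun_prop) (by fun_prop)
  have hv := hneg.visc hopen hu.neg hf.neg hP0 (ψ := ψ) (hψs.of_le two_le_infty).contDiffAt (by
    have e1 : ∀ᶠ v : X n in 𝓝 P, t₀ < v.2 :=
      continuousAt_const.eventually_lt continuous_snd.continuousAt hPt
    filter_upwards [e1, hopen.eventually_mem hP0] with v h1 h2 h3
    have h4 := hloc v (le_of_lt h2) h1.le (h3.trans hPS.2.2.1)
    have h5 : ψ P = - u P := by simp only [hψ, huP]
    have h6 : u v = e v.2 * (g v + ε * (1 + Q v)) := by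
      simp only [hg]; linear_combination (- u v) * hee v.2
    have h7 : u v ≤ e v.2 * (m + ε * (1 + Q v)) := by
      rw [h6]; have := he0 v.2; gcongr
    rw [h5]; simp only [hψ, Pi.neg_apply]; linarith only [h7])
  have hde : deriv e P.2 = K * e P.2 := by
    have : HasDerivAt e (Real.exp (K * (P.2 - t₀)) * (K * 1)) P.2 :=
      (((hasDerivAt_id P.2).sub_const t₀).const_mul K).exp
    rw [this.deriv]; simp only [he]; ring
  have hheat : heat ψ P = - (K * u P - e P.2 * (ε * (2 * (n + 1)))) := by
    simp only [hψ]
    rw [heat_neg, heat_time_mul (hec.of_le two_le_infty).contDiffAt (heat1 P), hde]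
    have : heat (fun y => m + ε * (1 + Q y)) P = - (ε * (2 * (n + 1))) := by
      have hQ2 : ContDiffAt ℝ 2 Q P := (hQc.of_le two_le_infty).contDiffAt
      rw [heat_add (f := fun _ => m) (by fun_prop) (by fun_prop), heat_const, heat_const_mul,
        heat_add (f := fun _ => (1 : ℝ)) (by fun_prop) hQ2, heat_const, hQ, heat_qs]
      simp
    rw [this, huP]; ring
  rw [hheat, Pi.neg_apply] at hv
  have h8 := hfL P hP0
  have h9 : e P.2 * ε ≤ u P := by
    rw [huP]; have := he0 P.2
    gcongr
    nlinarith [mul_nonneg hε0.le hQP]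
  have hexp : K * u P = L * u P + 2 * (n + 1) * u P + u P := by rw [hK]; ring
  have h10 : (2 * ((n : ℝ) + 1)) * (e P.2 * ε) ≤ 2 * (n + 1) * u P := by gcongr
  nlinarith

end

section

variable {n : ℕ} {ι : Type*} [Fintype ι]

/-- The reaction term, with truncated arguments. -/
noncomputable def FF (β : ι → ι → ℝ) (r : ℝ) (U : ι → ℝ) (i : ι) : ℝ :=
  ∑ j, β i j * (max (U i) 0 ^ r * max (U j) 0 ^ (r + 1))

/-- A Lipschitz constant for the reaction term where all arguments are at most `ρ`. -/
noncomputable def LL (β : ι → ι → ℝ) (r ρ : ℝ) : ℝ :=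
  (∑ i, ∑ j, β i j) * ((2 * r + 1) * ρ ^ (2 * r))

section reaction

variable {β : ι → ι → ℝ} {r : ℝ}

lemma FF_continuous (hr : 1 ≤ r) (i : ι) : Continuous fun U : ι → ℝ => FF β r U i := by
  unfold FF
  refine continuous_finsetSum _ fun j _ => continuous_const.mul (.mul ?_ ?_)
  · exact Continuous.rpow_const (by fun_prop) fun _ => Or.inr (by linarith)
  · exact Continuous.rpow_const (by fun_prop) fun _ => Or.inr (by linarith)

lemma FF_nonneg (hβ : ∀ i j, 0 ≤ β i j) (U : ι → ℝ) (i : ι) : 0 ≤ FF β r U i :=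
  Finset.sum_nonneg fun j _ => by have := hβ i j; positivity

lemma FF_mono (hβ : ∀ i j, 0 ≤ β i j) (hr : 1 ≤ r) {U V : ι → ℝ} (h : ∀ j, U j ≤ V j) (i : ι) :
    FF β r U i ≤ FF β r V i := by
  refine Finset.sum_le_sum fun j _ => mul_le_mul_of_nonneg_left ?_ (hβ i j)
  have h1 := h i
  have h2 := h j
  gcongr

lemma LL_nonneg (hβ : ∀ i j, 0 ≤ β i j) (hr : 1 ≤ r) {ρ : ℝ} (hρ : 0 ≤ ρ) : 0 ≤ LL β r ρ := by
  have : 0 ≤ ∑ i, ∑ j, β i j := Finset.sum_nonneg fun i _ => Finset.sum_nonneg fun j _ => hβ i j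
  unfold LL; positivity

lemma rpow_sub_le {q : ℝ} (hq : 1 ≤ q) {a a' ρ δ : ℝ} (h0 : 0 ≤ a') (h1 : a' ≤ a) (h2 : a ≤ ρ)
    (h3 : a - a' ≤ δ) : a ^ q - a' ^ q ≤ q * ρ ^ (q - 1) * δ := by
  rcases eq_or_lt_of_le (h0.trans h1) with ha | ha
  · have : a' = a := by linarith
    have h4 : 0 ≤ δ := by linarith
    have h5 : 0 ≤ ρ := by linarith
    rw [this, sub_self]; positivity
  · have hb := one_add_mul_self_le_rpow_one_add (s := (a' - a) / a)
      (by rw [le_div_iff₀ ha]; linarith) hq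
    have e1 : 1 + (a' - a) / a = a' / a := by field_simp; ring
    rw [e1, Real.div_rpow h0 ha.le, le_div_iff₀ (by positivity)] at hb
    have e2 : a ^ q = a ^ (q - 1) * a := by
      rw [← Real.rpow_add_one ha.ne']; congr 1; ring
    have h6 : a ^ q - a' ^ q ≤ q * a ^ (q - 1) * (a - a') := by
      have : (1 + q * ((a' - a) / a)) * a ^ q = a ^ q + q * a ^ (q - 1) * (a' - a) := by
        rw [e2]; field_simp
      linarith
    refine h6.trans ?_
    have : a ^ (q - 1) ≤ ρ ^ (q - 1) := Real.rpow_le_rpow ha.le h2 (by linarith)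
    have h7 : 0 ≤ a - a' := by linarith
    have h8 : 0 ≤ a ^ (q - 1) := by positivity
    have h9 : 0 ≤ q * ρ ^ (q - 1) := mul_nonneg (by linarith) (h8.trans this)
    gcongr

lemma FF_lip (hβ : ∀ i j, 0 ≤ β i j) (hr : 1 ≤ r) {U V : ι → ℝ} {ρ δ : ℝ} (hρ : 0 ≤ ρ)
    (hδ : 0 ≤ δ) (hU : ∀ j, U j ≤ ρ) (hV : ∀ j, U j - δ ≤ V j) (i : ι) :
    FF β r U i - FF β r V i ≤ LL β r ρ * δ := by
  have h1 : FF β r (fun j => U j - δ) i ≤ FF β r V i := FF_mono hβ hr hV i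
  have h2 : ∀ j, β i j * (max (U i) 0 ^ r * max (U j) 0 ^ (r + 1))
      - β i j * (max (U i - δ) 0 ^ r * max (U j - δ) 0 ^ (r + 1))
      ≤ β i j * ((2 * r + 1) * ρ ^ (2 * r) * δ) := by
    intro j
    rw [← mul_sub]
    refine mul_le_mul_of_nonneg_left ?_ (hβ i j)
    have key : ∀ k, 0 ≤ max (U k - δ) 0 ∧ max (U k - δ) 0 ≤ max (U k) 0 ∧ max (U k) 0 ≤ ρ ∧
        max (U k) 0 - max (U k - δ) 0 ≤ δ := by
      intro k
      refine ⟨le_max_right _ _, max_le_max (by linarith) le_rfl, max_le (hU k) hρ, ?_⟩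
      rcases le_total (U k) 0 with h | h
      · rw [max_eq_right h]; linarith [le_max_right (U k - δ) 0]
      · rw [max_eq_left h]; linarith [le_max_left (U k - δ) 0]
    obtain ⟨a1, a2, a3, a4⟩ := key i
    obtain ⟨b1, b2, b3, b4⟩ := key j
    have c1 := rpow_sub_le hr a1 a2 a3 a4
    have c2 := rpow_sub_le (q := r + 1) (by linarith) b1 b2 b3 b4
    set a := max (U i) 0
    set b := max (U j) 0
    set a' := max (U i - δ) 0
    set b' := max (U j - δ) 0
    have d1 : b ^ (r + 1) ≤ ρ ^ (r + 1) := Real.rpow_le_rpow (b1.trans b2) b3 (by linarith)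
    have d2 : a' ^ r ≤ ρ ^ r := Real.rpow_le_rpow a1 (a2.trans a3) (by linarith)
    have d3 : 0 ≤ b ^ (r + 1) := Real.rpow_nonneg (b1.trans b2) _
    have d4 : 0 ≤ a' ^ r := Real.rpow_nonneg a1 _
    have e1 : ρ ^ (2 * r) = ρ ^ (r - 1) * ρ ^ (r + 1) := by
      rw [← Real.rpow_add_of_nonneg hρ (by linarith) (by linarith)]; congr 1; ring
    have e2 : ρ ^ (2 * r) = ρ ^ r * ρ ^ (r + 1 - 1) := by
      rw [← Real.rpow_add_of_nonneg hρ (by linarith) (by linarith)]; congr 1; ring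
    calc a ^ r * b ^ (r + 1) - a' ^ r * b' ^ (r + 1)
        = (a ^ r - a' ^ r) * b ^ (r + 1) + a' ^ r * (b ^ (r + 1) - b' ^ (r + 1)) := by ring
      _ ≤ r * ρ ^ (r - 1) * δ * ρ ^ (r + 1) + ρ ^ r * ((r + 1) * ρ ^ (r + 1 - 1) * δ) := by
          have hr0 : 0 ≤ r := by linarith
          have : 0 ≤ r * ρ ^ (r - 1) * δ := by positivity
          have : b' ^ (r + 1) ≤ b ^ (r + 1) := Real.rpow_le_rpow b1 b2 (by linarith)
          have : 0 ≤ b ^ (r + 1) - b' ^ (r + 1) := by linarith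
          gcongr
      _ = (2 * r + 1) * ρ ^ (2 * r) * δ := by
          linear_combination (-r * δ) * e1 - ((r + 1) * δ) * e2
  have h3 : FF β r U i - FF β r (fun j => U j - δ) i
      ≤ (∑ j, β i j) * ((2 * r + 1) * ρ ^ (2 * r) * δ) := by
    unfold FF
    rw [← Finset.sum_sub_distrib, Finset.sum_mul]
    exact Finset.sum_le_sum fun j _ => h2 j
  have h4 : ∑ j, β i j ≤ ∑ i, ∑ j, β i j :=
    Finset.single_le_sum (f := fun i => ∑ j, β i j)
      (fun i _ => Finset.sum_nonneg fun j _ => hβ i j) (Finset.mem_univ i)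
  have h5 : (∑ j, β i j) * ((2 * r + 1) * ρ ^ (2 * r) * δ)
      ≤ (∑ i, ∑ j, β i j) * ((2 * r + 1) * ρ ^ (2 * r) * δ) := by gcongr
  unfold LL
  linarith

lemma FF_le (hβ : ∀ i j, 0 ≤ β i j) (hr : 1 ≤ r) {U : ι → ℝ} {C : ℝ} (hC : ∀ j, U j ≤ C)
    (i : ι) : FF β r U i ≤ (∑ j, β i j) * (max C 0 ^ r * max C 0 ^ (r + 1)) := by
  refine (FF_mono hβ hr hC i).trans ?_
  rw [FF, Finset.sum_mul]

lemma FF_le_mul (hβ : ∀ i j, 0 ≤ β i j) (hr : 1 ≤ r) {U : ι → ℝ} {C : ℝ} (hC : ∀ j, U j ≤ C)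
    (i : ι) (h0 : 0 ≤ U i) :
    FF β r U i ≤ (∑ j, β i j) * (max C 0 ^ (r - 1) * max C 0 ^ (r + 1)) * U i := by
  rw [FF, Finset.sum_mul, Finset.sum_mul]
  refine Finset.sum_le_sum fun j _ => ?_
  rw [mul_assoc]
  refine mul_le_mul_of_nonneg_left ?_ (hβ i j)
  have h1 : max (U i) 0 ^ r = max (U i) 0 ^ (r - 1) * U i := by
    rw [max_eq_left h0]
    rcases eq_or_lt_of_le h0 with h | h
    · rw [← h, Real.zero_rpow (by linarith)]; simp
    · rw [← Real.rpow_add_one h.ne']; congr 1; ring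
  have h2 : max (U i) 0 ^ (r - 1) ≤ max C 0 ^ (r - 1) :=
    Real.rpow_le_rpow (le_max_right _ _) (max_le_max (hC i) le_rfl) (by linarith)
  have h3 : max (U j) 0 ^ (r + 1) ≤ max C 0 ^ (r + 1) :=
    Real.rpow_le_rpow (le_max_right _ _) (max_le_max (hC j) le_rfl) (by linarith)
  rw [h1]
  calc max (U i) 0 ^ (r - 1) * U i * max (U j) 0 ^ (r + 1)
      ≤ max C 0 ^ (r - 1) * U i * max C 0 ^ (r + 1) := by gcongr
    _ = _ := by ring

end reaction

/-- Odd extensions of bounded nonnegative half-space solutions, with a common bound and modulus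
of continuity. -/
structure Sol (β : ι → ι → ℝ) (r C : ℝ) (md : ℝ → ℝ) (U : ι → X n → ℝ) : Prop where
  mod : ∀ i, Mod md (U i)
  bdd : ∀ i z, |U i z| ≤ C
  odd : ∀ i z, U i (rfl' 0 0 z) = - U i z
  nonneg : ∀ i (z : X n), 0 ≤ z.1 0 → 0 ≤ U i z
  weak : ∀ i, Weak {z | 0 < z.1 0} (U i) fun z => FF β r (fun j => U j z) i

lemma aff_one (a z : X n) : aff 1 a z = z + a := by
  ext k <;> simp [aff]

lemma rfl'_add {a : X n} (ha : a.1 0 = 0) (c : ℝ) (z : X n) :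
    rfl' 0 c (z + a) = rfl' 0 c z + a := by
  rw [rfl'_apply, rfl'_apply]
  ext k
  · by_cases hk : k = 0
    · subst hk; simp [ha]
    · simp [hk]
  · simp

@[simp] lemma rfl'_zero (c : ℝ) (z : X n) : (rfl' 0 c z).1 0 = 2 * c - z.1 0 := by
  rw [rfl'_apply]; simp

@[simp] lemma rfl'_time (i : Fin (n + 1)) (c : ℝ) (z : X n) : (rfl' i c z).2 = z.2 := by
  rw [rfl'_apply]

lemma rfl'_eq_self {c : ℝ} {z : X n} (h : z.1 0 = c) : rfl' 0 c z = z := by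
  rw [rfl'_apply]
  ext k
  · by_cases hk : k = 0
    · subst hk; simp; linarith
    · simp [hk]
  · rfl

lemma rfl'_continuous (i : Fin (n + 1)) (c : ℝ) : Continuous (rfl' i c : X n → X n) :=
  aff_continuous _ _

namespace Sol

variable {β : ι → ι → ℝ} {r C : ℝ} {md : ℝ → ℝ} {U : ι → X n → ℝ}

lemma continuous (hU : Sol β r C md U) (hmd : ∀ ε, 0 < ε → 0 < md ε) (i : ι) :
    Continuous (U i) := (hU.mod i).continuous hmd

lemma continuous_FF (hU : Sol β r C md U) (hmd : ∀ ε, 0 < ε → 0 < md ε) (hr : 1 ≤ r) (i : ι) :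
    Continuous fun z => FF β r (fun j => U j z) i :=
  (FF_continuous hr i).comp (continuous_pi fun j => hU.continuous hmd j)

lemma zero (hU : Sol β r C md U) (i : ι) {z : X n} (h : z.1 0 = 0) : U i z = 0 := by
  have := hU.odd i z
  rw [rfl'_eq_self h] at this
  linarith

lemma le (hU : Sol β r C md U) (i : ι) (z : X n) : U i z ≤ C := (abs_le.1 (hU.bdd i z)).2

lemma translate (hU : Sol β r C md U) {a : X n} (ha : a.1 0 = 0) :
    Sol β r C md fun i z => U i (z + a) where
  mod i ε hε z w hzw := hU.mod i ε hε _ _ (by rwa [dist_add_right])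
  bdd i z := hU.bdd i _
  odd i z := by rw [← rfl'_add ha, hU.odd]
  nonneg i z hz := hU.nonneg i _ (by simpa [ha] using hz)
  weak i := by
    have := (hU.weak i).aff (s := 1) (by simp) a
    simp only [aff_one] at this
    refine this.mono fun z hz => ?_
    simpa [aff_one, ha] using hz

lemma limit {κ : Type*} {l : Filter κ} [l.NeBot] {Uk : κ → ι → X n → ℝ}
    (hmd : ∀ ε, 0 < ε → 0 < md ε) (hr : 1 ≤ r) (hU : ∀ k, Sol β r C md (Uk k))
    (hl : ∀ i z, Tendsto (fun k => Uk k i z) l (𝓝 (U i z)))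
    (hlF : ∀ i, LU l (fun k z => FF β r (fun j => Uk k j z) i) fun z => FF β r (fun j => U j z) i) :
    Sol β r C md U := by
  have hmod : ∀ i, Mod md (U i) := fun i => Mod.of_tendsto (fun k => (hU k).mod i) (hl i)
  have hc : ∀ i, Continuous (U i) := fun i => (hmod i).continuous hmd
  refine ⟨hmod, fun i z => le_of_tendsto (hl i z).abs (Eventually.of_forall fun k => (hU k).bdd i z),
    fun i z => ?_, fun i z hz => ge_of_tendsto (hl i z)
      (Eventually.of_forall fun k => (hU k).nonneg i z hz), fun i => ?_⟩
  · refine tendsto_nhds_unique (hl i _) ?_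
    simp only [(hU _).odd]
    exact (hl i z).neg
  · refine Weak.of_LU (fun k => (hU k).weak i) (LU.of_tendsto hmd (fun k => (hU k).mod i) (hl i))
      (hlF i) (fun k => ((hU k).continuous hmd i).locallyIntegrable) (hc i).locallyIntegrable
      (fun k => ((hU k).continuous_FF hmd hr i).locallyIntegrable) ?_
    exact ((FF_continuous hr i).comp (continuous_pi hc)).locallyIntegrable

end Sol

/-- Locally uniform limits commute with the reaction term. -/
lemma LU_FF {β : ι → ι → ℝ} {r C : ℝ} (hβ : ∀ i j, 0 ≤ β i j) (hr : 1 ≤ r) (hC : 0 ≤ C)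
    {κ : Type*} {l : Filter κ} {Uk : κ → ι → X n → ℝ} {U : ι → X n → ℝ}
    (h : ∀ i, LU l (fun k => Uk k i) (U i)) (hk : ∀ k i z, Uk k i z ≤ C) (hb : ∀ i z, U i z ≤ C)
    (i : ι) :
    LU l (fun k z => FF β r (fun j => Uk k j z) i) fun z => FF β r (fun j => U j z) i := by
  intro K hK ε hε
  have hL := LL_nonneg hβ hr hC
  have : ∀ᶠ k in l, ∀ j, ∀ z ∈ K, |Uk k j z - U j z| ≤ ε / (LL β r C + 1) :=
    eventually_all.2 fun j => h j K hK _ (by positivity)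
  filter_upwards [this] with k hk' z hz
  have hδ : 0 ≤ ε / (LL β r C + 1) := by positivity
  have h1 := FF_lip hβ hr (U := fun j => Uk k j z) (V := fun j => U j z) hC hδ
    (fun j => hk k j z) (fun j => by linarith [(abs_le.1 (hk' j z hz)).2]) i
  have h2 := FF_lip hβ hr (V := fun j => Uk k j z) (U := fun j => U j z) hC hδ
    (fun j => hb j z) (fun j => by linarith [(abs_le.1 (hk' j z hz)).1]) i
  have h3 : LL β r C * (ε / (LL β r C + 1)) ≤ ε := by
    rw [mul_div_assoc', div_le_iff₀ (by positivity)]; nlinarith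
  rw [abs_le]; constructor <;> linarith

namespace Sol

variable {β : ι → ι → ℝ} {r C : ℝ} {md : ℝ → ℝ} {U : ι → X n → ℝ}

lemma weak_diff (hU : Sol β r C md U) (hmd : ∀ ε, 0 < ε → 0 < md ε) (hr : 1 ≤ r) (c : ℝ) (i : ι) :
    Weak {z | z.1 ∈ {x : Fin (n + 1) → ℝ | 0 < x 0 ∧ x 0 < c}}
      (fun z => U i (rfl' 0 c z) - U i z)
      (fun z => FF β r (fun j => U j (rfl' 0 c z)) i - FF β r (fun j => U j z) i) := by
  have h1 := (hU.weak i).aff (s := sg 0) (sg_mul_self 0) (Pi.single 0 (2 * c), 0)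
  have hc := hU.continuous hmd i
  have hF := hU.continuous_FF hmd hr i
  refine Weak.sub (h1.mono fun z hz => ?_) ((hU.weak i).mono fun z hz => hz.1) ?_ ?_ ?_ ?_
  · change 0 < (rfl' 0 c z).1 0
    rw [rfl'_zero]; have := hz.1; have := hz.2; linarith
  · exact (hc.comp (aff_continuous _ _)).locallyIntegrable
  · exact hc.locallyIntegrable
  · exact (hF.comp (aff_continuous _ _)).locallyIntegrable
  · exact hF.locallyIntegrable

lemma touching (hU : Sol β r C md U) (hmd : ∀ ε, 0 < ε → 0 < md ε) (hβ : ∀ i j, 0 ≤ β i j)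
    (hr : 1 ≤ r) {c : ℝ} {h : ℝ → ℝ} (hh : ContDiff ℝ ∞ h) (h1 : ∀ s, 0 ≤ s → s ≤ c → 1 ≤ h s)
    {m : ℝ} (hm : 0 < m)
    (hw : ∀ j (z : X n), 0 ≤ z.1 0 → z.1 0 ≤ c → -m * h (z.1 0) ≤ U j (rfl' 0 c z) - U j z)
    {i : ι} {P : X n} (hP0 : 0 ≤ P.1 0) (hPc : P.1 0 ≤ c) {ε d σ ρ : ℝ}
    (hP : U i (rfl' 0 c P) - U i P ≤ -m * h (P.1 0) + m * ε) (hε : 0 < ε) (hε1 : ε < 1)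
    (hd : 0 < d) (hρ : 0 ≤ ρ)
    (hρU : ∀ j (z : X n), dist z P ≤ d → 0 ≤ z.1 0 → z.1 0 ≤ c → z.2 ≤ P.2 → U j z ≤ ρ)
    (hσ : ∀ s, 0 ≤ s → s ≤ c → |s - P.1 0| ≤ d → deriv (deriv h) s + LL β r ρ * h s ≤ -σ) :
    σ * d ^ 2 ≤ 4 * ε * (d + n + 1) := by
  set A := 2 * m * ε / d ^ 2 with hA
  have hA0 : 0 < A := by positivity
  set w : X n → ℝ := fun z => U i (rfl' 0 c z) - U i z with hwdef
  have hcU := hU.continuous hmd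
  have hcw : Continuous w := ((hcU i).comp (rfl'_continuous 0 c)).sub (hcU i)
  have hch := hh.continuous
  have hcq := (qq_contDiff P).continuous
  set K : Set (X n) := closedBall P d ∩ {z | 0 ≤ z.1 0 ∧ z.1 0 ≤ c ∧ z.2 ≤ P.2} with hK
  have hKc : IsCompact K := by
    refine (isCompact_closedBall P d).inter_right ?_
    have c1 : IsClosed {v : X n | 0 ≤ v.1 0} := isClosed_le (by fun_prop) (by fun_prop)
    have c2 : IsClosed {v : X n | v.1 0 ≤ c} := isClosed_le (by fun_prop) (by fun_prop)
    have c3 : IsClosed {v : X n | v.2 ≤ P.2} := isClosed_le (by fun_prop) (by fun_prop)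
    exact c1.inter (c2.inter c3)
  have hPK : P ∈ K := ⟨mem_closedBall_self hd.le, hP0, hPc, le_rfl⟩
  set ψ : X n → ℝ := fun z => -(m * h (z.1 0) + A * qq P z) with hψ
  have hψs : ContDiff ℝ ∞ ψ := by
    have := qq_contDiff P
    simp only [hψ]; fun_prop
  obtain ⟨Q, hQK, hQmin⟩ := hKc.exists_isMinOn ⟨P, hPK⟩ (f := fun z => w z - ψ z)
    (hcw.sub hψs.continuous).continuousOn
  have hQP : w Q + m * h (Q.1 0) + A * qq P Q ≤ m * ε := by
    have h2 : w Q - ψ Q ≤ w P - ψ P := hQmin hPK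
    simp only [hψ, qq_self] at h2
    have h3 : w P ≤ -m * h (P.1 0) + m * ε := hP
    linarith
  have hQ0' := hw i Q hQK.2.1 hQK.2.2.1
  have hqq : qq P Q ≤ d ^ 2 / 2 := by
    have h2 : A * qq P Q ≤ m * ε := by
      have : w Q = U i (rfl' 0 c Q) - U i Q := rfl
      linarith
    have h3 : m * ε = A * (d ^ 2 / 2) := by rw [hA]; field_simp
    rw [h3] at h2
    exact le_of_mul_le_mul_left h2 hA0
  have hdist : dist Q P < d := by
    have h2 := dist_sq_le_qq P Q
    have h3 : dist Q P ^ 2 < d ^ 2 := by have : 0 < d ^ 2 := by positivity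
                                         linarith
    exact lt_of_pow_lt_pow_left₀ 2 hd.le h3
  have hbd : 0 ≤ w Q → False := by
    intro h2
    have h3 := h1 _ hQK.2.1 hQK.2.2.1
    have h4 := qq_nonneg P Q
    nlinarith [mul_nonneg hA0.le h4]
  have hQ0 : 0 < Q.1 0 := by
    refine lt_of_le_of_ne hQK.2.1 fun h2 => hbd ?_
    have h3 : U i Q = 0 := hU.zero i h2.symm
    have h4 : 0 ≤ U i (rfl' 0 c Q) := hU.nonneg i _ (by rw [rfl'_zero, ← h2]; linarith)
    simp only [hwdef, h3, sub_zero]; exact h4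
  have hQc : Q.1 0 < c := by
    refine lt_of_le_of_ne hQK.2.2.1 fun h2 => hbd ?_
    simp only [hwdef, rfl'_eq_self h2, sub_self]; exact le_rfl
  have hopen : IsOpen {z : X n | z.1 ∈ {x : Fin (n + 1) → ℝ | 0 < x 0 ∧ x 0 < c}} := by
    have o1 : IsOpen {v : X n | 0 < v.1 0} := isOpen_lt (by fun_prop) (by fun_prop)
    have o2 : IsOpen {v : X n | v.1 0 < c} := isOpen_lt (by fun_prop) (by fun_prop)
    exact o1.inter o2
  have hFc := hU.continuous_FF hmd hr i
  have hv := (hU.weak_diff hmd hr c i).visc hopen hcw ((hFc.comp (rfl'_continuous 0 c)).sub hFc)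
    (P := Q) ⟨hQ0, hQc⟩ (ψ := ψ) (hψs.of_le two_le_infty).contDiffAt (by
      filter_upwards [isOpen_ball.eventually_mem hdist, hopen.eventually_mem (x := Q) ⟨hQ0, hQc⟩]
        with v h2 h3 h4
      have : w Q - ψ Q ≤ w v - ψ v :=
        hQmin ⟨ball_subset_closedBall h2, h3.1.le, h3.2.le, h4.trans hQK.2.2.2⟩
      linarith)
  have hheat : heat ψ Q = m * deriv (deriv h) (Q.1 0) - A * (2 * (Q.2 - P.2) - 2 * (n + 1)) := by
    have hh2 : ContDiff ℝ 2 h := hh.of_le two_le_infty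
    have hq2 : ContDiff ℝ 2 (qq P) := (qq_contDiff P).of_le two_le_infty
    simp only [hψ]
    rw [heat_neg, heat_add (f := fun z : X n => m * h (z.1 0)) (by fun_prop) (by fun_prop),
      heat_const_mul, heat_const_mul, heat_coord_comp hh2.contDiffAt, heat_qq]
    ring
  rw [hheat] at hv
  replace hv : FF β r (fun j => U j (rfl' 0 c Q)) i - FF β r (fun j => U j Q) i ≤ _ := hv
  have hlip := FF_lip hβ hr (U := fun j => U j Q) (V := fun j => U j (rfl' 0 c Q))
    (δ := m * h (Q.1 0)) hρ (by have := h1 _ hQK.2.1 hQK.2.2.1; positivity)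
    (fun j => hρU j Q hdist.le hQK.2.1 hQK.2.2.1 hQK.2.2.2)
    (fun j => by linarith [hw j Q hQK.2.1 hQK.2.2.1]) i
  have hcoord : |Q.1 0 - P.1 0| ≤ d :=
    ((dist_le_pi_dist Q.1 P.1 0).trans (le_max_left _ _)).trans hdist.le
  have htime : |Q.2 - P.2| ≤ d := (le_max_right _ (dist Q.2 P.2)).trans hdist.le
  have hs := hσ _ hQK.2.1 hQK.2.2.1 hcoord
  have e1 : m * σ ≤ A * (2 * d + 2 * (n + 1)) := by
    have h2 := (abs_le.1 htime).1
    have h3 : A * (-(2 * (Q.2 - P.2)) + 2 * (n + 1)) ≤ A * (2 * d + 2 * (n + 1)) := by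
      gcongr; linarith
    have h4 := mul_le_mul_of_nonneg_left hs hm.le
    linarith
  have e2 : A * (2 * d + 2 * (n + 1)) * d ^ 2 = m * (4 * ε * (d + n + 1)) := by
    rw [hA]; field_simp; ring
  have e3 : m * (σ * d ^ 2) ≤ m * (4 * ε * (d + n + 1)) := by
    rw [← e2]; have : 0 < d ^ 2 := by positivity
    nlinarith
  exact le_of_mul_le_mul_left e3 hm

end Sol

end

section

variable {n : ℕ} {ι : Type*} [Fintype ι]

/-- A concave profile which is very concave near the two ends of a strip. -/
lemma exists_profile {L c : ℝ} (hL : 0 ≤ L) (hc : 0 ≤ c) :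
    ∃ η μ : ℝ, 0 < η ∧ η ≤ 1 ∧ 0 < μ ∧ ∃ h : ℝ → ℝ, ContDiff ℝ ∞ h ∧
      (∀ s, 0 ≤ s → s ≤ c + η → 1 ≤ h s ∧ h s ≤ 2 ∧ deriv (deriv h) s ≤ -2 * μ) ∧
      (∀ s, 0 ≤ s → s ≤ c + η → s ≤ η ∨ c - η ≤ s → deriv (deriv h) s + L * h s ≤ -1) := by
  set M := Real.exp 1 * (2 * L + 1) with hM
  have hM0 : 0 < M := by positivity
  set e := Real.exp 1 with he
  have he0 : 0 < e := Real.exp_pos 1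
  set η := min 1 (1 / (2 * M * (e + 1))) with hη
  have hη0 : 0 < η := by positivity
  have hη1 : η ≤ 1 := min_le_left _ _
  have hηM : M * η ^ 2 * (e + 1) ≤ 1 / 2 := by
    have h1 : η ≤ 1 / (2 * M * (e + 1)) := min_le_right _ _
    rw [le_div_iff₀ (by positivity)] at h1
    nlinarith [mul_pos hM0 (show 0 < e + 1 by linarith),
      mul_nonneg (mul_pos (mul_pos hM0 hη0) (show 0 < e + 1 by linarith)).le (sub_nonneg.2 hη1)]
  set μ := 1 / (2 * (c + 1) ^ 2) with hμ
  have hμ0 : 0 < μ := by positivity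
  set h : ℝ → ℝ := fun s =>
    2 - μ * s ^ 2 - M * η ^ 2 * (Real.exp ((s - c) / η) + Real.exp (-s / η)) with hh
  have d1 : deriv h = fun s => -(2 * μ * s)
      - M * η * (Real.exp ((s - c) / η) - Real.exp (-s / η)) := by
    ext s
    have e1 : HasDerivAt (fun s => Real.exp ((s - c) / η)) (Real.exp ((s - c) / η) * (1 / η)) s :=
      (((hasDerivAt_id s).sub_const c).div_const η).exp
    have e2 : HasDerivAt (fun s => Real.exp (-s / η)) (Real.exp (-s / η) * (-1 / η)) s :=
      ((hasDerivAt_id s).neg.div_const η).exp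
    have e3 : HasDerivAt h (0 - μ * (2 * s ^ 1 * 1) - M * η ^ 2 *
        (Real.exp ((s - c) / η) * (1 / η) + Real.exp (-s / η) * (-1 / η))) s :=
      ((hasDerivAt_const s 2).sub (((hasDerivAt_id s).pow 2).const_mul μ)).sub
        ((e1.add e2).const_mul _)
    rw [e3.deriv]; field_simp; ring
  have d2 : ∀ s, deriv (deriv h) s
      = -2 * μ - M * (Real.exp ((s - c) / η) + Real.exp (-s / η)) := by
    intro s
    rw [d1]
    have e1 : HasDerivAt (fun s => Real.exp ((s - c) / η)) (Real.exp ((s - c) / η) * (1 / η)) s :=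
      (((hasDerivAt_id s).sub_const c).div_const η).exp
    have e2 : HasDerivAt (fun s => Real.exp (-s / η)) (Real.exp (-s / η) * (-1 / η)) s :=
      ((hasDerivAt_id s).neg.div_const η).exp
    have e3 : HasDerivAt (fun s => -(2 * μ * s)
        - M * η * (Real.exp ((s - c) / η) - Real.exp (-s / η))) (-(2 * μ * 1) - M * η *
        (Real.exp ((s - c) / η) * (1 / η) - Real.exp (-s / η) * (-1 / η))) s :=
      (((hasDerivAt_id s).const_mul (2 * μ)).neg).sub ((e1.sub e2).const_mul _)
    rw [e3.deriv]; field_simp; ring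
  have hb : ∀ s, 0 ≤ s → s ≤ c + η → 1 ≤ h s ∧ h s ≤ 2 := by
    intro s h0 h1
    have a1 : Real.exp ((s - c) / η) ≤ e := by
      apply Real.exp_le_exp.2; rw [div_le_one hη0]; linarith
    have a2 : Real.exp (-s / η) ≤ 1 := by
      apply Real.exp_le_one_iff.2; apply div_nonpos_of_nonpos_of_nonneg <;> linarith
    have a3 : μ * s ^ 2 ≤ 1 / 2 := by
      have : s ^ 2 ≤ (c + 1) ^ 2 := by gcongr; linarith
      calc μ * s ^ 2 ≤ μ * (c + 1) ^ 2 := by gcongr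
        _ = 1 / 2 := by rw [hμ]; field_simp
    have a4 : M * η ^ 2 * (Real.exp ((s - c) / η) + Real.exp (-s / η)) ≤ M * η ^ 2 * (e + 1) := by
      gcongr
    have a5 := Real.exp_pos ((s - c) / η)
    have a6 := Real.exp_pos (-s / η)
    have a7 : 0 ≤ M * η ^ 2 * (Real.exp ((s - c) / η) + Real.exp (-s / η)) := by positivity
    have a8 : 0 ≤ μ * s ^ 2 := by positivity
    constructor <;> simp only [hh] <;> linarith
  refine ⟨η, μ, hη0, hη1, hμ0, h, ?_, fun s h0 h1 => ⟨(hb s h0 h1).1, (hb s h0 h1).2, ?_⟩,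
    fun s h0 h1 h2 => ?_⟩
  · simp only [hh]
    have : ContDiff ℝ ∞ fun s : ℝ => (s - c) / η := by fun_prop
    fun_prop
  · rw [d2]
    have a5 := Real.exp_pos ((s - c) / η)
    have a6 := Real.exp_pos (-s / η)
    have : 0 ≤ M * (Real.exp ((s - c) / η) + Real.exp (-s / η)) := by positivity
    linarith
  · rw [d2]
    have a5 := Real.exp_pos ((s - c) / η)
    have a6 := Real.exp_pos (-s / η)
    have key : Real.exp (-1) ≤ Real.exp ((s - c) / η) + Real.exp (-s / η) := by
      rcases h2 with h2 | h2
      · have : Real.exp (-1) ≤ Real.exp (-s / η) := by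
          apply Real.exp_le_exp.2; rw [le_div_iff₀ hη0]; linarith
        linarith
      · have : Real.exp (-1) ≤ Real.exp ((s - c) / η) := by
          apply Real.exp_le_exp.2; rw [le_div_iff₀ hη0]; linarith
        linarith
    have h3 : M * Real.exp (-1) = 2 * L + 1 := by
      rw [hM, mul_right_comm, he, ← Real.exp_add]; simp
    have h4 := mul_le_mul_of_nonneg_left key hM0.le
    have h5 : L * h s ≤ L * 2 := by gcongr; exact (hb s h0 h1).2
    linarith

/-- Ordering with respect to the reflection in `x 0 = c`. -/
def Ord (U : ι → X n → ℝ) (c : ℝ) : Prop :=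
  ∀ i (z : X n), 0 ≤ z.1 0 → z.1 0 ≤ c → U i z ≤ U i (rfl' 0 c z)

lemma tendsto_of_mod {κ : Type*} {l : Filter κ} {md : ℝ → ℝ} (hmd : ∀ ε, 0 < ε → 0 < md ε)
    {f : κ → X n → ℝ} {g : X n → ℝ} (hf : ∀ k, Mod md (f k))
    (h : ∀ z, Tendsto (fun k => f k z) l (𝓝 (g z))) {zk : κ → X n} {z : X n}
    (hz : Tendsto zk l (𝓝 z)) : Tendsto (fun k => f k (zk k)) l (𝓝 (g z)) := by
  rw [Metric.tendsto_nhds]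
  intro ε hε
  filter_upwards [Metric.tendsto_nhds.1 (h z) (ε / 2) (by positivity),
    Metric.tendsto_nhds.1 hz (md (ε / 4)) (hmd _ (by positivity))] with k h1 h2
  have h3 := hf k (ε / 4) (by positivity) _ _ h2
  rw [Real.dist_eq] at h1 ⊢
  calc |f k (zk k) - g z| = |(f k (zk k) - f k z) + (f k z - g z)| := by ring_nf
    _ ≤ _ := abs_add_le _ _
    _ < ε := by linarith

/-- A near-maximal violation of the ordering. -/
lemma exists_near_sup {β : ι → ι → ℝ} {r C : ℝ} {md : ℝ → ℝ} {U : ι → X n → ℝ}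
    (hU : Sol β r C md U) {c : ℝ} (hord : ¬ Ord U c) {h : ℝ → ℝ}
    (hh : ∀ s, 0 ≤ s → s ≤ c → 1 ≤ h s ∧ h s ≤ 2) {ε : ℝ} (hε : 0 < ε) :
    ∃ m i, ∃ P : X n, 0 < m ∧ 0 ≤ P.1 0 ∧ P.1 0 ≤ c ∧
      (∀ j (z : X n), 0 ≤ z.1 0 → z.1 0 ≤ c → -m * h (z.1 0) ≤ U j (rfl' 0 c z) - U j z) ∧
      U i (rfl' 0 c P) - U i P ≤ -m * h (P.1 0) + m * ε := by
  simp only [Ord, not_forall, not_le] at hord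
  obtain ⟨i₀, z₀, h0, h1, h2⟩ := hord
  set S : Set ℝ := {x | ∃ i, ∃ z : X n, 0 ≤ z.1 0 ∧ z.1 0 ≤ c ∧
    x = (U i z - U i (rfl' 0 c z)) / h (z.1 0)} with hS
  have hC : 0 ≤ C := (abs_nonneg _).trans (hU.bdd i₀ z₀)
  have hSb : BddAbove S := by
    refine ⟨2 * C, ?_⟩
    rintro x ⟨i, z, h3, h4, rfl⟩
    have h5 := hh _ h3 h4
    rw [div_le_iff₀ (by linarith)]
    have h6 := abs_le.1 (hU.bdd i z)
    have h7 := abs_le.1 (hU.bdd i (rfl' 0 c z))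
    nlinarith
  have hx₀ : (U i₀ z₀ - U i₀ (rfl' 0 c z₀)) / h (z₀.1 0) ∈ S := ⟨i₀, z₀, h0, h1, rfl⟩
  have hm : 0 < sSup S := by
    refine lt_of_lt_of_le ?_ (le_csSup hSb hx₀)
    have := hh _ h0 h1
    exact div_pos (by linarith) (by linarith)
  obtain ⟨x, ⟨i, P, hP0, hPc, rfl⟩, hx⟩ := exists_lt_of_lt_csSup ⟨_, hx₀⟩
    (show sSup S - sSup S * ε / 2 < sSup S by have := mul_pos hm hε; linarith)
  refine ⟨sSup S, i, P, hm, hP0, hPc, fun j z h3 h4 => ?_, ?_⟩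
  · have h5 := hh _ h3 h4
    have h6 := le_csSup hSb (show (U j z - U j (rfl' 0 c z)) / h (z.1 0) ∈ S from
      ⟨j, z, h3, h4, rfl⟩)
    rw [div_le_iff₀ (by linarith)] at h6
    linarith
  · have h5 := hh _ hP0 hPc
    rw [lt_div_iff₀ (by linarith)] at hx
    have := mul_pos hm hε
    nlinarith

lemma exists_ulim_index (f : ℕ → ι) : ∃ i, ∀ᶠ k in (hyperfilter ℕ : Filter ℕ), f k = i := by
  obtain ⟨i, hi⟩ := Ultrafilter.eq_pure_of_finite ((hyperfilter ℕ).map f)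
  refine ⟨i, ?_⟩
  have : {i} ∈ (hyperfilter ℕ).map f := by rw [hi]; exact mem_singleton i
  exact this

namespace Sol

variable {β : ι → ι → ℝ} {r C : ℝ} {md : ℝ → ℝ} {U : ι → X n → ℝ}

lemma pos_of_pos (hU : Sol β r C md U) (hmd : ∀ ε, 0 < ε → 0 < md ε) (hβ : ∀ i j, 0 ≤ β i j)
    (hr : 1 ≤ r) {i : ι} {y z : X n} (hy : 0 < y.1 0) (hz : 0 < z.1 0) (hyz : y.2 < z.2)
    (hpos : 0 < U i y) : 0 < U i z := by
  have hS : IsOpen {x : Fin (n + 1) → ℝ | 0 < x 0} := isOpen_lt (by fun_prop) (by fun_prop)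
  have hSc : Convex ℝ {x : Fin (n + 1) → ℝ | 0 < x 0} :=
    convex_halfSpace_gt (f := fun x : Fin (n + 1) → ℝ => x 0) ⟨fun _ _ => rfl, fun _ _ => rfl⟩ 0
  exact strong_max hS hSc (hU.continuous hmd i) (hU.continuous_FF hmd hr i) (hU.weak i)
    (fun z hz => hU.nonneg i z (le_of_lt hz)) (fun z _ => FF_nonneg hβ _ i) hy hz hyz hpos

/-- If an ordered solution touches its reflection at an interior point, the touching component
vanishes in the past. -/
lemma eq_zero_of_touch (hU : Sol β r C md U) (hmd : ∀ ε, 0 < ε → 0 < md ε)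
    (hβ : ∀ i j, 0 ≤ β i j) (hr : 1 ≤ r) {c : ℝ} (hord : Ord U c) {i : ι} {P : X n}
    (hP0 : 0 < P.1 0) (hPc : P.1 0 < c) (hP : U i (rfl' 0 c P) ≤ U i P) (z : X n)
    (hz0 : 0 ≤ z.1 0) (hz : z.2 < P.2) : U i z = 0 := by
  have hS1 : IsOpen {x : Fin (n + 1) → ℝ | 0 < x 0} := isOpen_lt (by fun_prop) (by fun_prop)
  have hS2 : IsOpen {x : Fin (n + 1) → ℝ | x 0 < c} := isOpen_lt (by fun_prop) (by fun_prop)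
  have hSc1 : Convex ℝ {x : Fin (n + 1) → ℝ | 0 < x 0} :=
    convex_halfSpace_gt (f := fun x : Fin (n + 1) → ℝ => x 0) ⟨fun _ _ => rfl, fun _ _ => rfl⟩ 0
  have hSc2 : Convex ℝ {x : Fin (n + 1) → ℝ | x 0 < c} :=
    convex_halfSpace_lt (f := fun x : Fin (n + 1) → ℝ => x 0) ⟨fun _ _ => rfl, fun _ _ => rfl⟩ c
  have hcU := hU.continuous hmd i
  have hFc := hU.continuous_FF hmd hr i
  have hle : ∀ y : X n, 0 < y.1 0 → y.1 0 < c → y.2 < P.2 → U i (rfl' 0 c y) - U i y = 0 := by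
    intro y h1 h2 h3
    refine le_antisymm ?_ (by linarith [hord i y h1.le h2.le])
    by_contra! h4
    have := strong_max (S := {x : Fin (n + 1) → ℝ | 0 < x 0 ∧ x 0 < c}) (hS1.inter hS2)
      (hSc1.inter hSc2)
      ((hcU.comp (rfl'_continuous 0 c)).sub hcU) ((hFc.comp (rfl'_continuous 0 c)).sub hFc)
      (hU.weak_diff hmd hr c i) (fun z hz => by
        have := hord i z hz.1.le hz.2.le
        simp only [Pi.sub_apply, Function.comp]; linarith)
      (fun z hz => by
        have := FF_mono hβ hr (fun j => hord j z hz.1.le hz.2.le) i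
        simp only [Pi.sub_apply, Function.comp]; linarith)
      (y := y) (z := P) ⟨h1, h2⟩ ⟨hP0, hPc⟩ h3 h4
    simp only [Pi.sub_apply, Function.comp] at this
    linarith
  have hc0 : 0 < c := hP0.trans hPc
  -- the value on `x 0 = 2 c`
  have hvan : ∀ t, t < P.2 → U i (rfl' 0 c ((0, t) : X n)) = 0 := by
    intro t ht
    have h1 : Tendsto (fun s : ℝ => ((Pi.single 0 s, t) : X n)) (𝓝[>] 0) (𝓝 (0, t)) := by
      have : Continuous fun s : ℝ => ((Pi.single 0 s, t) : X n) := by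
        refine Continuous.prodMk (continuous_pi fun k => ?_) continuous_const
        by_cases hk : k = 0
        · subst hk; simp; exact continuous_id
        · simp [hk]; exact continuous_const
      have := this.tendsto 0
      simp only [Pi.single_zero] at this
      exact this.mono_left nhdsWithin_le_nhds
    have h2 : Tendsto (fun s : ℝ => U i (rfl' 0 c ((Pi.single 0 s, t) : X n))
        - U i ((Pi.single 0 s, t) : X n)) (𝓝[>] 0) (𝓝 (U i (rfl' 0 c ((0, t) : X n))
          - U i ((0, t) : X n))) :=
      (((hcU.comp (rfl'_continuous 0 c)).sub hcU).tendsto _).comp h1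
    have h3 : ∀ᶠ s : ℝ in 𝓝[>] 0, U i (rfl' 0 c ((Pi.single 0 s, t) : X n))
        - U i ((Pi.single 0 s, t) : X n) = 0 := by
      filter_upwards [Ioo_mem_nhdsGT hc0] with s hs
      exact hle _ (by simpa using hs.1) (by simpa using hs.2) ht
    have h4 : U i ((0, t) : X n) = 0 := hU.zero i rfl
    have h5 := tendsto_nhds_unique h2 (tendsto_const_nhds.congr' (h3.mono fun s hs => hs.symm))
    linarith
  rcases eq_or_lt_of_le hz0 with h0 | h0
  · exact hU.zero i h0.symm
  refine le_antisymm ?_ (hU.nonneg i z hz0)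
  by_contra! hpos
  have := hU.pos_of_pos hmd hβ hr (y := z) (z := rfl' 0 c ((0, (z.2 + P.2) / 2) : X n)) h0
    (by rw [rfl'_zero]; simpa using hc0) (by rw [rfl'_time]; dsimp only; linarith) hpos
  rw [hvan _ (by linarith)] at this
  exact lt_irrefl _ this

lemma forward (hU : Sol β r C md U) (hmd : ∀ ε, 0 < ε → 0 < md ε) (hβ : ∀ i j, 0 ≤ β i j)
    (hr : 1 ≤ r) {i : ι} {t₀ : ℝ} (h : ∀ z : X n, 0 ≤ z.1 0 → z.2 ≤ t₀ → U i z = 0) (z : X n) :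
    U i z = 0 := by
  have key : ∀ z : X n, 0 ≤ z.1 0 → U i z = 0 := by
    intro z hz
    have hS : 0 ≤ ∑ j, β i j := Finset.sum_nonneg fun j _ => hβ i j
    refine le_antisymm (forward_zero (hU.continuous hmd i) (hU.continuous_FF hmd hr i) (hU.weak i)
      (C := C) (t₀ := t₀) (L := (∑ j, β i j) * (max C 0 ^ (r - 1) * max C 0 ^ (r + 1)))
      (by positivity) (hU.le i) (fun z hz => (hU.zero i hz).le)
      (fun z hz => FF_le_mul hβ hr (fun j => hU.le j z) i (hU.nonneg i z hz.le))
      (fun z h1 h2 => (h z h1 h2).le) z hz) (hU.nonneg i z hz)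
  rcases le_total 0 (z.1 0) with hz | hz
  · exact key z hz
  · have := hU.odd i z
    rw [key _ (by rw [rfl'_zero]; linarith)] at this
    linarith

end Sol

end

section

variable {n : ℕ} {ι : Type*} [Fintype ι]

lemma rfl'_continuous_param {κ : Type*} {l : Filter κ} {ck : κ → ℝ} {c : ℝ} {zk : κ → X n}
    {z : X n} (hc : Tendsto ck l (𝓝 c)) (hz : Tendsto zk l (𝓝 z)) :
    Tendsto (fun k => rfl' 0 (ck k) (zk k)) l (𝓝 (rfl' 0 c z)) := by
  simp only [rfl'_apply]
  have h1 : Tendsto (fun k => (zk k).1) l (𝓝 z.1) := (continuous_fst.tendsto z).comp hz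
  have h2 : Tendsto (fun k => (zk k).2) l (𝓝 z.2) := (continuous_snd.tendsto z).comp hz
  have h3 : Tendsto (fun k => (zk k).1 0) l (𝓝 (z.1 0)) := (continuous_apply 0).continuousAt.tendsto.comp h1
  exact (h1.update 0 ((hc.const_mul 2).sub h3)).prodMk_nhds h2

lemma exists_small_LL (β : ι → ι → ℝ) {r μ : ℝ} (hr : 1 ≤ r) (hμ : 0 < μ) :
    ∃ ρ, 0 < ρ ∧ 2 * LL β r ρ ≤ μ := by
  have hc : Continuous fun ρ : ℝ => 2 * LL β r ρ := by
    unfold LL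
    have : Continuous fun ρ : ℝ => ρ ^ (2 * r) :=
      continuous_id.rpow_const fun _ => Or.inr (by linarith)
    fun_prop
  have h0 : 2 * LL β r 0 = 0 := by
    unfold LL; rw [Real.zero_rpow (by linarith)]; simp
  have h1 : ∀ᶠ ρ in 𝓝 (0 : ℝ), 2 * LL β r ρ < μ :=
    (hc.tendsto 0).eventually_lt_const (by simpa [h0] using hμ)
  obtain ⟨δ, hδ, h⟩ := Metric.eventually_nhds_iff.1 h1
  exact ⟨δ / 2, by positivity, (h (by rw [Real.dist_eq, sub_zero, abs_of_pos] <;> linarith)).le⟩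

section moving

variable {β : ι → ι → ℝ} {r C : ℝ} {md : ℝ → ℝ} {U : ι → X n → ℝ}

/-- Openness step of the method of moving planes. -/
lemma Sol.ord_step (hmd : ∀ ε, 0 < ε → 0 < md ε) (hβ : ∀ i j, 0 ≤ β i j) (hr : 1 ≤ r)
    (hU : Sol β r C md U)
    (IH : ∀ V : ι → X n → ℝ, Sol β r C md V → (∃ i, (∀ z, V i z = 0) ∧ ∃ z, U i z ≠ 0) →
      (∀ i, (∀ z, U i z = 0) → ∀ z, V i z = 0) → ∀ i z, V i z = 0)
    {c : ℝ} (hc : 0 ≤ c) (hord : Ord U c) : ∃ η, 0 < η ∧ ∀ b, c ≤ b → b ≤ c + η → Ord U b := by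
  by_contra! hcon
  have hC : 0 ≤ C := by
    obtain ⟨b, -, -, hb⟩ := hcon 1 one_pos
    simp only [Ord, not_forall] at hb
    obtain ⟨i, z, -⟩ := hb
    exact (abs_nonneg _).trans (hU.bdd i z)
  obtain ⟨η, μ, hη, hη1, hμ, h, hh, hh1, hh2⟩ := exists_profile (LL_nonneg hβ hr hC) hc
  have hex : ∀ k : ℕ, ∃ b, c ≤ b ∧ b ≤ c + η / (k + 2) ∧ ¬ Ord U b := fun k =>
    hcon (η / (k + 2)) (by positivity)
  choose b hb1 hb2 hb3 using hex
  have hbη : ∀ k, b k ≤ c + η / 2 := fun k => (hb2 k).trans (by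
    have : (0 : ℝ) ≤ k := by positivity
    gcongr; linarith)
  have hhb : ∀ k s, 0 ≤ s → s ≤ b k → 1 ≤ h s ∧ h s ≤ 2 := fun k s h0 h1 =>
    ⟨(hh1 s h0 (by linarith [hbη k])).1, (hh1 s h0 (by linarith [hbη k])).2.1⟩
  have hns : ∀ k : ℕ, ∃ m i, ∃ P : X n, 0 < m ∧ 0 ≤ P.1 0 ∧ P.1 0 ≤ b k ∧
      (∀ j (z : X n), 0 ≤ z.1 0 → z.1 0 ≤ b k →
        -m * h (z.1 0) ≤ U j (rfl' 0 (b k) z) - U j z) ∧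
      U i (rfl' 0 (b k) P) - U i P ≤ -m * h (P.1 0) + m * (1 / (k + 2) : ℝ) := fun k =>
    exists_near_sup hU (hb3 k) (hhb k) (by positivity)
  choose m i P hm hP0 hPb hw hP using hns
  have hε0 : ∀ k : ℕ, (0 : ℝ) < 1 / (k + 2) := fun k => by positivity
  have hε1 : ∀ k : ℕ, (1 : ℝ) / (k + 2) < 1 := fun k => by
    rw [div_lt_one (by positivity)]; have : (0 : ℝ) ≤ k := by positivity
    linarith
  have hεl : Tendsto (fun k : ℕ => (1 : ℝ) / (k + 2)) atTop (𝓝 0) := by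
    have := (tendsto_one_div_add_atTop_nhds_zero_nat (𝕜 := ℝ)).comp (tendsto_add_atTop_nat 1)
    refine this.congr fun k => ?_
    simp only [Function.comp]; push_cast; ring_nf
  have hneg : ∀ k, U (i k) (rfl' 0 (b k) (P k)) - U (i k) (P k) < 0 := fun k => by
    have h1 := (hhb k _ (hP0 k) (hPb k)).1
    have h2 := mul_pos (hm k) (show 0 < h ((P k).1 0) - 1 / (k + 2) by linarith [hε1 k])
    have := hP k
    linarith
  have hint : ∀ᶠ k in (hyperfilter ℕ : Filter ℕ), η / 2 ≤ (P k).1 0 ∧ (P k).1 0 ≤ c - η / 2 := by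
    have h1 : Tendsto (fun k : ℕ => 4 * ((1 : ℝ) / (k + 2)) * (η / 2 + n + 1)) atTop (𝓝 0) := by
      simpa using (hεl.const_mul 4).mul_const (η / 2 + n + 1)
    have h2 : ∀ᶠ k in atTop, 4 * ((1 : ℝ) / ((k : ℕ) + 2)) * (η / 2 + n + 1) < 1 * (η / 2) ^ 2 :=
      h1.eventually_lt_const (by positivity)
    filter_upwards [Nat.hyperfilter_le_atTop h2] with k hk
    by_contra hk2
    have hk3 : (P k).1 0 < η / 2 ∨ c - η / 2 < (P k).1 0 := by
      by_contra! h3; exact hk2 h3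
    refine absurd (hU.touching hmd hβ hr hh (fun s h0 h1 => (hhb k s h0 h1).1) (hm k) (hw k)
      (hP0 k) (hPb k) (hP k) (hε0 k) (hε1 k) (d := η / 2) (σ := 1) (by positivity) hC
      (fun j z _ _ _ _ => hU.le j z) ?_) (not_le.2 hk)
    intro s h0 h1 h3
    refine hh2 s h0 (by linarith [hbη k]) ?_
    have := abs_le.1 h3
    rcases hk3 with h4 | h4
    · left; linarith
    · right; linarith
  -- the limit of the translates
  set a : ℕ → X n := fun k => (Function.update (P k).1 0 0, (P k).2) with ha
  have ha0 : ∀ k, (a k).1 0 = 0 := fun k => by simp [ha]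
  set Uk : ℕ → ι → X n → ℝ := fun k j z => U j (z + a k) with hUk
  have hUks : ∀ k, Sol β r C md (Uk k) := fun k => hU.translate (ha0 k)
  have hVex : ∀ j z, ∃ x, |x| ≤ C ∧ Tendsto (fun k => Uk k j z) (hyperfilter ℕ) (𝓝 x) :=
    fun j z => exists_ulim fun k => (hUks k).bdd j z
  choose V hVC hV using hVex
  have hLU : ∀ j, LU (hyperfilter ℕ) (fun k => Uk k j) (V j) := fun j =>
    LU.of_tendsto hmd (fun k => (hUks k).mod j) (hV j)
  have hVs : Sol β r C md V := Sol.limit hmd hr hUks hV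
    (LU_FF hβ hr hC hLU (fun k j z => (hUks k).le j z) fun j z => (abs_le.1 (hVC j z)).2)
  have hbl : Tendsto b (hyperfilter ℕ) (𝓝 c) := by
    refine Tendsto.mono_left ?_ Nat.hyperfilter_le_atTop
    refine tendsto_of_tendsto_of_tendsto_of_le_of_le tendsto_const_nhds ?_ hb1 hb2
    have := (hεl.const_mul η).const_add c
    simpa [div_eq_mul_inv] using this
  obtain ⟨x, -, hx⟩ := exists_ulim (a := fun k => (P k).1 0) (C := c + 1) fun k => by
    rw [abs_of_nonneg (hP0 k)]; linarith [hPb k, hbη k]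
  obtain ⟨i₀, hi₀⟩ := exists_ulim_index i
  set Q : X n := (Pi.single 0 x, 0) with hQ
  set zk : ℕ → X n := fun k => (Pi.single 0 ((P k).1 0), 0) with hzk
  have hzl : Tendsto zk (hyperfilter ℕ) (𝓝 Q) := by
    refine Tendsto.prodMk_nhds ?_ tendsto_const_nhds
    exact ((continuous_single (A := fun _ : Fin (n + 1) => ℝ) 0).tendsto x).comp hx
  have hza : ∀ k, zk k + a k = P k := fun k => by
    ext j
    · by_cases hj : j = 0
      · subst hj; simp [hzk, ha]
      · simp [hzk, ha, hj]
    · simp [hzk, ha]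
  have hxi : η / 2 ≤ x ∧ x ≤ c - η / 2 :=
    ⟨ge_of_tendsto hx (hint.mono fun k hk => hk.1), le_of_tendsto hx (hint.mono fun k hk => hk.2)⟩
  have hVQ : V i₀ (rfl' 0 c Q) ≤ V i₀ Q := by
    have t1 := tendsto_of_mod hmd (fun k => (hUks k).mod i₀) (hV i₀) hzl
    have t2 := tendsto_of_mod hmd (fun k => (hUks k).mod i₀) (hV i₀)
      (rfl'_continuous_param hbl hzl)
    refine le_of_tendsto_of_tendsto t2 t1 (hi₀.mono fun k hk => ?_)
    simp only [hUk, ← rfl'_add (ha0 k), hza]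
    rw [← hk]; linarith [hneg k]
  have hVord : Ord V c := fun j z h0 h1 => by
    refine le_of_tendsto_of_tendsto' (hV j z) (hV j _) fun k => ?_
    simp only [hUk, ← rfl'_add (ha0 k)]
    exact hord j _ (by simpa [ha0] using h0) (by simpa [ha0] using h1)
  have hVi : ∀ z, V i₀ z = 0 := by
    refine hVs.forward hmd hβ hr (t₀ := -1) fun z h0 h1 => ?_
    exact hVs.eq_zero_of_touch hmd hβ hr hVord (P := Q) (by simp [hQ]; linarith)
      (by simp [hQ]; linarith) hVQ z h0 (by simp [hQ]; linarith)
  have hV0 : ∀ j z, V j z = 0 := by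
    refine IH V hVs ⟨i₀, hVi, ?_⟩ fun j hj z => ?_
    · by_contra! h0
      obtain ⟨k, hk⟩ := hi₀.exists
      have := hneg k
      rw [hk, h0, h0] at this
      simp at this
    · refine tendsto_nhds_unique (hV j z) ?_
      simp only [hUk, hj]; exact tendsto_const_nhds
  -- small solutions are ordered
  obtain ⟨ρ, hρ, hρμ⟩ := exists_small_LL β hr hμ
  have e1 : ∀ᶠ k in (hyperfilter ℕ : Filter ℕ), ∀ j, ∀ z ∈ closedBall Q 2, |Uk k j z - V j z| ≤ ρ :=
    eventually_all.2 fun j => hLU j _ (isCompact_closedBall Q 2) ρ hρ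
  have e2 : ∀ᶠ k in (hyperfilter ℕ : Filter ℕ), dist (zk k) Q < 1 :=
    (Metric.tendsto_nhds.1 hzl) 1 one_pos
  have e3 : ∀ᶠ k : ℕ in (hyperfilter ℕ : Filter ℕ), 4 * ((1 : ℝ) / (k + 2)) * (1 + n + 1) < μ * 1 ^ 2 := by
    have h1 : Tendsto (fun k : ℕ => 4 * ((1 : ℝ) / (k + 2)) * (1 + n + 1)) atTop (𝓝 0) := by
      simpa using (hεl.const_mul 4).mul_const (1 + n + 1 : ℝ)
    exact Nat.hyperfilter_le_atTop (h1.eventually_lt_const (by positivity))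
  obtain ⟨k, ⟨k1, k2⟩, k3⟩ := ((e1.and e2).and e3).exists
  refine absurd (hU.touching hmd hβ hr hh (fun s h0 h1 => (hhb k s h0 h1).1) (hm k) (hw k)
      (hP0 k) (hPb k) (hP k) (hε0 k) (hε1 k) (d := 1) (σ := μ) one_pos hρ.le
      (fun j z hz _ _ _ => ?_) ?_) (not_le.2 k3)
  · have h1 : z - a k ∈ closedBall Q 2 := by
      rw [mem_closedBall]
      have h2 : dist (z - a k) (zk k) ≤ 1 := by
        have : zk k = P k - a k := by rw [← hza k]; simp
        rw [this, dist_sub_right]; exact hz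
      linarith [dist_triangle (z - a k) (zk k) Q]
    have h3 := k1 j _ h1
    simp only [hUk, sub_add_cancel, hV0, sub_zero] at h3
    exact (abs_le.1 h3).2
  · intro s h0 h1 _
    have h3 := hh1 s h0 (by linarith [hbη k])
    have h4 : LL β r ρ * h s ≤ LL β r ρ * 2 := by
      have := LL_nonneg hβ hr hρ.le
      gcongr; exact h3.2.1
    linarith [h3.2.2]

lemma Sol.monotone (hmd : ∀ ε, 0 < ε → 0 < md ε) (hβ : ∀ i j, 0 ≤ β i j) (hr : 1 ≤ r)
    (hU : Sol β r C md U)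
    (IH : ∀ V : ι → X n → ℝ, Sol β r C md V → (∃ i, (∀ z, V i z = 0) ∧ ∃ z, U i z ≠ 0) →
      (∀ i, (∀ z, U i z = 0) → ∀ z, V i z = 0) → ∀ i z, V i z = 0)
    (i : ι) (z : X n) (h0 : 0 ≤ z.1 0) {s : ℝ} (hs : 0 ≤ s) :
    U i z ≤ U i (z + s • ex 0) := by
  have hall : ∀ c, 0 ≤ c → Ord U c := by
    intro c hc
    have hcl : IsClosed ({b | Ord U b} ∩ Icc 0 c) := by
      refine IsSeqClosed.isClosed fun bk b hbk hb => ⟨fun j y h0 h1 => ?_, isClosed_Icc.mem_of_tendsto hb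
        (Eventually.of_forall fun k => (hbk k).2)⟩
      rcases h1.eq_or_lt with h1 | h1
      · rw [rfl'_eq_self h1]
      · have t := ((hU.continuous hmd j).tendsto _).comp
          (rfl'_continuous_param hb (tendsto_const_nhds (x := y)))
        refine ge_of_tendsto t ?_
        filter_upwards [hb.eventually_const_lt h1] with k hk
        exact (hbk k).1 j y h0 hk.le
    exact hcl.Icc_subset_of_forall_exists_gt
      (fun i z h0 h1 => by rw [rfl'_eq_self (by linarith)])
      (fun b hb y hy => by
        obtain ⟨η, hη, hstep⟩ := hU.ord_step hmd hβ hr IH hb.2.1 hb.1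
        exact ⟨min y (b + η), hstep _ (le_min hy.le (by linarith)) (min_le_right _ _),
          lt_min hy (by linarith), min_le_left _ _⟩) ⟨hc, le_rfl⟩
  have := hall (z.1 0 + s / 2) (by positivity) i z h0 (by linarith)
  convert this using 2
  rw [rfl'_apply]
  ext k
  · by_cases hk : k = 0
    · subst hk; simp [ex]; ring
    · simp [ex, hk]
  · simp [ex]

end moving

end

section

variable {n : ℕ} {ι : Type*} [Fintype ι]

section induction

variable {β : ι → ι → ℝ} {r C : ℝ} {md : ℝ → ℝ} {U : ι → X n → ℝ}

lemma Sol.exists_profile_at_infinity (hmd : ∀ ε, 0 < ε → 0 < md ε) (hβ : ∀ i j, 0 ≤ β i j)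
    (hr : 1 ≤ r) (hU : Sol β r C md U) (hC : 0 ≤ C)
    (hmono : ∀ i (z : X n), 0 ≤ z.1 0 → ∀ s : ℝ, 0 ≤ s → U i z ≤ U i (z + s • ex 0)) :
    ∃ V : ι → X n → ℝ, (∀ i, Mod md (V i)) ∧ (∀ i z, 0 ≤ V i z) ∧ (∀ i z, V i z ≤ C) ∧
      (∀ i z (s : ℝ), V i (z + s • ex 0) = V i z) ∧
      (∀ i, Weak univ (V i) fun z => FF β r (fun j => V j z) i) ∧
      ∀ i (z : X n), 0 ≤ z.1 0 → U i z ≤ V i z := by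
  have hex0 : ∀ (z : X n) (s : ℝ), (z + s • ex 0).1 0 = z.1 0 + s := fun z s => by simp [ex]
  have hlim : ∀ i z, ∃ x, Tendsto (fun t : ℝ => U i (z + t • ex 0)) atTop (𝓝 x) := by
    intro i z
    have h1 : Monotone fun t : ℝ => U i (z + (max t (-z.1 0)) • ex 0) := by
      intro s t hst
      have h2 := hmono i (z + (max s (-z.1 0)) • ex 0)
        (by rw [hex0]; linarith [le_max_right s (-z.1 0)]) (max t (-z.1 0) - max s (-z.1 0))
        (sub_nonneg.2 (max_le_max_right _ hst))
      rwa [add_assoc, ← add_smul, add_sub_cancel] at h2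
    refine ⟨_, (tendsto_atTop_ciSup h1 ⟨C, ?_⟩).congr' ?_⟩
    · rintro _ ⟨t, rfl⟩; exact hU.le i _
    · filter_upwards [eventually_ge_atTop (-z.1 0)] with t ht
      rw [max_eq_left ht]
  choose V hV using hlim
  have hmod : ∀ i (t : ℝ), Mod md fun z => U i (z + t • ex 0) := fun i t ε hε z w hzw =>
    hU.mod i ε hε _ _ (by rwa [dist_add_right])
  have hVm : ∀ i, Mod md (V i) := fun i => Mod.of_tendsto (hmod i) (hV i)
  have hVC : ∀ i z, V i z ≤ C := fun i z =>
    le_of_tendsto (hV i z) (Eventually.of_forall fun t => hU.le i _)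
  refine ⟨V, hVm, fun i z => ?_, hVC, fun i z s => ?_, fun i => ?_, fun i z hz => ?_⟩
  · refine ge_of_tendsto (hV i z) ?_
    filter_upwards [eventually_ge_atTop (-z.1 0)] with t ht
    exact hU.nonneg i _ (by rw [hex0]; linarith)
  · refine tendsto_nhds_unique (hV i _) ?_
    have := (hV i z).comp (tendsto_atTop_add_const_left atTop s tendsto_id)
    refine this.congr fun t => ?_
    simp only [Function.comp, id, add_smul, add_assoc]
  · intro φ hφ hc hs
    obtain ⟨R, hR⟩ := (show IsCompact (tsupport φ) from hc).isBounded.subset_closedBall 0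
    have hT : Tendsto (fun t : ℝ => max t (R + 1)) atTop atTop :=
      tendsto_atTop_mono (fun t => le_max_left _ _) tendsto_id
    have hl : ∀ j z, Tendsto (fun t : ℝ => U j (z + (max t (R + 1)) • ex 0)) atTop (𝓝 (V j z)) :=
      fun j z => (hV j z).comp hT
    have hLU : ∀ j, LU atTop (fun t : ℝ => fun z => U j (z + (max t (R + 1)) • ex 0)) (V j) :=
      fun j => LU.of_tendsto hmd (fun t => hmod j _) (hl j)
    have hFc := hU.continuous_FF hmd hr i
    have hw : ∀ t : ℝ, Weak {z : X n | -(R + 1) < z.1 0}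
        (fun z => U i (z + (max t (R + 1)) • ex 0))
        (fun z => FF β r (fun j => U j (z + (max t (R + 1)) • ex 0)) i) := by
      intro t
      have := (hU.weak i).aff (s := 1) (by simp) ((max t (R + 1)) • ex 0)
      simp only [aff_one] at this
      refine this.mono fun z hz => ?_
      simp only [mem_ofPred_eq] at hz
      simp only [mem_preimage, mem_ofPred_eq, aff_one, hex0]
      linarith [le_max_right t (R + 1)]
    refine Weak.of_LU hw (hLU i) (LU_FF hβ hr hC hLU (fun t j z => hU.le j _) hVC i)
      (fun t => (((hmod i _).continuous hmd)).locallyIntegrable)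
      ((hVm i).continuous hmd).locallyIntegrable
      (fun t => (hFc.comp (by fun_prop)).locallyIntegrable)
      ((FF_continuous hr i).comp (continuous_pi fun j =>
        (hVm j).continuous hmd)).locallyIntegrable φ hφ hc fun z hz => ?_
    have h1 := hR hz
    rw [mem_closedBall, dist_zero_right] at h1
    have h2 : |z.1 0| ≤ R := ((norm_le_pi_norm z.1 0).trans (norm_fst_le z)).trans h1
    simp only [mem_ofPred_eq]
    linarith [(abs_le.1 h2).1]
  · refine ge_of_tendsto (hV i z) ?_
    filter_upwards [eventually_ge_atTop 0] with t ht
    exact hmono i z hz t ht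

/-- The half-space Liouville theorem follows from the one for solutions on the whole space which
do not depend on the first variable. -/
lemma Sol.eq_zero (hmd : ∀ ε, 0 < ε → 0 < md ε) (hβ : ∀ i j, 0 ≤ β i j) (hr : 1 ≤ r)
    (HG : ∀ V : ι → X n → ℝ, (∀ i, Continuous (V i)) → (∀ i z, 0 ≤ V i z) → (∀ i z, V i z ≤ C) →
      (∀ i z (s : ℝ), V i (z + s • ex 0) = V i z) →
      (∀ i, Weak univ (V i) fun z => FF β r (fun j => V j z) i) → ∀ i z, V i z = 0) :
    ∀ U : ι → X n → ℝ, Sol β r C md U → ∀ i z, U i z = 0 := by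
  classical
  have key : ∀ (k : ℕ) (U : ι → X n → ℝ), Sol β r C md U →
      (Finset.univ.filter fun i => ∃ z, U i z ≠ 0).card = k → ∀ i z, U i z = 0 := by
    intro k
    induction k using Nat.strong_induction_on with
    | _ k ih =>
      intro U hU hk
      have IH : ∀ V : ι → X n → ℝ, Sol β r C md V → (∃ i, (∀ z, V i z = 0) ∧ ∃ z, U i z ≠ 0) →
          (∀ i, (∀ z, U i z = 0) → ∀ z, V i z = 0) → ∀ i z, V i z = 0 := by
        rintro V hV ⟨i, hi, hi2⟩ hsub
        refine ih _ ?_ V hV rfl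
        rw [← hk]
        refine Finset.card_lt_card ?_
        rw [Finset.ssubset_iff_of_subset]
        · exact ⟨i, by simpa using hi2, by simpa using hi⟩
        · intro j hj
          simp only [Finset.mem_filter_univ] at hj ⊢
          by_contra! h
          obtain ⟨z, hz⟩ := hj
          exact hz (hsub j h z)
      intro i z
      have hC : 0 ≤ C := (abs_nonneg _).trans (hU.bdd i z)
      obtain ⟨V, h1, h2, h3, h4, h5, h6⟩ := hU.exists_profile_at_infinity hmd hβ hr hC
        fun i z h0 s hs => hU.monotone hmd hβ hr IH i z h0 hs
      have hV := HG V (fun i => (h1 i).continuous hmd) h2 h3 h4 h5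
      have hpos : ∀ z : X n, 0 ≤ z.1 0 → U i z = 0 := fun z hz =>
        le_antisymm ((h6 i z hz).trans (hV i z).le) (hU.nonneg i z hz)
      rcases le_total 0 (z.1 0) with hz | hz
      · exact hpos z hz
      · have h7 := hU.odd i z
        rw [hpos _ (by rw [rfl'_zero]; linarith)] at h7
        linarith
  exact fun U hU => key _ U hU rfl

end induction

end

section

variable {n : ℕ} {ι : Type*} [Fintype ι]

/-- The map `(x, t) ↦ (s x, T t)`. -/
noncomputable def scl (n : ℕ) (s T : ℝ) : X n →L[ℝ] X n :=
  ((s • ContinuousLinearMap.id ℝ _).prodMap (T • ContinuousLinearMap.id ℝ _))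

@[simp] lemma scl_apply (s T : ℝ) (z : X n) : scl n s T z = (s • z.1, T * z.2) := by
  rfl

lemma dd_clm {V W : Type*} [NormedAddCommGroup V] [NormedSpace ℝ V] [NormedAddCommGroup W]
    [NormedSpace ℝ W] (L : V →L[ℝ] W) {f : W → ℝ} (hf : Differentiable ℝ f) (v : V) :
    dd v (fun z => f (L z)) = fun z => dd (L v) f (L z) := by
  ext z
  have := ((hf (L z)).hasFDerivAt.comp z L.hasFDerivAt).fderiv
  simp only [dd]
  rw [show (fun z => f (L z)) = f ∘ L from rfl, this]
  rfl

lemma dd_smul {V : Type*} [NormedAddCommGroup V] [NormedSpace ℝ V] (c : ℝ) (v : V) (f : V → ℝ) :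
    dd (c • v) f = fun z => c * dd v f z := by
  ext z; simp [dd]

lemma dd_et_scl {f : X n → ℝ} (hf : Differentiable ℝ f) (s T : ℝ) (z : X n) :
    dd et (fun z => f (scl n s T z)) z = T * dd et f (scl n s T z) := by
  rw [dd_clm _ hf, show scl n s T et = T • et by ext <;> simp [et], dd_smul]

lemma heat_scl {f : X n → ℝ} (hf : ContDiff ℝ ∞ f) (s : ℝ) (z : X n) :
    heat (fun z => f (scl n s (s ^ 2) z)) z = s ^ 2 * heat f (scl n s (s ^ 2) z) := by
  have hx : ∀ i, scl n s (s ^ 2) (ex i) = s • ex i := fun i => by ext <;> simp [ex]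
  have hd := hf.differentiable (by simp)
  simp only [heat, dd_et_scl hd]
  have : ∀ i, dd (ex i) (dd (ex i) fun z => f (scl n s (s ^ 2) z)) z
      = s ^ 2 * dd (ex i) (dd (ex i) f) (scl n s (s ^ 2) z) := by
    intro i
    rw [dd_clm _ hd, hx, dd_smul, dd_const_mul,
      dd_clm _ ((dd_contDiff hf).differentiable (by simp)), hx, dd_smul]
    ring
  simp only [this, ← Finset.mul_sum]
  ring

lemma scl_map_volume {s T : ℝ} (hs : 0 < s) (hT : 0 < T) :
    Measure.map (scl n s T) volume = ENNReal.ofReal ((s ^ (n + 1) * T)⁻¹) • volume := by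
  have h1 := Measure.map_addHaar_smul (volume : Measure (Fin (n + 1) → ℝ)) hs.ne'
  have h2 := Measure.map_addHaar_smul (volume : Measure ℝ) hT.ne'
  have h3 := Measure.map_prod_map (volume : Measure (Fin (n + 1) → ℝ)) (volume : Measure ℝ)
    (f := fun x => s • x) (g := fun x => T • x) (by fun_prop) (by fun_prop)
  rw [h1, h2, Measure.prod_smul_left, Measure.prod_smul_right, smul_smul] at h3
  have h4 : (scl n s T : X n → X n) = Prod.map (fun x => s • x) (fun x => T • x) := by
    ext z <;> simp
  rw [h4, Measure.volume_eq_prod, ← h3]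
  congr 1
  rw [← ENNReal.ofReal_mul (by positivity)]
  congr 1
  simp only [Module.finrank_fintype_fun_eq_card, Fintype.card_fin, Module.finrank_self, pow_one]
  rw [abs_of_pos (by positivity), abs_of_pos (by positivity), mul_inv]

lemma integral_scl {s T : ℝ} (hs : 0 < s) (hT : 0 < T) (f : X n → ℝ) :
    ∫ z, f (scl n s T z) = (s ^ (n + 1) * T)⁻¹ * ∫ z, f z := by
  have he : MeasurableEmbedding (scl n s T) := by
    refine (Topology.IsClosedEmbedding.measurableEmbedding ?_)
    refine (LinearMap.isClosedEmbedding_of_injective (f := (scl n s T).toLinearMap) ?_)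
    rw [LinearMap.ker_eq_bot]
    intro z w h
    simp only [ContinuousLinearMap.coe_coe, scl_apply, Prod.mk.injEq] at h
    exact Prod.ext (smul_right_injective _ hs.ne' h.1) (mul_left_cancel₀ hT.ne' h.2)
  rw [← he.integral_map, scl_map_volume hs hT, integral_smul_measure,
    ENNReal.toReal_ofReal (by positivity), smul_eq_mul]

lemma setIntegral_ball_le_scl {ρ s T : ℝ} (hρ : 0 < ρ) (hs : ρ ≤ s) (hT : ρ ≤ T) {g : X n → ℝ}
    (hg : Continuous g) (h0 : ∀ z, 0 ≤ g z) :
    ∫ z in closedBall 0 ρ, g z ≤ (s ^ (n + 1) * T) * ∫ z in closedBall 0 1, g (scl n s T z) := by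
  have hs0 : 0 < s := hρ.trans_le hs
  have hT0 : 0 < T := hρ.trans_le hT
  set S : Set (X n) := closedBall 0 s ×ˢ closedBall 0 T with hS
  have hSc : IsCompact S := (isCompact_closedBall _ _).prod (isCompact_closedBall _ _)
  have h1 := integral_scl hs0 hT0 (S.indicator g)
  have h2 : (fun z => S.indicator g (scl n s T z))
      = (closedBall (0 : X n) 1).indicator fun z => g (scl n s T z) := by
    ext z
    have : scl n s T z ∈ S ↔ z ∈ closedBall (0 : X n) 1 := by
      simp only [hS, mem_prod, mem_closedBall, dist_zero_right, scl_apply, norm_smul, norm_mul,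
        Real.norm_of_nonneg hs0.le, Real.norm_of_nonneg hT0.le, Prod.norm_def, sup_le_iff]
      rw [mul_le_iff_le_one_right hs0, mul_le_iff_le_one_right hT0]
    by_cases h : z ∈ closedBall (0 : X n) 1
    · rw [indicator_of_mem h, indicator_of_mem (this.2 h)]
    · rw [indicator_of_notMem h, indicator_of_notMem (fun h' => h (this.1 h'))]
  rw [h2, integral_indicator measurableSet_closedBall, integral_indicator hSc.measurableSet] at h1
  rw [h1, mul_inv_cancel_left₀ (by positivity)]
  refine setIntegral_mono_set (hg.continuousOn.integrableOn_compact hSc)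
    (Eventually.of_forall h0) (LE.le.eventuallyLE ?_)
  intro z hz
  simp only [hS, mem_prod, mem_closedBall, dist_zero_right, Prod.norm_def, sup_le_iff] at hz ⊢
  exact ⟨hz.1.trans hs, hz.2.trans hT⟩

lemma LU.comp {κ : Type*} {l : Filter κ} {n' : ℕ} {uk : κ → X n → ℝ} {u : X n → ℝ}
    (h : LU l uk u) {S : X n' → X n} (hS : Continuous S) :
    LU l (fun k z => uk k (S z)) fun z => u (S z) := by
  intro K hK ε hε
  filter_upwards [h _ (hK.image hS) ε hε] with k hk z hz
  exact hk _ (mem_image_of_mem S hz)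

lemma LU.const_mul {κ : Type*} {l : Filter κ} {uk : κ → X n → ℝ} {u : X n → ℝ}
    (h : LU l uk u) (c : ℝ) : LU l (fun k z => c * uk k z) fun z => c * u z := by
  intro K hK ε hε
  filter_upwards [h K hK (ε / (|c| + 1)) (by positivity)] with k hk z hz
  rw [← mul_sub, abs_mul]
  calc |c| * |uk k z - u z| ≤ |c| * (ε / (|c| + 1)) := by gcongr; exact hk z hz
    _ ≤ ε := by
        rw [mul_div_assoc', div_le_iff₀ (by positivity)]; nlinarith [abs_nonneg c]

lemma LU.add {κ : Type*} {l : Filter κ} {uk vk : κ → X n → ℝ} {u v : X n → ℝ}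
    (h : LU l uk u) (h' : LU l vk v) : LU l (fun k z => uk k z + vk k z) fun z => u z + v z := by
  intro K hK ε hε
  filter_upwards [h K hK (ε / 2) (by positivity), h' K hK (ε / 2) (by positivity)] with k h1 h2 z hz
  calc |uk k z + vk k z - (u z + v z)| = |(uk k z - u z) + (vk k z - v z)| := by ring_nf
    _ ≤ _ := abs_add_le _ _
    _ ≤ ε := by linarith [h1 z hz, h2 z hz]

lemma LU.sub {κ : Type*} {l : Filter κ} {uk vk : κ → X n → ℝ} {u v : X n → ℝ}
    (h : LU l uk u) (h' : LU l vk v) : LU l (fun k z => uk k z - vk k z) fun z => u z - v z := by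
  have := h.add (h'.const_mul (-1))
  simpa [sub_eq_add_neg] using this

lemma LU.tendsto {κ : Type*} {l : Filter κ} {uk : κ → X n → ℝ} {u : X n → ℝ}
    (h : LU l uk u) (z : X n) : Tendsto (fun k => uk k z) l (𝓝 (u z)) := by
  rw [Metric.tendsto_nhds]
  intro ε hε
  filter_upwards [h {z} isCompact_singleton (ε / 2) (by positivity)] with k hk
  rw [Real.dist_eq]; linarith [hk z rfl]

lemma FF_smul {β : ι → ι → ℝ} {r : ℝ} (hr : 1 ≤ r) {s : ℝ} (hs : 0 < s) (U : ι → ℝ) (i : ι) :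
    FF β r (fun j => s ^ (1 / r) * U j) i = s ^ (1 / r) * s ^ 2 * FF β r U i := by
  have hc : 0 ≤ s ^ (1 / r) := by positivity
  have h1 : ∀ x : ℝ, max (s ^ (1 / r) * x) 0 = s ^ (1 / r) * max x 0 := fun x => by
    rw [mul_max_of_nonneg _ _ hc, mul_zero]
  have hr0 : r ≠ 0 := by positivity
  have h2 : (s ^ (1 / r)) ^ r * (s ^ (1 / r)) ^ (r + 1) = s ^ (1 / r) * s ^ 2 := by
    rw [← Real.rpow_mul hs.le, ← Real.rpow_mul hs.le, ← Real.rpow_add hs, ← Real.rpow_natCast,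
      ← Real.rpow_add hs]
    congr 1; field_simp; push_cast; ring
  simp only [FF, h1, Finset.mul_sum]
  refine Finset.sum_congr rfl fun j _ => ?_
  rw [Real.mul_rpow hc (le_max_right _ _), Real.mul_rpow hc (le_max_right _ _), ← h2]
  ring

/-- Smooth positive approximate solutions converging to `V`. -/
structure Ap (β : ι → ι → ℝ) (r : ℝ) (V : ι → X n → ℝ) (w : ℕ → ι → X n → ℝ) : Prop where
  smooth : ∀ k i, ContDiff ℝ ∞ (w k i)
  pos : ∀ k i z, 0 < w k i z
  lim : ∀ i, LU atTop (fun k => w k i) (V i)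
  err : ∀ i, LU atTop (fun k z => heat (w k i) z - FF β r (fun j => w k j z) i) fun _ => 0

namespace Ap

variable {β : ι → ι → ℝ} {r : ℝ} {V : ι → X n → ℝ} {w : ℕ → ι → X n → ℝ}

lemma nonneg (h : Ap β r V w) (i : ι) (z : X n) : 0 ≤ V i z :=
  ge_of_tendsto' ((h.lim i).tendsto z) fun k => (h.pos k i z).le

lemma scale (h : Ap β r V w) (hr : 1 ≤ r) {s : ℝ} (hs : 0 < s) :
    Ap β r (fun i z => s ^ (1 / r) * V i (scl n s (s ^ 2) z))
      (fun k i z => s ^ (1 / r) * w k i (scl n s (s ^ 2) z)) where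
  smooth k i := contDiff_const.mul ((h.smooth k i).comp (scl n s (s ^ 2)).contDiff)
  pos k i z := mul_pos (Real.rpow_pos_of_pos hs _) (h.pos k i _)
  lim i := ((h.lim i).comp (scl n s (s ^ 2)).continuous).const_mul _
  err i := by
    have := ((h.err i).comp (scl n s (s ^ 2)).continuous).const_mul (s ^ (1 / r) * s ^ 2)
    simp only [mul_zero] at this
    refine (congrArg (fun f => LU atTop f fun _ => 0) ?_).mp this
    ext k z
    rw [heat_const_mul, heat_scl (h.smooth k i),
      FF_smul hr hs (fun j => w k j (scl n s (s ^ 2) z))]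
    ring

end Ap

lemma moll_add_of_invariant {u : X n → ℝ} {v : X n} (h : ∀ z, u (z + v) = u z) (k : X n → ℝ)
    (z : X n) : moll u k (z + v) = moll u k z := by
  simp only [moll]
  rw [← integral_add_right_eq_self _ v]
  simp only [h, add_sub_add_right_eq_sub]

lemma exists_ap {β : ι → ι → ℝ} {r : ℝ} (hβ : ∀ i j, 0 ≤ β i j) (hr : 1 ≤ r) {V : ι → X n → ℝ}
    (hV : ∀ i, Continuous (V i)) (h0 : ∀ i z, 0 ≤ V i z) {C : ℝ} (hC : ∀ i z, V i z ≤ C)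
    (hC0 : 0 ≤ C)
    (hw : ∀ i, Weak univ (V i) fun z => FF β r (fun j => V j z) i) :
    Ap β r V fun k i z => moll (V i) (ker k) z + rad k := by
  have hli : ∀ i, LocallyIntegrable (V i) := fun i => (hV i).locallyIntegrable
  have hs : ∀ k i, ContDiff ℝ ∞ (moll (V i) (ker k)) := fun k i =>
    moll_contDiff (hli i) (ker_contDiff k) (ker_hasCompactSupport k)
  have hrad : LU atTop (fun k (_ : X n) => rad k) fun _ => 0 := by
    intro K hK ε hε
    filter_upwards [rad_tendsto.eventually_lt_const hε] with k hk z _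
    rw [sub_zero, abs_of_pos (rad_pos k)]; exact hk.le
  have hlim : ∀ i, LU atTop (fun k z => moll (V i) (ker k) z + rad k) (V i) := fun i => by
    simpa using (moll_LU (hV i)).add hrad
  refine ⟨fun k i => (hs k i).add contDiff_const, fun k i z => ?_, hlim, fun i => ?_⟩
  · have := le_moll (hli i) (j := k) (z := z) (a := 0) fun y _ => h0 i y
    linarith [rad_pos k]
  · have hF : Continuous fun z => FF β r (fun j => V j z) i :=
      (FF_continuous hr i).comp (continuous_pi hV)
    have h1 := (moll_LU hF).sub (LU_FF hβ hr (C := C + 1) (by linarith) hlim (fun k j z => ?_)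
      (fun j z => by linarith [hC j z]) i)
    · simp only [sub_self] at h1
      refine (congrArg (fun f => LU atTop f fun _ => 0) ?_).mp h1
      ext k z
      rw [heat_add (f := moll (V i) (ker k)) (g := fun _ => rad k)
        ((hs k i).of_le two_le_infty).contDiffAt contDiffAt_const,
        heat_const, (hw i).heat_moll (hli i) (subset_univ _), add_zero]
    · have h2 := moll_le (hli j) (j := k) (z := z) (a := C) fun y _ => hC j y
      have h3 : rad k ≤ 1 := by
        unfold rad; rw [div_le_one (by positivity)]; have : (0 : ℝ) ≤ k := by positivity
        linarith
      linarith

/-- The inclusion of the hyperplane `x 0 = 0`. -/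
noncomputable def slice (n : ℕ) : X n →L[ℝ] X (n + 1) :=
  (ContinuousLinearMap.pi (Fin.cases 0 fun i => ContinuousLinearMap.proj i)).prodMap
    (ContinuousLinearMap.id ℝ ℝ)

lemma slice_ex (i : Fin (n + 1)) : slice n (ex i) = ex i.succ := by
  ext j
  · refine Fin.cases ?_ (fun j => ?_) j
    · simp [slice, ex]
    · simp [slice, ex, Pi.single_apply]
  · simp [slice, ex]

lemma slice_et : slice n et = et := by
  ext j
  · refine Fin.cases ?_ (fun j => ?_) j <;> simp [slice, et]
  · simp [slice, et]

lemma heat_slice {f : X (n + 1) → ℝ} (hf : ContDiff ℝ ∞ f)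
    (h : ∀ z (s : ℝ), f (z + s • ex 0) = f z) (z : X n) :
    heat (fun z => f (slice n z)) z = heat f (slice n z) := by
  have hd := hf.differentiable (by simp)
  have h0 : dd (ex 0) f = fun _ => 0 := by
    ext z
    have h1 := dd_hasDerivAt (v := ex 0) (hd z)
    simp only [h] at h1
    exact h1.unique (hasDerivAt_const _ _)
  simp only [heat]
  rw [dd_clm _ hd, slice_et, Fin.sum_univ_succ (n := n + 1), h0, dd_const, zero_add]
  congr 1
  refine Finset.sum_congr rfl fun i _ => ?_
  rw [dd_clm _ hd, slice_ex, dd_clm _ ((dd_contDiff hf).differentiable (by simp)), slice_ex]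

lemma Ap.slice {β : ι → ι → ℝ} {r : ℝ} {V : ι → X (n + 1) → ℝ} {w : ℕ → ι → X (n + 1) → ℝ}
    (h : Ap β r V w) (hw : ∀ k i z (s : ℝ), w k i (z + s • ex 0) = w k i z) :
    Ap β r (fun i z => V i (slice n z)) fun k i z => w k i (slice n z) where
  smooth k i := (h.smooth k i).comp (Liouville.slice n).contDiff
  pos k i z := h.pos k i _
  lim i := (h.lim i).comp (Liouville.slice n).continuous
  err i := by
    have := (h.err i).comp (Liouville.slice n).continuous
    refine (congrArg (fun f => LU atTop f fun _ => 0) ?_).mp this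
    ext k z
    rw [heat_slice (h.smooth k i) (hw k i)]

/-- Solutions which do not depend on `x 0` vanish if the Liouville theorem holds in one space
dimension less. -/
lemma eq_zero_of_slice {β : ι → ι → ℝ} {r : ℝ} (hβ : ∀ i j, 0 ≤ β i j) (hr : 1 ≤ r)
    (HL : ∀ (V : ι → X n → ℝ) (w : ℕ → ι → X n → ℝ) (C : ℝ), (∀ i, Continuous (V i)) →
      (∀ i z, V i z ≤ C) → Ap β r V w → ∀ i z, V i z = 0)
    {C : ℝ} (V : ι → X (n + 1) → ℝ) (hV : ∀ i, Continuous (V i)) (h0 : ∀ i z, 0 ≤ V i z)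
    (hC : ∀ i z, V i z ≤ C) (hinv : ∀ i z (s : ℝ), V i (z + s • ex 0) = V i z)
    (hw : ∀ i, Weak univ (V i) fun z => FF β r (fun j => V j z) i) (i : ι) (z : X (n + 1)) :
    V i z = 0 := by
  have hap := exists_ap hβ hr hV h0 hC ((h0 i z).trans (hC i z)) hw
  have h1 := HL _ _ C (fun i => (hV i).comp (slice n).continuous) (fun i z => hC i _)
    (hap.slice fun k i z s => by rw [moll_add_of_invariant fun z => hinv i z s])
  have h2 : z = slice n (fun j => z.1 j.succ, z.2) + z.1 0 • ex 0 := by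
    ext j
    · refine Fin.cases ?_ (fun j => ?_) j <;> simp [slice, ex]
    · simp [slice, ex]
  rw [h2, hinv]
  exact h1 i _

end

section

variable {n : ℕ} {ι : Type*} [Fintype ι]

/-! ### Integral identities -/

/-- `A` is integrable with integral zero. -/
def ZI (A : X n → ℝ) : Prop := Integrable A ∧ ∫ z, A z = 0

namespace ZI

lemma add {A B : X n → ℝ} (hA : ZI A) (hB : ZI B) : ZI fun z => A z + B z :=
  ⟨hA.1.add hB.1, by rw [integral_add hA.1 hB.1, hA.2, hB.2, add_zero]⟩

lemma sub {A B : X n → ℝ} (hA : ZI A) (hB : ZI B) : ZI fun z => A z - B z :=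
  ⟨hA.1.sub hB.1, by rw [integral_sub hA.1 hB.1, hA.2, hB.2, sub_zero]⟩

lemma const_mul {A : X n → ℝ} (hA : ZI A) (c : ℝ) : ZI fun z => c * A z :=
  ⟨hA.1.const_mul c, by rw [integral_const_mul, hA.2, mul_zero]⟩

lemma sum {κ : Type*} {s : Finset κ} {A : κ → X n → ℝ} (hA : ∀ i, ZI (A i)) :
    ZI fun z => ∑ i ∈ s, A i z :=
  ⟨integrable_finsetSum _ fun i _ => (hA i).1, by
    rw [integral_finsetSum _ fun i _ => (hA i).1]
    exact Finset.sum_eq_zero fun i _ => (hA i).2⟩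

lemma congr {A B : X n → ℝ} (hA : ZI A) (h : ∀ z, A z = B z) : ZI B :=
  (funext h : A = B) ▸ hA

end ZI

/-- `f` is smooth and `f'` is its derivative in the direction `v`. -/
structure HD (v : X n) (f f' : X n → ℝ) : Prop where
  smooth : ContDiff ℝ ∞ f
  eq : ∀ z, dd v f z = f' z

namespace HD

variable {v : X n} {f f' g g' : X n → ℝ}

lemma of_contDiff (hf : ContDiff ℝ ∞ f) : HD v f (dd v f) := ⟨hf, fun _ => rfl⟩

lemma diff (hf : HD v f f') : Differentiable ℝ f := hf.smooth.differentiable (by simp)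

lemma mul (hf : HD v f f') (hg : HD v g g') :
    HD v (fun z => f z * g z) fun z => f' z * g z + f z * g' z :=
  ⟨hf.smooth.mul hg.smooth, fun z => by rw [dd_mul (hf.diff z) (hg.diff z), hf.eq, hg.eq]⟩

lemma const_mul (c : ℝ) (hf : HD v f f') : HD v (fun z => c * f z) fun z => c * f' z :=
  ⟨contDiff_const.mul hf.smooth, fun z => by rw [dd_const_mul, hf.eq]⟩

lemma sum {κ : Type*} {s : Finset κ} {f f' : κ → X n → ℝ} (h : ∀ i, HD v (f i) (f' i)) :
    HD v (fun z => ∑ i ∈ s, f i z) fun z => ∑ i ∈ s, f' i z :=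
  ⟨ContDiff.sum fun i _ => (h i).smooth, fun z => by
    rw [dd_sum fun i _ => (h i).diff z]; exact Finset.sum_congr rfl fun i _ => (h i).eq z⟩

lemma rpow (hf : HD v f f') (h0 : ∀ z, 0 < f z) (q : ℝ) :
    HD v (fun z => f z ^ q) fun z => q * f z ^ (q - 1) * f' z :=
  ⟨hf.smooth.rpow_const_of_ne fun z => (h0 z).ne', fun z => by
    rw [dd_comp (g := fun x => x ^ q) (Real.differentiableAt_rpow_const_of_ne q (h0 z).ne')
      (hf.diff z), hf.eq, Real.deriv_rpow_const]⟩

lemma inv (hf : HD v f f') (h0 : ∀ z, 0 < f z) :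
    HD v (fun z => (f z)⁻¹) fun z => - ((f z)⁻¹ ^ 2 * f' z) :=
  ⟨hf.smooth.inv fun z => (h0 z).ne', fun z => by
    rw [dd_comp (g := fun x => x⁻¹) (differentiableAt_inv (h0 z).ne') (hf.diff z), hf.eq,
      deriv_inv, inv_pow]; ring⟩

lemma zi (hf : HD v f f') (hc : HasCompactSupport f) : ZI f' := by
  rw [← (funext hf.eq : dd v f = f')]
  exact ⟨(dd_contDiff hf.smooth).continuous.integrable_of_hasCompactSupport
    (dd_hasCompactSupport hc), integral_dd_eq_zero (hf.smooth.of_le one_le_infty) hc⟩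

end HD

/-- The product of the space gradients. -/
noncomputable def gp (f g : X n → ℝ) (z : X n) : ℝ := ∑ l, dd (ex l) f z * dd (ex l) g z

/-- The Laplacian in the space variable. -/
noncomputable def lapl (f : X n → ℝ) (z : X n) : ℝ := ∑ l, dd (ex l) (dd (ex l) f) z

/-- The squared norm of the space Hessian. -/
noncomputable def hs (f : X n → ℝ) (z : X n) : ℝ := ∑ l, ∑ m, dd (ex l) (dd (ex m) f) z ^ 2

/-- The space Hessian applied to the gradient. -/
noncomputable def hv (f : X n → ℝ) (z : X n) : ℝ :=
  ∑ l, ∑ m, dd (ex l) f z * dd (ex m) f z * dd (ex l) (dd (ex m) f) z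

section Identities

variable {φ w : X n → ℝ}

lemma zi_bochner (hφ : ContDiff ℝ ∞ φ) (hc : HasCompactSupport φ) (hw : ContDiff ℝ ∞ w) :
    ZI fun z => φ z * (hs w z - lapl w z ^ 2) - lapl w z * gp φ w z
    - 1 / 2 * gp w w z * lapl φ z := by
  have h1 := fun l m : Fin (n + 1) => ((((HD.of_contDiff (v := ex l) hφ).mul
    (HD.of_contDiff (dd_contDiff (v := ex m) hw))).mul
    (HD.of_contDiff (dd_contDiff (v := ex l) (dd_contDiff (v := ex m) hw))))).zi
    (hc.mul_right.mul_right)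
  have h2 := fun l m : Fin (n + 1) => ((((HD.of_contDiff (v := ex l) hφ).mul
    (HD.of_contDiff (dd_contDiff (v := ex l) hw))).mul
    (HD.of_contDiff (dd_contDiff (v := ex m) (dd_contDiff (v := ex m) hw))))).zi
    (hc.mul_right.mul_right)
  have h3 := fun l m : Fin (n + 1) => ((((HD.of_contDiff (v := ex l)
    (dd_contDiff (v := ex l) hφ)).mul
    (HD.of_contDiff (dd_contDiff (v := ex m) hw))).mul
    (HD.of_contDiff (dd_contDiff (v := ex m) hw)))).zi
    ((dd_hasCompactSupport hc).mul_right.mul_right)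
  refine (ZI.sum (s := Finset.univ) fun l => ZI.sum (s := Finset.univ) fun m =>
    (((h1 l m).sub (h2 l m)).sub ((h3 l m).const_mul (1 / 2)))).congr fun z => ?_
  have e1 : ∑ l, ∑ m, φ z * (dd (ex m) w z * dd (ex l) (dd (ex l) (dd (ex m) w)) z)
      = ∑ l, ∑ m, φ z * (dd (ex l) w z * dd (ex l) (dd (ex m) (dd (ex m) w)) z) := by
    rw [Finset.sum_comm]
    refine Finset.sum_congr rfl fun l _ => Finset.sum_congr rfl fun m _ => ?_
    have c1 : dd (ex m) (dd (ex l) w) = dd (ex l) (dd (ex m) w) :=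
      funext fun y => dd_comm (hw.of_le two_le_infty).contDiffAt
    rw [c1, dd_comm ((dd_contDiff hw).of_le two_le_infty).contDiffAt]
  have e2 : ∀ l m : Fin (n + 1), dd (ex l) (dd (ex m) w) z = dd (ex m) (dd (ex l) w) z :=
    fun l m => dd_comm (hw.of_le two_le_infty).contDiffAt
  have e3 : lapl w z ^ 2 = ∑ l, ∑ m, dd (ex l) (dd (ex l) w) z * dd (ex m) (dd (ex m) w) z := by
    rw [sq, lapl, Finset.sum_mul_sum]
  have e4 : lapl w z * gp φ w z
      = ∑ l, ∑ m, dd (ex l) φ z * dd (ex l) w z * dd (ex m) (dd (ex m) w) z := by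
    rw [mul_comm, lapl, gp, Finset.sum_mul_sum]
  have e5 : 1 / 2 * gp w w z * lapl φ z
      = ∑ l, ∑ m, 1 / 2 * (dd (ex l) (dd (ex l) φ) z * (dd (ex m) w z * dd (ex m) w z)) := by
    rw [mul_assoc, mul_comm (gp w w z), lapl, gp, Finset.sum_mul_sum]
    simp only [Finset.mul_sum]
  rw [mul_sub, e3, e4, e5, hs]
  simp only [Finset.mul_sum]
  rw [← sub_eq_zero]
  simp only [← Finset.sum_sub_distrib]
  rw [← sub_eq_zero] at e1
  simp only [← Finset.sum_sub_distrib] at e1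
  refine Eq.trans ?_ e1
  refine Finset.sum_congr rfl fun l _ => Finset.sum_congr rfl fun m _ => ?_
  ring

lemma zi_div (hφ : ContDiff ℝ ∞ φ) (hc : HasCompactSupport φ) (hw : ContDiff ℝ ∞ w)
    {F : X n → ℝ} (hF : ContDiff ℝ ∞ F) :
    ZI fun z => φ z * gp F w z + φ z * F z * lapl w z + F z * gp φ w z := by
  refine (ZI.sum (s := Finset.univ) fun l : Fin (n + 1) =>
    ((((HD.of_contDiff (v := ex l) hφ).mul (HD.of_contDiff hF)).mul
    (HD.of_contDiff (dd_contDiff (v := ex l) hw)))).zi hc.mul_right.mul_right).congr fun z => ?_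
  simp only [gp, lapl, Finset.mul_sum, ← Finset.sum_add_distrib]
  exact Finset.sum_congr rfl fun l _ => by ring

lemma zi_div_inv (hφ : ContDiff ℝ ∞ φ) (hc : HasCompactSupport φ) (hw : ContDiff ℝ ∞ w)
    (h0 : ∀ z, 0 < w z) :
    ZI fun z => φ z * (- ((w z)⁻¹ * gp w w z) ^ 2 + 2 * (w z)⁻¹ * hv w z
      + (w z)⁻¹ * gp w w z * lapl w z) + (w z)⁻¹ * gp w w z * gp φ w z := by
  have hP : ContDiff ℝ ∞ (gp w w) := by
    unfold gp
    exact ContDiff.sum fun l _ => (dd_contDiff hw).mul (dd_contDiff hw)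
  refine (zi_div hφ hc hw (F := fun z => (w z)⁻¹ * gp w w z)
    ((hw.inv fun z => (h0 z).ne').mul hP)).congr fun z => ?_
  have h1 : ∀ l : Fin (n + 1), dd (ex l) (fun z => (w z)⁻¹ * gp w w z) z
      = - ((w z)⁻¹ ^ 2 * dd (ex l) w z) * gp w w z
        + (w z)⁻¹ * ∑ m, 2 * (dd (ex m) w z * dd (ex l) (dd (ex m) w) z) := fun l => by
    have h2 := ((HD.of_contDiff (v := ex l) hw).inv h0).mul
      (HD.sum (s := Finset.univ) fun m => (HD.of_contDiff (v := ex l)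
        (dd_contDiff (v := ex m) hw)).mul (HD.of_contDiff (v := ex l)
        (dd_contDiff (v := ex m) hw)))
    rw [show dd (ex l) (fun z => (w z)⁻¹ * gp w w z) z = _ from h2.eq z]
    congr 2
    exact Finset.sum_congr rfl fun m _ => by ring
  have h2 : gp (fun z => (w z)⁻¹ * gp w w z) w z
      = - ((w z)⁻¹ * gp w w z) ^ 2 + 2 * (w z)⁻¹ * hv w z := by
    rw [gp]
    simp only [h1]
    have : - ((w z)⁻¹ * gp w w z) ^ 2
        = ∑ l, - (w z)⁻¹ ^ 2 * gp w w z * (dd (ex l) w z * dd (ex l) w z) := by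
      rw [← Finset.mul_sum]
      change _ = _ * gp w w z
      ring
    rw [this]
    simp only [hv, Finset.mul_sum, ← Finset.sum_add_distrib]
    refine Finset.sum_congr rfl fun l _ => ?_
    rw [add_mul, Finset.sum_mul]
    congr 1
    · ring
    · exact Finset.sum_congr rfl fun m _ => by ring
  rw [h2]; ring

lemma zi_time (hφ : ContDiff ℝ ∞ φ) (hc : HasCompactSupport φ) (hw : ContDiff ℝ ∞ w) :
    ZI fun z => φ z * dd et w z * lapl w z + dd et w z * gp φ w z
    - 1 / 2 * dd et φ z * gp w w z := by
  have h1 := zi_div hφ hc hw (F := dd et w) (dd_contDiff hw)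
  have h2 := fun l : Fin (n + 1) => ((((HD.of_contDiff (v := et) hφ).mul
    (HD.of_contDiff (dd_contDiff (v := ex l) hw))).mul
    (HD.of_contDiff (dd_contDiff (v := ex l) hw)))).zi hc.mul_right.mul_right
  refine (h1.sub (ZI.sum (s := Finset.univ) fun l => (h2 l).const_mul (1 / 2))).congr fun z => ?_
  have e : ∀ l : Fin (n + 1), dd (ex l) (dd et w) z = dd et (dd (ex l) w) z :=
    fun l => dd_comm (hw.of_le two_le_infty).contDiffAt
  rw [← sub_eq_zero]
  have : φ z * gp (dd et w) w z + 1 / 2 * dd et φ z * gp w w z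
      = ∑ l, 1 / 2 * ((dd et φ z * dd (ex l) w z + φ z * dd et (dd (ex l) w) z) * dd (ex l) w z
        + φ z * dd (ex l) w z * dd et (dd (ex l) w) z) := by
    simp only [gp, Finset.mul_sum, ← Finset.sum_add_distrib]
    exact Finset.sum_congr rfl fun l _ => by rw [e]; ring
  rw [← this]; ring

lemma zi_energy (hφ : ContDiff ℝ ∞ φ) (hc : HasCompactSupport φ) (hw : ContDiff ℝ ∞ w) :
    ZI fun z => φ z * gp w w z - φ z * w z * heat w z
    - 1 / 2 * w z ^ 2 * (dd et φ z + lapl φ z) := by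
  have h1 := zi_div hφ hc hw (F := w) hw
  have h2 := fun l : Fin (n + 1) => ((((HD.of_contDiff (v := ex l)
    (dd_contDiff (v := ex l) hφ)).mul (HD.of_contDiff hw)).mul
    (HD.of_contDiff hw))).zi (dd_hasCompactSupport hc).mul_right.mul_right
  have h3 := ((((HD.of_contDiff (v := et) hφ).mul (HD.of_contDiff hw)).mul
    (HD.of_contDiff hw))).zi hc.mul_right.mul_right
  refine ((h1.sub (ZI.sum (s := Finset.univ) fun l => (h2 l).const_mul (1 / 2))).sub
    (h3.const_mul (1 / 2))).congr fun z => ?_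
  have : w z * gp φ w z + 1 / 2 * w z ^ 2 * lapl φ z
      = ∑ l, 1 / 2 * ((dd (ex l) (dd (ex l) φ) z * w z + dd (ex l) φ z * dd (ex l) w z) * w z
        + dd (ex l) φ z * w z * dd (ex l) w z) := by
    simp only [gp, lapl, Finset.mul_sum, ← Finset.sum_add_distrib]
    exact Finset.sum_congr rfl fun l _ => by ring
  rw [← this]
  have hh : heat w z = dd et w z - lapl w z := rfl
  rw [hh]; ring

lemma zi_heat (hφ : ContDiff ℝ ∞ φ) (hc : HasCompactSupport φ) (hw : ContDiff ℝ ∞ w) :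
    ZI fun z => φ z * heat w z + w z * (dd et φ z + lapl φ z) := by
  have h1 := zi_div hφ hc hw (F := fun _ => 1) contDiff_const
  have h2 := fun l : Fin (n + 1) => (((HD.of_contDiff (v := ex l)
    (dd_contDiff (v := ex l) hφ)).mul (HD.of_contDiff hw))).zi (dd_hasCompactSupport hc).mul_right
  have h3 := (((HD.of_contDiff (v := et) hφ).mul (HD.of_contDiff hw))).zi hc.mul_right
  refine ((ZI.sum (s := Finset.univ) h2).sub h1 |>.add h3).congr fun z => ?_
  have e0 : gp (fun _ => 1) w z = 0 := by simp [gp, dd_const]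
  have : w z * lapl φ z + gp φ w z
      = ∑ l, (dd (ex l) (dd (ex l) φ) z * w z + dd (ex l) φ z * dd (ex l) w z) := by
    simp only [gp, lapl, Finset.mul_sum, ← Finset.sum_add_distrib]
    exact Finset.sum_congr rfl fun l _ => by ring
  have hh : heat w z = dd et w z - lapl w z := rfl
  rw [← this, e0, hh]; ring

end Identities

/-! ### The nonlinearity along smooth positive functions -/

/-- The potential of the nonlinearity. -/
noncomputable def GG (β : ι → ι → ℝ) (r : ℝ) (U : ι → ℝ) : ℝ :=
  (2 * (r + 1))⁻¹ * ∑ i, U i * FF β r U i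

section Nonlinearity

variable {β : ι → ι → ℝ} {r : ℝ} {w : ι → X n → ℝ}

lemma FF_of_pos {U : ι → ℝ} (h : ∀ i, 0 < U i) (i : ι) :
    FF β r U i = ∑ j, β i j * (U i ^ r * U j ^ (r + 1)) := by
  simp only [FF, max_eq_left (h _).le]

lemma rpow_mul_rpow_aux {x : ℝ} (hx : 0 < x) (r : ℝ) : x * x ^ r = x ^ (r + 1) := by
  rw [Real.rpow_add_one hx.ne', mul_comm]

lemma GG_of_pos {U : ι → ℝ} (h : ∀ i, 0 < U i) :
    GG β r U = (2 * (r + 1))⁻¹ * ∑ i, ∑ j, β i j * (U i ^ (r + 1) * U j ^ (r + 1)) := by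
  simp only [GG, FF_of_pos h, Finset.mul_sum]
  refine Finset.sum_congr rfl fun i _ => Finset.sum_congr rfl fun j _ => ?_
  rw [← rpow_mul_rpow_aux (h i) r]; ring

lemma hd_FF (hw : ∀ i, ContDiff ℝ ∞ (w i)) (h0 : ∀ i z, 0 < w i z) (v : X n) (i : ι) :
    HD v (fun z => FF β r (fun j => w j z) i) fun z => ∑ j, β i j *
      (r * w i z ^ (r - 1) * dd v (w i) z * w j z ^ (r + 1)
        + w i z ^ r * ((r + 1) * w j z ^ r * dd v (w j) z)) := by
  have h := HD.sum (s := Finset.univ) fun j => (((HD.of_contDiff (v := v) (hw i)).rpow (h0 i) r).mul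
    ((HD.of_contDiff (v := v) (hw j)).rpow (h0 j) (r + 1))).const_mul (β i j)
  simp only [add_sub_cancel_right] at h
  have e : (fun z => FF β r (fun j => w j z) i) = fun z =>
      ∑ j, β i j * (w i z ^ r * w j z ^ (r + 1)) := funext fun z => FF_of_pos (h0 · z) i
  rw [e]; exact h

lemma hd_GG (hr : 1 ≤ r) (hβs : ∀ i j, β i j = β j i) (hw : ∀ i, ContDiff ℝ ∞ (w i))
    (h0 : ∀ i z, 0 < w i z) (v : X n) :
    HD v (fun z => GG β r fun j => w j z) fun z => ∑ i, FF β r (fun j => w j z) i * dd v (w i) z := by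
  have h := (HD.sum (s := Finset.univ) fun i => HD.sum (s := Finset.univ) fun j =>
    (((HD.of_contDiff (v := v) (hw i)).rpow (h0 i) (r + 1)).mul
    ((HD.of_contDiff (v := v) (hw j)).rpow (h0 j) (r + 1))).const_mul (β i j)).const_mul
    (2 * (r + 1))⁻¹
  simp only [add_sub_cancel_right] at h
  have e : (fun z => GG β r fun j => w j z) = fun z =>
      (2 * (r + 1))⁻¹ * ∑ i, ∑ j, β i j * (w i z ^ (r + 1) * w j z ^ (r + 1)) :=
    funext fun z => GG_of_pos (h0 · z)
  rw [e]
  refine ⟨h.smooth, fun z => ?_⟩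
  rw [h.eq]
  simp only [FF_of_pos (h0 · z), Finset.sum_mul, mul_add, Finset.sum_add_distrib]
  have e2 : ∑ i, ∑ j, β i j * (w i z ^ (r + 1) * ((r + 1) * w j z ^ r * dd v (w j) z))
      = ∑ i, ∑ j, β i j * ((r + 1) * w i z ^ r * dd v (w i) z * w j z ^ (r + 1)) := by
    rw [Finset.sum_comm]
    exact Finset.sum_congr rfl fun i _ => Finset.sum_congr rfl fun j _ => by rw [hβs j i]; ring
  rw [e2, ← mul_add, ← two_mul, ← mul_assoc]
  have hr' : r + 1 ≠ 0 := by linarith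
  simp only [Finset.mul_sum]
  refine Finset.sum_congr rfl fun i _ => Finset.sum_congr rfl fun j _ => ?_
  field_simp

lemma sum_gp_FF_le (hr : 1 ≤ r) (hβ : ∀ i j, 0 ≤ β i j) (hβs : ∀ i j, β i j = β j i)
    (hw : ∀ i, ContDiff ℝ ∞ (w i)) (h0 : ∀ i z, 0 < w i z) (z : X n) :
    ∑ i, gp (fun z => FF β r (fun j => w j z) i) (w i) z
      ≤ (2 * r + 1) * ∑ i, (w i z)⁻¹ * gp (w i) (w i) z * FF β r (fun j => w j z) i := by
  have e1 : (2 * r + 1) * ∑ i, (w i z)⁻¹ * gp (w i) (w i) z * FF β r (fun j => w j z) i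
      = ∑ l, (2 * r + 1) * ∑ i, (w i z)⁻¹ * (dd (ex l) (w i) z) ^ 2
          * FF β r (fun j => w j z) i := by
    rw [← Finset.mul_sum, Finset.sum_comm]
    congr 1
    refine Finset.sum_congr rfl fun i _ => ?_
    rw [gp, ← Finset.sum_mul, ← Finset.mul_sum]
    simp only [sq]
  rw [e1]
  simp only [gp]
  rw [Finset.sum_comm]
  refine Finset.sum_le_sum fun l _ => ?_
  set q : ι → ℝ := fun i => dd (ex l) (w i) z / w i z with hq
  have hd : ∀ i, dd (ex l) (w i) z = q i * w i z := fun i => by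
    rw [hq]; field_simp [(h0 i z).ne']
  set b : ι → ι → ℝ := fun i j => β i j * (w i z ^ (r + 1) * w j z ^ (r + 1)) with hb
  have hbs : ∀ i j, b i j = b j i := fun i j => by simp only [hb]; rw [hβs]; ring
  have hb0 : ∀ i j, 0 ≤ b i j := fun i j => mul_nonneg (hβ i j)
    (mul_nonneg (Real.rpow_nonneg (h0 i z).le _) (Real.rpow_nonneg (h0 j z).le _))
  have hL : ∀ i, dd (ex l) (fun z => FF β r (fun j => w j z) i) z * dd (ex l) (w i) z
      = ∑ j, b i j * (r * q i ^ 2 + (r + 1) * (q i * q j)) := fun i => by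
    rw [(hd_FF hw h0 (ex l) i).eq, Finset.sum_mul]
    refine Finset.sum_congr rfl fun j _ => ?_
    have h1 := rpow_mul_rpow_aux (h0 i z) (r - 1)
    have h2 := rpow_mul_rpow_aux (h0 i z) r
    have h3 := rpow_mul_rpow_aux (h0 j z) r
    rw [sub_add_cancel] at h1
    simp only [hb, hd, ← h3, ← h2, ← h1]
    ring
  have hR : ∀ i, (w i z)⁻¹ * (dd (ex l) (w i) z) ^ 2 * FF β r (fun j => w j z) i
      = ∑ j, b i j * q i ^ 2 := fun i => by
    rw [FF_of_pos (h0 · z), Finset.mul_sum]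
    refine Finset.sum_congr rfl fun j _ => ?_
    simp only [hb, hd, ← rpow_mul_rpow_aux (h0 i z) r]
    field_simp [(h0 i z).ne']
  simp only [hL, hR]
  have hsym : ∑ i, ∑ j, b i j * q j ^ 2 = ∑ i, ∑ j, b i j * q i ^ 2 := by
    rw [Finset.sum_comm]
    exact Finset.sum_congr rfl fun i _ => Finset.sum_congr rfl fun j _ => by rw [hbs]
  calc ∑ i, ∑ j, b i j * (r * q i ^ 2 + (r + 1) * (q i * q j))
      ≤ ∑ i, ∑ j, (r * (b i j * q i ^ 2)
          + (r + 1) / 2 * (b i j * q i ^ 2 + b i j * q j ^ 2)) := by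
        refine Finset.sum_le_sum fun i _ => Finset.sum_le_sum fun j _ => ?_
        have := mul_nonneg (mul_nonneg (hb0 i j) (by linarith : (0 : ℝ) ≤ (r + 1) / 2))
          (sq_nonneg (q i - q j))
        nlinarith only [this]
    _ = (2 * r + 1) * ∑ i, ∑ j, b i j * q i ^ 2 := by
        simp only [Finset.sum_add_distrib, ← Finset.mul_sum, hsym]
        ring

end Nonlinearity

end

section

variable {n : ℕ} {ι : Type*} [Fintype ι]

/-! ### Cutoff functions and integral estimates -/

/-- A smooth cutoff function. -/
structure Cut (ξ : X n → ℝ) : Prop where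
  smooth : ContDiff ℝ ∞ ξ
  supp : HasCompactSupport ξ
  nonneg : ∀ z, 0 ≤ ξ z
  le_one : ∀ z, ξ z ≤ 1

lemma exists_cut (n : ℕ) : ∃ ξ : X n → ℝ, Cut ξ ∧ ∀ z ∈ closedBall (0 : X n) 1, ξ z = 1 := by
  let f : ContDiffBump (0 : X n) := ⟨1, 2, one_pos, one_lt_two⟩
  exact ⟨f, ⟨f.contDiff, f.hasCompactSupport, fun z => f.nonneg, fun z => f.le_one⟩,
    fun z hz => f.one_of_mem_closedBall hz⟩

lemma gp_self_nonneg (f : X n → ℝ) (z : X n) : 0 ≤ gp f f z :=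
  Finset.sum_nonneg fun _ _ => mul_self_nonneg _

lemma gp_sq_le (f g : X n → ℝ) (z : X n) : gp f g z ^ 2 ≤ gp f f z * gp g g z := by
  simp only [gp, ← sq]
  exact Finset.sum_mul_sq_le_sq_mul_sq _ _ _

namespace Cut

variable {ξ : X n → ℝ}

lemma pow_contDiff (hξ : Cut ξ) (k : ℕ) : ContDiff ℝ ∞ fun z => ξ z ^ k := hξ.smooth.pow k

lemma pow_supp (hξ : Cut ξ) {k : ℕ} (hk : k ≠ 0) : HasCompactSupport fun z => ξ z ^ k :=
  hξ.supp.mono fun z hz h => hz (by simp [h, hk])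

lemma integrable (hξ : Cut ξ) {k : ℕ} (hk : k ≠ 0) {f : X n → ℝ} (hf : Continuous f) :
    Integrable fun z => ξ z ^ k * f z :=
  ((hξ.pow_contDiff k).continuous.mul hf).integrable_of_hasCompactSupport
    (hξ.pow_supp hk).mul_right

lemma pow_anti (hξ : Cut ξ) {j k : ℕ} (h : j ≤ k) (z : X n) : ξ z ^ k ≤ ξ z ^ j :=
  pow_le_pow_of_le_one (hξ.nonneg z) (hξ.le_one z) h

lemma exists_bound {f : X n → ℝ} (hf : Continuous f) (hc : HasCompactSupport f) :
    ∃ B, 0 ≤ B ∧ ∀ z, |f z| ≤ B := by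
  obtain ⟨B, hB⟩ := hf.bounded_above_of_compact_support hc
  exact ⟨B, (norm_nonneg _).trans (hB 0), hB⟩

lemma dd_pow (hξ : Cut ξ) (v : X n) (k : ℕ) (z : X n) :
    dd v (fun z => ξ z ^ (k + 1)) z = (k + 1) * ξ z ^ k * dd v ξ z := by
  rw [dd_comp (g := fun x => x ^ (k + 1)) (by fun_prop)
    (hξ.smooth.differentiable (by simp) z)]
  simp

lemma dd_dd_pow (hξ : Cut ξ) (v : X n) (k : ℕ) (z : X n) :
    dd v (dd v fun z => ξ z ^ (k + 2)) z
      = (k + 2) * (k + 1) * ξ z ^ k * dd v ξ z ^ 2 + (k + 2) * ξ z ^ (k + 1) * dd v (dd v ξ) z := by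
  have h1 : dd v (fun z => ξ z ^ (k + 2)) = fun z => (k + 2) * (ξ z ^ (k + 1) * dd v ξ z) := by
    ext z; rw [hξ.dd_pow v (k + 1)]; push_cast; ring
  rw [h1, dd_const_mul, dd_mul ((hξ.pow_contDiff _).differentiable (by simp) z)
    ((dd_contDiff hξ.smooth).differentiable (by simp) z), hξ.dd_pow]
  ring

lemma bounds (hξ : Cut ξ)
    (k : ℕ) : ∃ C, 0 ≤ C ∧ ∀ z, |dd et (fun z => ξ z ^ (k + 2)) z| ≤ C * ξ z ^ k ∧
    |lapl (fun z => ξ z ^ (k + 2)) z| ≤ C * ξ z ^ k ∧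
    ∀ f, gp (fun z => ξ z ^ (k + 2)) f z ^ 2 ≤ C * ξ z ^ (2 * k + 2) * gp f f z := by
  obtain ⟨B₀, hB₀, h₀⟩ := exists_bound (dd_contDiff (v := et) hξ.smooth).continuous
    (dd_hasCompactSupport hξ.supp)
  have hl : ContDiff ℝ ∞ (lapl ξ) := by
    unfold lapl; exact ContDiff.sum fun l _ => dd_contDiff (dd_contDiff hξ.smooth)
  have hg : ContDiff ℝ ∞ (gp ξ ξ) := by
    unfold gp; exact ContDiff.sum fun l _ => (dd_contDiff hξ.smooth).mul (dd_contDiff hξ.smooth)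
  have hts : ∀ {f : X n → ℝ}, (∀ z, z ∉ tsupport ξ → f z = 0) → HasCompactSupport f := fun h =>
    HasCompactSupport.intro hξ.supp h
  have hz0 : ∀ {v : X n} {z : X n}, z ∉ tsupport ξ → dd v ξ z = 0 := fun {v z} h =>
    image_eq_zero_of_notMem_tsupport fun h' => h (dd_tsupport h')
  have hz1 : ∀ {v : X n} {z : X n}, z ∉ tsupport ξ → dd v (dd v ξ) z = 0 := fun {v z} h =>
    image_eq_zero_of_notMem_tsupport fun h' => h (dd_tsupport (dd_tsupport h'))
  obtain ⟨B₁, hB₁, h₁⟩ := exists_bound hl.continuous (hts fun z hz => by simp [lapl, hz1 hz])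
  obtain ⟨B₂, hB₂, h₂⟩ := exists_bound hg.continuous (hts fun z hz => by simp [gp, hz0 hz])
  set K : ℝ := (k + 2) * (B₀ + B₁ + (k + 2) * B₂) with hK
  have hk : (0 : ℝ) ≤ k := by positivity
  refine ⟨K, by positivity, fun z => ?_⟩
  have p0 := pow_nonneg (hξ.nonneg z) k
  have p1 := pow_nonneg (hξ.nonneg z) (k + 1)
  have p2 := hξ.pow_anti (Nat.le_succ k) z
  have hgn := gp_self_nonneg ξ z
  have hg2 := (le_abs_self _).trans (h₂ z)
  refine ⟨?_, ?_, fun f => ?_⟩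
  · rw [hξ.dd_pow, abs_mul, abs_mul, abs_of_nonneg p1, abs_of_nonneg (by positivity)]
    push_cast
    calc (k + 1 + 1 : ℝ) * ξ z ^ (k + 1) * |dd et ξ z| ≤ (k + 2) * ξ z ^ k * B₀ := by
          refine mul_le_mul (mul_le_mul (by linarith) p2 p1 (by linarith)) (h₀ z) (abs_nonneg _)
            (by positivity)
      _ = (k + 2) * (B₀ + 0) * ξ z ^ k := by ring
      _ ≤ _ := by rw [hK]; gcongr; exacts [by linarith, by positivity]
  · have : lapl (fun z => ξ z ^ (k + 2)) z
        = (k + 2) * (k + 1) * ξ z ^ k * gp ξ ξ z + (k + 2) * ξ z ^ (k + 1) * lapl ξ z := by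
      simp only [lapl, hξ.dd_dd_pow, Finset.sum_add_distrib, ← Finset.mul_sum, gp, sq]
    rw [this]
    refine (abs_add_le _ _).trans ?_
    rw [abs_mul _ (gp ξ ξ z), abs_mul _ (lapl ξ z), abs_of_nonneg hgn,
      abs_of_nonneg (a := (k + 2) * (k + 1) * ξ z ^ k) (by positivity),
      abs_of_nonneg (a := (k + 2) * ξ z ^ (k + 1)) (by positivity)]
    calc _ ≤ (k + 2) * (k + 2) * ξ z ^ k * B₂ + (k + 2) * ξ z ^ k * B₁ := by
          gcongr ?_ * ?_ * _ * ?_ + _ * ?_ * ?_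
          · linarith
          · exact h₁ z
      _ = (k + 2) * (0 + B₁ + (k + 2) * B₂) * ξ z ^ k := by ring
      _ ≤ _ := by rw [hK]; gcongr
  · refine (gp_sq_le _ _ _).trans (mul_le_mul_of_nonneg_right ?_ (gp_self_nonneg _ _))
    have : gp (fun z => ξ z ^ (k + 2)) (fun z => ξ z ^ (k + 2)) z
        = (k + 2) ^ 2 * ξ z ^ (2 * k + 2) * gp ξ ξ z := by
      simp only [gp, hξ.dd_pow, Finset.mul_sum]
      refine Finset.sum_congr rfl fun l _ => ?_
      push_cast; ring
    rw [this]
    calc _ ≤ (k + 2) ^ 2 * ξ z ^ (2 * k + 2) * B₂ := by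
          gcongr
          have := hξ.nonneg z
          positivity
      _ = (k + 2) * (0 + 0 + (k + 2) * B₂) * ξ z ^ (2 * k + 2) := by ring
      _ ≤ _ := by
          rw [hK]; gcongr
          exact pow_nonneg (hξ.nonneg z) _

end Cut

lemma ZI.integral_le {Q A B : X n → ℝ} (hQ : ZI Q) (hA : Integrable A) (hB : Integrable B)
    (h : ∀ z, A z ≤ B z + Q z) : ∫ z, A z ≤ ∫ z, B z := by
  have := integral_mono hA (hB.add hQ.1) h
  simp only [Pi.add_apply] at this
  rwa [integral_add hB hQ.1, hQ.2, add_zero] at this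

/-- The error in the equation. -/
noncomputable def er (β : ι → ι → ℝ) (r : ℝ) (w : ι → X n → ℝ) (i : ι) (z : X n) : ℝ :=
  heat (w i) z - FF β r (fun j => w j z) i

/-- The squared error in the system. -/
noncomputable def ee (β : ι → ι → ℝ) (r : ℝ) (w : ι → X n → ℝ) (z : X n) : ℝ :=
  ∑ i, er β r w i z ^ 2

section Estimates

variable {β : ι → ι → ℝ} {r : ℝ}

lemma ee_nonneg (w : ι → X n → ℝ) (z : X n) : 0 ≤ ee β r w z :=
  Finset.sum_nonneg fun _ _ => sq_nonneg _

lemma er_sq_le (w : ι → X n → ℝ) (i : ι) (z : X n) : er β r w i z ^ 2 ≤ ee β r w z :=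
  Finset.single_le_sum (f := fun i => er β r w i z ^ 2) (fun _ _ => sq_nonneg _)
    (Finset.mem_univ i)

lemma rpow_le_FF (hβ : ∀ i j, 0 ≤ β i j) {U : ι → ℝ} (h : ∀ i, 0 < U i) (i : ι) :
    β i i * U i ^ (2 * r + 1) ≤ FF β r U i := by
  rw [FF_of_pos h]
  have e : U i ^ (2 * r + 1) = U i ^ r * U i ^ (r + 1) := by
    rw [← Real.rpow_add (h i)]; congr 1; ring
  rw [e]
  exact Finset.single_le_sum (f := fun j => β i j * (U i ^ r * U j ^ (r + 1)))
    (fun j _ => mul_nonneg (hβ i j) (mul_nonneg (Real.rpow_nonneg (h i).le _)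
    (Real.rpow_nonneg (h j).le _))) (Finset.mem_univ i)

lemma sq_le_one_add_rpow {x q : ℝ} (hx : 0 < x) (hq : 2 ≤ q) : x ^ 2 ≤ 1 + x ^ q := by
  rcases le_total x 1 with h | h
  · nlinarith [Real.rpow_nonneg hx.le q]
  · have := Real.rpow_le_rpow_of_exponent_le h hq
    rw [Real.rpow_two] at this
    linarith

variable {w : ι → X n → ℝ}

lemma heat_contDiff {f : X n → ℝ} (hf : ContDiff ℝ ∞ f) : ContDiff ℝ ∞ (heat f) := by
  unfold heat
  exact (dd_contDiff hf).sub (ContDiff.sum fun l _ => dd_contDiff (dd_contDiff hf))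

lemma er_continuous (hw : ∀ i, ContDiff ℝ ∞ (w i)) (h0 : ∀ i z, 0 < w i z) (i : ι) :
    Continuous (er β r w i) :=
  (heat_contDiff (hw i)).continuous.sub (hd_FF hw h0 0 i).smooth.continuous

lemma ee_continuous (hw : ∀ i, ContDiff ℝ ∞ (w i)) (h0 : ∀ i z, 0 < w i z) :
    Continuous (ee β r w) :=
  continuous_finsetSum _ fun i _ => (er_continuous hw h0 i).pow 2

lemma rpow_continuous (hw : ∀ i, ContDiff ℝ ∞ (w i)) (h0 : ∀ i z, 0 < w i z) (i : ι) (q : ℝ) :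
    Continuous fun z => w i z ^ q :=
  (hw i).continuous.rpow_const fun z => Or.inl (h0 i z).ne'

variable {ξ : X n → ℝ}

lemma estimate_power (hξ : Cut ξ) (hr : 1 ≤ r) (hβ : ∀ i j, 0 ≤ β i j)
    {i : ι} (hd : 0 < β i i) : ∃ C, 0 ≤ C ∧ ∀ w : ι → X n → ℝ,
    (∀ i, ContDiff ℝ ∞ (w i)) → (∀ i z, 0 < w i z) →
    ∫ z, ξ z ^ 8 * w i z ^ (2 * r + 1) ≤ C * ∫ z, ξ z ^ 4 * (1 + ee β r w z) := by
  obtain ⟨C, hC, hb⟩ := hξ.bounds 6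
  set b := β i i with hb'
  set K := 1 + b / 2 + 2 * C ^ 2 / b with hK
  refine ⟨2 / b * K, by positivity, fun w hw h0 => ?_⟩
  rw [mul_assoc, ← integral_const_mul, ← integral_const_mul]
  refine ((zi_heat (hξ.pow_contDiff 8) (hξ.pow_supp (by simp)) (hw i)).const_mul (2 / b)).integral_le
    (hξ.integrable (by simp) (rpow_continuous hw h0 i _))
    (((hξ.integrable (by simp) (continuous_const.add (ee_continuous hw h0))).const_mul _).const_mul
      _) fun z => ?_
  obtain ⟨h1, h2, -⟩ := hb z
  have hF := rpow_le_FF (r := r) hβ (fun j => h0 j z) i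
  have hs := sq_le_one_add_rpow (q := 2 * r + 1) (h0 i z) (by linarith)
  have he := er_sq_le (β := β) (r := r) w i z
  have hh : heat (w i) z = FF β r (fun j => w j z) i + er β r w i z := by simp [er]
  rw [hh]
  set x := ξ z
  have hx := hξ.nonneg z
  have hx1 : x ^ 8 ≤ x ^ 4 := hξ.pow_anti (by norm_num) z
  set F := FF β r (fun j => w j z) i
  set e := er β r w i z
  set E := ee β r w z
  set y := w i z ^ (2 * r + 1)
  set a := dd et (fun z => ξ z ^ (6 + 2)) z
  set l := lapl (fun z => ξ z ^ (6 + 2)) z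
  have hy := h0 i z
  set v := w i z
  rw [← mul_assoc, div_mul_eq_mul_div, div_mul_eq_mul_div, div_mul_eq_mul_div, ← add_div,
    le_div_iff₀ hd]
  have q1 : v * (a + l) ≥ - (v * (2 * C * x ^ 6)) := by
    have : a + l ≥ - (2 * C * x ^ 6) := by linarith [(abs_le.1 h1).1, (abs_le.1 h2).1]
    nlinarith
  have q2 : v * (2 * C * x ^ 6) ≤ b / 2 * (x ^ 8 * v ^ 2) + 2 * C ^ 2 / b * x ^ 4 := by
    have : 0 ≤ (b * x ^ 4 * v - 2 * C * x ^ 2) ^ 2 / (2 * b) := by positivity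
    have e : (b * x ^ 4 * v - 2 * C * x ^ 2) ^ 2 / (2 * b)
      = b / 2 * (x ^ 8 * v ^ 2) + 2 * C ^ 2 / b * x ^ 4 - v * (2 * C * x ^ 6) := by
      field_simp; ring
    linarith
  have x8 : 0 ≤ x ^ 8 := by positivity
  have q3 : x ^ 8 * v ^ 2 ≤ x ^ 4 + x ^ 8 * y := by nlinarith
  have q4 : x ^ 8 * (F + e) ≥ x ^ 8 * (b * y) - x ^ 4 * (1 + E) := by
    have h5 : -e ≤ 1 + E := by nlinarith [sq_nonneg (e + 1)]
    have h6 : x ^ 8 * (1 + E) ≤ x ^ 4 * (1 + E) :=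
      mul_le_mul_of_nonneg_right hx1 (by nlinarith [sq_nonneg e])
    nlinarith
  have hE : 0 ≤ E := ee_nonneg w z
  have q5 : 0 ≤ (b / 2 + 2 * C ^ 2 / b) * (x ^ 4 * E) := by positivity
  have q6 := mul_le_mul_of_nonneg_left q3 (by positivity : 0 ≤ b / 2)
  rw [hK]
  linarith only [q1, q2, q4, q5, q6]

end Estimates

end

section

variable {n : ℕ} {ι : Type*} [Fintype ι]

section TimeDerivative

variable {β : ι → ι → ℝ} {r : ℝ}

lemma abs_mul_le_young {x T a C P δ : ℝ} (ha : a ^ 2 ≤ C * x ^ 22 * P)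
    (hδ : 0 < δ) (hCP : 0 ≤ C * P) :
    |T * a| ≤ δ * (x ^ 12 * T ^ 2) + C / (4 * δ) * (x ^ 10 * P) := by
  have h1 : 0 ≤ δ * (x ^ 12 * T ^ 2) := by positivity
  have h2 : 0 ≤ C / (4 * δ) * (x ^ 10 * P) := by
    have : C / (4 * δ) * (x ^ 10 * P) = C * P * x ^ 10 / (4 * δ) := by ring
    rw [this]; positivity
  refine abs_le_of_sq_le_sq ?_ (by positivity)
  have h3 : (T * a) ^ 2 ≤ T ^ 2 * (C * x ^ 22 * P) := by
    rw [mul_pow]; gcongr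
  have h4 : T ^ 2 * (C * x ^ 22 * P)
      = 4 * (δ * (x ^ 12 * T ^ 2)) * (C / (4 * δ) * (x ^ 10 * P)) := by
    field_simp
  rw [h4] at h3
  nlinarith [sq_nonneg (δ * (x ^ 12 * T ^ 2) - C / (4 * δ) * (x ^ 10 * P))]

lemma time_term_le {x T F e P b g C : ℝ} (hC : 0 ≤ C) (hP : 0 ≤ P) (hb : |b| ≤ C * x ^ 10)
    (hg : g ^ 2 ≤ C * x ^ 22 * P) :
    1 / 2 * (x ^ 12 * T ^ 2) ≤ x ^ 12 * T * (T - F - e) + T * g - 1 / 2 * b * P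
      + x ^ 12 * F * T + x ^ 12 * e ^ 2 + 3 / 2 * C * x ^ 10 * P := by
  have y1 := abs_mul_le_young (T := T) hg (δ := 1 / 4) (by norm_num) (by positivity)
  have y2 : b * P ≤ C * x ^ 10 * P := mul_le_mul_of_nonneg_right (abs_le.1 hb).2 hP
  have y3 := (abs_le.1 y1).1
  have y4 : 0 ≤ x ^ 12 * (1 / 2 * T - e) ^ 2 := by positivity
  norm_num at y3
  nlinarith only [y2, y3, y4]

lemma GG_le (hβ : ∀ i j, 0 ≤ β i j) (hr : 1 ≤ r) {U : ι → ℝ} (h : ∀ i, 0 < U i) {M : ℝ}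
    (hM : ∀ i, U i ≤ M) :
    GG β r U ≤ (∑ i, ∑ j, β i j) * M * ∑ i, U i ^ (2 * r + 1) := by
  rw [GG_of_pos h]
  have h0 : ∀ i, U i ^ (r + 1) * U i ^ (r + 1) ≤ M * ∑ i, U i ^ (2 * r + 1) := fun i => by
    have e : U i ^ (r + 1) * U i ^ (r + 1) = U i * U i ^ (2 * r + 1) := by
      rw [rpow_mul_rpow_aux (h i), ← Real.rpow_add (h i)]; congr 1; ring
    rw [e]
    have hp : ∀ j, 0 ≤ U j ^ (2 * r + 1) := fun j => Real.rpow_nonneg (h j).le _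
    exact mul_le_mul (hM i) (Finset.single_le_sum (f := fun i => U i ^ (2 * r + 1))
      (fun j _ => hp j) (Finset.mem_univ i)) (hp i) ((h i).le.trans (hM i))
  have h1 : ∑ i, ∑ j, β i j * (U i ^ (r + 1) * U j ^ (r + 1))
      ≤ (∑ i, ∑ j, β i j) * (M * ∑ i, U i ^ (2 * r + 1)) := by
    simp only [Finset.sum_mul]
    refine Finset.sum_le_sum fun i _ => Finset.sum_le_sum fun j _ => ?_
    refine mul_le_mul_of_nonneg_left ?_ (hβ i j)
    nlinarith [h0 i, h0 j, sq_nonneg (U i ^ (r + 1) - U j ^ (r + 1))]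
  have h2 : 0 ≤ ∑ i, ∑ j, β i j * (U i ^ (r + 1) * U j ^ (r + 1)) :=
    Finset.sum_nonneg fun i _ => Finset.sum_nonneg fun j _ => mul_nonneg (hβ i j)
      (mul_nonneg (Real.rpow_nonneg (h i).le _) (Real.rpow_nonneg (h j).le _))
  have h3 : (2 * (r + 1))⁻¹ ≤ 1 := inv_le_one_of_one_le₀ (by linarith)
  rw [mul_assoc]
  refine le_trans ?_ h1
  nlinarith

lemma GG_nonneg (hβ : ∀ i j, 0 ≤ β i j) (hr : 1 ≤ r) {U : ι → ℝ} (h : ∀ i, 0 < U i) :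
    0 ≤ GG β r U := by
  rw [GG_of_pos h]
  exact mul_nonneg (by positivity) (Finset.sum_nonneg fun i _ => Finset.sum_nonneg fun j _ =>
    mul_nonneg (hβ i j) (mul_nonneg (Real.rpow_nonneg (h i).le _) (Real.rpow_nonneg (h j).le _)))

lemma zi_potential (hr : 1 ≤ r) (hβs : ∀ i j, β i j = β j i) {w : ι → X n → ℝ}
    (hw : ∀ i, ContDiff ℝ ∞ (w i)) (h0 : ∀ i z, 0 < w i z) {φ : X n → ℝ}
    (hφ : ContDiff ℝ ∞ φ) (hc : HasCompactSupport φ) :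
    ZI fun z => dd et φ z * GG β r (fun j => w j z)
      + φ z * ∑ i, FF β r (fun j => w j z) i * dd et (w i) z :=
  ((HD.of_contDiff hφ).mul (hd_GG hr hβs hw h0 et)).zi hc.mul_right

lemma sum_mul_FF (hr : 1 ≤ r) (U : ι → ℝ) :
    ∑ i, U i * FF β r U i = 2 * (r + 1) * GG β r U := by
  have : 2 * (r + 1) ≠ 0 := by linarith
  rw [GG, mul_inv_cancel_left₀ this]

variable {ξ : X n → ℝ}

lemma energy_pointwise (hξ : Cut ξ) (hr : 1 ≤ r) :
    ∃ C, 0 ≤ C ∧ ∀ w : ι → X n → ℝ,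
    (∀ i, ContDiff ℝ ∞ (w i)) → (∀ i z, 0 < w i z) → ∃ Q, ZI Q ∧ ∀ z,
    ξ z ^ 10 * ∑ i, gp (w i) (w i) z ≤ Q z + 2 * (r + 1) * (ξ z ^ 10 * GG β r fun j => w j z)
      + C * (ξ z ^ 8 * ∑ i, w i z ^ 2) + ξ z ^ 8 * ee β r w z := by
  obtain ⟨C, hC, hb⟩ := hξ.bounds 8
  refine ⟨1 + C, by positivity, fun w hw h0 => ⟨_, ZI.sum (s := Finset.univ) fun i =>
    zi_energy (hξ.pow_contDiff 10) (hξ.pow_supp (by simp)) (hw i), fun z => ?_⟩⟩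
  obtain ⟨h1, h2, -⟩ := hb z
  have e1 : 2 * (r + 1) * (ξ z ^ 10 * GG β r fun j => w j z)
      = ∑ i, ξ z ^ 10 * (w i z * FF β r (fun j => w j z) i) := by
    rw [← Finset.mul_sum, sum_mul_FF hr]; ring
  rw [e1, ee]
  simp only [Finset.mul_sum, ← Finset.sum_add_distrib]
  refine Finset.sum_le_sum fun i _ => ?_
  have hh : heat (w i) z = FF β r (fun j => w j z) i + er β r w i z := by simp [er]
  rw [hh]
  have hx := hξ.nonneg z
  have hx1 : ξ z ^ 10 ≤ ξ z ^ 8 := hξ.pow_anti (by norm_num) z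
  set x := ξ z
  set F := FF β r (fun j => w j z) i
  set e := er β r w i z
  set a := dd et (fun z => ξ z ^ (8 + 2)) z with ha
  set l := lapl (fun z => ξ z ^ (8 + 2)) z with hl
  change _ ≤ _ - 1 / 2 * w i z ^ 2 * (a + l) + _ + _ + _
  set v := w i z
  have q1 : v ^ 2 * (a + l) ≤ v ^ 2 * (2 * C * x ^ 8) := by
    refine mul_le_mul_of_nonneg_left ?_ (sq_nonneg v)
    linarith [(abs_le.1 h1).2, (abs_le.1 h2).2]
  have q2 : x ^ 10 * (v ^ 2 + e ^ 2) ≤ x ^ 8 * (v ^ 2 + e ^ 2) :=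
    mul_le_mul_of_nonneg_right hx1 (by positivity)
  have q3 : 0 ≤ x ^ 10 * (v - e) ^ 2 := by positivity
  have q4 : 0 ≤ x ^ 10 * (v + e) ^ 2 := by positivity
  have q5 : 0 ≤ x ^ 8 * (v ^ 2 + e ^ 2) := by positivity
  nlinarith only [q1, q2, q3, q4, q5]

set_option maxHeartbeats 800000 in
lemma estimate_time (hξ : Cut ξ) (hr : 1 ≤ r) (hβ : ∀ i j, 0 ≤ β i j)
    (hβs : ∀ i j, β i j = β j i) (hd : ∀ i, 0 < β i i) :
    ∃ C, 0 ≤ C ∧ ∀ (M : ℝ) (w : ι → X n → ℝ), 1 ≤ M →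
    (∀ i, ContDiff ℝ ∞ (w i)) → (∀ i z, 0 < w i z) → (∀ i z, ξ z ≠ 0 → w i z ≤ M) →
    ∫ z, ξ z ^ 12 * ∑ i, dd et (w i) z ^ 2 ≤ C * M * ∫ z, ξ z ^ 4 * (1 + ee β r w z) := by
  obtain ⟨C, hC, hb⟩ := hξ.bounds 10
  obtain ⟨C', hC', he⟩ := energy_pointwise (ι := ι) (β := β) hξ hr
  choose A hA hA' using fun i => estimate_power hξ hr hβ (hd i)
  obtain ⟨m, hm'⟩ : ∃ m : ℝ, m = ∑ _i : ι, 1 := ⟨_, rfl⟩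
  have hm : 0 ≤ m := hm' ▸ by positivity
  set B := ∑ i, ∑ j, β i j with hB
  have hB0 : 0 ≤ B := Finset.sum_nonneg fun i _ => Finset.sum_nonneg fun j _ => hβ i j
  set S := ∑ i, A i
  have hS : 0 ≤ S := Finset.sum_nonneg fun i _ => hA i
  set k₁ := 2 * C + 6 * C * (r + 1) with hk₁
  have hk₁0 : 0 ≤ k₁ := by positivity
  set k₂ := k₁ * B + 3 * C * C' with hk₂
  have hk₂0 : 0 ≤ k₂ := by positivity
  set k₃ := 2 + 3 * C + 3 * C * C' * m with hk₃
  have hk₃0 : 0 ≤ k₃ := by positivity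
  refine ⟨k₂ * S + k₃, by positivity, fun M w hM hw h0 hwM => ?_⟩
  obtain ⟨Q', hQ', hq'⟩ := he w hw h0
  have hZ := (((ZI.sum (s := Finset.univ) fun i => zi_time (hξ.pow_contDiff 12)
    (hξ.pow_supp (by simp)) (hw i)).add (zi_potential hr hβs hw h0 (hξ.pow_contDiff 12)
    (hξ.pow_supp (by simp)))).const_mul 2).add (hQ'.const_mul (3 * C))
  have hcp : Continuous fun z => ∑ i, w i z ^ (2 * r + 1) :=
    continuous_finsetSum _ fun i _ => rpow_continuous hw h0 i _
  have hce : Continuous fun z => 1 + ee β r w z := continuous_const.add (ee_continuous hw h0)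
  have hi1 := hξ.integrable (k := 8) (by simp) hcp
  have hi2 := hξ.integrable (k := 4) (by simp) hce
  have hsum : ∫ z, ξ z ^ 8 * ∑ i, w i z ^ (2 * r + 1)
      ≤ S * ∫ z, ξ z ^ 4 * (1 + ee β r w z) := by
    simp only [Finset.mul_sum]
    rw [integral_finsetSum _ fun i _ => hξ.integrable (by simp) (rpow_continuous hw h0 i _),
      Finset.sum_mul]
    exact Finset.sum_le_sum fun i _ => hA' i w hw h0
  have hmain : ∫ z, ξ z ^ 12 * ∑ i, dd et (w i) z ^ 2
      ≤ ∫ z, (k₂ * M * (ξ z ^ 8 * ∑ i, w i z ^ (2 * r + 1))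
        + k₃ * M * (ξ z ^ 4 * (1 + ee β r w z))) := by
    refine hZ.integral_le (hξ.integrable (by simp) (continuous_finsetSum _ fun i _ =>
      (dd_contDiff (hw i)).continuous.pow 2)) ((hi1.const_mul _).add (hi2.const_mul _)) fun z => ?_
    obtain ⟨h1, -, h2⟩ := hb z
    have hx := hξ.nonneg z
    have x84 : ξ z ^ 8 ≤ ξ z ^ 4 := hξ.pow_anti (by norm_num) z
    have x12 : ξ z ^ 12 ≤ ξ z ^ 4 := hξ.pow_anti (by norm_num) z
    have x10 : ξ z ^ 10 ≤ ξ z ^ 8 := hξ.pow_anti (by norm_num) z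
    have hE : 0 ≤ ee β r w z := ee_nonneg w z
    have hG0 : 0 ≤ GG β r fun j => w j z := GG_nonneg hβ hr (h0 · z)
    have s1 : ∑ i, w i z ^ 2 ≤ m + ∑ i, w i z ^ (2 * r + 1) := by
      rw [hm', ← Finset.sum_add_distrib]
      exact Finset.sum_le_sum fun i _ => sq_le_one_add_rpow (h0 i z) (by linarith)
    have hY : 0 ≤ ∑ i, w i z ^ (2 * r + 1) :=
      Finset.sum_nonneg fun i _ => Real.rpow_nonneg (h0 i z).le _
    have s2 : ξ z ^ 10 * GG β r (fun j => w j z)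
        ≤ B * M * (ξ z ^ 8 * ∑ i, w i z ^ (2 * r + 1)) := by
      by_cases hz : ξ z = 0
      · simp [hz]
      · have h3 := GG_le hβ hr (h0 · z) (hwM · z hz)
        have h4 : 0 ≤ B * M * ∑ i, w i z ^ (2 * r + 1) := by positivity
        calc _ ≤ ξ z ^ 8 * (B * M * ∑ i, w i z ^ (2 * r + 1)) :=
              mul_le_mul x10 h3 hG0 (by positivity)
          _ = _ := by ring
    have s3 : 1 / 2 * (ξ z ^ 12 * ∑ i, dd et (w i) z ^ 2)
        ≤ ∑ i, (ξ z ^ 12 * dd et (w i) z * lapl (w i) z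
            + dd et (w i) z * gp (fun z => ξ z ^ 12) (w i) z
            - 1 / 2 * dd et (fun z => ξ z ^ 12) z * gp (w i) (w i) z)
          + ξ z ^ 12 * ∑ i, FF β r (fun j => w j z) i * dd et (w i) z
          + ξ z ^ 12 * ee β r w z + 3 / 2 * C * (ξ z ^ 10 * ∑ i, gp (w i) (w i) z) := by
      rw [ee]
      simp only [Finset.mul_sum, ← Finset.sum_add_distrib]
      refine Finset.sum_le_sum fun i _ => ?_
      have hP := gp_self_nonneg (w i) z
      have hh : lapl (w i) z = dd et (w i) z - FF β r (fun j => w j z) i - er β r w i z := by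
        simp only [er, heat, lapl]; ring
      rw [hh]
      have := time_term_le (T := dd et (w i) z) (F := FF β r (fun j => w j z) i)
        (e := er β r w i z) hC hP h1 (h2 (w i))
      simp only [mul_assoc] at this ⊢
      exact this
    have s4 : - (dd et (fun z => ξ z ^ 12) z * GG β r fun j => w j z)
        ≤ C * (ξ z ^ 10 * GG β r fun j => w j z) := by
      have := mul_le_mul_of_nonneg_right (abs_le.1 h1).1 hG0
      nlinarith only [this]
    have s5 := mul_le_mul_of_nonneg_left (hq' z) (by positivity : 0 ≤ 3 * C)
    have s6 := mul_le_mul_of_nonneg_left s2 hk₁0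
    have s7 : 3 * C * (C' * (ξ z ^ 8 * ∑ i, w i z ^ 2))
        ≤ 3 * C * C' * M * (ξ z ^ 8 * ∑ i, w i z ^ (2 * r + 1)) + 3 * C * C' * m * M * ξ z ^ 4 := by
      have t1 : ξ z ^ 8 * ∑ i, w i z ^ 2 ≤ ξ z ^ 8 * ∑ i, w i z ^ (2 * r + 1) + m * ξ z ^ 4 := by
        have := mul_le_mul_of_nonneg_left s1 (by positivity : 0 ≤ ξ z ^ 8)
        nlinarith only [this, x84, hm]
      have t2 : ξ z ^ 8 * ∑ i, w i z ^ (2 * r + 1) + m * ξ z ^ 4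
          ≤ M * (ξ z ^ 8 * ∑ i, w i z ^ (2 * r + 1) + m * ξ z ^ 4) :=
        le_mul_of_one_le_left (by positivity) hM
      have := mul_le_mul_of_nonneg_left (t1.trans t2) (by positivity : 0 ≤ 3 * C * C')
      nlinarith only [this]
    have s8 : (2 + 3 * C) * (ξ z ^ 4 * ee β r w z) ≤ (2 + 3 * C) * M * (ξ z ^ 4 * ee β r w z) := by
      have : ξ z ^ 4 * ee β r w z ≤ M * (ξ z ^ 4 * ee β r w z) :=
        le_mul_of_one_le_left (by positivity) hM
      have := mul_le_mul_of_nonneg_left this (by positivity : 0 ≤ 2 + 3 * C)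
      nlinarith only [this]
    have s9 : 2 * (ξ z ^ 12 * ee β r w z) ≤ 2 * (ξ z ^ 4 * ee β r w z) := by gcongr
    have s10 : 3 * C * (ξ z ^ 8 * ee β r w z) ≤ 3 * C * (ξ z ^ 4 * ee β r w z) := by gcongr
    have s11 : 0 ≤ 3 * C * C' * m * M * (ξ z ^ 4 * ee β r w z) := by positivity
    have s12 : 0 ≤ (2 + 3 * C) * M * ξ z ^ 4 := by positivity
    rw [hk₂, hk₃]
    rw [hk₁] at s6 ⊢
    linarith only [s3, s4, s5, s6, s7, s8, s9, s10, s11, s12]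
  rw [integral_add (hi1.const_mul _) (hi2.const_mul _), integral_const_mul,
    integral_const_mul] at hmain
  have := mul_le_mul_of_nonneg_left hsum (by positivity : 0 ≤ k₂ * M)
  linarith only [hmain, this]

end TimeDerivative

end

section

variable {n : ℕ} {ι : Type*} [Fintype ι]

/-! ### The Liouville theorem in space dimension at most two -/

lemma LU.setIntegral_tendsto {w : ℕ → ι → X n → ℝ} {V : ι → X n → ℝ}
    (h : ∀ i, LU atTop (fun k => w k i) (V i)) (hw : ∀ k i, Continuous (w k i))
    (hV : ∀ i, Continuous (V i)) {g : (ι → ℝ) → ℝ} (hg : Continuous g) {K : Set (X n)}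
    (hK : IsCompact K) :
    Tendsto (fun k => ∫ z in K, g fun i => w k i z) atTop (𝓝 (∫ z in K, g fun i => V i z)) := by
  obtain ⟨M, hM⟩ := hK.exists_bound_of_continuousOn (f := fun z i => V i z)
    (continuous_pi hV).continuousOn
  obtain ⟨B, hB⟩ := (isCompact_closedBall (0 : ι → ℝ) (|M| + 1)).exists_bound_of_continuousOn
    hg.continuousOn
  have h1 : ∀ᶠ k : ℕ in atTop, ∀ i, ∀ z ∈ K, |w k i z - V i z| ≤ 1 :=
    eventually_all.2 fun i => h i K hK 1 one_pos
  refine tendsto_integral_filter_of_dominated_convergence (fun _ => B)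
    (Eventually.of_forall fun k =>
      (hg.comp (continuous_pi (hw k))).aestronglyMeasurable) ?_
    (integrableOn_const hK.measure_lt_top.ne) (Eventually.of_forall fun z => ?_)
  · filter_upwards [h1] with k hk
    refine (ae_restrict_iff' hK.measurableSet).2 (Eventually.of_forall fun z hz => hB _ ?_)
    rw [mem_closedBall, dist_zero_right, pi_norm_le_iff_of_nonneg (by positivity)]
    intro i
    have h2 := (norm_le_pi_norm (fun i => V i z) i).trans (hM z hz)
    have h3 : ‖w k i z‖ ≤ ‖V i z‖ + ‖w k i z - V i z‖ := norm_le_insert' _ _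
    have h4 := hk i z hz
    rw [← Real.norm_eq_abs] at h4
    linarith [le_abs_self M]
  · exact (hg.tendsto _).comp (tendsto_pi_nhds.2 fun i => (h i).tendsto z)

namespace Ap

variable {β : ι → ι → ℝ} {r : ℝ} {V : ι → X n → ℝ} {w : ℕ → ι → X n → ℝ}

lemma eventually_error (h : Ap β r V w) {ξ : X n → ℝ} (hξ : Cut ξ) :
    ∀ᶠ k : ℕ in atTop, ∫ z, ξ z ^ 4 * (1 + ee β r (w k) z) ≤ ∫ z, ξ z ^ 4 * 2 := by
  obtain ⟨m, hm'⟩ : ∃ m : ℝ, m = ∑ _i : ι, 1 := ⟨_, rfl⟩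
  have hm : 0 ≤ m := hm' ▸ by positivity
  have h1 : ∀ᶠ k : ℕ in atTop, ∀ i, ∀ z ∈ tsupport ξ, |er β r (w k) i z - 0| ≤ 1 / (m + 1) :=
    eventually_all.2 fun i => h.err i _ hξ.supp _ (by positivity)
  filter_upwards [h1] with k hk
  refine integral_mono (hξ.integrable (by simp)
    (continuous_const.add (ee_continuous (h.smooth k) (h.pos k))))
    (hξ.integrable (by simp) continuous_const) fun z => ?_
  by_cases hz : ξ z = 0
  · simp [hz]
  · have h2 : ee β r (w k) z ≤ 1 := by
      have : ∀ i ∈ Finset.univ, er β r (w k) i z ^ 2 ≤ 1 / (m + 1) * 1 := fun i _ => by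
        have h3 := hk i z (subset_tsupport _ hz)
        rw [sub_zero] at h3
        have h4 : 1 / (m + 1) ≤ 1 := by rw [div_le_one (by positivity)]; linarith
        rw [← sq_abs]
        have := abs_nonneg (er β r (w k) i z)
        nlinarith
      refine (Finset.sum_le_sum this).trans ?_
      rw [← Finset.mul_sum, ← hm', div_mul_eq_mul_div, one_mul, div_le_one (by positivity)]
      linarith
    have : 0 ≤ ξ z ^ 4 := by positivity
    nlinarith

lemma setIntegral_le_cut {ξ : X n → ℝ} (hξ : Cut ξ) (h1 : ∀ z ∈ closedBall (0 : X n) 1, ξ z = 1)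
    {j : ℕ} (hj : j ≠ 0) {f : X n → ℝ} (hf : Continuous f) (h0 : ∀ z, 0 ≤ f z) :
    ∫ z in closedBall 0 1, f z ≤ ∫ z, ξ z ^ j * f z := by
  calc ∫ z in closedBall 0 1, f z = ∫ z in closedBall 0 1, ξ z ^ j * f z :=
        setIntegral_congr_fun measurableSet_closedBall fun z hz => by simp [h1 z hz]
    _ ≤ _ := setIntegral_le_integral (hξ.integrable hj hf)
        (Eventually.of_forall fun z => mul_nonneg (pow_nonneg (hξ.nonneg z) _) (h0 z))

variable (n) in
lemma exists_power_bound (hr : 1 ≤ r) (hβ : ∀ i j, 0 ≤ β i j) {i : ι} (hd : 0 < β i i) :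
    ∃ C, 0 ≤ C ∧ ∀ (V : ι → X n → ℝ) (w : ℕ → ι → X n → ℝ), (∀ i, Continuous (V i)) →
    Ap β r V w → ∫ z in closedBall 0 1, V i z ^ (2 * r + 1) ≤ C := by
  obtain ⟨ξ, hξ, h1⟩ := exists_cut n
  obtain ⟨C, hC, hp⟩ := estimate_power hξ hr hβ hd
  have hI : 0 ≤ ∫ z, ξ z ^ 4 * 2 := integral_nonneg fun z => by
    have : 0 ≤ ξ z ^ 4 := by positivity
    simp only [Pi.zero_apply]; linarith
  refine ⟨C * ∫ z, ξ z ^ 4 * 2, by positivity, fun V w hV h => ?_⟩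
  have hq : 0 < 2 * r + 1 := by linarith
  refine le_of_tendsto (LU.setIntegral_tendsto h.lim (fun k i => (h.smooth k i).continuous) hV
    (g := fun U => U i ^ (2 * r + 1))
    ((continuous_apply i).rpow_const fun _ => Or.inr hq.le) (isCompact_closedBall 0 1)) ?_
  filter_upwards [h.eventually_error hξ] with k hk
  exact (setIntegral_le_cut hξ h1 (j := 8) (by simp)
    (rpow_continuous (h.smooth k) (h.pos k) i _)
    fun z => Real.rpow_nonneg (h.pos k i z).le _).trans
    ((hp _ (h.smooth k) (h.pos k)).trans (by gcongr))

variable (n) in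
lemma exists_time_bound (hr : 1 ≤ r) (hβ : ∀ i j, 0 ≤ β i j) (hβs : ∀ i j, β i j = β j i)
    (hd : ∀ i, 0 < β i i) :
    ∃ C, 0 ≤ C ∧ ∀ (M : ℝ) (V : ι → X n → ℝ) (w : ℕ → ι → X n → ℝ), 1 ≤ M →
    (∀ i z, V i z ≤ M) → Ap β r V w → ∀ᶠ k : ℕ in atTop, ∀ i,
      ∫ z in closedBall 0 1, dd et (w k i) z ^ 2 ≤ C * M := by
  obtain ⟨ξ, hξ, h1⟩ := exists_cut n
  obtain ⟨C, hC, hp⟩ := estimate_time hξ hr hβ hβs hd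
  have hI : 0 ≤ ∫ z, ξ z ^ 4 * 2 := integral_nonneg fun z => by
    have : 0 ≤ ξ z ^ 4 := by positivity
    simp only [Pi.zero_apply]; linarith
  refine ⟨C * 2 * ∫ z, ξ z ^ 4 * 2, by positivity, fun M V w hM hV h => ?_⟩
  have h2 : ∀ᶠ k : ℕ in atTop, ∀ i, ∀ z ∈ tsupport ξ, |w k i z - V i z| ≤ 1 :=
    eventually_all.2 fun i => h.lim i _ hξ.supp 1 one_pos
  filter_upwards [h.eventually_error hξ, h2] with k hk hk2 i
  have hcont : ∀ i, Continuous (dd et (w k i)) := fun i => (dd_contDiff (h.smooth k i)).continuous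
  have h3 := hp (2 * M) (w k) (by linarith) (h.smooth k) (h.pos k) fun i z hz => by
    linarith [(abs_le.1 (hk2 i z (subset_tsupport _ hz))).2, hV i z]
  calc ∫ z in closedBall 0 1, dd et (w k i) z ^ 2
      ≤ ∫ z, ξ z ^ 12 * dd et (w k i) z ^ 2 :=
        setIntegral_le_cut hξ h1 (by simp) ((hcont i).pow 2) fun z => sq_nonneg _
    _ ≤ ∫ z, ξ z ^ 12 * ∑ i, dd et (w k i) z ^ 2 := by
        refine integral_mono (hξ.integrable (by simp) ((hcont i).pow 2))
          (hξ.integrable (by simp) (continuous_finsetSum _ fun i _ => (hcont i).pow 2)) fun z => ?_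
        exact mul_le_mul_of_nonneg_left (Finset.single_le_sum (f := fun i => dd et (w k i) z ^ 2)
          (fun i _ => sq_nonneg _) (Finset.mem_univ i)) (by have := hξ.nonneg z; positivity)
    _ ≤ C * (2 * M) * ∫ z, ξ z ^ 4 * 2 := h3.trans (by gcongr)
    _ = _ := by ring

end Ap

end

section

variable {n : ℕ} {ι : Type*} [Fintype ι]

lemma eq_zero_of_setIntegral_le {f : X n → ℝ} (hf : Continuous f) (h0 : ∀ z, 0 ≤ f z)
    (h : ∀ ρ, 0 < ρ → ∫ z in closedBall 0 ρ, f z ≤ 0) (z : X n) : f z = 0 := by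
  have hρ : 0 < ‖z‖ + 1 := by positivity
  have h1 : ∫ z in closedBall 0 (‖z‖ + 1), f z = 0 :=
    le_antisymm (h _ hρ) (integral_nonneg h0)
  rw [integral_eq_zero_iff_of_nonneg h0
    (hf.continuousOn.integrableOn_compact (isCompact_closedBall _ _))] at h1
  have h2 : f =ᵐ[volume.restrict (ball 0 (‖z‖ + 1))] 0 :=
    ae_restrict_of_ae_restrict_of_subset ball_subset_closedBall h1
  exact Measure.eqOn_open_of_ae_eq h2 isOpen_ball hf.continuousOn continuousOn_const
    (mem_ball_zero_iff.2 (by linarith))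

/-- If the weak time derivative vanishes, the function does not depend on time. -/
lemma time_invariant {u : X n → ℝ} (hu : Continuous u)
    (h : ∀ φ : X n → ℝ, ContDiff ℝ ∞ φ → HasCompactSupport φ → ∫ z, u z * dd et φ z = 0)
    (z : X n) (s : ℝ) : u (z + s • et) = u z := by
  have hm : ∀ j, ContDiff ℝ ∞ (moll u (ker j)) := fun j =>
    moll_contDiff hu.locallyIntegrable (ker_contDiff j) (ker_hasCompactSupport j)
  have h1 : ∀ j z, dd et (moll u (ker j)) z = 0 := fun j z => by
    rw [dd_moll hu.locallyIntegrable (ker_contDiff j) (ker_hasCompactSupport j)]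
    have h2 := h (fun y => ker j (z - y)) ((ker_contDiff j).comp (contDiff_const.sub contDiff_id))
      ((ker_hasCompactSupport j).comp_homeomorph (Homeomorph.subLeft z))
    rw [dd_sub_left ((ker_contDiff j).differentiable (by simp))] at h2
    simpa [moll, integral_neg] using h2
  have h2 : ∀ j, moll u (ker j) (z + s • et) = moll u (ker j) z := fun j => by
    have hd := fun s => dd_hasDerivAt' (v := et) (z := z) (s := s)
      ((hm j).differentiable (by simp) _)
    have := is_const_of_deriv_eq_zero (fun s => (hd s).differentiableAt)
      (fun s => by rw [(hd s).deriv, h1]) s 0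
    simpa using this
  exact tendsto_nhds_unique (moll_tendsto hu _)
    ((moll_tendsto hu z).congr fun j => (h2 j).symm)

namespace Ap

variable {β : ι → ι → ℝ} {r : ℝ} {V : ι → X n → ℝ} {w : ℕ → ι → X n → ℝ}

lemma eventually_time_small (h : Ap β r V w) (hn : n ≤ 1) (hr : 1 ≤ r) (hβ : ∀ i j, 0 ≤ β i j)
    (hβs : ∀ i j, β i j = β j i) (hd : ∀ i, 0 < β i i) {M : ℝ} (hV : ∀ i z, V i z ≤ M)
    {ρ ε : ℝ} (hρ : 0 < ρ) (hε : 0 < ε) :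
    ∀ᶠ k : ℕ in atTop, ∀ i, ∫ z in closedBall 0 ρ, dd et (w k i) z ^ 2 ≤ ε := by
  obtain ⟨C, hC, hb⟩ := exists_time_bound n hr hβ hβs hd
  obtain ⟨s, hs1, hsρ, hsε⟩ : ∃ s : ℝ, 1 ≤ s ∧ ρ ≤ s ∧ C * max M 1 / ε ≤ s :=
    ⟨max (max 1 ρ) (C * max M 1 / ε), (le_max_left _ _).trans (le_max_left _ _),
      (le_max_right _ _).trans (le_max_left _ _), le_max_right _ _⟩
  have hs0 : 0 < s := by linarith
  set R := s ^ r with hR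
  have hsR : s ≤ R := by
    simpa using Real.rpow_le_rpow_of_exponent_le hs1 hr
  have hR1 : 1 ≤ R := hs1.trans hsR
  have hR0 : 0 < R := by linarith
  have hRs : R ^ (1 / r) = s := by
    rw [hR, ← Real.rpow_mul hs0.le, mul_one_div_cancel (by positivity), Real.rpow_one]
  have hM1 : 1 ≤ max M 1 := le_max_right _ _
  have h1 := hb (s * max M 1) _ _ (by nlinarith) (fun i z => ?_) (h.scale hr hR0)
  · filter_upwards [h1] with k hk i
    have hcont : Continuous (dd et (w k i)) := (dd_contDiff (h.smooth k i)).continuous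
    have h2 := hk i
    have h3 : ∀ z, dd et (fun z => R ^ (1 / r) * w k i (scl n R (R ^ 2) z)) z ^ 2
        = s ^ 2 * R ^ 4 * dd et (w k i) (scl n R (R ^ 2) z) ^ 2 := fun z => by
      rw [dd_const_mul, dd_et_scl ((h.smooth k i).differentiable (by simp)), hRs]; ring
    simp only [h3] at h2
    rw [integral_const_mul] at h2
    have h4 := setIntegral_ball_le_scl hρ (hsρ.trans hsR) (T := R ^ 2) (by nlinarith)
      (g := fun z => dd et (w k i) z ^ 2) (hcont.pow 2) fun z => sq_nonneg _
    set I := ∫ z in closedBall 0 1, dd et (w k i) (scl n R (R ^ 2) z) ^ 2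
    have hI : 0 ≤ I := integral_nonneg fun z => sq_nonneg _
    have h5 : R ^ (n + 1) * R ^ 2 ≤ R ^ 4 := by
      rw [← pow_add]; exact pow_le_pow_right₀ hR1 (by omega)
    have h6 : s * (R ^ 4 * I) ≤ s * ε := by
      rw [div_le_iff₀ hε] at hsε
      have : s * (s * (R ^ 4 * I)) ≤ s * (s * ε) := by nlinarith
      exact le_of_mul_le_mul_left this hs0
    exact h4.trans ((mul_le_mul_of_nonneg_right h5 hI).trans (le_of_mul_le_mul_left h6 hs0))
  · simp only [hRs]
    exact mul_le_mul_of_nonneg_left ((hV i _).trans (le_max_left _ _)) hs0.le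

lemma time_invariant (h : Ap β r V w) (hn : n ≤ 1) (hr : 1 ≤ r) (hβ : ∀ i j, 0 ≤ β i j)
    (hβs : ∀ i j, β i j = β j i) (hd : ∀ i, 0 < β i i) (hVc : ∀ i, Continuous (V i)) {M : ℝ}
    (hV : ∀ i z, V i z ≤ M) (i : ι) (z : X n) (s : ℝ) : V i (z + s • et) = V i z := by
  refine Liouville.time_invariant (hVc i) (fun φ hφ hc => ?_) z s
  obtain ⟨ρ, hρ, hsub⟩ : ∃ ρ, 0 < ρ ∧ tsupport φ ⊆ closedBall 0 ρ := by
    obtain ⟨ρ, hρ⟩ := hc.isBounded.subset_closedBall 0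
    exact ⟨max ρ 1, by positivity, hρ.trans (closedBall_subset_closedBall (le_max_left _ _))⟩
  have hlim := LU.integral_tendsto (h.lim i)
    (fun k => (h.smooth k i).continuous.locallyIntegrable) (hVc i).locallyIntegrable
    (dd_contDiff hφ (v := et)).continuous (dd_hasCompactSupport hc)
  set J := ∫ z, φ z ^ 2 with hJ
  have key : ∀ δ : ℝ, 0 < δ → |∫ z, V i z * dd et φ z| ≤ δ * (J + 1) := fun δ hδ => by
    refine le_of_tendsto hlim.abs ?_
    filter_upwards [h.eventually_time_small hn hr hβ hβs hd hV hρ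
      (ε := 4 * δ ^ 2) (by positivity)] with k hk
    have hT : Continuous (dd et (w k i)) := (dd_contDiff (h.smooth k i)).continuous
    have hint : Integrable fun z => φ z * dd et (w k i) z :=
      (hφ.continuous.mul hT).integrable_of_hasCompactSupport hc.mul_right
    have hint2 : Integrable fun z => w k i z * dd et φ z :=
      ((h.smooth k i).continuous.mul
        (dd_contDiff hφ).continuous).integrable_of_hasCompactSupport (dd_hasCompactSupport hc).mul_left
    have e1 : ∫ z, w k i z * dd et φ z = - ∫ z, φ z * dd et (w k i) z := by
      have := integral_dd_eq_zero (μ := volume) (v := et) (f := fun z => φ z * w k i z)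
        ((hφ.mul (h.smooth k i)).of_le one_le_infty) hc.mul_right
      simp only [dd_mul (hφ.differentiable (by simp) _)
        ((h.smooth k i).differentiable (by simp) _)] at this
      rw [integral_add (hint2.congr (Eventually.of_forall fun z => mul_comm _ _)) hint] at this
      simp only [mul_comm (dd et φ _)] at this
      linarith
    rw [e1, abs_neg]
    have hφ2 : Integrable fun z => φ z ^ 2 :=
      (hφ.continuous.pow 2).integrable_of_hasCompactSupport
        (hc.mono fun z hz hz' => hz (by simp [hz']))
    have hball : IntegrableOn (fun z => dd et (w k i) z ^ 2) (closedBall 0 ρ) :=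
      (hT.pow 2).continuousOn.integrableOn_compact (isCompact_closedBall _ _)
    calc |∫ z, φ z * dd et (w k i) z| = |∫ z in closedBall 0 ρ, φ z * dd et (w k i) z| := by
          rw [setIntegral_eq_integral_of_forall_compl_eq_zero]
          intro z hz
          rw [image_eq_zero_of_notMem_tsupport fun h => hz (hsub h), zero_mul]
      _ ≤ ∫ z in closedBall 0 ρ, |φ z * dd et (w k i) z| := abs_integral_le_integral_abs
      _ ≤ ∫ z in closedBall 0 ρ, (δ * φ z ^ 2 + 1 / (4 * δ) * dd et (w k i) z ^ 2) := by
          refine integral_mono hint.abs.integrableOn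
            ((hφ2.integrableOn.const_mul _).add (hball.const_mul _)) fun z => ?_
          simp only
          rw [abs_mul]
          have h1 : 0 ≤ (2 * δ * |φ z| - |dd et (w k i) z|) ^ 2 / (4 * δ) := by positivity
          have h2 : (2 * δ * |φ z| - |dd et (w k i) z|) ^ 2 / (4 * δ)
            = δ * φ z ^ 2 + 1 / (4 * δ) * dd et (w k i) z ^ 2 - |φ z| * |dd et (w k i) z| := by
            rw [← sq_abs (φ z), ← sq_abs (dd et (w k i) z)]; field_simp; ring
          linarith
      _ = δ * (∫ z in closedBall 0 ρ, φ z ^ 2)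
          + 1 / (4 * δ) * ∫ z in closedBall 0 ρ, dd et (w k i) z ^ 2 := by
          rw [integral_add (hφ2.integrableOn.const_mul _) (hball.const_mul _),
            integral_const_mul, integral_const_mul]
      _ ≤ δ * J + 1 / (4 * δ) * (4 * δ ^ 2) := by
          have h1 : ∫ z in closedBall 0 ρ, φ z ^ 2 ≤ J :=
            setIntegral_le_integral hφ2 (Eventually.of_forall fun z => sq_nonneg _)
          have h2 := hk i
          gcongr
      _ = _ := by field_simp
  have hJ0 : 0 ≤ J := integral_nonneg fun z => sq_nonneg _
  by_contra hne
  have hpos := abs_pos.2 hne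
  have := key (|∫ z, V i z * dd et φ z| / (2 * (J + 1))) (by positivity)
  rw [div_mul_eq_mul_div, le_div_iff₀ (by positivity)] at this
  nlinarith

/-- The Liouville theorem in space dimension at most two. -/
theorem eq_zero_of_le_one (h : Ap β r V w) (hn : n ≤ 1) (hr : 1 ≤ r) (hβ : ∀ i j, 0 ≤ β i j)
    (hβs : ∀ i j, β i j = β j i) (hd : ∀ i, 0 < β i i) (hVc : ∀ i, Continuous (V i)) {M : ℝ}
    (hV : ∀ i z, V i z ≤ M) (i : ι) (z : X n) : V i z = 0 := by
  obtain ⟨C, hC, hb⟩ := exists_power_bound n hr hβ (hd i)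
  have hinv := h.time_invariant hn hr hβ hβs hd hVc hV i
  have hp : 0 < 2 * r + 1 := by linarith
  have hc : Continuous fun z => V i z ^ (2 * r + 1) :=
    (hVc i).rpow_const fun _ => Or.inr hp.le
  have key : ∀ ρ, 0 < ρ → ∫ z in closedBall 0 ρ, V i z ^ (2 * r + 1) ≤ 0 := fun ρ hρ => by
    have hs : ∀ s : ℝ, 1 ≤ s → ρ ≤ s →
        s * ∫ z in closedBall 0 ρ, V i z ^ (2 * r + 1) ≤ ρ * C := fun s hs1 hsρ => by
      have hs0 : 0 < s := by linarith
      set R := s ^ r with hR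
      have hsR : s ≤ R := by
        simpa using Real.rpow_le_rpow_of_exponent_le hs1 hr
      have hR1 : 1 ≤ R := hs1.trans hsR
      have hR0 : 0 < R := by linarith
      have hRs : R ^ (1 / r) = s := by
        rw [hR, ← Real.rpow_mul hs0.le, mul_one_div_cancel (by positivity), Real.rpow_one]
      have h1 : ∫ z in closedBall 0 1, (R ^ (1 / r) * V i (scl n R (R ^ 2) z)) ^ (2 * r + 1) ≤ C :=
        hb _ _ (fun i => continuous_const.mul
          ((hVc i).comp (scl n R (R ^ 2)).continuous)) (h.scale hr hR0)
      have h2 : ∀ z, (R ^ (1 / r) * V i (scl n R (R ^ 2) z)) ^ (2 * r + 1)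
          = R ^ 2 * s * V i (scl n R ρ z) ^ (2 * r + 1) := fun z => by
        have e1 : scl n R (R ^ 2) z = scl n R ρ z + ((R ^ 2 - ρ) * z.2) • et := by
          ext <;> simp [et]; ring
        rw [hRs, Real.mul_rpow hs0.le (h.nonneg i _), e1, hinv, Real.rpow_add hs0, Real.rpow_one,
          mul_comm 2 r, Real.rpow_mul hs0.le, ← hR, Real.rpow_two]
      simp only [h2] at h1
      rw [integral_const_mul] at h1
      have h3 := setIntegral_ball_le_scl hρ (hsρ.trans hsR) (T := ρ) le_rfl hc
        fun z => Real.rpow_nonneg (h.nonneg i z) _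
      set I := ∫ z in closedBall 0 1, V i (scl n R ρ z) ^ (2 * r + 1)
      have hI : 0 ≤ I := integral_nonneg fun z => Real.rpow_nonneg (h.nonneg i _) _
      have h5 : R ^ (n + 1) ≤ R ^ 2 := pow_le_pow_right₀ hR1 (by omega)
      calc _ ≤ s * (R ^ (n + 1) * ρ * I) := by gcongr
        _ ≤ s * (R ^ 2 * ρ * I) := by gcongr
        _ = ρ * (R ^ 2 * s * I) := by ring
        _ ≤ ρ * C := by gcongr
    by_contra! hpos
    set J := ∫ z in closedBall 0 ρ, V i z ^ (2 * r + 1)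
    have := hs (max (max 1 ρ) (ρ * C / J + 1)) ((le_max_left _ _).trans (le_max_left _ _))
      ((le_max_right _ _).trans (le_max_left _ _))
    have h2 : (ρ * C / J + 1) * J ≤ ρ * C := (by gcongr; exact le_max_right _ _ :
      (ρ * C / J + 1) * J ≤ max (max 1 ρ) (ρ * C / J + 1) * J).trans this
    rw [add_mul, div_mul_cancel₀ _ hpos.ne'] at h2
    linarith
  have := eq_zero_of_setIntegral_le hc (fun z => Real.rpow_nonneg (h.nonneg i z) _) key z
  exact (Real.rpow_eq_zero (h.nonneg i z) hp.ne').1 this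

end Ap

end

section

variable {n : ℕ} {ι : Type*} [Fintype ι]

/-! ### The Liouville theorem in space dimension three -/

lemma half_sq_absorb {c : ℝ} (hc : 0 < c) (b F X : ℝ) :
    - (b ^ 2 / (2 * c) * X ^ 2) ≤ c / 2 * F ^ 2 + b * (F * X) := by
  have h : 0 ≤ c / 2 * (F + b / c * X) ^ 2 := by positivity
  have e : c / 2 * (F + b / c * X) ^ 2 = c / 2 * F ^ 2 + b * (F * X) + b ^ 2 / (2 * c) * X ^ 2 := by
    field_simp
    ring
  linarith

/-- The interior quadratic form of the weighted Bochner inequality is positive. -/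
lemma bv_quadratic {κ θ p : ℝ} (hα : 0 < κ - 2 / 3 * κ ^ 2) (hθ : 0 < θ)
    (hp : (2 / 3 + θ) * p = 5 / 3 * κ) : ∃ Λ c K, 0 ≤ Λ ∧ 0 < c ∧ 0 ≤ K ∧
    ∀ T F e y H h : ℝ, (T - F - e - κ * y) ^ 2 / 3 ≤ H - 2 * κ * h + κ ^ 2 * y ^ 2 →
    c * (F ^ 2 + y ^ 2 + T ^ 2) - K * e ^ 2 ≤
      H - (T - F - e) ^ 2 - κ * (- y ^ 2 + 2 * h + y * (T - F - e))
      - (2 / 3 + θ) * (p * (y * F) + F * (T - F - e)) + Λ * (T * (T - F - e) + F * T) := by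
  set α := κ - 2 / 3 * κ ^ 2 with hα'
  obtain ⟨K, hK⟩ : ∃ K, K = 2 / 3 + (2 / 3 - θ) ^ 2 / (2 * θ) + (- (5 / 3 * κ)) ^ 2 / (2 * α) :=
    ⟨_, rfl⟩
  have hK0 : 0 ≤ K := by rw [hK]; positivity
  obtain ⟨c, hc0, hc1, hc2, hc3⟩ : ∃ c : ℝ, 0 < c ∧ c ≤ θ / 2 ∧ c ≤ α / 2 ∧ c ≤ 1 :=
    ⟨min (min (θ / 2) (α / 2)) 1, by positivity, (min_le_left _ _).trans (min_le_left _ _),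
      (min_le_left _ _).trans (min_le_right _ _), min_le_right _ _⟩
  refine ⟨4 * K + 2, c, 4 * K + 1, by positivity, hc0, by positivity, fun T F e y H h hH => ?_⟩
  have h1 := half_sq_absorb hθ (2 / 3 - θ) F (T - e)
  have h2 := half_sq_absorb hα (- (5 / 3 * κ)) y (T - e)
  have h3 : K * (T - e) ^ 2 ≤ K * (2 * T ^ 2 + 2 * e ^ 2) :=
    mul_le_mul_of_nonneg_left (by nlinarith only [sq_nonneg (T + e)]) hK0
  have h4 : 0 ≤ (2 * K + 1) * (T - e) ^ 2 := by positivity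
  have h5 : K * (T - e) ^ 2 = 2 / 3 * (T - e) ^ 2 + (2 / 3 - θ) ^ 2 / (2 * θ) * (T - e) ^ 2
      + (- (5 / 3 * κ)) ^ 2 / (2 * α) * (T - e) ^ 2 := by rw [hK]; ring
  have h6 : (2 / 3 + θ) * (p * (y * F)) = 5 / 3 * κ * (y * F) := by rw [← hp]; ring
  have h7 : α * y ^ 2 = κ * y ^ 2 - 2 / 3 * κ ^ 2 * y ^ 2 := by rw [hα']; ring
  have h8 := mul_le_mul_of_nonneg_right hc1 (sq_nonneg F)
  have h9 := mul_le_mul_of_nonneg_right hc2 (sq_nonneg y)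
  have h10 := mul_le_mul_of_nonneg_right hc3 (sq_nonneg T)
  generalize (2 / 3 - θ) ^ 2 / (2 * θ) = k₁ at *
  generalize (- (5 / 3 * κ)) ^ 2 / (2 * α) = k₂ at *
  generalize α = α at *
  linarith only [hH, h1, h2, h3, h4, h5, h6, h7, h8, h9, h10]

lemma young_coeff {x X a C P c B k : ℝ} (ha : a ^ 2 ≤ C * x ^ 22 * P) (hCP : 0 ≤ C * P)
    (hc : 0 < c) (hB : 0 < B) (hk : |k| ≤ B) :
    |k * (X * a)| ≤ c / 8 * (x ^ 12 * X ^ 2) + 2 * B ^ 2 * C / c * (x ^ 10 * P) := by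
  have h := abs_mul_le_young (T := X) ha (δ := c / (8 * B)) (by positivity) hCP
  rw [abs_mul]
  have h2 := mul_le_mul hk h (abs_nonneg _) hB.le
  refine h2.trans (le_of_eq ?_)
  field_simp
  ring

lemma bv_cutoff {κ θ Λ c : ℝ} (hΛ : 0 ≤ Λ) (hθ : 0 < θ) (hκ : 0 ≤ κ) (hc : 0 < c) {b C : ℝ}
    (hb : 0 < b) (hC : 0 ≤ C) : ∃ K, 0 ≤ K ∧ ∀ x T F e y w a τ L q : ℝ, 0 ≤ x → x ≤ 1 → 0 ≤ F →
    0 ≤ y → 0 ≤ w → a ^ 2 ≤ C * x ^ 22 * (y * w) → |τ| ≤ C * x ^ 10 → |L| ≤ C * x ^ 10 →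
    b * q ≤ F → w ^ 2 ≤ 1 + q →
    - (c / 2 * (x ^ 12 * (F ^ 2 + y ^ 2 + T ^ 2)) + K * (x ^ 4 * (1 + e ^ 2))) ≤
      - ((T - F - e) * a) - 1 / 2 * (y * w) * L - κ * (y * a) - (2 / 3 + θ) * (F * a)
      + Λ * (T * a - 1 / 2 * τ * (y * w)) - Λ * (C * x ^ 10 * (w * F)) := by
  obtain ⟨B, hB⟩ : ∃ B, B = Λ + 2 + θ + κ := ⟨_, rfl⟩
  have hB0 : 0 < B := by rw [hB]; positivity
  obtain ⟨K₁, hK₁⟩ : ∃ K, K = 4 * (2 * B ^ 2 * C / c) + C / 2 + Λ * C / 2 := ⟨_, rfl⟩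
  have hK₁0 : 0 ≤ K₁ := by rw [hK₁]; positivity
  obtain ⟨K₂, hK₂⟩ : ∃ K, K = 2 * K₁ ^ 2 / c + 2 * (Λ * C) ^ 2 / c := ⟨_, rfl⟩
  have hK₂0 : 0 ≤ K₂ := by rw [hK₂]; positivity
  have y2 : ∀ k s t : ℝ, k * (s * t) ≤ c / 8 * s ^ 2 + 2 * k ^ 2 / c * t ^ 2 := fun k s t => by
    have h : 0 ≤ c / 8 * (s - 4 * k / c * t) ^ 2 := by positivity
    have e : c / 8 * (s - 4 * k / c * t) ^ 2
        = c / 8 * s ^ 2 + 2 * k ^ 2 / c * t ^ 2 - k * (s * t) := by field_simp; ring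
    linarith
  refine ⟨c + K₂ + 2 * (K₂ / b) ^ 2 / c, by positivity,
    fun x T F e y w a τ L q hx hx1 hF hy hw ha hτ hL hq hwq => ?_⟩
  have hCP : 0 ≤ C * (y * w) := by positivity
  have a1 := young_coeff (X := T) (k := Λ - 1) ha hCP hc hB0 (abs_le.2 ⟨by linarith, by linarith⟩)
  have a2 := young_coeff (X := e) (k := 1) ha hCP hc hB0 (abs_le.2 ⟨by linarith, by linarith⟩)
  have a3 := young_coeff (X := F) (k := 1 / 3 - θ) ha hCP hc hB0
    (abs_le.2 ⟨by linarith, by linarith⟩)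
  have a4 := young_coeff (X := y) (k := - κ) ha hCP hc hB0 (abs_le.2 ⟨by linarith, by linarith⟩)
  have a1' := (abs_le.1 a1).1
  have a2' := (abs_le.1 a2).1
  have a3' := (abs_le.1 a3).1
  have a4' := (abs_le.1 a4).1
  have hyw : 0 ≤ y * w := by positivity
  have l1 := mul_le_mul_of_nonneg_right (abs_le.1 hL).2 hyw
  have l2 := mul_le_mul_of_nonneg_left (mul_le_mul_of_nonneg_right (abs_le.1 hτ).2 hyw) hΛ
  have p1 : K₁ * (x ^ 10 * (y * w)) ≤ c / 8 * (x ^ 12 * y ^ 2) + 2 * K₁ ^ 2 / c * (x ^ 8 * w ^ 2) := by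
    have := y2 K₁ (x ^ 6 * y) (x ^ 4 * w)
    calc _ = K₁ * (x ^ 6 * y * (x ^ 4 * w)) := by ring
      _ ≤ _ := this
      _ = _ := by ring
  have p2 : Λ * C * (x ^ 10 * (w * F))
      ≤ c / 8 * (x ^ 12 * F ^ 2) + 2 * (Λ * C) ^ 2 / c * (x ^ 8 * w ^ 2) := by
    have := y2 (Λ * C) (x ^ 6 * F) (x ^ 4 * w)
    calc _ = Λ * C * (x ^ 6 * F * (x ^ 4 * w)) := by ring
      _ ≤ _ := this
      _ = _ := by ring
  have p3 : K₂ / b * (x ^ 8 * F) ≤ c / 8 * (x ^ 12 * F ^ 2) + 2 * (K₂ / b) ^ 2 / c * x ^ 4 := by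
    have := y2 (K₂ / b) (x ^ 6 * F) (x ^ 2)
    calc _ = K₂ / b * (x ^ 6 * F * x ^ 2) := by ring
      _ ≤ _ := this
      _ = _ := by ring
  have x84 : x ^ 8 ≤ x ^ 4 := pow_le_pow_of_le_one hx hx1 (by norm_num)
  have x124 : x ^ 12 ≤ x ^ 4 := pow_le_pow_of_le_one hx hx1 (by norm_num)
  have p4 : K₂ * (x ^ 8 * w ^ 2) ≤ K₂ * x ^ 4 + K₂ / b * (x ^ 8 * F) := by
    have h1 : K₂ * (x ^ 8 * w ^ 2) ≤ K₂ * (x ^ 8 * (1 + q)) := by gcongr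
    have h2 : K₂ / b * (x ^ 8 * (b * q)) ≤ K₂ / b * (x ^ 8 * F) := by gcongr
    have h3 : K₂ / b * (x ^ 8 * (b * q)) = K₂ * (x ^ 8 * q) := by field_simp
    have h4 := mul_le_mul_of_nonneg_left x84 hK₂0
    linear_combination h1 + h2 + h4 - h3
  have p5 : K₂ * (x ^ 8 * w ^ 2) = 2 * K₁ ^ 2 / c * (x ^ 8 * w ^ 2)
      + 2 * (Λ * C) ^ 2 / c * (x ^ 8 * w ^ 2) := by rw [hK₂]; ring
  have p6 : K₁ * (x ^ 10 * (y * w)) = 4 * (2 * B ^ 2 * C / c * (x ^ 10 * (y * w)))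
      + C / 2 * (x ^ 10 * (y * w)) + Λ * C / 2 * (x ^ 10 * (y * w)) := by rw [hK₁]; ring
  have e1 : c * (x ^ 12 * e ^ 2) ≤ c * (x ^ 4 * e ^ 2) := by gcongr
  have e2 : 0 ≤ (K₂ + 2 * (K₂ / b) ^ 2 / c) * (x ^ 4 * e ^ 2) := by positivity
  have e3 : 0 ≤ c * x ^ 4 := by positivity
  have f1 : 0 ≤ c * (x ^ 12 * F ^ 2) := by positivity
  have f2 : 0 ≤ c * (x ^ 12 * y ^ 2) := by positivity
  have f3 : 0 ≤ c * (x ^ 12 * T ^ 2) := by positivity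
  have f4 : 0 ≤ c * (x ^ 12 * e ^ 2) := by positivity
  linarith only [a1', a2', a3', a4', l1, l2, p1, p2, p3, p4, p5, p6, e1, e2, e3, f1, f2, f3, f4]

end

section

variable {ι : Type*} [Fintype ι]

lemma bochner_trace_le (f : X 2 → ℝ) (z : X 2) (κ k : ℝ) :
    (lapl f z - κ * (k * gp f f z)) ^ 2 / 3
      ≤ hs f z - 2 * κ * (k * hv f z) + κ ^ 2 * (k * gp f f z) ^ 2 := by
  have h : ∀ a b c A B C d d' e e' g g' : ℝ,
      (A + B + C - κ * (k * (a * a + b * b + c * c))) ^ 2 / 3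
      ≤ (A ^ 2 + d ^ 2 + e ^ 2 + (d' ^ 2 + B ^ 2 + g ^ 2) + (e' ^ 2 + g' ^ 2 + C ^ 2))
        - 2 * κ * (k * (a * a * A + a * b * d + a * c * e + (b * a * d' + b * b * B + b * c * g)
          + (c * a * e' + c * b * g' + c * c * C)))
        + κ ^ 2 * (k * (a * a + b * b + c * c)) ^ 2 := by
    intro a b c A B C d d' e e' g g'
    have h1 := sq_nonneg ((A - κ * k * (a * a)) - (B - κ * k * (b * b)))
    have h2 := sq_nonneg ((A - κ * k * (a * a)) - (C - κ * k * (c * c)))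
    have h3 := sq_nonneg ((B - κ * k * (b * b)) - (C - κ * k * (c * c)))
    have h4 := sq_nonneg (d - κ * k * (a * b))
    have h5 := sq_nonneg (d' - κ * k * (a * b))
    have h6 := sq_nonneg (e - κ * k * (a * c))
    have h7 := sq_nonneg (e' - κ * k * (a * c))
    have h8 := sq_nonneg (g - κ * k * (b * c))
    have h9 := sq_nonneg (g' - κ * k * (b * c))
    linarith only [h1, h2, h3, h4, h5, h6, h7, h8, h9]
  have e3 : ∀ f : Fin (2 + 1) → ℝ, ∑ l, f l = f 0 + f 1 + f 2 := fun f => Fin.sum_univ_three f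
  simp only [lapl, gp, hs, hv, e3]
  exact h _ _ _ _ _ _ _ _ _ _ _ _

section Estimate

variable {β : ι → ι → ℝ} {r : ℝ} {ξ : X 2 → ℝ}

set_option maxHeartbeats 800000 in
lemma estimate_bv (hξ : Cut ξ) (hr : 1 ≤ r) (hβ : ∀ i j, 0 ≤ β i j) (hr2 : 2 * r + 1 < 15 / 4)
    (hβs : ∀ i j, β i j = β j i) (hd : ∀ i, 0 < β i i) :
    ∃ C, 0 ≤ C ∧ ∀ w : ι → X 2 → ℝ, (∀ i, ContDiff ℝ ∞ (w i)) → (∀ i z, 0 < w i z) →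
    ∫ z, ξ z ^ 12 * ∑ i, FF β r (fun j => w j z) i ^ 2
      ≤ C * ∫ z, ξ z ^ 4 * (1 + ee β r w z) := by
  obtain ⟨p, hp⟩ : ∃ p, p = 2 * r + 1 := ⟨_, rfl⟩
  obtain ⟨κ, hκ⟩ : ∃ κ, κ = (2 / 5 * p + 3 / 2) / 2 := ⟨_, rfl⟩
  obtain ⟨θ, hθ'⟩ : ∃ θ, θ = (5 * κ - 2 * p) / (3 * p) := ⟨_, rfl⟩
  have hp0 : 0 < p := by linarith
  have hκ0 : 0 < κ := by linarith
  have hκ1 : κ < 3 / 2 := by linarith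
  have hθ : 0 < θ := by rw [hθ']; exact div_pos (by linarith) (by linarith)
  have hθp : (2 / 3 + θ) * p = 5 / 3 * κ := by rw [hθ']; field_simp; ring
  obtain ⟨Λ, c, K₀, hΛ, hc, hK₀, hquad⟩ := bv_quadratic (by nlinarith) hθ hθp
  obtain ⟨C, hC, hb⟩ := hξ.bounds 10
  choose K hK hcut using fun i => bv_cutoff (C := C) hΛ hθ hκ0.le hc (hd i) hC
  obtain ⟨S, hS⟩ : ∃ S, S = ∑ i, (K i + K₀) := ⟨_, rfl⟩
  have hS0 : 0 ≤ S := hS ▸ Finset.sum_nonneg fun i _ => add_nonneg (hK i) hK₀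
  refine ⟨2 / c * S, by positivity, fun w hw h0 => ?_⟩
  have hφ := hξ.pow_contDiff 12
  have hφc := hξ.pow_supp (k := 12) (by simp)
  have hZ := ((ZI.sum (s := Finset.univ) fun i => (((zi_bochner hφ hφc (hw i)).sub
    ((zi_div_inv hφ hφc (hw i) (h0 i)).const_mul κ)).sub
    ((zi_div hφ hφc (hw i) (hd_FF (β := β) (r := r) hw h0 0 i).smooth).const_mul (2 / 3 + θ))).add
    ((zi_time hφ hφc (hw i)).const_mul Λ)).add
    ((zi_potential hr hβs hw h0 hφ hφc).const_mul Λ)).const_mul (2 / c)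
  rw [mul_assoc, ← integral_const_mul, ← integral_const_mul]
  have hFc : ∀ i, Continuous fun z => FF β r (fun j => w j z) i := fun i =>
    (hd_FF hw h0 0 i).smooth.continuous
  have hi2 := hξ.integrable (k := 4) (by simp)
    (continuous_const.add (ee_continuous (β := β) (r := r) hw h0) : Continuous fun z =>
      1 + ee β r w z)
  refine hZ.integral_le (hξ.integrable (by simp) (continuous_finsetSum _ fun i _ =>
    (hFc i).pow 2)) ((hi2.const_mul S).const_mul (2 / c)) fun z => ?_
  obtain ⟨h1, h2, h3⟩ := hb z
  have hx := hξ.nonneg z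
  have hF0 : ∀ i, 0 ≤ FF β r (fun j => w j z) i := fun i => FF_nonneg hβ _ i
  have hcomp : ∀ i, c / 2 * (ξ z ^ 12 * FF β r (fun j => w j z) i ^ 2)
      + (2 / 3 + θ) * ξ z ^ 12 * (p * ((w i z)⁻¹ * gp (w i) (w i) z * FF β r (fun j => w j z) i)
        - gp (fun z => FF β r (fun j => w j z) i) (w i) z)
      + Λ * (C * ξ z ^ 10 * (w i z * FF β r (fun j => w j z) i))
      ≤ (K i + K₀) * (ξ z ^ 4 * (1 + ee β r w z))
      + (ξ z ^ 12 * (hs (w i) z - lapl (w i) z ^ 2)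
            - lapl (w i) z * gp (fun z => ξ z ^ 12) (w i) z
            - 1 / 2 * gp (w i) (w i) z * lapl (fun z => ξ z ^ 12) z
          - κ * (ξ z ^ 12 * (- ((w i z)⁻¹ * gp (w i) (w i) z) ^ 2 + 2 * (w i z)⁻¹ * hv (w i) z
              + (w i z)⁻¹ * gp (w i) (w i) z * lapl (w i) z)
            + (w i z)⁻¹ * gp (w i) (w i) z * gp (fun z => ξ z ^ 12) (w i) z)
          - (2 / 3 + θ) * (ξ z ^ 12 * gp (fun z => FF β r (fun j => w j z) i) (w i) z
            + ξ z ^ 12 * FF β r (fun j => w j z) i * lapl (w i) z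
            + FF β r (fun j => w j z) i * gp (fun z => ξ z ^ 12) (w i) z)
          + Λ * (ξ z ^ 12 * dd et (w i) z * lapl (w i) z
            + dd et (w i) z * gp (fun z => ξ z ^ 12) (w i) z
            - 1 / 2 * dd et (fun z => ξ z ^ 12) z * gp (w i) (w i) z))
      + Λ * (ξ z ^ 12 * (FF β r (fun j => w j z) i * dd et (w i) z)) := by
    intro i
    have hh : lapl (w i) z = dd et (w i) z - FF β r (fun j => w j z) i - er β r w i z := by
      simp only [er, heat, lapl]; ring
    have hP := gp_self_nonneg (w i) z
    have hw0 := h0 i z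
    have hwp : gp (w i) (w i) z = (w i z)⁻¹ * gp (w i) (w i) z * w i z := by
      field_simp
    have hy : 0 ≤ (w i z)⁻¹ * gp (w i) (w i) z := by positivity
    have htr := bochner_trace_le (w i) z κ (w i z)⁻¹
    have ha := h3 (w i)
    have hq := rpow_le_FF (r := r) hβ (fun i => h0 i z) i
    have hwq := sq_le_one_add_rpow (h0 i z) (q := 2 * r + 1) (by linarith)
    have he := er_sq_le (β := β) (r := r) w i z
    rw [hwp] at ha
    have hc1 := hcut i (ξ z) (dd et (w i) z) (FF β r (fun j => w j z) i) (er β r w i z) _ _ _ _ _ _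
      hx (hξ.le_one z) (hF0 i) hy hw0.le ha h1 h2 hq hwq
    rw [hh] at htr
    have hc2 := mul_le_mul_of_nonneg_left (hquad _ _ _ _ _ _ htr)
      (by positivity : 0 ≤ ξ z ^ 12)
    rw [← hwp] at hc1
    rw [hh]
    have hx4 : ξ z ^ 12 ≤ ξ z ^ 4 := hξ.pow_anti (by norm_num) z
    have b1 : ξ z ^ 12 * (K₀ * er β r w i z ^ 2) ≤ ξ z ^ 4 * (K₀ * ee β r w z) := by gcongr
    have b2 : K i * (ξ z ^ 4 * (1 + er β r w i z ^ 2)) ≤ K i * (ξ z ^ 4 * (1 + ee β r w z)) := by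
      have := hK i
      gcongr
    have b3 : 0 ≤ K₀ * ξ z ^ 4 := by positivity
    have b4 : 0 ≤ c * (ξ z ^ 12 * dd et (w i) z ^ 2) := by positivity
    have b5 : 0 ≤ c * (ξ z ^ 12 * ((w i z)⁻¹ * gp (w i) (w i) z) ^ 2) := by positivity
    generalize (w i z)⁻¹ * gp (w i) (w i) z = y at *
    rw [show 2 * (w i z)⁻¹ * hv (w i) z = 2 * ((w i z)⁻¹ * hv (w i) z) by ring]
    generalize (w i z)⁻¹ * hv (w i) z = h at *
    linarith only [hc1, hc2, b1, b2, b3, b4, b5]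
  have hsum := Finset.sum_le_sum fun i (_ : i ∈ Finset.univ) => hcomp i
  simp only [Finset.sum_add_distrib, ← Finset.mul_sum, ← Finset.sum_mul,
    Finset.sum_sub_distrib] at hsum
  simp only [Finset.sum_add_distrib, ← Finset.mul_sum, ← Finset.sum_mul,
    Finset.sum_sub_distrib]
  have hgp := sum_gp_FF_le hr hβ hβs hw h0 z
  rw [← hp] at hgp
  have g1 := mul_nonneg (by positivity : 0 ≤ (2 / 3 + θ) * ξ z ^ 12) (sub_nonneg.2 hgp)
  have hG := sum_mul_FF (β := β) hr fun j => w j z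
  have hG0 : 0 ≤ GG β r fun j => w j z := GG_nonneg hβ hr (h0 · z)
  have g2 : GG β r (fun j => w j z) ≤ ∑ i, w i z * FF β r (fun j => w j z) i := by
    rw [hG]; nlinarith
  have g3 : Λ * (- (dd et (fun z => ξ z ^ 12) z * GG β r fun j => w j z))
      ≤ Λ * (C * ξ z ^ 10 * ∑ i, w i z * FF β r (fun j => w j z) i) := by
    have e1 := mul_le_mul_of_nonneg_right (abs_le.1 h1).1 hG0
    have e2 : C * ξ z ^ 10 * GG β r (fun j => w j z)
        ≤ C * ξ z ^ 10 * ∑ i, w i z * FF β r (fun j => w j z) i := by gcongr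
    exact mul_le_mul_of_nonneg_left (by linarith) hΛ
  have hSS : ∑ i, K i + ∑ _i : ι, K₀ = S := by rw [hS, Finset.sum_add_distrib]
  rw [hSS] at hsum
  rw [← mul_add, ← div_le_iff₀' (by positivity), div_div_eq_mul_div]
  linarith only [hsum, g1, g3]

end Estimate

namespace Ap

variable {β : ι → ι → ℝ} {r : ℝ} {V : ι → X 2 → ℝ} {w : ℕ → ι → X 2 → ℝ}

lemma exists_bv_bound (hr : 1 ≤ r) (hr2 : 2 * r + 1 < 15 / 4) (hβ : ∀ i j, 0 ≤ β i j)
    (hβs : ∀ i j, β i j = β j i) (hd : ∀ i, 0 < β i i) :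
    ∃ C, 0 ≤ C ∧ ∀ (V : ι → X 2 → ℝ) (w : ℕ → ι → X 2 → ℝ), (∀ i, Continuous (V i)) →
    Ap β r V w → ∫ z in closedBall 0 1, ∑ i, FF β r (fun j => V j z) i ^ 2 ≤ C := by
  obtain ⟨ξ, hξ, h1⟩ := exists_cut 2
  obtain ⟨C, hC, hp⟩ := estimate_bv hξ hr hβ hr2 hβs hd
  have hI : 0 ≤ ∫ z, ξ z ^ 4 * 2 := integral_nonneg fun z => by
    have : 0 ≤ ξ z ^ 4 := by positivity
    simp only [Pi.zero_apply]; linarith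
  refine ⟨C * ∫ z, ξ z ^ 4 * 2, by positivity, fun V w hV h => ?_⟩
  have hcF : Continuous fun U : ι → ℝ => ∑ i, FF β r U i ^ 2 :=
    continuous_finsetSum _ fun i _ => (FF_continuous hr i).pow 2
  refine le_of_tendsto (LU.setIntegral_tendsto h.lim (fun k i => (h.smooth k i).continuous) hV
    hcF (isCompact_closedBall 0 1)) ?_
  filter_upwards [h.eventually_error hξ] with k hk
  exact (setIntegral_le_cut hξ h1 (j := 12) (by simp)
    (hcF.comp (continuous_pi fun i => (h.smooth k i).continuous))
    fun z => Finset.sum_nonneg fun i _ => sq_nonneg _).trans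
    ((hp _ (h.smooth k) (h.pos k)).trans (by gcongr))

/-- The Liouville theorem in space dimension three. -/
theorem eq_zero_of_dim_three (h : Ap β r V w) (hr : 1 ≤ r) (hr2 : 2 * r + 1 < 15 / 4)
    (hβ : ∀ i j, 0 ≤ β i j) (hβs : ∀ i j, β i j = β j i) (hd : ∀ i, 0 < β i i)
    (hVc : ∀ i, Continuous (V i)) (i : ι) (z : X 2) : V i z = 0 := by
  obtain ⟨C, hC, hb⟩ := exists_bv_bound hr hr2 hβ hβs hd
  have hc : Continuous fun z => ∑ i, FF β r (fun j => V j z) i ^ 2 :=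
    (continuous_finsetSum _ fun i _ => (FF_continuous hr i).pow 2 :
      Continuous fun U : ι → ℝ => ∑ i, FF β r U i ^ 2).comp (continuous_pi hVc)
  have hn : ∀ z, 0 ≤ ∑ i, FF β r (fun j => V j z) i ^ 2 := fun z =>
    Finset.sum_nonneg fun i _ => sq_nonneg _
  have key : ∀ ρ, 0 < ρ → ∫ z in closedBall 0 ρ, ∑ i, FF β r (fun j => V j z) i ^ 2 ≤ 0 := by
    intro ρ hρ
    have hlim : Tendsto (fun s : ℝ => C * s ^ (-(2 - r))) atTop (𝓝 (C * 0)) :=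
      (tendsto_rpow_neg_atTop (by linarith)).const_mul C
    rw [mul_zero] at hlim
    refine ge_of_tendsto hlim ?_
    filter_upwards [eventually_ge_atTop 1, eventually_ge_atTop ρ] with s hs1 hsρ
    have hs0 : 0 < s := by linarith
    set R := s ^ r with hR
    have hsR : s ≤ R := by
      simpa using Real.rpow_le_rpow_of_exponent_le hs1 hr
    have hR1 : 1 ≤ R := hs1.trans hsR
    have hR0 : 0 < R := by linarith
    have hRs : R ^ (1 / r) = s := by
      rw [hR, ← Real.rpow_mul hs0.le, mul_one_div_cancel (by positivity), Real.rpow_one]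
    have h1 : ∫ z in closedBall 0 1, ∑ i,
        FF β r (fun j => R ^ (1 / r) * V j (scl 2 R (R ^ 2) z)) i ^ 2 ≤ C :=
      hb _ _ (fun i => continuous_const.mul
        ((hVc i).comp (scl 2 R (R ^ 2)).continuous)) (h.scale hr hR0)
    have e2 : ∀ z i, FF β r (fun j => R ^ (1 / r) * V j (scl 2 R (R ^ 2) z)) i
        = R ^ (1 / r) * R ^ 2 * FF β r (fun j => V j (scl 2 R (R ^ 2) z)) i := fun z i =>
      FF_smul hr hR0 _ i
    simp only [e2, mul_pow, ← Finset.mul_sum] at h1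
    rw [hRs, integral_const_mul] at h1
    have h3 := setIntegral_ball_le_scl hρ (hsρ.trans hsR) (T := R ^ 2) (by nlinarith) hc hn
    set I := ∫ z in closedBall 0 1, ∑ i, FF β r (fun j => V j (scl 2 R (R ^ 2) z)) i ^ 2
    have e1 : s ^ (-(2 - r)) = R / s ^ 2 := by
      rw [hR, neg_sub, Real.rpow_sub hs0, Real.rpow_two]
    refine h3.trans ?_
    rw [e1, ← mul_div_assoc, le_div_iff₀ (by positivity)]
    calc _ = R * (s ^ 2 * (R ^ 2) ^ 2 * I) := by ring
      _ ≤ R * C := by gcongr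
      _ = C * R := mul_comm _ _
  have h1 := eq_zero_of_setIntegral_le hc hn key z
  have h2 := (Finset.sum_eq_zero_iff_of_nonneg fun i _ => sq_nonneg _).1 h1 i (Finset.mem_univ i)
  have h3 : FF β r (fun j => V j z) i = 0 := by simpa using h2
  have hm : ∀ j, 0 ≤ max (V j z) 0 := fun j => le_max_right _ _
  have h4 := (Finset.sum_eq_zero_iff_of_nonneg fun j _ => mul_nonneg (hβ i j)
    (mul_nonneg (Real.rpow_nonneg (hm i) _) (Real.rpow_nonneg (hm j) _))).1 h3 i (Finset.mem_univ i)
  rw [max_eq_left (h.nonneg i z)] at h4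
  by_contra hne
  have hpos : 0 < V i z := lt_of_le_of_ne (h.nonneg i z) (Ne.symm hne)
  have := hd i
  have h5 : 0 < β i i * (V i z ^ r * V i z ^ (r + 1)) := by positivity
  exact h5.ne' h4

end Ap

end

section

variable {n : ℕ}

/-! ### Separately regular solutions -/

/-- The Laplacian on `Fin (n + 1) → ℝ`. -/
noncomputable def lapE (f : (Fin (n + 1) → ℝ) → ℝ) (x : Fin (n + 1) → ℝ) : ℝ :=
  ∑ i, dd (Pi.single i 1) (dd (Pi.single i 1) f) x

lemma lapE_contDiff {φ : (Fin (n + 1) → ℝ) → ℝ} (hφ : ContDiff ℝ ∞ φ) : ContDiff ℝ ∞ (lapE φ) :=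
  ContDiff.sum fun _ _ => dd_contDiff (dd_contDiff hφ)

lemma lapE_eq_zero_of_notMem {φ : (Fin (n + 1) → ℝ) → ℝ} {x} (hx : x ∉ tsupport φ) :
    lapE φ x = 0 := by
  refine Finset.sum_eq_zero fun i _ => ?_
  by_contra h
  exact hx (dd_tsupport (dd_tsupport (subset_tsupport _ h)))

lemma lapE_hasCompactSupport {φ : (Fin (n + 1) → ℝ) → ℝ} (hc : HasCompactSupport φ) :
    HasCompactSupport (lapE φ) := by
  refine hc.mono' fun z hz => ?_
  by_contra h
  exact hz (lapE_eq_zero_of_notMem h)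

lemma lapE_continuousAt {v : (Fin (n + 1) → ℝ) → ℝ} {x} (hv : ContDiffAt ℝ 2 v x) :
    ContinuousAt (lapE v) x := by
  refine tendsto_finsetSum _ fun i _ => ?_
  have h1 : ContDiffAt ℝ 1 (dd (Pi.single i 1) v) x :=
    dd_contDiffAt (k := 1) (by simpa [one_add_one_eq_two] using hv)
  exact (dd_contDiffAt (k := 0) (by simpa using h1)).continuousAt

/-- Green's identity against a test function supported where `v` is regular. -/
lemma integral_mul_lapE {v φ : (Fin (n + 1) → ℝ) → ℝ} {Ω : Set (Fin (n + 1) → ℝ)}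
    (hv : ∀ x ∈ Ω, ContDiffAt ℝ 2 v x) (hvc : Continuous v) (hφ : ContDiff ℝ ∞ φ)
    (hc : HasCompactSupport φ) (hs : tsupport φ ⊆ Ω) :
    Integrable (fun x => lapE v x * φ x) ∧ ∫ x, v x * lapE φ x = ∫ x, lapE v x * φ x := by
  have hcont : Continuous fun x => lapE v x * φ x := by
    rw [continuous_iff_continuousAt]
    intro x
    by_cases hx : x ∈ tsupport φ
    · exact (lapE_continuousAt (hv x (hs hx))).mul hφ.continuous.continuousAt
    · have : (fun x => lapE v x * φ x) =ᶠ[𝓝 x] fun _ => 0 := by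
        filter_upwards [(isClosed_tsupport φ).isOpen_compl.mem_nhds hx] with y hy
        simp [image_eq_zero_of_notMem_tsupport hy]
      exact this.continuousAt
  have hi : Integrable fun x => lapE v x * φ x :=
    hcont.integrable_of_hasCompactSupport hc.mul_left
  have hi2 : Integrable fun x => v x * lapE φ x :=
    (hvc.mul (lapE_contDiff hφ).continuous).integrable_of_hasCompactSupport
      (lapE_hasCompactSupport hc).mul_left
  refine ⟨hi, ?_⟩
  let F : Fin (n + 1) → (Fin (n + 1) → ℝ) → ℝ := fun i x =>
    v x * dd (Pi.single i 1) φ x - φ x * dd (Pi.single i 1) v x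
  have hz : ∀ i x, x ∉ tsupport φ → F i =ᶠ[𝓝 x] fun _ => 0 := by
    intro i x hx
    filter_upwards [(isClosed_tsupport φ).isOpen_compl.mem_nhds hx] with y hy
    have h1 : dd (Pi.single i 1) φ y = 0 := by
      by_contra h
      exact hy (dd_tsupport (subset_tsupport _ h))
    simp [F, h1, image_eq_zero_of_notMem_tsupport hy]
  have hF : ∀ i, ContDiff ℝ 1 (F i) := by
    intro i
    rw [contDiff_iff_contDiffAt]
    intro x
    by_cases hx : x ∈ tsupport φ
    · have h1 : ContDiffAt ℝ 1 (dd (Pi.single i 1) v) x :=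
        dd_contDiffAt (k := 1) (by simpa [one_add_one_eq_two] using hv x (hs hx))
      exact (((hv x (hs hx)).of_le (by norm_num)).mul
        ((dd_contDiff hφ).of_le one_le_infty).contDiffAt).sub
        ((hφ.of_le one_le_infty).contDiffAt.mul h1)
    · exact contDiffAt_const.congr_of_eventuallyEq (hz i x hx)
  have hFc : ∀ i, HasCompactSupport (F i) := by
    intro i
    refine hc.mono' fun x hx => ?_
    by_contra h
    exact hx (hz i x h).eq_of_nhds
  have hFi : ∀ i, Integrable (dd (Pi.single i 1) (F i)) := fun i =>
    Continuous.integrable_of_hasCompactSupport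
      (((hF i).continuous_fderiv (by norm_num)).clm_apply continuous_const)
      (dd_hasCompactSupport (hFc i))
  have key : ∀ x, v x * lapE φ x - lapE v x * φ x = ∑ i, dd (Pi.single i 1) (F i) x := by
    intro x
    by_cases hx : x ∈ tsupport φ
    · have hvx := hv x (hs hx)
      have h2 : ContDiffAt ℝ 2 φ x := (hφ.of_le two_le_infty).contDiffAt
      simp only [lapE, Finset.mul_sum, Finset.sum_mul]
      rw [← Finset.sum_sub_distrib]
      refine Finset.sum_congr rfl fun i _ => ?_
      have h3 := hvx.differentiableAt (by norm_num)
      have h4 := h2.differentiableAt (by norm_num)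
      have h5 := dd_differentiableAt (v := Pi.single i 1) hvx
      have h6 := dd_differentiableAt (v := Pi.single i 1) h2
      simp only [F]
      rw [dd_sub (h3.fun_mul h6) (h4.fun_mul h5), dd_mul h3 h6, dd_mul h4 h5]
      ring
    · rw [lapE_eq_zero_of_notMem hx, image_eq_zero_of_notMem_tsupport hx]
      have : ∀ i, dd (Pi.single i 1) (F i) x = 0 := fun i => by
        rw [(dd_congr (hz i x hx)).eq_of_nhds, dd_const]
      simp [this]
  have h1 : ∫ x, (v x * lapE φ x - lapE v x * φ x) = 0 := by
    simp only [key]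
    rw [integral_finsetSum _ fun i _ => hFi i]
    exact Finset.sum_eq_zero fun i _ => integral_dd_eq_zero (hF i) (hFc i)
  rw [integral_sub hi2 hi] at h1
  linarith only [h1]

lemma dd_reflect {V : Type*} [NormedAddCommGroup V] [NormedSpace ℝ V] {k : V → ℝ}
    (hk : Differentiable ℝ k) (v z : V) :
    dd v (fun y => k (z - y)) = fun y => - dd v k (z - y) := by
  ext y
  have h := (hk (z - y)).hasFDerivAt.comp y ((hasFDerivAt_id y).const_sub z)
  have h2 : fderiv ℝ (fun y => k (z - y)) y = _ := h.fderiv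
  simp only [dd]
  rw [h2]; simp

lemma lapE_reflect {k : (Fin (n + 1) → ℝ) → ℝ} (hk : ContDiff ℝ ∞ k) (z y) :
    lapE (fun y => k (z - y)) y = lapE k (z - y) := by
  refine Finset.sum_congr rfl fun i _ => ?_
  rw [dd_reflect (hk.differentiable (by simp))]
  have h2 := congrFun (dd_reflect ((dd_contDiff hk).differentiable (by simp)) (Pi.single i 1) z
    (k := dd (Pi.single i 1) k)) y
  rw [dd_neg, h2]; simp

lemma lapE_moll {u k : (Fin (n + 1) → ℝ) → ℝ} (hu : Continuous u) (hk : ContDiff ℝ ∞ k)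
    (hc : HasCompactSupport k) (z) :
    lapE (moll u k) z = ∫ y, u y * lapE (fun y => k (z - y)) y := by
  have hu' := hu.locallyIntegrable (μ := volume)
  have h1 : ∀ i, dd (Pi.single i 1) (dd (Pi.single i 1) (moll u k))
      = moll u (dd (Pi.single i 1) (dd (Pi.single i 1) k)) := by
    intro i
    rw [dd_moll hu' hk hc, dd_moll hu' (dd_contDiff hk) (dd_hasCompactSupport hc)]
  have hi : ∀ i, Integrable fun y => u y * dd (Pi.single i 1) (dd (Pi.single i 1) k) (z - y) :=
    fun i => moll_integrable hu' (dd_contDiff (dd_contDiff hk)).continuous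
      (dd_hasCompactSupport (dd_hasCompactSupport hc)) z
  simp only [lapE_reflect hk]
  simp only [lapE, h1, moll, Finset.mul_sum]
  rw [integral_finsetSum _ fun i _ => hi i]

/-- The translated kernel `y ↦ ker j (x - y)` as a test function. -/
lemma ker_test (j : ℕ) (x : Fin (n + 1) → ℝ) :
    ContDiff ℝ ∞ (fun y => (ker j : (Fin (n + 1) → ℝ) → ℝ) (x - y)) ∧
    HasCompactSupport (fun y => (ker j : (Fin (n + 1) → ℝ) → ℝ) (x - y)) ∧
    tsupport (fun y => (ker j : (Fin (n + 1) → ℝ) → ℝ) (x - y)) ⊆ closedBall x (rad j) := by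
  refine ⟨(ker_contDiff j).comp (contDiff_const.sub contDiff_id),
    (ker_hasCompactSupport j).comp_homeomorph (Homeomorph.subLeft x), ?_⟩
  refine closure_minimal ?_ isClosed_closedBall
  intro y hy
  rw [mem_closedBall, dist_comm, dist_eq_norm]
  by_contra! hlt
  exact hy (ker_eq_zero hlt.le)

lemma integral_abs_ker (j : ℕ) (x : Fin (n + 1) → ℝ) :
    ∫ y, |(ker j : (Fin (n + 1) → ℝ) → ℝ) (x - y)| = 1 := by
  rw [← ker_integral_sub j x]
  exact integral_congr_ae (Eventually.of_forall fun y => abs_of_nonneg (ker_nonneg _ _))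

/-- A weak bound on the Laplacian is a pointwise bound. -/
lemma lapE_le_of_weak {v : (Fin (n + 1) → ℝ) → ℝ} {O : Set (Fin (n + 1) → ℝ)} (hO : IsOpen O)
    (hv : ∀ x ∈ O, ContDiffAt ℝ 2 v x) (hvc : Continuous v) {k : ℝ}
    (h : ∀ φ : (Fin (n + 1) → ℝ) → ℝ, ContDiff ℝ ∞ φ → HasCompactSupport φ → tsupport φ ⊆ O →
      |∫ x, v x * lapE φ x| ≤ k * ∫ x, |φ x|) {x} (hx : x ∈ O) : |lapE v x| ≤ k := by
  by_contra! hlt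
  obtain ⟨c, hkc, hcl⟩ := exists_between hlt
  have main : ∀ s : ℝ, |s| = 1 → c < s * lapE v x → False := by
    intro s hs hc
    have hcs : ContinuousAt (fun y => s * lapE v y) x :=
      continuousAt_const.mul (lapE_continuousAt (hv x hx))
    have hev : ∀ᶠ y in 𝓝 x, c < s * lapE v y := hcs.eventually (lt_mem_nhds hc)
    obtain ⟨δ, hδ, hb⟩ := Metric.eventually_nhds_iff_ball.1 (hev.and (hO.mem_nhds hx))
    obtain ⟨j, hj⟩ := (rad_tendsto.eventually_lt_const hδ).exists
    obtain ⟨h1, h2, h3⟩ := ker_test j x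
    have h4 : tsupport (fun y => (ker j : (Fin (n + 1) → ℝ) → ℝ) (x - y)) ⊆ O :=
      h3.trans fun y hy => (hb y (lt_of_le_of_lt hy hj)).2
    obtain ⟨hi, he⟩ := integral_mul_lapE hv hvc h1 h2 h4
    have h5 := h _ h1 h2 h4
    rw [he, integral_abs_ker, mul_one] at h5
    have h6 : c ≤ s * ∫ y, lapE v y * (ker j : (Fin (n + 1) → ℝ) → ℝ) (x - y) := by
      have e : ∫ y, c * (ker j : (Fin (n + 1) → ℝ) → ℝ) (x - y) = c := by
        rw [integral_const_mul, ker_integral_sub, mul_one]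
      rw [← integral_const_mul]
      conv_lhs => rw [← e]
      refine integral_mono ((h1.continuous.integrable_of_hasCompactSupport h2).const_mul c)
        (hi.const_mul s) fun y => ?_
      by_cases hy : dist y x < rad j
      · have := (hb y (lt_trans hy hj)).1.le
        have h7 := mul_le_mul_of_nonneg_right this (ker_nonneg j (x - y))
        simpa only [mul_assoc] using h7
      · have : (ker j : (Fin (n + 1) → ℝ) → ℝ) (x - y) = 0 := by
          apply ker_eq_zero
          rw [← dist_eq_norm, dist_comm]; linarith
        simp [this]
    have h7 : s * ∫ y, lapE v y * (ker j : (Fin (n + 1) → ℝ) → ℝ) (x - y) ≤ k := by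
      refine (le_abs_self _).trans ?_
      rw [abs_mul, hs, one_mul]; exact h5
    linarith only [h6, h7, hkc]
  rcases abs_cases (lapE v x) with ⟨h1, _⟩ | ⟨h1, _⟩
  · exact main 1 (by simp) (by linarith)
  · exact main (-1) (by simp) (by linarith)

/-- A bounded function of space and time, separately continuous, solving `∂ₜu = Δu + f` pointwise
over `Ω`. -/
structure Sep (Ω : Set (Fin (n + 1) → ℝ)) (u f : (Fin (n + 1) → ℝ) → ℝ → ℝ) (C A : ℝ) : Prop where
  ux : ∀ t, Continuous fun x => u x t
  ut : ∀ x, Continuous (u x)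
  fx : ∀ t, Continuous fun x => f x t
  ft : ∀ x, Continuous (f x)
  uC : ∀ x t, |u x t| ≤ C
  fA : ∀ x t, |f x t| ≤ A
  reg : ∀ t, ∀ x ∈ Ω, ContDiffAt ℝ 2 (fun x => u x t) x
  eqn : ∀ x ∈ Ω, ∀ t, HasDerivAt (u x) (lapE (fun x => u x t) x + f x t) t

lemma continuous_slice {u : (Fin (n + 1) → ℝ) → ℝ → ℝ} {C : ℝ}
    (hx : ∀ t, Continuous fun x => u x t) (ht : ∀ x, Continuous (u x)) (hC : ∀ x t, |u x t| ≤ C)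
    {ψ : (Fin (n + 1) → ℝ) → ℝ} (hψ : Continuous ψ) (hc : HasCompactSupport ψ) :
    Continuous fun t => ∫ x, u x t * ψ x := by
  refine continuous_of_dominated (bound := fun x => C * |ψ x|) (fun t => ?_) (fun t => ?_) ?_ ?_
  · exact ((hx t).mul hψ).aestronglyMeasurable
  · refine Eventually.of_forall fun x => ?_
    rw [norm_mul, Real.norm_eq_abs, Real.norm_eq_abs]
    exact mul_le_mul_of_nonneg_right (hC x t) (abs_nonneg _)
  · exact ((hψ.integrable_of_hasCompactSupport hc).abs).const_mul C
  · exact Eventually.of_forall fun x => (ht x).mul continuous_const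

end

section

variable {n : ℕ}

/-- Test functions in `O`. -/
structure Test (O : Set (Fin (n + 1) → ℝ)) (φ : (Fin (n + 1) → ℝ) → ℝ) : Prop where
  smooth : ContDiff ℝ ∞ φ
  cpt : HasCompactSupport φ
  supp : tsupport φ ⊆ O

/-- The right-hand side of the equation tested against `φ`. -/
noncomputable def rhs (u f : (Fin (n + 1) → ℝ) → ℝ → ℝ) (φ : (Fin (n + 1) → ℝ) → ℝ) (t : ℝ) : ℝ :=
  (∫ x, u x t * lapE φ x) + ∫ x, f x t * φ x

lemma continuous_moll_slice {u : (Fin (n + 1) → ℝ) → ℝ → ℝ} {C : ℝ}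
    (hx : ∀ t, Continuous fun x => u x t) (ht : ∀ x, Continuous (u x)) (hC : ∀ x t, |u x t| ≤ C)
    (j : ℕ) : Continuous fun z : (Fin (n + 1) → ℝ) × ℝ => moll (fun x => u x z.2) (ker j) z.1 := by
  rw [continuous_iff_continuousAt]
  intro z₀
  have hkc : Continuous (ker j : (Fin (n + 1) → ℝ) → ℝ) := (ker_contDiff j).continuous
  obtain ⟨K, hK⟩ := hkc.bounded_above_of_compact_support (ker_hasCompactSupport j)
  have hC0 : 0 ≤ C := (abs_nonneg _).trans (hC 0 0)
  refine continuousAt_of_dominated (bound := (closedBall z₀.1 2).indicator fun _ => C * K)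
    ?_ ?_ ?_ ?_
  · refine Eventually.of_forall fun z => Continuous.aestronglyMeasurable ?_
    have := hx z.2
    fun_prop
  · have : ∀ᶠ z : (Fin (n + 1) → ℝ) × ℝ in 𝓝 z₀, dist z.1 z₀.1 < 1 :=
      continuous_fst.continuousAt.eventually (ball_mem_nhds _ one_pos)
    filter_upwards [this] with z hz
    refine Eventually.of_forall fun y => ?_
    by_cases hy : rad j ≤ ‖z.1 - y‖
    · simp only [ker_eq_zero hy, mul_zero, norm_zero]
      exact indicator_nonneg (fun _ _ => mul_nonneg hC0 ((norm_nonneg _).trans (hK 0))) _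
    · have h1 : rad j ≤ 1 := by
        unfold rad
        rw [div_le_one (by positivity)]
        linarith [(Nat.cast_nonneg j : (0 : ℝ) ≤ j)]
      have h2 : y ∈ closedBall z₀.1 2 := by
        rw [mem_closedBall]
        have h3 := dist_triangle y z.1 z₀.1
        rw [dist_comm y z.1, dist_eq_norm z.1 y] at h3
        linarith
      rw [indicator_of_mem h2, norm_mul]
      exact mul_le_mul (hC _ _) (hK _) (norm_nonneg _) hC0
  · exact (integrableOn_const (isCompact_closedBall z₀.1 2).measure_lt_top.ne).integrable_indicator
      isClosed_closedBall.measurableSet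
  · refine Eventually.of_forall fun y => ?_
    have := ht y
    exact Continuous.continuousAt (by fun_prop)

lemma lapE_barrier {v w : (Fin (n + 1) → ℝ) → ℝ} (hv : ContDiff ℝ ∞ v) (hw : ContDiff ℝ ∞ w)
    (σ b c : ℝ) (x₀ x : Fin (n + 1) → ℝ) :
    lapE (fun y => σ * (v y - w y) - (b + c * ∑ i, (y i - x₀ i) ^ 2)) x
      = σ * (lapE v x - lapE w x) - c * (2 * (n + 1)) := by
  have hq : ∀ l : Fin (n + 1), dd (Pi.single l 1) (dd (Pi.single l 1)
      (fun y : Fin (n + 1) → ℝ => b + c * ∑ i, (y i - x₀ i) ^ 2)) x = c * 2 := by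
    intro l
    have h1 : ∀ y : Fin (n + 1) → ℝ, dd (Pi.single l 1)
        (fun y : Fin (n + 1) → ℝ => b + c * ∑ i, (y i - x₀ i) ^ 2) y = c * 2 * (y l - x₀ l) := by
      intro y
      have hd : HasFDerivAt (fun y : Fin (n + 1) → ℝ => b + c * ∑ i, (y i - x₀ i) ^ 2)
          (c • ∑ i, ((2 : ℕ) • (y i - x₀ i) ^ (2 - 1)) •
            ContinuousLinearMap.proj (R := ℝ) (φ := fun _ : Fin (n + 1) => ℝ) i) y := by
        refine ((HasFDerivAt.fun_sum fun i _ => ?_).const_mul c).const_add b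
        exact ((hasFDerivAt_apply i y).sub_const (x₀ i)).pow 2
      simp only [dd]
      rw [hd.fderiv]
      simp [Pi.single_apply]
      ring
    rw [show dd (Pi.single l 1) (fun y : Fin (n + 1) → ℝ => b + c * ∑ i, (y i - x₀ i) ^ 2)
      = fun y => c * 2 * (y l - x₀ l) from funext h1]
    have hd : HasFDerivAt (fun y : Fin (n + 1) → ℝ => c * 2 * (y l - x₀ l))
        ((c * 2) • ContinuousLinearMap.proj (R := ℝ) (φ := fun _ : Fin (n + 1) => ℝ) l) x :=
      ((hasFDerivAt_apply l x).sub_const (x₀ l)).const_mul (c * 2)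
    simp only [dd]
    rw [hd.fderiv]
    simp
  have h2 : ∀ {g : (Fin (n + 1) → ℝ) → ℝ}, ContDiff ℝ ∞ g → ContDiffAt ℝ 2 g x := fun hg =>
    (hg.of_le two_le_infty).contDiffAt
  have hqc : ContDiff ℝ ∞ fun y : Fin (n + 1) → ℝ => b + c * ∑ i, (y i - x₀ i) ^ 2 := by
    fun_prop
  simp only [lapE]
  have e : ∀ l : Fin (n + 1), dd (Pi.single l 1) (dd (Pi.single l 1)
      (fun y => σ * (v y - w y) - (b + c * ∑ i, (y i - x₀ i) ^ 2))) x
      = σ * (dd (Pi.single l 1) (dd (Pi.single l 1) v) x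
        - dd (Pi.single l 1) (dd (Pi.single l 1) w) x) - c * 2 := by
    intro l
    rw [dd_dd_sub (h2 (contDiff_const.mul (hv.sub hw))) (h2 hqc), hq, dd_dd_const_mul,
      dd_dd_sub (h2 hv) (h2 hw)]
  simp only [e, Finset.sum_sub_distrib, ← Finset.mul_sum, Finset.sum_const, Finset.card_univ,
    Fintype.card_fin, nsmul_eq_mul]
  push_cast
  ring

lemma deriv_nonneg_of_left_max {g : ℝ → ℝ} {a s d : ℝ} (has : a < s) (hg : HasDerivAt g d s)
    (h : ∀ s' ∈ Icc a s, g s' ≤ g s) : 0 ≤ d := by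
  have h1 := hg.hasDerivWithinAt (s := Iio s)
  rw [hasDerivWithinAt_iff_tendsto_slope' (by simp)] at h1
  refine ge_of_tendsto h1 ?_
  filter_upwards [Ioo_mem_nhdsLT has] with s' hs'
  rw [slope_def_field]
  exact div_nonneg_of_nonpos (by linarith [h s' ⟨hs'.1.le, hs'.2.le⟩]) (by linarith [hs'.2])

lemma le_sum_sq_of_dist {x x₀ : Fin (n + 1) → ℝ} {ρ : ℝ} (h : ρ ≤ dist x x₀) (hρ : 0 ≤ ρ) :
    ρ ^ 2 ≤ ∑ i, (x i - x₀ i) ^ 2 := by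
  have h0 : 0 ≤ ∑ i, (x i - x₀ i) ^ 2 := Finset.sum_nonneg fun i _ => sq_nonneg _
  have h1 : dist x x₀ ≤ √(∑ i, (x i - x₀ i) ^ 2) := by
    refine (dist_pi_le_iff (Real.sqrt_nonneg _)).2 fun i => ?_
    rw [Real.dist_eq]
    exact Real.abs_le_sqrt (Finset.single_le_sum (f := fun i => (x i - x₀ i) ^ 2)
      (fun i _ => sq_nonneg _) (Finset.mem_univ i))
  calc ρ ^ 2 ≤ √(∑ i, (x i - x₀ i) ^ 2) ^ 2 := by gcongr; exact h.trans h1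
    _ = _ := Real.sq_sqrt h0

section Gap

variable {Ω O : Set (Fin (n + 1) → ℝ)} {u f : (Fin (n + 1) → ℝ) → ℝ → ℝ} {C A : ℝ}

/-- The mollified solution obeys the comparison principle on a time interval where the tested
equation holds. -/
lemma Sep.moll_gap (h : Sep Ω u f C A) {x₀ : Fin (n + 1) → ℝ} {ρ : ℝ} (hρ : 0 < ρ)
    (hb : closedBall x₀ (2 * ρ) ⊆ O) {a t k : ℝ} (hat : a ≤ t)
    (hk : ∀ φ, Test O φ → |∫ x, u x a * lapE φ x| ≤ k * ∫ x, |φ x|)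
    (hd : ∀ s ∈ Ioc a t, ∀ φ, Test O φ → HasDerivAt (fun t => ∫ x, u x t * φ x) (rhs u f φ s) s)
    {σ : ℝ} (hσ : |σ| = 1) {j : ℕ} (hj : rad j < ρ) :
    σ * (moll (fun x => u x t) (ker j) x₀ - moll (fun x => u x a) (ker j) x₀)
      ≤ (A + k + rad j + 4 * C * (n + 1) / ρ ^ 2) * (t - a) := by
  have hC0 : 0 ≤ C := (abs_nonneg _).trans (h.uC 0 0)
  have hA0 : 0 ≤ A := (abs_nonneg _).trans (h.fA 0 0)
  have htest : ∀ y ∈ closedBall x₀ ρ,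
      Test O fun z => (ker j : (Fin (n + 1) → ℝ) → ℝ) (y - z) := by
    intro y hy
    obtain ⟨h1, h2, h3⟩ := ker_test j y
    refine ⟨h1, h2, (h3.trans ?_).trans hb⟩
    exact closedBall_subset_closedBall' (by linarith [mem_closedBall.1 hy])
  have hk0 : 0 ≤ k := by
    have h1 := hk _ (htest x₀ (mem_closedBall_self hρ.le))
    rw [integral_abs_ker, mul_one] at h1
    exact (abs_nonneg _).trans h1
  obtain ⟨c, hc⟩ : ∃ c, c = 2 * C / ρ ^ 2 := ⟨_, rfl⟩
  have hc0 : 0 ≤ c := by rw [hc]; positivity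
  have hcρ : c * ρ ^ 2 = 2 * C := by rw [hc]; field_simp
  obtain ⟨L, hL⟩ : ∃ L, L = A + k + rad j + c * (2 * (n + 1)) := ⟨_, rfl⟩
  have hL0 : 0 ≤ L := by have := rad_pos j; rw [hL]; positivity
  have hm : ∀ s y, |moll (fun x => u x s) (ker j) y| ≤ C := fun s y => abs_le.2
    ⟨le_moll (h.ux s).locallyIntegrable fun z _ => (abs_le.1 (h.uC z s)).1,
     moll_le (h.ux s).locallyIntegrable fun z _ => (abs_le.1 (h.uC z s)).2⟩
  have hσm : ∀ x, σ * x ≤ |x| := fun x => by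
    have := le_abs_self (σ * x)
    rwa [abs_mul, hσ, one_mul] at this
  let D : (Fin (n + 1) → ℝ) × ℝ → ℝ := fun z =>
    σ * (moll (fun x => u x z.2) (ker j) z.1 - moll (fun x => u x a) (ker j) z.1)
      - (L * (z.2 - a) + c * ∑ i, (z.1 i - x₀ i) ^ 2)
  have hmc := continuous_moll_slice h.ux h.ut h.uC j
  have hDc : Continuous D := by
    have h2 : Continuous fun z : (Fin (n + 1) → ℝ) × ℝ => moll (fun x => u x a) (ker j) z.1 :=
      hmc.comp (continuous_fst.prodMk continuous_const)
    simp only [D]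
    fun_prop
  have hK : IsCompact (closedBall x₀ ρ ×ˢ Icc a t) := (isCompact_closedBall x₀ ρ).prod isCompact_Icc
  obtain ⟨⟨y, s⟩, ⟨hy, hs⟩, hmax⟩ := hK.exists_isMaxOn
    ⟨(x₀, a), mem_closedBall_self hρ.le, left_mem_Icc.2 hat⟩ hDc.continuousOn
  simp only at hy hs
  have hsum : 0 ≤ ∑ i, (y i - x₀ i) ^ 2 := Finset.sum_nonneg fun i _ => sq_nonneg _
  have hD : D (y, s) ≤ 0 := by
    by_contra! hpos
    have hsa : a < s := by
      refine lt_of_le_of_ne hs.1 fun e => ?_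
      have : D (y, s) ≤ 0 := by
        simp only [D, ← e]
        nlinarith only [hc0, hsum, mul_nonneg hc0 hsum]
      linarith
    have hyρ : dist y x₀ < ρ := by
      by_contra! hge
      have h1 := mul_le_mul_of_nonneg_left (le_sum_sq_of_dist hge hρ.le) hc0
      have h2 := hσm (moll (fun x => u x s) (ker j) y - moll (fun x => u x a) (ker j) y)
      have h3 := abs_sub (moll (fun x => u x s) (ker j) y) (moll (fun x => u x a) (ker j) y)
      have h4 := hm s y
      have h5 := hm a y
      have h6 := mul_nonneg hL0 (sub_nonneg.2 hs.1)
      simp only [D] at hpos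
      linarith
    have ht := htest y hy
    have hder := hd s ⟨hsa, hs.2⟩ _ ht
    have hDt : HasDerivAt (fun s => D (y, s))
        (σ * rhs u f (fun z => ker j (y - z)) s - L) s := by
      have h1 : HasDerivAt (fun s => moll (fun x => u x s) (ker j) y)
        (rhs u f (fun z => ker j (y - z)) s) s := hder
      have h2 := ((h1.sub_const (moll (fun x => u x a) (ker j) y)).const_mul σ).sub
        ((((hasDerivAt_id s).sub_const a).const_mul L).add_const (c * ∑ i, (y i - x₀ i) ^ 2))
      rw [mul_one] at h2
      exact h2
    have h0 : 0 ≤ σ * rhs u f (fun z => ker j (y - z)) s - L :=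
      deriv_nonneg_of_left_max hsa hDt fun s' hs' =>
        hmax ⟨hy, ⟨hs'.1, hs'.2.trans hs.2⟩⟩
    have hsm : ∀ s, ContDiff ℝ ∞ (moll (fun x => u x s) (ker j)) := fun s =>
      moll_contDiff (h.ux s).locallyIntegrable (ker_contDiff j) (ker_hasCompactSupport j)
    have hlap : lapE (fun y => D (y, s)) y ≤ 0 := by
      refine Finset.sum_nonpos fun l _ => dd_dd_nonpos ?_ ?_
      · have h1 := hsm s
        have h2 := hsm a
        have h3 : ContDiff ℝ ∞ fun y => D (y, s) := by
          simp only [D]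
          fun_prop
        exact (h3.of_le two_le_infty).contDiffAt
      · have h1 : ContinuousAt (fun r : ℝ => y + r • (Pi.single l 1 : Fin (n + 1) → ℝ)) 0 := by
          fun_prop
        have h2 : ∀ᶠ z in 𝓝 (y + (0 : ℝ) • (Pi.single l 1 : Fin (n + 1) → ℝ)),
            z ∈ closedBall x₀ ρ := by
          rw [zero_smul, add_zero]
          exact closedBall_mem_nhds_of_mem hyρ
        filter_upwards [h1.eventually h2] with r hr
        simpa using hmax (a := (y + r • (Pi.single l 1 : Fin (n + 1) → ℝ), s)) ⟨hr, hs⟩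
    have hlap2 := lapE_barrier (hsm s) (hsm a) σ (L * (s - a)) c x₀ y
    rw [show lapE (fun y => D (y, s)) y = _ from hlap2,
      lapE_moll (h.ux s) (ker_contDiff j) (ker_hasCompactSupport j),
      lapE_moll (h.ux a) (ker_contDiff j) (ker_hasCompactSupport j)] at hlap
    have h1 := (hσm _).trans (hk _ ht)
    rw [integral_abs_ker, mul_one] at h1
    have h2 : σ * ∫ z, f z s * ker j (y - z) ≤ A := by
      refine (hσm _).trans (abs_le.2 ?_)
      exact ⟨le_moll (h.fx s).locallyIntegrable fun z _ => (abs_le.1 (h.fA z s)).1,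
        moll_le (h.fx s).locallyIntegrable fun z _ => (abs_le.1 (h.fA z s)).2⟩
    have h3 := rad_pos j
    simp only [rhs] at h0
    linarith only [h0, hlap, h1, h2, h3, hL]
  have h1 := (hmax (a := (x₀, t)) ⟨mem_closedBall_self hρ.le, right_mem_Icc.2 hat⟩ :
    D (x₀, t) ≤ D (y, s)).trans hD
  have e : A + k + rad j + 4 * C * (n + 1) / ρ ^ 2 = L := by rw [hL, hc]; ring
  rw [e]
  have h2 : D (x₀, t) = σ * (moll (fun x => u x t) (ker j) x₀ - moll (fun x => u x a) (ker j) x₀)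
      - L * (t - a) := by simp [D]
  linarith

lemma Sep.gap (h : Sep Ω u f C A) {x₀ : Fin (n + 1) → ℝ} {ρ : ℝ} (hρ : 0 < ρ)
    (hb : closedBall x₀ (2 * ρ) ⊆ O) {a t k : ℝ} (hat : a ≤ t)
    (hk : ∀ φ, Test O φ → |∫ x, u x a * lapE φ x| ≤ k * ∫ x, |φ x|)
    (hd : ∀ s ∈ Ioc a t, ∀ φ, Test O φ → HasDerivAt (fun t => ∫ x, u x t * φ x) (rhs u f φ s) s) :
    |u x₀ t - u x₀ a| ≤ (A + k + 4 * C * (n + 1) / ρ ^ 2) * (t - a) := by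
  have main : ∀ σ : ℝ, |σ| = 1 →
      σ * (u x₀ t - u x₀ a) ≤ (A + k + 4 * C * (n + 1) / ρ ^ 2) * (t - a) := by
    intro σ hσ
    have h1 := ((moll_tendsto (h.ux t) x₀).sub (moll_tendsto (h.ux a) x₀)).const_mul σ
    have h2 : Tendsto (fun j : ℕ => (A + k + rad j + 4 * C * (n + 1) / ρ ^ 2) * (t - a)) atTop
        (𝓝 ((A + k + 0 + 4 * C * (n + 1) / ρ ^ 2) * (t - a))) :=
      ((rad_tendsto.const_add (A + k)).add_const _).mul_const _
    rw [add_zero] at h2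
    refine le_of_tendsto_of_tendsto h1 h2 ?_
    filter_upwards [rad_tendsto.eventually_lt_const hρ] with j hj
    exact h.moll_gap hρ hb hat hk hd hσ hj
  have h1 := main 1 (by simp)
  have h2 := main (-1) (by simp)
  exact abs_le.2 ⟨by linarith, by linarith⟩

end Gap

end

section

variable {n : ℕ}

lemma hasDerivAt_of_right {g g' : ℝ → ℝ} (hg : Continuous g) (hg' : Continuous g') {S : Set ℝ}
    (hS : IsOpen S) (h : ∀ t ∈ S, HasDerivWithinAt g (g' t) (Ioi t) t) {t : ℝ} (ht : t ∈ S) :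
    HasDerivAt g (g' t) t := by
  obtain ⟨ε, hε, hb⟩ := Metric.isOpen_iff.1 hS t ht
  have key : ∀ s ∈ Ioo (t - ε / 2) (t + ε / 2),
      g s = g (t - ε / 2) + ∫ y in (t - ε / 2)..s, g' y := by
    intro s hs
    rw [intervalIntegral.integral_eq_sub_of_hasDeriv_right_of_le hs.1.le hg.continuousOn
      (fun y hy => h y (hb ?_)) (hg'.intervalIntegrable _ _)]
    · ring
    · rw [mem_ball, Real.dist_eq, abs_lt]
      constructor <;> linarith [hy.1, hy.2, hs.2]
  have h1 : HasDerivAt (fun s => g (t - ε / 2) + ∫ y in (t - ε / 2)..s, g' y) (g' t) t :=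
    (intervalIntegral.integral_hasDerivAt_right (hg'.intervalIntegrable _ _)
      (hg'.stronglyMeasurableAtFilter _ _) hg'.continuousAt).const_add _
  refine h1.congr_of_eventuallyEq ?_
  filter_upwards [Ioo_mem_nhds (show t - ε / 2 < t by linarith) (show t < t + ε / 2 by linarith)]
    with s hs using key s hs

/-- A Lipschitz estimate assembled from pointwise derivatives on a closed set and estimates from
the left end on its gaps. -/
lemma lip_of_gaps {g : ℝ → ℝ} (hg : Continuous g) {B : Set ℝ} (hB : IsClosed B) {t₀ T L : ℝ}
    (ht₀ : t₀ ∈ B)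
    (hder : ∀ a ∈ B, a ∈ Ico t₀ T → ∃ d, HasDerivAt g d a ∧ |d| < L)
    (hgap : ∀ a ∈ B, ∀ t, t₀ ≤ a → a ≤ t → t ≤ T → (∀ s ∈ Ioc a t, s ∉ B) →
      |g t - g a| ≤ L * (t - a)) :
    ∀ s ∈ Icc t₀ T, |g s - g t₀| ≤ L * (s - t₀) := by
  set S : Set ℝ := {x | ∀ y, t₀ ≤ y → |g (min y x) - g t₀| ≤ L * (min y x - t₀)} with hS
  have hSc : IsClosed S := by
    have : S = ⋂ y, ⋂ (_ : t₀ ≤ y), {x | |g (min y x) - g t₀| ≤ L * (min y x - t₀)} := by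
      ext x; simp [hS]
    rw [this]
    exact isClosed_iInter fun y => isClosed_iInter fun _ =>
      isClosed_le (by fun_prop) (by fun_prop)
  have hext : ∀ x z, x ∈ S → x ≤ z → (∀ w, x < w → w ≤ z → |g w - g t₀| ≤ L * (w - t₀)) →
      z ∈ S := by
    intro x z hx hxz hw y hy
    by_cases h : min y z ≤ x
    · have e : min y z = min y x := by
        rcases le_total y z with h1 | h1
        · rw [min_eq_left h1] at h ⊢; rw [min_eq_left h]
        · rw [min_eq_right h1] at h
          rw [le_antisymm h hxz]
      rw [e]; exact hx y hy
    · exact hw _ (not_le.1 h) (min_le_right _ _)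
  have hsub : Icc t₀ T ⊆ S := by
    refine (hSc.inter isClosed_Icc).Icc_subset_of_forall_exists_gt ?_ ?_
    · intro y hy
      simp [min_eq_right hy]
    · rintro x ⟨hx, hx0, hxT⟩ y hy
      have hxx : |g x - g t₀| ≤ L * (x - t₀) := by simpa using hx x hx0
      by_cases hxB : x ∈ B
      · obtain ⟨d, hd, hdL⟩ := hder x hxB ⟨hx0, hxT⟩
        have h1 := (hasDerivAt_iff_tendsto_slope.1 hd).abs.eventually (gt_mem_nhds hdL)
        rw [eventually_nhdsWithin_iff] at h1
        obtain ⟨δ, hδ, hb⟩ := Metric.eventually_nhds_iff_ball.1 h1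
        have hy' : x < y := hy
        have hz : x < min y (x + δ / 2) := lt_min hy' (by linarith)
        refine ⟨min y (x + δ / 2), hext x _ hx hz.le fun w hw1 hw2 => ?_, hz, min_le_left _ _⟩
        have h2 : w ≤ x + δ / 2 := hw2.trans (min_le_right _ _)
        have h3 := hb w (by rw [mem_ball, Real.dist_eq, abs_lt]; constructor <;> linarith)
          (by simpa using hw1.ne')
        rw [slope_def_field, abs_div, abs_of_pos (sub_pos.2 hw1), div_lt_iff₀ (sub_pos.2 hw1)] at h3
        have h4 := abs_sub_le (g w) (g x) (g t₀)
        linarith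
      · have hne : (B ∩ Icc t₀ x).Nonempty := ⟨t₀, ht₀, le_rfl, hx0⟩
        have hcpt : IsCompact (B ∩ Icc t₀ x) := isCompact_Icc.inter_left hB
        set a := sSup (B ∩ Icc t₀ x) with ha
        obtain ⟨haB, ha0, hax⟩ : a ∈ B ∩ Icc t₀ x := hcpt.sSup_mem hne
        obtain ⟨δ, hδ, hb⟩ := Metric.isOpen_iff.1 hB.isOpen_compl x hxB
        have hy' : x < y := hy
        have hz : x < min (min y T) (x + δ / 2) := lt_min (lt_min hy' hxT) (by linarith)
        refine ⟨min (min y T) (x + δ / 2), hext x _ hx hz.le fun w hw1 hw2 => ?_, hz,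
          (min_le_left _ _).trans (min_le_left _ _)⟩
        have h2 : w ≤ x + δ / 2 := hw2.trans (min_le_right _ _)
        have h3 : w ≤ T := hw2.trans ((min_le_left _ _).trans (min_le_right _ _))
        have h4 := hgap a haB w ha0 (by linarith) h3 fun s hs hsB => by
          rcases le_or_gt s x with h | h
          · have := le_csSup hcpt.bddAbove (⟨hsB, by linarith [hs.1], h⟩ : s ∈ B ∩ Icc t₀ x)
            linarith [hs.1]
          · refine hb ?_ hsB
            rw [mem_ball, Real.dist_eq, abs_lt]
            constructor <;> linarith [hs.2]
        have h5 : |g a - g t₀| ≤ L * (a - t₀) := by simpa [min_eq_left hax] using hx a ha0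
        have h6 := abs_sub_le (g w) (g a) (g t₀)
        linarith
  intro s hs
  simpa using hsub hs s hs.1

section Good

variable {Ω O : Set (Fin (n + 1) → ℝ)} {u f : (Fin (n + 1) → ℝ) → ℝ → ℝ} {C A : ℝ}

lemma Sep.rhs_continuous (h : Sep Ω u f C A) {φ} (hφ : Test O φ) : Continuous (rhs u f φ) :=
  (continuous_slice h.ux h.ut h.uC (lapE_contDiff hφ.smooth).continuous
    (lapE_hasCompactSupport hφ.cpt)).add
  (continuous_slice h.fx h.ft h.fA hφ.smooth.continuous hφ.cpt)

lemma Sep.hasDeriv_right (h : Sep Ω u f C A) {φ} (hφ : Test Ω φ) {t₀ T L : ℝ} (hT : t₀ < T)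
    (hL : ∀ x ∈ tsupport φ, ∀ s ∈ Icc t₀ T, |u x s - u x t₀| ≤ L * (s - t₀)) :
    HasDerivWithinAt (fun t => ∫ x, u x t * φ x) (rhs u f φ t₀) (Ioi t₀) t₀ := by
  have hint : ∀ t, Integrable fun x => u x t * φ x := fun t =>
    ((h.ux t).mul hφ.smooth.continuous).integrable_of_hasCompactSupport hφ.cpt.mul_left
  obtain ⟨hi, he⟩ := integral_mul_lapE (h.reg t₀) (h.ux t₀) hφ.smooth hφ.cpt hφ.supp
  have hfi : Integrable fun x => f x t₀ * φ x :=
    ((h.fx t₀).mul hφ.smooth.continuous).integrable_of_hasCompactSupport hφ.cpt.mul_left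
  have hr : rhs u f φ t₀ = ∫ x, (lapE (fun x => u x t₀) x + f x t₀) * φ x := by
    rw [rhs, he, ← integral_add hi hfi]
    simp only [add_mul]
  rw [hr, hasDerivWithinAt_iff_tendsto_slope' (by simp)]
  have hs : ∀ s, slope (fun t => ∫ x, u x t * φ x) t₀ s
      = ∫ x, (u x s - u x t₀) / (s - t₀) * φ x := by
    intro s
    rw [slope_def_field, ← integral_sub (hint s) (hint t₀), ← integral_div]
    congr 1; ext x; ring
  simp only [funext hs]
  refine tendsto_integral_filter_of_dominated_convergence (fun x => L * |φ x|) ?_ ?_ ?_ ?_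
  · refine Eventually.of_forall fun s => Continuous.aestronglyMeasurable ?_
    exact (((h.ux s).sub (h.ux t₀)).div_const _).mul hφ.smooth.continuous
  · filter_upwards [Ioc_mem_nhdsGT hT] with s hs
    refine Eventually.of_forall fun x => ?_
    by_cases hx : x ∈ tsupport φ
    · rw [norm_mul, Real.norm_eq_abs, Real.norm_eq_abs, abs_div, abs_of_pos (sub_pos.2 hs.1)]
      refine mul_le_mul_of_nonneg_right ?_ (abs_nonneg _)
      rw [div_le_iff₀ (sub_pos.2 hs.1)]
      exact hL x hx s ⟨hs.1.le, hs.2⟩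
    · simp [image_eq_zero_of_notMem_tsupport hx]
  · exact ((hφ.smooth.continuous.integrable_of_hasCompactSupport hφ.cpt).abs).const_mul L
  · refine Eventually.of_forall fun x => ?_
    by_cases hx : x ∈ tsupport φ
    · refine Tendsto.mul_const _ ?_
      have h1 := (h.eqn x (hφ.supp hx) t₀).hasDerivWithinAt (s := Ioi t₀)
      rw [hasDerivWithinAt_iff_tendsto_slope' (by simp)] at h1
      exact h1.congr fun s => slope_def_field _ _ _
    · simp [image_eq_zero_of_notMem_tsupport hx]

/-- The times at which the tested equation holds from the right. -/
def good (O : Set (Fin (n + 1) → ℝ)) (u f : (Fin (n + 1) → ℝ) → ℝ → ℝ) : Set ℝ :=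
  {t | ∀ φ, Test O φ → HasDerivWithinAt (fun t => ∫ x, u x t * φ x) (rhs u f φ t) (Ioi t) t}

lemma Sep.hasDerivAt_of_interior_good (h : Sep Ω u f C A) {t : ℝ} (ht : t ∈ interior (good O u f))
    {φ} (hφ : Test O φ) : HasDerivAt (fun t => ∫ x, u x t * φ x) (rhs u f φ t) t :=
  hasDerivAt_of_right (continuous_slice h.ux h.ut h.uC hφ.smooth.continuous hφ.cpt)
    (h.rhs_continuous hφ) isOpen_interior
    (fun s hs => (interior_subset hs : s ∈ good O u f) φ hφ) ht

lemma Sep.exists_lap_bound (h : Sep Ω u f C A) (hO : IsCompact (closure O)) (hOΩ : closure O ⊆ Ω)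
    (t : ℝ) : ∃ k : ℕ, ∀ φ, Test O φ → |∫ x, u x t * lapE φ x| ≤ k * ∫ x, |φ x| := by
  have hc : ContinuousOn (lapE fun x => u x t) (closure O) := fun x hx =>
    (lapE_continuousAt (h.reg t x (hOΩ hx))).continuousWithinAt
  obtain ⟨M, hM⟩ := hO.exists_bound_of_continuousOn hc
  obtain ⟨k, hk⟩ := exists_nat_ge M
  refine ⟨k, fun φ hφ => ?_⟩
  obtain ⟨hi, he⟩ := integral_mul_lapE (h.reg t) (h.ux t) hφ.smooth hφ.cpt
    (hφ.supp.trans (subset_closure.trans hOΩ))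
  rw [he, ← integral_const_mul]
  refine (abs_integral_le_integral_abs).trans (integral_mono hi.abs
    ((hφ.smooth.continuous.integrable_of_hasCompactSupport hφ.cpt).abs.const_mul _) fun x => ?_)
  by_cases hx : x ∈ tsupport φ
  · simp only [abs_mul]
    exact mul_le_mul_of_nonneg_right ((hM x (subset_closure (hφ.supp hx))).trans hk) (abs_nonneg _)
  · simp [image_eq_zero_of_notMem_tsupport hx]

/-- By a Baire category argument the tested equation holds at all times. -/
lemma Sep.good_eq_univ (h : Sep Ω u f C A) (hO : IsOpen O) (hOc : IsCompact (closure O))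
    (hOΩ : closure O ⊆ Ω) : interior (good O u f) = univ := by
  by_contra hne
  set B : Set ℝ := (interior (good O u f))ᶜ with hBdef
  have hB : IsClosed B := isOpen_interior.isClosed_compl
  have hBne : B.Nonempty := by
    rw [hBdef, nonempty_compl]; exact hne
  have : Nonempty B := hBne.to_subtype
  have : CompleteSpace B := hB.completeSpace_coe
  let F : ℕ → Set B := fun k =>
    {t | ∀ φ, Test O φ → |∫ x, u x t * lapE φ x| ≤ k * ∫ x, |φ x|}
  have hFc : ∀ k, IsClosed (F k) := by
    intro k
    have : F k = ⋂ φ, ⋂ (_ : Test O φ),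
        {t : B | |∫ x, u x t * lapE φ x| ≤ k * ∫ x, |φ x|} := by ext t; simp [F]
    rw [this]
    refine isClosed_iInter fun φ => isClosed_iInter fun hφ => isClosed_le ?_ continuous_const
    exact ((continuous_slice h.ux h.ut h.uC (lapE_contDiff hφ.smooth).continuous
      (lapE_hasCompactSupport hφ.cpt)).comp continuous_subtype_val).abs
  have hFu : ⋃ k, F k = univ := by
    refine eq_univ_of_forall fun t => mem_iUnion.2 ?_
    exact h.exists_lap_bound hOc hOΩ t
  obtain ⟨k, ⟨⟨t₁, ht₁B⟩, ht₁⟩⟩ := nonempty_interior_of_iUnion_of_closed hFc hFu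
  obtain ⟨ε, hε, hball⟩ := Metric.isOpen_iff.1 isOpen_interior _ ht₁
  have hk : ∀ t ∈ B, dist t t₁ < ε →
      ∀ φ, Test O φ → |∫ x, u x t * lapE φ x| ≤ k * ∫ x, |φ x| := fun t ht hd =>
    interior_subset (hball (show (⟨t, ht⟩ : B) ∈ ball ⟨t₁, ht₁B⟩ ε from hd))
  have hC0 : 0 ≤ C := (abs_nonneg _).trans (h.uC 0 0)
  have hgood : ball t₁ ε ⊆ good O u f := by
    intro t ht φ hφ
    by_cases htB : t ∈ B
    · rw [mem_ball, Real.dist_eq, abs_lt] at ht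
      obtain ⟨T, hT⟩ : ∃ T, T = (t + (t₁ + ε)) / 2 := ⟨_, rfl⟩
      have htT : t < T := by linarith [ht.2]
      have hin : ∀ s ∈ Icc t T, dist s t₁ < ε := fun s hs => by
        rw [Real.dist_eq, abs_lt]
        constructor <;> linarith [hs.1, hs.2, ht.1, ht.2]
      obtain ⟨δ, hδ, hth⟩ := hφ.cpt.exists_cthickening_subset_open hO hφ.supp
      have hball2 : ∀ x ∈ tsupport φ, closedBall x (2 * (δ / 2)) ⊆ O := fun x hx => by
        rw [mul_div_cancel₀ δ two_ne_zero]
        exact (closedBall_subset_cthickening hx δ).trans hth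
      have hb0 : 0 ≤ 4 * C * (n + 1) / (δ / 2) ^ 2 := by positivity
      refine h.hasDeriv_right ⟨hφ.smooth, hφ.cpt, hφ.supp.trans (subset_closure.trans hOΩ)⟩ htT
        (L := A + k + 4 * C * (n + 1) / (δ / 2) ^ 2 + 1) fun x hx => ?_
      have hxO : x ∈ O := hφ.supp hx
      refine lip_of_gaps (h.ut x) hB htB ?_ ?_
      · intro a haB ha
        refine ⟨_, h.eqn x (hOΩ (subset_closure hxO)) a, ?_⟩
        have h1 := lapE_le_of_weak hO (fun x hx => h.reg a x (hOΩ (subset_closure hx))) (h.ux a)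
          (fun φ h1 h2 h3 => hk a haB (hin a ⟨ha.1, ha.2.le⟩) φ ⟨h1, h2, h3⟩) hxO
        have h2 := abs_add_le (lapE (fun x => u x a) x) (f x a)
        have h3 := h.fA x a
        linarith
      · intro a haB s hta has hsT hgap
        have h1 := h.gap (half_pos hδ) (hball2 x hx) has (hk a haB (hin a ⟨hta, has.trans hsT⟩))
          fun s' hs' φ hφ => h.hasDerivAt_of_interior_good (not_not.1 (hgap s' hs')) hφ
        refine h1.trans ?_
        linarith [sub_nonneg.2 has]
    · exact (interior_subset (not_not.1 htB) : t ∈ good O u f) φ hφ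
  exact ht₁B (interior_maximal hgood isOpen_ball (mem_ball_self hε))

lemma Sep.hasDerivAt_test (h : Sep Ω u f C A) (hΩ : IsOpen Ω) {φ} (hφ : Test Ω φ) (t : ℝ) :
    HasDerivAt (fun t => ∫ x, u x t * φ x) (rhs u f φ t) t := by
  obtain ⟨δ, hδ, hth⟩ := hφ.cpt.exists_cthickening_subset_open hΩ hφ.supp
  have h1 : closure (thickening δ (tsupport φ)) ⊆ cthickening δ (tsupport φ) :=
    closure_thickening_subset_cthickening _ _
  have h2 : IsCompact (closure (thickening δ (tsupport φ))) :=
    (hφ.cpt.isCompact.cthickening).of_isClosed_subset isClosed_closure h1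
  refine h.hasDerivAt_of_interior_good (O := thickening δ (tsupport φ)) ?_
    ⟨hφ.smooth, hφ.cpt, self_subset_thickening hδ _⟩
  rw [h.good_eq_univ isOpen_thickening h2 (h1.trans hth)]
  trivial

end Good

end

section

variable {n : ℕ}

lemma stronglyMeasurable_of_separate {u : (Fin (n + 1) → ℝ) → ℝ → ℝ}
    (hx : ∀ t, Continuous fun x => u x t) (ht : ∀ x, Continuous (u x)) :
    StronglyMeasurable fun z : X n => u z.1 z.2 := by
  have := stronglyMeasurable_uncurry_of_continuous_of_stronglyMeasurable (u := fun x t => u x t)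
    (fun t => hx t) fun x => (ht x).stronglyMeasurable
  exact this

lemma locallyIntegrable_of_bounded {u : X n → ℝ} (hu : AEStronglyMeasurable u) {C : ℝ}
    (hC : ∀ z, |u z| ≤ C) : LocallyIntegrable u :=
  (locallyIntegrable_const C).mono hu (Eventually.of_forall fun z => by
    rw [Real.norm_eq_abs, Real.norm_eq_abs]
    exact (hC z).trans (le_abs_self _))

lemma dd_slice {ψ : X n → ℝ} (hψ : Differentiable ℝ ψ) (i : Fin (n + 1)) (t : ℝ) :
    dd (Pi.single i 1) (fun x => ψ (x, t)) = fun x => dd (ex i) ψ (x, t) := by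
  ext x
  have h1 : HasFDerivAt (fun x : Fin (n + 1) → ℝ => ((x, t) : X n))
      (ContinuousLinearMap.inl ℝ (Fin (n + 1) → ℝ) ℝ) x := hasFDerivAt_prodMk_left x t
  have h2 := ((hψ (x, t)).hasFDerivAt.comp x h1).fderiv
  have h3 : fderiv ℝ (fun x => ψ (x, t)) x = _ := h2
  simp only [dd]
  rw [h3]
  simp [ex]

lemma lapE_slice {ψ : X n → ℝ} (hψ : ContDiff ℝ ∞ ψ) (t : ℝ) (x : Fin (n + 1) → ℝ) :
    lapE (fun x => ψ (x, t)) x = ∑ i, dd (ex i) (dd (ex i) ψ) (x, t) := by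
  simp only [lapE, dd_slice (hψ.differentiable (by simp)),
    dd_slice ((dd_contDiff hψ).differentiable (by simp))]

lemma test_slice {Ω : Set (Fin (n + 1) → ℝ)} {ψ : X n → ℝ} (hψ : ContDiff ℝ ∞ ψ)
    (hc : HasCompactSupport ψ) (hs : tsupport ψ ⊆ {z | z.1 ∈ Ω}) (t : ℝ) :
    Test Ω fun x => ψ (x, t) := by
  have hK : IsCompact (Prod.fst '' tsupport ψ) := hc.isCompact.image continuous_fst
  have hsub : tsupport (fun x => ψ (x, t)) ⊆ Prod.fst '' tsupport ψ :=
    closure_minimal (fun x hx => ⟨(x, t), subset_tsupport _ hx, rfl⟩) hK.isClosed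
  refine ⟨hψ.comp (contDiff_id.prodMk contDiff_const),
    hK.of_isClosed_subset (isClosed_tsupport _) hsub, hsub.trans ?_⟩
  rintro _ ⟨z, hz, rfl⟩
  exact hs hz

section

variable {Ω : Set (Fin (n + 1) → ℝ)} {u f : (Fin (n + 1) → ℝ) → ℝ → ℝ} {C A : ℝ}

lemma Sep.hasDerivAt_moving (h : Sep Ω u f C A) (hΩ : IsOpen Ω) {ψ : X n → ℝ}
    (hψ : ContDiff ℝ ∞ ψ) (hc : HasCompactSupport ψ) (hs : tsupport ψ ⊆ {z | z.1 ∈ Ω}) (t : ℝ) :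
    HasDerivAt (fun s => ∫ x, u x s * ψ (x, s))
      (rhs u f (fun x => ψ (x, t)) t + ∫ x, u x t * dd et ψ (x, t)) t := by
  have hC0 : 0 ≤ C := (abs_nonneg _).trans (h.uC 0 0)
  have hK : IsCompact (Prod.fst '' tsupport ψ) := hc.isCompact.image continuous_fst
  obtain ⟨K, hlip⟩ := hψ.lipschitzWith_of_hasCompactSupport hc (by simp)
  have hψc : ∀ s, Continuous fun x : Fin (n + 1) → ℝ => ψ (x, s) := fun s =>
    hψ.continuous.comp (continuous_id.prodMk continuous_const)
  have hint : ∀ s r, Integrable fun x => u x s * ψ (x, r) := fun s r =>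
    ((h.ux s).mul (hψc r)).integrable_of_hasCompactSupport (test_slice hψ hc hs r).cpt.mul_left
  have h1 := h.hasDerivAt_test hΩ (test_slice hψ hc hs t) t
  have h2 : HasDerivAt (fun s => ∫ x, u x s * (ψ (x, s) - ψ (x, t)))
      (∫ x, u x t * dd et ψ (x, t)) t := by
    rw [hasDerivAt_iff_tendsto_slope]
    have e : ∀ s, slope (fun s => ∫ x, u x s * (ψ (x, s) - ψ (x, t))) t s
        = ∫ x, u x s * ((ψ (x, s) - ψ (x, t)) / (s - t)) := by
      intro s
      simp only [slope_def_field, sub_self, mul_zero, integral_zero, sub_zero]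
      rw [← integral_div]
      simp only [mul_div_assoc]
    simp only [funext e]
    refine tendsto_integral_filter_of_dominated_convergence
      ((Prod.fst '' tsupport ψ).indicator fun _ => C * K) ?_ ?_ ?_ ?_
    · refine Eventually.of_forall fun s => Continuous.aestronglyMeasurable ?_
      exact (h.ux s).mul (((hψc s).sub (hψc t)).div_const _)
    · refine Eventually.of_forall fun s => Eventually.of_forall fun x => ?_
      by_cases hx : x ∈ Prod.fst '' tsupport ψ
      · rw [indicator_of_mem hx, norm_mul, Real.norm_eq_abs, Real.norm_eq_abs, abs_div]
        refine mul_le_mul (h.uC x s) ?_ (by positivity) hC0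
        refine div_le_of_le_mul₀ (abs_nonneg _) K.2 ?_
        have h3 := hlip.dist_le_mul (x, s) (x, t)
        rw [Prod.dist_eq, dist_self, Real.dist_eq, Real.dist_eq,
          max_eq_right (abs_nonneg (s - t))] at h3
        exact h3
      · have h0 : ∀ r, ψ (x, r) = 0 := fun r => by
          by_contra hr
          exact hx ⟨(x, r), subset_tsupport _ hr, rfl⟩
        simp [indicator_of_notMem hx, h0]
    · exact (integrableOn_const hK.measure_lt_top.ne).integrable_indicator
        hK.isClosed.measurableSet
    · refine Eventually.of_forall fun x => ?_
      have h3 : HasDerivAt (fun s => ψ (x, s)) (dd et ψ (x, t)) t := by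
        have h4 : HasDerivAt (fun s : ℝ => ((x, s) : X n)) et t :=
          (hasDerivAt_const t x).prodMk (hasDerivAt_id t)
        exact (hψ.differentiable (by simp) (x, t)).hasFDerivAt.comp_hasDerivAt t h4
      rw [hasDerivAt_iff_tendsto_slope] at h3
      have h5 : Tendsto (u x) (𝓝[≠] t) (𝓝 (u x t)) := ((h.ut x).tendsto t).mono_left inf_le_left
      exact h5.mul (h3.congr fun s => slope_def_field _ _ _)
  refine (h1.add h2).congr_of_eventuallyEq (Eventually.of_forall fun s => ?_)
  have e2 : ∀ x, u x s * (ψ (x, s) - ψ (x, t)) = u x s * ψ (x, s) - u x s * ψ (x, t) :=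
    fun x => mul_sub _ _ _
  simp only [Pi.add_apply, e2]
  rw [integral_sub (hint s s) (hint s t)]
  ring

/-- A separately regular solution solves the equation in the sense of distributions. -/
theorem Sep.weak (h : Sep Ω u f C A) (hΩ : IsOpen Ω) :
    Weak {z : X n | z.1 ∈ Ω} (fun z => u z.1 z.2) fun z => f z.1 z.2 := by
  intro ψ hψ hc hs
  have hu := locallyIntegrable_of_bounded
    (stronglyMeasurable_of_separate h.ux h.ut).aestronglyMeasurable (fun z => h.uC z.1 z.2)
  have hf := locallyIntegrable_of_bounded
    (stronglyMeasurable_of_separate h.fx h.ft).aestronglyMeasurable (fun z => h.fA z.1 z.2)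
  have i0 : Integrable fun z : X n => u z.1 z.2 * ψ z := LI_mul_integrable hu hψ.continuous hc
  have i1 : Integrable fun z : X n => u z.1 z.2 * heatS ψ z :=
    LI_mul_integrable hu (heatS_contDiff hψ).continuous (heatS_hasCompactSupport hc)
  have i2 : Integrable fun z : X n => f z.1 z.2 * ψ z := LI_mul_integrable hf hψ.continuous hc
  have hslice : ∀ {g : X n → ℝ}, Continuous g → HasCompactSupport g → ∀ t,
      Continuous (fun x => g (x, t)) ∧ HasCompactSupport fun x => g (x, t) := by
    intro g hg hgc t
    have hK : IsCompact (Prod.fst '' tsupport g) := hgc.isCompact.image continuous_fst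
    refine ⟨hg.comp (continuous_id.prodMk continuous_const),
      hK.of_isClosed_subset (isClosed_tsupport _) (closure_minimal
        (fun x hx => ⟨(x, t), subset_tsupport _ hx, rfl⟩) hK.isClosed)⟩
  have hd : ∀ t, rhs u f (fun x => ψ (x, t)) t + ∫ x, u x t * dd et ψ (x, t)
      = ∫ x, (f x t * ψ (x, t) - u x t * heatS ψ (x, t)) := by
    intro t
    have ht := test_slice hψ hc hs t
    obtain ⟨c1, c2⟩ := hslice (dd_contDiff (v := et) hψ).continuous (dd_hasCompactSupport hc) t
    have j1 : Integrable fun x => u x t * lapE (fun x => ψ (x, t)) x :=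
      ((h.ux t).mul (lapE_contDiff ht.smooth).continuous).integrable_of_hasCompactSupport
        (lapE_hasCompactSupport ht.cpt).mul_left
    have j2 : Integrable fun x => f x t * ψ (x, t) :=
      ((h.fx t).mul ht.smooth.continuous).integrable_of_hasCompactSupport ht.cpt.mul_left
    have j3 : Integrable fun x => u x t * dd et ψ (x, t) :=
      ((h.ux t).mul c1).integrable_of_hasCompactSupport c2.mul_left
    have j12 : Integrable fun x => u x t * lapE (fun x => ψ (x, t)) x + f x t * ψ (x, t) :=
      j1.add j2
    rw [rhs, ← integral_add j1 j2, ← integral_add j12 j3]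
    congr 1
    ext x
    simp only [heatS, lapE_slice hψ]
    ring
  have hder : ∀ t, HasDerivAt (fun s => ∫ x, u x s * ψ (x, s))
      (∫ x, (f x t * ψ (x, t) - u x t * heatS ψ (x, t))) t := fun t =>
    hd t ▸ h.hasDerivAt_moving hΩ hψ hc hs t
  have i3 : Integrable fun z : X n => f z.1 z.2 * ψ z - u z.1 z.2 * heatS ψ z := i2.sub i1
  rw [Measure.volume_eq_prod] at i0 i3
  have h0 := integral_eq_zero_of_hasDerivAt_of_integrable hder i3.integral_prod_right
    i0.integral_prod_right
  have h1 : ∫ z : X n, (f z.1 z.2 * ψ z - u z.1 z.2 * heatS ψ z) = 0 := by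
    rw [Measure.volume_eq_prod, integral_prod_symm _ i3]
    exact h0
  rw [integral_sub i2 i1] at h1
  linarith only [h1]

end

end

section

variable {n : ℕ}

/-! ### Odd reflection -/

/-- The dilation of the first space coordinate. -/
noncomputable def dil (a : ℝ) (z : X n) : X n := (fun k => (Function.update 1 0 a : Fin (n + 1) → ℝ) k * z.1 k, z.2)

@[simp] lemma dil_zero_coord (a : ℝ) (z : X n) : (dil a z).1 0 = a * z.1 0 := by simp [dil]

lemma dil_coord (a : ℝ) (z : X n) {k : Fin (n + 1)} (hk : k ≠ 0) : (dil a z).1 k = z.1 k := by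
  simp [dil, hk]

@[simp] lemma dil_time (a : ℝ) (z : X n) : (dil a z).2 = z.2 := rfl

lemma dil_continuous : Continuous fun p : ℝ × X n => dil p.1 p.2 := by
  have : (fun p : ℝ × X n => dil p.1 p.2)
      = fun p => (fun k => (if k = 0 then p.1 else 1) * p.2.1 k, p.2.2) := by
    ext p k
    · by_cases hk : k = 0
      · subst hk; simp
      · simp [dil_coord _ _ hk, hk]
    · rfl
  rw [this]
  refine Continuous.prodMk (continuous_pi fun k => ?_) (by fun_prop)
  split_ifs <;> fun_prop

lemma dil_map_volume {a : ℝ} (ha : 0 < a) :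
    Measure.map (dil a : X n → X n) volume = ENNReal.ofReal a⁻¹ • volume := by
  set D : Fin (n + 1) → ℝ := Function.update 1 0 a with hD
  have hdet : Matrix.det (Matrix.diagonal D) = a := by
    rw [Matrix.det_diagonal, Fin.prod_univ_succ]
    simp [hD]
  have h1 := Real.map_matrix_volume_pi_eq_smul_volume_pi (M := Matrix.diagonal D)
    (by rw [hdet]; exact ha.ne')
  rw [hdet, abs_of_pos (inv_pos.2 ha)] at h1
  have h3 := Measure.map_prod_map (volume : Measure (Fin (n + 1) → ℝ)) (volume : Measure ℝ)
    (f := Matrix.toLin' (Matrix.diagonal D)) (g := id)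
    (LinearMap.continuous_of_finiteDimensional _).measurable measurable_id
  rw [h1, Measure.map_id, Measure.prod_smul_left] at h3
  have h4 : (dil a : X n → X n) = Prod.map (Matrix.toLin' (Matrix.diagonal D)) id := by
    ext z k
    · simp [dil, hD, Matrix.mulVec_diagonal]
    · rfl
  rw [h4, Measure.volume_eq_prod, ← h3]

lemma integral_dil {a : ℝ} (ha : 0 < a) {g : X n → ℝ} (hg : StronglyMeasurable g) :
    ∫ z, g z = a * ∫ z, g (dil a z) := by
  have hm : Measurable (dil a : X n → X n) :=
    (dil_continuous.comp (continuous_const.prodMk continuous_id)).measurable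
  rw [← integral_map hm.aemeasurable hg.aestronglyMeasurable, dil_map_volume ha,
    integral_smul_measure, ENNReal.toReal_ofReal (inv_pos.2 ha).le, smul_eq_mul, ← mul_assoc,
    mul_inv_cancel₀ ha.ne', one_mul]

lemma heatS_cutoff {κ : ℝ → ℝ} (hκ : ContDiff ℝ ∞ κ) {ψ : X n → ℝ} (hψ : ContDiff ℝ ∞ ψ)
    (z : X n) :
    heatS (fun z => κ (z.1 0) * ψ z) z = κ (z.1 0) * heatS ψ z
      - (2 * deriv κ (z.1 0) * dd (ex 0) ψ z + deriv (deriv κ) (z.1 0) * ψ z) := by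
  have hc : ContDiff ℝ ∞ fun z : X n => z.1 0 := by fun_prop
  have h1 : ContDiffAt ℝ 2 (fun z : X n => κ (z.1 0)) z :=
    ((hκ.comp hc).of_le two_le_infty).contDiffAt
  have h2 : ContDiffAt ℝ 2 ψ z := (hψ.of_le two_le_infty).contDiffAt
  have h3 : ∀ v : X n, dd v (fun z : X n => κ (z.1 0)) z = deriv κ (z.1 0) * v.1 0 := fun v => by
    rw [dd_comp (g := κ) (f := fun z : X n => z.1 0) (hκ.differentiable (by simp) _)
      (hc.differentiable (by simp) _), dd_coord]
  have h4 : ∀ v : X n, dd v (dd v (fun z : X n => κ (z.1 0))) z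
      = deriv (deriv κ) (z.1 0) * v.1 0 ^ 2 := fun v => by
    rw [dd_dd_comp (g := κ) (f := fun z : X n => z.1 0) (hκ.of_le two_le_infty).contDiffAt
      (hc.of_le two_le_infty).contDiffAt, dd_coord, dd_const, mul_zero, add_zero]
  have h5 : ∀ i : Fin (n + 1), (ex i : X n).1 0 = if i = 0 then 1 else 0 := fun i => by
    by_cases hi : i = 0
    · subst hi; simp [ex]
    · simp [ex, hi, Ne.symm hi]
  simp only [heatS, dd_dd_mul h1 h2, dd_mul (h1.differentiableAt (by norm_num))
    (h2.differentiableAt (by norm_num)), h3, h4, h5, Finset.sum_add_distrib, ← Finset.mul_sum]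
  simp [et]
  ring

lemma exists_cutoff : ∃ θ : ℝ → ℝ, ContDiff ℝ ∞ θ ∧ (∀ s ≤ 1, θ s = 0) ∧ (∀ s, 2 ≤ s → θ s = 1) ∧
    (∀ s, |θ s| ≤ 1) ∧ ∃ T, 0 ≤ T ∧ (∀ s, |deriv θ s| ≤ T) ∧ (∀ s, |deriv (deriv θ) s * s| ≤ T) ∧
    (∀ s, 2 < |s| → deriv θ s = 0 ∧ deriv (deriv θ) s = 0) := by
  set θ : ℝ → ℝ := fun s => Real.smoothTransition (s - 1) with hθ
  have hs : ContDiff ℝ ∞ θ := Real.smoothTransition.contDiff.comp (contDiff_id.sub contDiff_const)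
  have h0 : ∀ s ≤ 1, θ s = 0 := fun s h =>
    Real.smoothTransition.zero_of_nonpos (by linarith)
  have h1 : ∀ s, 2 ≤ s → θ s = 1 := fun s h => Real.smoothTransition.one_of_one_le (by linarith)
  have hs1 : ContDiff ℝ ∞ (deriv θ) := hs.iterate_deriv 1
  have hs2 : ContDiff ℝ ∞ (deriv (deriv θ)) := hs.iterate_deriv 2
  have hz : ∀ s, 2 < |s| → θ =ᶠ[𝓝 s] (fun _ => θ s) := by
    intro s h
    rcases lt_abs.1 h with h | h
    · filter_upwards [lt_mem_nhds h] with y hy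
      rw [h1 y hy.le, h1 s h.le]
    · filter_upwards [gt_mem_nhds (show s < 1 by linarith)] with y hy
      rw [h0 y hy.le, h0 s (by linarith)]
  have hd : ∀ s, 2 < |s| → deriv θ s = 0 := fun s h => by
    rw [(hz s h).deriv_eq, deriv_const]
  have hdd : ∀ s, 2 < |s| → deriv (deriv θ) s = 0 := fun s h => by
    have : deriv θ =ᶠ[𝓝 s] fun _ => 0 := by
      filter_upwards [continuous_abs.continuousAt.eventually (lt_mem_nhds h)] with y hy
      exact hd y hy
    rw [this.deriv_eq, deriv_const]
  obtain ⟨T1, hT1⟩ := (isCompact_Icc (a := (-2 : ℝ)) (b := 2)).exists_bound_of_continuousOn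
    hs1.continuous.continuousOn
  obtain ⟨T2, hT2⟩ := (isCompact_Icc (a := (-2 : ℝ)) (b := 2)).exists_bound_of_continuousOn
    (hs2.continuous.mul continuous_id).continuousOn
  have hT0 : 0 ≤ max T1 T2 := (norm_nonneg _).trans
    ((hT1 0 (by norm_num)).trans (le_max_left _ _))
  refine ⟨θ, hs, h0, h1, fun s => ?_, max T1 T2, hT0, fun s => ?_, fun s => ?_,
    fun s h => ⟨hd s h, hdd s h⟩⟩
  · rw [abs_of_nonneg (Real.smoothTransition.nonneg _)]
    exact Real.smoothTransition.le_one _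
  · by_cases h : 2 < |s|
    · rw [hd s h, abs_zero]; exact hT0
    · exact (hT1 s (abs_le.1 (not_lt.1 h))).trans (le_max_left _ _)
  · by_cases h : 2 < |s|
    · rw [hdd s h, zero_mul, abs_zero]; exact hT0
    · exact (hT2 s (abs_le.1 (not_lt.1 h))).trans (le_max_right _ _)

lemma abs_sub_dil_le {ψ : X n → ℝ} {L : NNReal} (hL : LipschitzWith L ψ)
    (h0 : ∀ z : X n, z.1 0 = 0 → ψ z = 0) {a : ℝ} (ha : 0 < a) (z : X n) :
    |ψ (dil a z)| ≤ L * (a * |z.1 0|) := by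
  have h1 := hL.dist_le_mul (dil a z) (dil 0 z)
  rw [h0 (dil 0 z) (by simp), Real.dist_eq, sub_zero] at h1
  refine h1.trans (mul_le_mul_of_nonneg_left ?_ L.2)
  rw [Prod.dist_eq, dil_time, dil_time, dist_self]
  refine max_le ((dist_pi_le_iff (by positivity)).2 fun k => ?_) (by positivity)
  by_cases hk : k = 0
  · subst hk
    rw [dil_zero_coord, dil_zero_coord, zero_mul, Real.dist_eq, sub_zero, abs_mul, abs_of_pos ha]
  · rw [dil_coord _ _ hk, dil_coord _ _ hk, dist_self]; positivity

lemma dil_notMem_closedBall {R a : ℝ} {z : X n} (hz : z ∉ closedBall (0 : X n) (max R 2))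
    (h2 : |z.1 0| ≤ 2) : dil a z ∉ closedBall (0 : X n) R := by
  intro h
  apply hz
  rw [mem_closedBall_zero_iff, Prod.norm_def] at h ⊢
  refine max_le ((pi_norm_le_iff_of_nonneg (le_max_of_le_right zero_le_two)).2 fun k => ?_) ?_
  · by_cases hk : k = 0
    · subst hk; exact h2.trans (le_max_right _ _)
    · rw [← dil_coord a z hk]
      exact ((norm_le_pi_norm _ k).trans ((le_max_left _ _).trans h)).trans (le_max_left _ _)
  · exact ((le_max_right _ _).trans h).trans (le_max_left _ _)

section

variable {u f : X n → ℝ} {C A : ℝ}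

lemma Weak.integral_half_eq_zero (hw : Weak {z : X n | 0 < z.1 0} u f) (hu : StronglyMeasurable u)
    (hf : StronglyMeasurable f) (hC : ∀ z, |u z| ≤ C) (hA : ∀ z, |f z| ≤ A)
    (hlim : ∀ z, Tendsto (fun a => u (dil a z)) (𝓝 0) (𝓝 0)) {ψ : X n → ℝ} (hψ : ContDiff ℝ ∞ ψ)
    (hc : HasCompactSupport ψ) (h0 : ∀ z : X n, z.1 0 = 0 → ψ z = 0) :
    ∫ z, {z : X n | 0 < z.1 0}.indicator (fun z => u z * heatS ψ z - f z * ψ z) z = 0 := by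
  have hC0 : 0 ≤ C := (abs_nonneg _).trans (hC 0)
  have hli := locallyIntegrable_of_bounded hu.aestronglyMeasurable hC
  have hlf := locallyIntegrable_of_bounded hf.aestronglyMeasurable hA
  have hHi : Integrable fun z => u z * heatS ψ z - f z * ψ z :=
    (LI_mul_integrable hli (heatS_contDiff hψ).continuous (heatS_hasCompactSupport hc)).sub
      (LI_mul_integrable hlf hψ.continuous hc)
  set H : X n → ℝ := fun z => u z * heatS ψ z - f z * ψ z with hH
  obtain ⟨θ, hθ, hθ0, hθ1, hθb, T, hT0, hT1, hT2, hT⟩ := exists_cutoff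
  obtain ⟨L, hL⟩ := hψ.lipschitzWith_of_hasCompactSupport hc (by simp)
  have hd : Continuous (dd (ex 0) ψ) := (dd_contDiff hψ).continuous
  have hdc : HasCompactSupport (dd (ex 0) ψ) := dd_hasCompactSupport hc
  obtain ⟨M, hM⟩ := hdc.exists_bound_of_continuous hd
  obtain ⟨R, hR⟩ := hc.isCompact.isBounded.subset_closedBall (0 : X n)
  have hM0 : 0 ≤ M := (norm_nonneg _).trans (hM 0)
  have hout : ∀ z, z ∉ closedBall (0 : X n) R → ψ z = 0 ∧ dd (ex 0) ψ z = 0 := fun z hz =>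
    ⟨image_eq_zero_of_notMem_tsupport fun h => hz (hR h),
      image_eq_zero_of_notMem_tsupport fun h => hz (hR (dd_tsupport h))⟩
  have hdT : ContDiff ℝ ∞ (deriv θ) := hθ.iterate_deriv 1
  have hddT : ContDiff ℝ ∞ (deriv (deriv θ)) := hθ.iterate_deriv 2
  set B : Set (X n) := closedBall 0 (max R 2) with hB
  set b : ℕ → ℝ := fun j => j + 1 with hb
  have hb0 : ∀ j, 0 < b j := fun j => by positivity
  have hrb : ∀ j, rad j * b j = 1 := fun j => by
    simp only [rad, hb]; exact one_div_mul_cancel (hb0 j).ne'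
  set E : ℕ → X n → ℝ := fun j z => u (dil (rad j) z) * (2 * deriv θ (z.1 0) *
    dd (ex 0) ψ (dil (rad j) z) + deriv (deriv θ) (z.1 0) * (b j * ψ (dil (rad j) z))) with hE
  have hEb : ∀ j z, |E j z| ≤ B.indicator (fun z => |u (dil (rad j) z)| * (2 * T * M + T * L)) z := by
    intro j z
    by_cases hz : z ∈ B
    · rw [indicator_of_mem hz, hE, abs_mul]
      refine mul_le_mul_of_nonneg_left ((abs_add_le _ _).trans (add_le_add ?_ ?_)) (abs_nonneg _)
      · rw [abs_mul, abs_mul, abs_two]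
        exact mul_le_mul (mul_le_mul_of_nonneg_left (hT1 _) zero_le_two) (hM _) (abs_nonneg _)
          (by positivity)
      · rw [abs_mul, abs_mul, abs_of_pos (hb0 j)]
        have h1 := abs_sub_dil_le hL h0 (rad_pos j) z
        calc |deriv (deriv θ) (z.1 0)| * (b j * |ψ (dil (rad j) z)|)
            ≤ |deriv (deriv θ) (z.1 0)| * (b j * (L * (rad j * |z.1 0|))) := by
              have := hb0 j; gcongr
          _ = |deriv (deriv θ) (z.1 0) * z.1 0| * L * (rad j * b j) := by rw [abs_mul]; ring
          _ ≤ T * L := by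
              rw [hrb, mul_one]
              exact mul_le_mul_of_nonneg_right (hT2 _) L.2
    · rw [indicator_of_notMem hz]
      refine le_of_eq (abs_eq_zero.2 ?_)
      by_cases h2 : 2 < |z.1 0|
      · simp [hE, hT _ h2]
      · simp [hE, hout _ (dil_notMem_closedBall hz (not_lt.1 h2))]
  have hdm : ∀ a, Continuous (dil a : X n → X n) := fun a =>
    dil_continuous.comp (continuous_const.prodMk continuous_id)
  have hEm : ∀ j, StronglyMeasurable (E j) := fun j => by
    refine (hu.comp_measurable (hdm _).measurable).mul (Continuous.stronglyMeasurable ?_)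
    have h1 := hd.comp (hdm (rad j))
    have h2 := hψ.continuous.comp (hdm (rad j))
    have h3 : Continuous fun z : X n => deriv θ (z.1 0) := hdT.continuous.comp (by fun_prop)
    have h4 : Continuous fun z : X n => deriv (deriv θ) (z.1 0) := hddT.continuous.comp (by fun_prop)
    exact ((continuous_const.mul h3).mul h1).add (h4.mul (continuous_const.mul h2))
  have hBi : Integrable (B.indicator fun _ => C * (2 * T * M + T * L)) :=
    (integrableOn_const (isCompact_closedBall _ _).measure_lt_top.ne).integrable_indicator
      measurableSet_closedBall
  have hElim : Tendsto (fun j => ∫ z, E j z) atTop (𝓝 0) := by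
    have hK : 0 ≤ 2 * T * M + T * L := by positivity
    rw [show (0 : ℝ) = ∫ _ : X n, (0 : ℝ) by simp]
    refine tendsto_integral_of_dominated_convergence _ (fun j => (hEm j).aestronglyMeasurable) hBi
      (fun j => Eventually.of_forall fun z => (hEb j z).trans ?_) (Eventually.of_forall fun z => ?_)
    · by_cases hz : z ∈ B
      · rw [indicator_of_mem hz, indicator_of_mem hz]
        exact mul_le_mul_of_nonneg_right (hC _) hK
      · rw [indicator_of_notMem hz, indicator_of_notMem hz]
    · refine squeeze_zero_norm (fun j => (hEb j z).trans (indicator_le_self' (fun _ _ => by positivity) z)) ?_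
      have := ((hlim z).comp rad_tendsto).abs.mul_const (2 * T * M + T * L)
      simpa using this
  have hEi : ∀ j, Integrable (fun z => u z * (2 * (b j * deriv θ (b j * z.1 0)) * dd (ex 0) ψ z
      + b j * (b j * deriv (deriv θ) (b j * z.1 0)) * ψ z)) := by
    intro j
    refine LI_mul_integrable hli ?_ ?_
    · have h3 : Continuous fun z : X n => deriv θ (b j * z.1 0) :=
        hdT.continuous.comp (by fun_prop)
      have h4 : Continuous fun z : X n => deriv (deriv θ) (b j * z.1 0) :=
        hddT.continuous.comp (by fun_prop)
      have := hψ.continuous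
      fun_prop
    · exact hdc.mul_left.add hc.mul_left
  have hkey : ∀ j, ∫ z : X n, θ (b j * z.1 0) * H z = ∫ z, E j z := by
    intro j
    have hκ : ContDiff ℝ ∞ fun s => θ (b j * s) := hθ.comp (contDiff_const.mul contDiff_id)
    have hκ1 : deriv (fun s => θ (b j * s)) = fun s => b j * deriv θ (b j * s) := by
      ext s; rw [deriv_comp_mul_left (b j) θ s, smul_eq_mul]
    have hκ2 : ∀ s, deriv (deriv (fun s => θ (b j * s))) s
        = b j * (b j * deriv (deriv θ) (b j * s)) := by
      intro s
      rw [hκ1, deriv_const_mul_field, deriv_comp_mul_left (b j) (deriv θ) s, smul_eq_mul]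
    have hcs : HasCompactSupport fun z : X n => θ (b j * z.1 0) * ψ z := hc.mul_left
    have hsm : ContDiff ℝ ∞ fun z : X n => θ (b j * z.1 0) * ψ z :=
      (hκ.comp (f := fun z : X n => z.1 0) (by fun_prop)).mul hψ
    have hsupp : tsupport (fun z : X n => θ (b j * z.1 0) * ψ z) ⊆ {z | 0 < z.1 0} := by
      have h1 : tsupport (fun z : X n => θ (b j * z.1 0) * ψ z) ⊆ {z | 1 ≤ b j * z.1 0} := by
        refine closure_minimal (fun z hz => ?_) (isClosed_le (by fun_prop) (by fun_prop))
        by_contra h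
        exact hz (show θ (b j * z.1 0) * ψ z = 0 by rw [hθ0 _ (not_le.1 h).le, zero_mul])
      intro z hz
      exact pos_of_mul_pos_right (one_pos.trans_le (h1 hz)) (hb0 j).le
    have h1 := hw _ hsm hcs hsupp
    have i1 : Integrable fun z : X n => f z * (θ (b j * z.1 0) * ψ z) :=
      LI_mul_integrable hlf hsm.continuous hcs
    have i2 : Integrable fun z : X n => u z * heatS (fun z : X n => θ (b j * z.1 0) * ψ z) z :=
      LI_mul_integrable hli (heatS_contDiff hsm).continuous (heatS_hasCompactSupport hcs)
    have h2 : ∀ z, θ (b j * z.1 0) * H z = (u z * heatS (fun z : X n => θ (b j * z.1 0) * ψ z) z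
        - f z * (θ (b j * z.1 0) * ψ z)) + u z * (2 * (b j * deriv θ (b j * z.1 0)) * dd (ex 0) ψ z
      + b j * (b j * deriv (deriv θ) (b j * z.1 0)) * ψ z) := by
      intro z
      have h3 := heatS_cutoff hκ hψ z
      rw [hκ2, hκ1] at h3
      rw [h3, hH]; ring
    simp only [h2]
    have i12 : Integrable fun z : X n => u z * heatS (fun z : X n => θ (b j * z.1 0) * ψ z) z
        - f z * (θ (b j * z.1 0) * ψ z) := i2.sub i1
    have hm : StronglyMeasurable fun z : X n => u z * (2 * (b j * deriv θ (b j * z.1 0)) *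
        dd (ex 0) ψ z + b j * (b j * deriv (deriv θ) (b j * z.1 0)) * ψ z) := by
      refine hu.mul (Continuous.stronglyMeasurable ?_)
      have h3 : Continuous fun z : X n => deriv θ (b j * z.1 0) :=
        hdT.continuous.comp (by fun_prop)
      have h4 : Continuous fun z : X n => deriv (deriv θ) (b j * z.1 0) :=
        hddT.continuous.comp (by fun_prop)
      have := hψ.continuous
      fun_prop
    rw [integral_add i12 (hEi j), integral_sub i2 i1, h1, sub_self, zero_add,
      integral_dil (rad_pos j) hm, ← integral_const_mul]
    congr 1
    ext z
    simp only [dil_zero_coord, hE]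
    have e1 : b j * (rad j * z.1 0) = z.1 0 := by rw [← mul_assoc, mul_comm (b j), hrb, one_mul]
    rw [e1]
    linear_combination (u (dil (rad j) z) * (2 * deriv θ (z.1 0) * dd (ex 0) ψ (dil (rad j) z)
      + deriv (deriv θ) (z.1 0) * (b j * ψ (dil (rad j) z)))) * hrb j
  have hθlim : Tendsto (fun j => ∫ z : X n, θ (b j * z.1 0) * H z) atTop
      (𝓝 (∫ z, {z : X n | 0 < z.1 0}.indicator H z)) := by
    refine tendsto_integral_of_dominated_convergence (fun z => |H z|) (fun j => ?_) hHi.abs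
      (fun j => Eventually.of_forall fun z => ?_) (Eventually.of_forall fun z => ?_)
    · refine AEStronglyMeasurable.mul (Continuous.aestronglyMeasurable ?_) hHi.aestronglyMeasurable
      exact hθ.continuous.comp (by fun_prop)
    · rw [norm_mul]
      exact mul_le_of_le_one_left (abs_nonneg _) (hθb _)
    · by_cases hz : 0 < z.1 0
      · rw [indicator_of_mem (by exact hz)]
        have h1 : Tendsto (fun j => b j * z.1 0) atTop atTop :=
          (tendsto_atTop_add_const_right _ _ tendsto_natCast_atTop_atTop).atTop_mul_const hz
        refine tendsto_const_nhds.congr' ?_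
        filter_upwards [h1.eventually_ge_atTop 2] with j hj
        rw [hθ1 _ hj, one_mul]
      · rw [indicator_of_notMem (by exact hz)]
        refine tendsto_const_nhds.congr fun j => ?_
        rw [hθ0 _ ((mul_nonpos_of_nonneg_of_nonpos (hb0 j).le (not_lt.1 hz)).trans zero_le_one),
          zero_mul]
  simp only [hkey] at hθlim
  exact tendsto_nhds_unique hθlim hElim

/-- The odd extension of a weak solution vanishing on the boundary is a weak solution. -/
theorem Weak.of_odd (hw : Weak {z : X n | 0 < z.1 0} u f) (hu : StronglyMeasurable u)
    (hf : StronglyMeasurable f) (hC : ∀ z, |u z| ≤ C) (hA : ∀ z, |f z| ≤ A)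
    (hlim : ∀ z, Tendsto (fun a => u (dil a z)) (𝓝 0) (𝓝 0))
    (hou : ∀ z, u (rfl' 0 0 z) = - u z) (hof : ∀ z, f (rfl' 0 0 z) = - f z) : Weak univ u f := by
  intro φ hφ hc _
  have hli := locallyIntegrable_of_bounded hu.aestronglyMeasurable hC
  have hlf := locallyIntegrable_of_bounded hf.aestronglyMeasurable hA
  have hinv : ∀ z : X n, rfl' 0 0 (rfl' 0 0 z) = z := fun z => by simp [rfl'_apply]
  have hint : ∀ g : X n → ℝ, ∫ z, g (rfl' 0 0 z) = ∫ z, g z := fun g =>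
    integral_aff (sg_mul_self 0) _ g
  have hφr : ContDiff ℝ ∞ fun z => φ (rfl' 0 0 z) := hφ.comp (aff_contDiff _ _)
  have hcr : HasCompactSupport fun z => φ (rfl' 0 0 z) :=
    hc.comp_homeomorph (affHomeo (sg 0) (sg_mul_self 0) _)
  set ψ : X n → ℝ := fun z => φ z - φ (rfl' 0 0 z) with hψ
  have hψv : ∀ z, ψ z = φ z - φ (rfl' 0 0 z) := fun _ => rfl
  have hψs : ContDiff ℝ ∞ ψ := hφ.sub hφr
  have hψc : HasCompactSupport ψ := hc.sub hcr
  have hhS : ∀ z, heatS ψ z = heatS φ z - heatS φ (rfl' 0 0 z) := by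
    intro z
    have h1 : heatS (fun y => φ (rfl' 0 0 y)) z = heatS φ (rfl' 0 0 z) :=
      heatS_aff (sg_mul_self 0) _ hφ z
    rw [← h1]
    simp only [heatS, hψ, dd_dd_sub (hφ.of_le two_le_infty).contDiffAt
      (hφr.of_le two_le_infty).contDiffAt, Finset.sum_sub_distrib,
      dd_sub (hφ.differentiable (by simp) z) (hφr.differentiable (by simp) z)]
    ring
  have h0 := hw.integral_half_eq_zero hu hf hC hA hlim hψs hψc fun z hz => by
    simp only [hψ, rfl'_eq_self hz, sub_self]
  set H : X n → ℝ := fun z => u z * heatS ψ z - f z * ψ z with hH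
  have hfix : ∀ z : X n, z.1 0 = 0 → u z = 0 ∧ f z = 0 := fun z hz => by
    have h1 := hou z
    have h2 := hof z
    rw [rfl'_eq_self hz] at h1 h2
    exact ⟨by linarith only [h1], by linarith only [h2]⟩
  have hsplit : ∀ z, H z = {z : X n | 0 < z.1 0}.indicator H z
      + {z : X n | 0 < z.1 0}.indicator H (rfl' 0 0 z) := by
    intro z
    have hev : H (rfl' 0 0 z) = H z := by
      simp only [hH, hou, hof, hhS, hψv, hinv]; ring
    rcases lt_trichotomy (z.1 0) 0 with h | h | h
    · rw [indicator_of_notMem (by exact not_lt.2 h.le), indicator_of_mem, hev, zero_add]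
      change 0 < (rfl' 0 0 z).1 0
      rw [rfl'_zero]; linarith only [h]
    · rw [indicator_of_notMem (by exact not_lt.2 h.le), rfl'_eq_self h,
        indicator_of_notMem (by exact not_lt.2 h.le)]
      simp [hH, hfix z h]
    · rw [indicator_of_mem (by exact h), indicator_of_notMem, add_zero]
      change ¬ 0 < (rfl' 0 0 z).1 0
      rw [rfl'_zero]; linarith only [h]
  have i1 := LI_mul_integrable hli (heatS_contDiff hφ).continuous (heatS_hasCompactSupport hc)
  have i2 := LI_mul_integrable hlf hφ.continuous hc
  have iH : Integrable H :=
    (LI_mul_integrable hli (heatS_contDiff hψs).continuous (heatS_hasCompactSupport hψc)).sub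
      (LI_mul_integrable hlf hψs.continuous hψc)
  have iI : Integrable ({z : X n | 0 < z.1 0}.indicator H) :=
    iH.indicator (isOpen_lt (by fun_prop) (by fun_prop)).measurableSet
  have hH0 : ∫ z, H z = 0 := by
    rw [integral_congr_ae (Eventually.of_forall hsplit), integral_add iI, hint, h0, add_zero]
    exact (aff_measurePreserving (sg_mul_self 0) _).integrable_comp_of_integrable iI
  set G : X n → ℝ := fun z => u z * heatS φ z - f z * φ z with hG
  have iG : Integrable G := i1.sub i2
  have hHG : ∀ z, H z = G z + G (rfl' 0 0 z) := fun z => by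
    simp only [hH, hG, hhS, hψv, hou, hof]; ring
  have h3 : ∫ z, G z = 0 := by
    rw [integral_congr_ae (Eventually.of_forall hHG), integral_add iG, hint] at hH0
    · linarith only [hH0]
    exact (aff_measurePreserving (sg_mul_self 0) _).integrable_comp_of_integrable iG
  rw [hG, integral_sub i1 i2] at h3
  linarith only [h3]

end

end

section

variable {n : ℕ} {ι : Type*} [Fintype ι]

/-! ### The half-space problem -/

/-- The odd extension in the first variable of a function on the closed half-space. -/
noncomputable def oddExt (g : (Fin (n + 1) → ℝ) → ℝ) (x : Fin (n + 1) → ℝ) : ℝ :=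
  if 0 ≤ x 0 then g x else - g (Function.update x 0 (- x 0))

lemma oddExt_of_nonneg {g : (Fin (n + 1) → ℝ) → ℝ} {x : Fin (n + 1) → ℝ} (hx : 0 ≤ x 0) :
    oddExt g x = g x := if_pos hx

lemma oddExt_of_neg {g : (Fin (n + 1) → ℝ) → ℝ} {x : Fin (n + 1) → ℝ} (hx : x 0 < 0) :
    oddExt g x = - g (Function.update x 0 (- x 0)) := if_neg (not_le.2 hx)

lemma oddExt_reflect {g : (Fin (n + 1) → ℝ) → ℝ} (hg : ∀ x, x 0 = 0 → g x = 0)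
    (x : Fin (n + 1) → ℝ) : oddExt g (Function.update x 0 (- x 0)) = - oddExt g x := by
  rcases lt_trichotomy (x 0) 0 with h | h | h
  · rw [oddExt_of_neg h, neg_neg, oddExt_of_nonneg (by simpa using h.le)]
  · have : Function.update x 0 (- x 0) = x := by
      rw [h, neg_zero]; nth_rw 1 [← h]; exact Function.update_eq_self 0 x
    rw [this, oddExt_of_nonneg h.ge, hg x h, neg_zero]
  · rw [oddExt_of_nonneg h.le, oddExt_of_neg (by simpa using h)]
    simp

lemma oddExt_continuous {g : (Fin (n + 1) → ℝ) → ℝ}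
    (hg : ContinuousOn g {x | 0 ≤ x 0}) (h0 : ∀ x, x 0 = 0 → g x = 0) :
    Continuous (oddExt g) := by
  have hv : Continuous fun x : Fin (n + 1) → ℝ => g (Function.update x 0 |x 0|) := by
    refine hg.comp_continuous ?_ fun x => by simp
    exact continuous_id.update 0 (by fun_prop)
  have e : oddExt g = fun x => if 0 ≤ x 0 then g (Function.update x 0 |x 0|)
      else - g (Function.update x 0 |x 0|) := by
    ext x
    unfold oddExt
    split_ifs with h
    · rw [abs_of_nonneg h, Function.update_eq_self]
    · rw [abs_of_neg (not_le.1 h)]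
  rw [e]
  refine Continuous.if_le hv hv.neg continuous_const (by fun_prop) fun x hx => ?_
  rw [h0 _ (by simp [← hx]), neg_zero]

lemma abs_oddExt_le {g : (Fin (n + 1) → ℝ) → ℝ} {C : ℝ} (hg : ∀ x, 0 ≤ x 0 → |g x| ≤ C)
    (x : Fin (n + 1) → ℝ) : |oddExt g x| ≤ C := by
  unfold oddExt
  split_ifs with h
  · exact hg x h
  · rw [abs_neg]
    exact hg _ (by simpa using (not_le.1 h).le)

lemma oddExt_continuous_time {g : (Fin (n + 1) → ℝ) → ℝ → ℝ}
    (hg : ∀ x, 0 ≤ x 0 → Continuous (g x)) (x : Fin (n + 1) → ℝ) :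
    Continuous fun t => oddExt (fun y => g y t) x := by
  unfold oddExt
  split_ifs with h
  · exact hg x h
  · exact (hg _ (by simpa using (not_le.1 h).le)).neg

lemma sep_oddExt {u f : (Fin (n + 1) → ℝ) → ℝ → ℝ} {C A : ℝ}
    (hux : ∀ t, ContinuousOn (fun x => u x t) {x | 0 ≤ x 0})
    (hut : ∀ x, 0 ≤ x 0 → Continuous (u x))
    (hfx : ∀ t, ContinuousOn (fun x => f x t) {x | 0 ≤ x 0})
    (hft : ∀ x, 0 ≤ x 0 → Continuous (f x))
    (hu0 : ∀ x t, x 0 = 0 → u x t = 0) (hf0 : ∀ x t, x 0 = 0 → f x t = 0)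
    (huC : ∀ x t, 0 ≤ x 0 → |u x t| ≤ C) (hfA : ∀ x t, 0 ≤ x 0 → |f x t| ≤ A)
    (hreg : ∀ t x, 0 < x 0 → ContDiffAt ℝ 2 (fun x => u x t) x)
    (heqn : ∀ x, 0 < x 0 → ∀ t, HasDerivAt (u x) (lapE (fun y => u y t) x + f x t) t) :
    Sep {x : Fin (n + 1) → ℝ | 0 < x 0} (fun x t => oddExt (fun y => u y t) x)
      (fun x t => oddExt (fun y => f y t) x) C A := by
  have hU : ∀ x : Fin (n + 1) → ℝ, 0 < x 0 → ∀ t,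
      (fun x => oddExt (fun y => u y t) x) =ᶠ[𝓝 x] fun x => u x t := by
    intro x hx t
    filter_upwards [(isOpen_lt continuous_const (continuous_apply 0)).mem_nhds hx] with y hy
    exact oddExt_of_nonneg (le_of_lt hy)
  refine ⟨fun t => oddExt_continuous (hux t) fun x hx => hu0 x t hx,
    oddExt_continuous_time hut, fun t => oddExt_continuous (hfx t) fun x hx => hf0 x t hx,
    oddExt_continuous_time hft, fun x t => abs_oddExt_le (fun x hx => huC x t hx) x,
    fun x t => abs_oddExt_le (fun x hx => hfA x t hx) x, fun t x hx => ?_, fun x hx t => ?_⟩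
  · exact (hreg t x hx).congr_of_eventuallyEq (hU x hx t)
  · have e1 : (fun t => oddExt (fun y => u y t) x) = u x := by
      ext t; exact oddExt_of_nonneg (le_of_lt hx)
    have e2 : lapE (fun x => oddExt (fun y => u y t) x) x = lapE (fun y => u y t) x := by
      refine Finset.sum_congr rfl fun k _ => ?_
      exact (dd_congr (dd_congr (hU x hx t))).eq_of_nhds
    rw [e1, e2, oddExt_of_nonneg (le_of_lt hx)]
    exact heqn x hx t

lemma FF_eq_zero {β : ι → ι → ℝ} {r : ℝ} (hr : 1 ≤ r) {U : ι → ℝ} (h : ∀ i, U i = 0) (i : ι) :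
    FF β r U i = 0 := by
  simp [FF, h, Real.zero_rpow (by linarith : r ≠ 0)]

lemma whole_space_eq_zero {β : ι → ι → ℝ} {r C : ℝ} (hr : 1 ≤ r)
    (hdim : n ≤ 2 ∨ n = 3 ∧ 2 * r + 1 < 15 / 4)
    (hβ : ∀ i j, 0 ≤ β i j) (hβs : ∀ i j, β i j = β j i) (hd : ∀ i, 0 < β i i)
    (V : ι → X n → ℝ) (hV : ∀ i, Continuous (V i)) (h0 : ∀ i z, 0 ≤ V i z)
    (hC : ∀ i z, V i z ≤ C) (hinv : ∀ i z (s : ℝ), V i (z + s • ex 0) = V i z)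
    (hw : ∀ i, Weak univ (V i) fun z => FF β r (fun j => V j z) i) (i : ι) (z : X n) :
    V i z = 0 := by
  rcases n with _ | n
  · exact (exists_ap hβ hr hV h0 hC ((h0 i z).trans (hC i z)) hw).eq_zero_of_le_one zero_le_one hr
      hβ hβs hd hV hC i z
  · refine eq_zero_of_slice hβ hr (fun V w C hV hC h => ?_) V hV h0 hC hinv hw i z
    rcases hdim with hn | ⟨hn, hr2⟩
    · exact h.eq_zero_of_le_one (by omega) hr hβ hβs hd hV hC
    · obtain rfl : n = 2 := by omega
      exact h.eq_zero_of_dim_three hr hr2 hβ hβs hd hV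

theorem half_space_eq_zero {β : ι → ι → ℝ} {r C : ℝ} (hr : 1 ≤ r)
    (hdim : n ≤ 2 ∨ n = 3 ∧ 2 * r + 1 < 15 / 4)
    (hβ : ∀ i j, 0 ≤ β i j) (hβs : ∀ i j, β i j = β j i) (hd : ∀ i, 0 < β i i)
    (u : ι → (Fin (n + 1) → ℝ) → ℝ → ℝ)
    (hreg : ∀ i t x, 0 < x 0 → ContDiffAt ℝ 2 (fun x => u i x t) x)
    (hregt : ∀ i x, 0 < x 0 → Differentiable ℝ (u i x))
    (hcont : ∀ i t, ContinuousOn (fun x => u i x t) {x | 0 ≤ x 0})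
    (hbc : ∀ i x t, x 0 = 0 → u i x t = 0)
    (hnonneg : ∀ i x t, 0 < x 0 → 0 ≤ u i x t)
    (hbdd : ∀ i x t, 0 < x 0 → u i x t ≤ C)
    (hpde : ∀ i x t, 0 < x 0 → deriv (u i x) t - lapE (fun y => u i y t) x
      = ∑ j, β i j * u i x t ^ r * u j x t ^ (r + 1))
    (i : ι) (x : Fin (n + 1) → ℝ) (t : ℝ) (hx : 0 < x 0) : u i x t = 0 := by
  have hC0 : 0 ≤ C := (hnonneg i x t hx).trans (hbdd i x t hx)
  have h0 : ∀ i x t, 0 ≤ x 0 → 0 ≤ u i x t := fun i x t hx => by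
    rcases hx.eq_or_lt with h | h
    · exact (hbc i x t h.symm).ge
    · exact hnonneg i x t h
  have h1 : ∀ i x t, 0 ≤ x 0 → u i x t ≤ C := fun i x t hx => by
    rcases hx.eq_or_lt with h | h
    · exact (hbc i x t h.symm).trans_le hC0
    · exact hbdd i x t h
  have ht : ∀ i x, 0 ≤ x 0 → Continuous (u i x) := fun i x hx => by
    rcases hx.eq_or_lt with h | h
    · rw [show u i x = fun _ => 0 from funext fun t => hbc i x t h.symm]; exact continuous_const
    · exact (hregt i x h).continuous
  set f : ι → (Fin (n + 1) → ℝ) → ℝ → ℝ := fun i x t => FF β r (fun j => u j x t) i with hf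
  have hf0 : ∀ i x t, x 0 = 0 → f i x t = 0 := fun i x t hx =>
    FF_eq_zero hr (fun j => hbc j x t hx) i
  set B : ℝ := ∑ i, ∑ j, β i j with hB
  set A : ℝ := B * (max C 0 ^ r * max C 0 ^ (r + 1)) with hA
  have hfA : ∀ i x t, 0 ≤ x 0 → |f i x t| ≤ A := fun i x t hx => by
    rw [abs_of_nonneg (FF_nonneg hβ _ i)]
    refine (FF_le hβ hr (fun j => h1 j x t hx) i).trans ?_
    refine mul_le_mul_of_nonneg_right ?_ (by positivity)
    exact Finset.single_le_sum (f := fun i => ∑ j, β i j)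
      (fun i _ => Finset.sum_nonneg fun j _ => hβ i j) (Finset.mem_univ i)
  have hA0 : 0 ≤ A := (abs_nonneg _).trans (hfA i x t hx.le)
  have hsep : ∀ i, Sep {x : Fin (n + 1) → ℝ | 0 < x 0} (fun x t => oddExt (fun y => u i y t) x)
      (fun x t => oddExt (fun y => f i y t) x) C A := by
    intro i
    have hfx : ∀ t, ContinuousOn (fun x => f i x t) {x | 0 ≤ x 0} := fun t =>
      Continuous.comp_continuousOn (g := fun U : ι → ℝ => FF β r U i)
        (f := fun x j => u j x t) (FF_continuous hr i) (continuousOn_pi.2 fun j => hcont j t)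
    have hft : ∀ x, 0 ≤ x 0 → Continuous (f i x) := fun x hx =>
      Continuous.comp (g := fun U : ι → ℝ => FF β r U i) (f := fun t j => u j x t)
        (FF_continuous hr i) (continuous_pi fun j => ht j x hx)
    refine sep_oddExt (hcont i) (ht i) hfx hft (hbc i) (hf0 i) (fun x t hx => ?_) (hfA i)
      (hreg i) fun x hx t => ?_
    · rw [abs_of_nonneg (h0 i x t hx)]; exact h1 i x t hx
    · have e3 : f i x t = ∑ j, β i j * u i x t ^ r * u j x t ^ (r + 1) := by
        simp only [hf, FF, max_eq_left (hnonneg _ x t hx), mul_assoc]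
      rw [e3, ← hpde i x t hx, add_sub_cancel]
      exact (hregt i x hx t).hasDerivAt
  set U : ι → X n → ℝ := fun i z => oddExt (fun y => u i y z.2) z.1 with hUdef
  set F : ι → X n → ℝ := fun i z => oddExt (fun y => f i y z.2) z.1 with hFdef
  have hUm : ∀ i, StronglyMeasurable (U i) := fun i =>
    stronglyMeasurable_of_separate (hsep i).ux (hsep i).ut
  have hFm : ∀ i, StronglyMeasurable (F i) := fun i =>
    stronglyMeasurable_of_separate (hsep i).fx (hsep i).ft
  have hrf : ∀ z : X n, rfl' 0 0 z = (Function.update z.1 0 (- z.1 0), z.2) := fun z => by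
    rw [rfl'_apply, mul_zero, zero_sub]
  have hUodd : ∀ i z, U i (rfl' 0 0 z) = - U i z := fun i z => by
    rw [hrf]; exact oddExt_reflect (fun x hx => hbc i x z.2 hx) z.1
  have hFodd : ∀ i z, F i (rfl' 0 0 z) = - F i z := fun i z => by
    rw [hrf]; exact oddExt_reflect (fun x hx => hf0 i x z.2 hx) z.1
  have hw0 : ∀ i, Weak {z : X n | 0 < z.1 0} (U i) (F i) := fun i =>
    (hsep i).weak (isOpen_lt continuous_const (continuous_apply 0))
  have hw : ∀ i, Weak univ (U i) (F i) := fun i => by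
    refine (hw0 i).of_odd (hUm i) (hFm i) (fun z => (hsep i).uC z.1 z.2)
      (fun z => (hsep i).fA z.1 z.2) (fun z => ?_) (hUodd i) (hFodd i)
    have hc : Continuous fun a : ℝ => U i (dil a z) :=
      ((hsep i).ux z.2).comp (continuous_fst.comp
        (dil_continuous.comp (continuous_id.prodMk continuous_const)))
    have h2 : U i (dil 0 z) = 0 := by
      have h3 : (dil 0 z).1 0 = 0 := by simp
      exact (oddExt_of_nonneg h3.ge).trans (hbc i _ _ h3)
    have h3 := hc.tendsto 0
    rwa [h2] at h3
  have hS : Sol β r C (regMod n C A) U := by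
    refine ⟨fun i => (hw i).mod (fun z => (hsep i).uC z.1 z.2) (fun z => (hsep i).fA z.1 z.2)
      (locallyIntegrable_of_bounded (hUm i).aestronglyMeasurable fun z => (hsep i).uC z.1 z.2)
      (locallyIntegrable_of_bounded (hFm i).aestronglyMeasurable fun z => (hsep i).fA z.1 z.2)
      (hsep i).ux (hsep i).ut, fun i z => (hsep i).uC z.1 z.2, hUodd, fun i z hz => ?_,
      fun i φ hφ hc hs => ?_⟩
    · have e : U i z = u i z.1 z.2 := oddExt_of_nonneg hz
      exact (h0 i z.1 z.2 hz).trans_eq e.symm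
    · rw [hw0 i φ hφ hc hs]
      congr 1
      ext z
      by_cases hz : z ∈ tsupport φ
      · have hz0 : 0 < z.1 0 := hs hz
        have e : F i z = f i z.1 z.2 := oddExt_of_nonneg hz0.le
        have e' : ∀ j, U j z = u j z.1 z.2 := fun j => oddExt_of_nonneg hz0.le
        simp only [e, e', hf]
      · rw [image_eq_zero_of_notMem_tsupport hz, mul_zero, mul_zero]
  have hz := Sol.eq_zero (regMod_pos hC0 hA0) hβ hr
    (fun V a1 a2 a3 a4 a5 => whole_space_eq_zero hr hdim hβ hβs hd V a1 a2 a3 a4 a5) U hS i (x, t)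
  exact (oddExt_of_nonneg hx.le).symm.trans hz

lemma lap_toLp {f : EuclideanSpace ℝ (Fin (n + 1)) → ℝ} {x : Fin (n + 1) → ℝ}
    (hf : ContDiffAt ℝ 2 f (WithLp.toLp 2 x)) :
    lap f (WithLp.toLp 2 x) = lapE (fun y => f (WithLp.toLp 2 y)) x := by
  set L : (Fin (n + 1) → ℝ) ≃L[ℝ] EuclideanSpace ℝ (Fin (n + 1)) :=
    (EuclideanSpace.equiv (Fin (n + 1)) ℝ).symm with hL
  have h1 : ∀ (g : EuclideanSpace ℝ (Fin (n + 1)) → ℝ) v,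
      dd v (fun y => g (WithLp.toLp 2 y)) = fun y => dd (L v) g (WithLp.toLp 2 y) := by
    intro g v
    ext y
    have h2 : fderiv ℝ (g ∘ L) y = (fderiv ℝ g (L y)).comp (L : _ →L[ℝ] _) :=
      L.comp_right_fderiv
    exact congrArg (fun T => T v) h2
  have hd : DifferentiableAt ℝ (fderiv ℝ f) (WithLp.toLp 2 x) :=
    (hf.fderiv_right (m := 1) (by norm_num)).differentiableAt (by norm_num)
  unfold lap lapE
  refine Finset.sum_congr rfl fun i _ => ?_
  rw [iteratedFDeriv_two_apply, h1, h1]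
  have h3 : L (Pi.single i 1) = EuclideanSpace.single i 1 := rfl
  have h4 := ((ContinuousLinearMap.apply ℝ ℝ (EuclideanSpace.single i (1 : ℝ))).hasFDerivAt.comp _
    hd.hasFDerivAt).fderiv
  rw [h3]
  exact (congrArg (fun T => T (EuclideanSpace.single i 1)) h4).symm

end

end Liouville

/-- Liouville-type theorem for the parabolic system (S) with Dirichlet
boundary conditions in the half-space `ℝ^N_+ × ℝ`, for `r ≥ 1` and `N ≤ 3`, or
`N = 4` and `p = 2r+1 < 15/4`. -/
theorem liouville_half_space
    (N m : ℕ) (hN : 0 < N) (hm : 2 ≤ m)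
    (r : ℝ) (hr : 1 ≤ r)
    (hdim : N ≤ 3 ∨ (N = 4 ∧ 2 * r + 1 < 15 / 4))
    (β : Fin m → Fin m → ℝ)
    (hsym : ∀ i j, β i j = β j i)
    (hoff : ∀ i j, i ≠ j → 0 ≤ β i j)
    (hdiag : ∀ i, 0 < β i i)
    (u : Fin m → EuclideanSpace ℝ (Fin N) → ℝ → ℝ)
    (hregx : ∀ i t, ContDiffOn ℝ 2 (fun x => u i x t)
      {x : EuclideanSpace ℝ (Fin N) | 0 < x ⟨0, hN⟩})
    (hregt : ∀ i (x : EuclideanSpace ℝ (Fin N)), 0 < x ⟨0, hN⟩ →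
      ContDiff ℝ 1 (fun t => u i x t))
    (hcont : ∀ i t, ContinuousOn (fun x => u i x t)
      {x : EuclideanSpace ℝ (Fin N) | 0 ≤ x ⟨0, hN⟩})
    (hbc : ∀ i (x : EuclideanSpace ℝ (Fin N)) (t : ℝ), x ⟨0, hN⟩ = 0 → u i x t = 0)
    (hnonneg : ∀ i (x : EuclideanSpace ℝ (Fin N)) (t : ℝ), 0 < x ⟨0, hN⟩ → 0 ≤ u i x t)
    (hbdd : ∃ C : ℝ, ∀ i (x : EuclideanSpace ℝ (Fin N)) (t : ℝ),
      0 < x ⟨0, hN⟩ → u i x t ≤ C)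
    (hpde : ∀ i (x : EuclideanSpace ℝ (Fin N)) (t : ℝ), 0 < x ⟨0, hN⟩ →
      deriv (fun s => u i x s) t - lap (fun y => u i y t) x
        = ∑ j, β i j * u i x t ^ r * u j x t ^ (r + 1)) :
    ∀ i (x : EuclideanSpace ℝ (Fin N)) (t : ℝ), 0 < x ⟨0, hN⟩ → u i x t = 0 := by
  obtain ⟨n, rfl⟩ : ∃ n, N = n + 1 := ⟨N - 1, by omega⟩
  obtain ⟨C, hC⟩ := hbdd
  have hβ : ∀ i j, 0 ≤ β i j := fun i j => by
    rcases eq_or_ne i j with rfl | h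
    · exact (hdiag i).le
    · exact hoff i j h
  have hLc : ContDiff ℝ 2 fun x : Fin (n + 1) → ℝ => (WithLp.toLp 2 x : EuclideanSpace ℝ _) :=
    (EuclideanSpace.equiv (Fin (n + 1)) ℝ).symm.contDiff
  have hat : ∀ i t (x : Fin (n + 1) → ℝ), 0 < x 0 →
      ContDiffAt ℝ 2 (fun x => u i x t) (WithLp.toLp 2 x) := fun i t x hx =>
    (hregx i t).contDiffAt ((isOpen_lt continuous_const
      (EuclideanSpace.proj (0 : Fin (n + 1))).continuous).mem_nhds hx)
  intro i x t hx
  refine Liouville.half_space_eq_zero (C := C) hr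
    (by rcases hdim with h | ⟨h, h'⟩; exacts [Or.inl (by omega), Or.inr ⟨by omega, h'⟩]) hβ hsym hdiag
    (fun i x t => u i (WithLp.toLp 2 x) t) (fun i t x hx => ?_) (fun i x hx => ?_) (fun i t => ?_)
    (fun i x t hx => hbc i _ t hx) (fun i x t hx => hnonneg i _ t hx)
    (fun i x t hx => hC i _ t hx) (fun i x t hx => ?_) i x.ofLp t hx
  · exact (hat i t x hx).comp x hLc.contDiffAt
  · exact (hregt i _ hx).differentiable (by norm_num)
  · exact (hcont i t).comp hLc.continuous.continuousOn fun x hx => hx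
  · rw [← Liouville.lap_toLp (hat i t x hx)]
    exact hpde i _ t hx
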